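/- Let n ≥ 2, let ℓ : (0,∞)×ℝ^{n-2} → [0,∞) be measurable with ℓ(r,x') ≤ 2πr for H^{n-1}-a.e. (r,x'), and let E ⊂ ℝⁿ be a circularly ℓ-distributed set of finite perimeter and finite volume with P(E) = P(F^ℓ). Then for H^{n-1}-a.e. (r,x') ∈ (0,∞)×ℝ^{n-2}: (a) E_{(r,x')} is H¹-equivalent to a circular arc and ∂*(E_{(r,x')}) = (∂*E)_{(r,x')}; (b) the three functions x ↦ ν^E(x)·x̂₁₂, x ↦ |ν₁₂∥^E(x)|, and x ↦ ν_{x'}^E(x) are constant on (∂*E)_{(r,x')}. -/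

import Mathlib

/- Common definitions: geometric measure theory notions (density points, essential
boundary, perimeter, reduced boundary and measure-theoretic outer unit normal),
spherical and circular symmetrisation, BV and Sobolev-type notions. -/

open MeasureTheory Metric Set Filter
open scoped ENNReal NNReal Topology RealInnerProductSpace

noncomputable section

/-- Euclidean space `ℝⁿ`. -/
abbrev Euc (n : ℕ) : Type := EuclideanSpace ℝ (Fin n)

/-- `ω_k`: the volume of the unit ball of `ℝ^k`. -/
def omegaBall (k : ℕ) : ℝ := (volume (ball (0 : Euc k) 1)).toReal

/-- The radial unit vector `x̂ = x/|x|`. -/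
def hatv {n : ℕ} (x : Euc n) : Euc n := ‖x‖⁻¹ • x

/-- The first vector of the canonical basis. -/
def e1 (n : ℕ) (hn : 0 < n) : Euc n := EuclideanSpace.single ⟨0, hn⟩ 1

/-- `E` has `n`-dimensional density `t` at `x`. -/
def DensityAt {n : ℕ} (E : Set (Euc n)) (x : Euc n) (t : ℝ≥0∞) : Prop :=
  Tendsto (fun ρ : ℝ => volume (E ∩ ball x ρ) / volume (ball x ρ)) (𝓝[>] (0:ℝ)) (𝓝 t)

/-- The essential boundary `∂ᵉE`: points of density neither `0` nor `1`. -/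
def essBoundary {n : ℕ} (E : Set (Euc n)) : Set (Euc n) :=
  {x | ¬ DensityAt E x 0 ∧ ¬ DensityAt E x 1}

/-- The perimeter of `E` relative to `A`: `P(E;A) = H^{n-1}(∂ᵉE ∩ A)`. -/
def perim {n : ℕ} (E A : Set (Euc n)) : ℝ≥0∞ := μH[(n : ℝ) - 1] (essBoundary E ∩ A)

/-- `ν` is the measure-theoretic outer unit normal of `E` at `x`: the blow-up of `E`
at `x` is the half space `{y : (y-x)·ν ≤ 0}` in density. -/
def HasMTNormal {n : ℕ} (E : Set (Euc n)) (x ν : Euc n) : Prop :=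
  ‖ν‖ = 1 ∧
    Tendsto (fun ρ : ℝ =>
        volume ({y | y ∈ E ∧ 0 < ⟪y - x, ν⟫} ∩ ball x ρ) / volume (ball x ρ))
      (𝓝[>] (0:ℝ)) (𝓝 0) ∧
    Tendsto (fun ρ : ℝ =>
        volume ({y | y ∉ E ∧ ⟪y - x, ν⟫ < 0} ∩ ball x ρ) / volume (ball x ρ))
      (𝓝[>] (0:ℝ)) (𝓝 0)

/-- The reduced boundary `∂*E`. -/
def redBoundary {n : ℕ} (E : Set (Euc n)) : Set (Euc n) := {x | ∃ ν, HasMTNormal E x ν}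

/-- The measure-theoretic outer unit normal `ν^E`. -/
def mtNormal {n : ℕ} (E : Set (Euc n)) (x : Euc n) : Euc n :=
  haveI := Classical.propDecidable (∃ ν, HasMTNormal E x ν)
  if h : ∃ ν, HasMTNormal E x ν then h.choose else 0

/-- The tangential component `ν∥^E(x) = ν^E(x) - (ν^E(x)·x̂)x̂` of the normal along
the sphere `∂B(|x|)`. -/
def nuPar {n : ℕ} (E : Set (Euc n)) (x : Euc n) : Euc n :=
  mtNormal E x - ⟪mtNormal E x, hatv x⟫ • hatv x

/-- The open geodesic ball (spherical cap) `B_β(r p)` in the sphere `∂B(0,r)`. -/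
def capSet {n : ℕ} (p : Euc n) (r β : ℝ) : Set (Euc n) :=
  {x | x ∈ sphere (0 : Euc n) r ∧ Real.arccos ⟪hatv x, p⟫ < β}

/-- The geodesic sphere `S_β(r p)` in the sphere `∂B(0,r)`. -/
def capSphere {n : ℕ} (p : Euc n) (r β : ℝ) : Set (Euc n) :=
  {x | x ∈ sphere (0 : Euc n) r ∧ Real.arccos ⟪hatv x, p⟫ = β}

/-- `E ⊆ ℝⁿ` is spherically `v`-distributed: `H^{n-1}(E ∩ ∂B(0,r)) = v r` for a.e. `r > 0`. -/
def SphDistrib {n : ℕ} (v : ℝ → ℝ) (E : Set (Euc n)) : Prop :=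
  ∀ᵐ r ∂(volume.restrict (Ioi (0:ℝ))),
    μH[(n : ℝ) - 1] (E ∩ sphere (0 : Euc n) r) = ENNReal.ofReal (v r)

/-- The spherical symmetral `F_v` (determined by the angle function `α = α_v` and the
direction `p`). -/
def sphSymm (n : ℕ) (α : ℝ → ℝ) (p : Euc n) : Set (Euc n) :=
  {x : Euc n | x ≠ 0 ∧ Real.arccos ⟪hatv x, p⟫ < α ‖x‖}

/-- `Φ(B × S^{n-1})`, for `B ⊆ (0,∞)`. -/
def sphShell (n : ℕ) (B : Set ℝ) : Set (Euc n) := {x : Euc n | x ≠ 0 ∧ ‖x‖ ∈ B}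

/-- `v ∈ BV(0,∞)`: `v` is integrable on `(0,∞)` and has a representative of bounded
pointwise variation there. -/
def BVIoi (v : ℝ → ℝ) : Prop :=
  IntegrableOn v (Ioi (0:ℝ)) volume ∧
    ∃ w : ℝ → ℝ, (∀ᵐ r ∂(volume.restrict (Ioi (0:ℝ))), w r = v r) ∧
      BoundedVariationOn w (Ioi (0:ℝ))

/-- `f ∈ W^{1,1}_loc(I)` for `I ⊆ ℝ`: `f` has a representative `w` which is locally
absolutely continuous on `I`, i.e. `w b - w a = ∫_a^b g` with `g` locally integrable on `I`. -/
def W11locOn (f : ℝ → ℝ) (I : Set ℝ) : Prop :=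
  ∃ w g : ℝ → ℝ, (∀ᵐ r ∂(volume.restrict I), w r = f r) ∧
    LocallyIntegrableOn g I volume ∧
    ∀ a b : ℝ, uIcc a b ⊆ I → w b - w a = ∫ t in a..b, g t

/-- `S ⊆ ℝ` has one-dimensional density `0` at `x`. -/
def RDensity0 (S : Set ℝ) (x : ℝ) : Prop :=
  Tendsto (fun ρ : ℝ => volume (S ∩ ball x ρ) / volume (ball x ρ)) (𝓝[>] (0:ℝ)) (𝓝 0)

/-- The approximate upper limit `f^∨(x)` (for bounded `f`). -/
def apSup (f : ℝ → ℝ) (x : ℝ) : ℝ := sInf {t : ℝ | RDensity0 {y | t < f y} x}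

/-- The approximate lower limit `f^∧(x)` (for bounded `f`). -/
def apInf (f : ℝ → ℝ) (x : ℝ) : ℝ := sSup {t : ℝ | RDensity0 {y | f y < t} x}

/-- `t` is the approximate limit of `f` at `x` with respect to `A`. -/
def apLimOn (f : ℝ → ℝ) (A : Set ℝ) (x t : ℝ) : Prop :=
  ∀ ε : ℝ, 0 < ε → RDensity0 ({y | ε < |f y - t|} ∩ A) x

/-- Density (with value `t`) at `x` of a subset `A` of the sphere `∂B(0,r)`,
with respect to the measure `H^{n-1}` on the sphere. -/
def SphDensityAt {n : ℕ} (A : Set (Euc n)) (r : ℝ) (x : Euc n) (t : ℝ≥0∞) : Prop :=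
  Tendsto (fun ρ : ℝ =>
      μH[(n : ℝ) - 1] (A ∩ ball x ρ) / μH[(n : ℝ) - 1] (sphere (0 : Euc n) r ∩ ball x ρ))
    (𝓝[>] (0:ℝ)) (𝓝 t)

/-- The essential boundary, within the sphere `∂B(0,r)`, of a subset `A` of that sphere. -/
def sphEssBoundary {n : ℕ} (A : Set (Euc n)) (r : ℝ) : Set (Euc n) :=
  {x | x ∈ sphere (0 : Euc n) r ∧ ¬ SphDensityAt A r x 0 ∧ ¬ SphDensityAt A r x 1}

/-- A pair of mutually singular measures `(σp, σm)` supported in `(0,∞)`, locally finite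
there, representing the distributional derivative `Dξ = σp - σm` of `ξ` on `(0,∞)`. -/
def RepDeriv (ξ : ℝ → ℝ) (σp σm : Measure ℝ) : Prop :=
  σp (Iic (0:ℝ)) = 0 ∧ σm (Iic (0:ℝ)) = 0 ∧
    (∀ K : Set ℝ, K ⊆ Ioi (0:ℝ) → IsCompact K → σp K < ⊤ ∧ σm K < ⊤) ∧
    σp.MutuallySingular σm ∧
    ∀ φ : ℝ → ℝ, ContDiff ℝ 1 φ → HasCompactSupport φ → tsupport φ ⊆ Ioi (0:ℝ) →
      (∫ r in Ioi (0:ℝ), ξ r * deriv φ r) = (∫ r, φ r ∂σm) - ∫ r, φ r ∂σp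

/-- The density `ξ'` of the absolutely continuous part of `Dξ = σp - σm`. -/
def acDeriv (σp σm : Measure ℝ) (r : ℝ) : ℝ :=
  (σp.rnDeriv volume r).toReal - (σm.rnDeriv volume r).toReal

/-- `p_E(r) = H^{n-2}(∂*E ∩ ∂B(0,r))` (as a real number). -/
def pSlice {n : ℕ} (E : Set (Euc n)) (r : ℝ) : ℝ :=
  (μH[(n : ℝ) - 2] (redBoundary E ∩ sphere (0 : Euc n) r)).toReal

/-- The projection `x ↦ x₁₂` onto the plane of the first two coordinates. -/
def pr12 {n : ℕ} (hn : 2 ≤ n) (x : Euc n) : Euc 2 :=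
  (EuclideanSpace.equiv (Fin 2) ℝ).symm fun i => x ⟨i.1, lt_of_lt_of_le i.2 hn⟩

/-- The projection `x ↦ x'` onto the remaining `n - 2` coordinates. -/
def prC {n : ℕ} (hn : 2 ≤ n) (x : Euc n) : Euc (n - 2) :=
  (EuclideanSpace.equiv (Fin (n - 2)) ℝ).symm fun i => x ⟨i.1 + 2, by have := i.2; omega⟩

/-- The circle `∂B((0,x'),r) ∩ Π_{x'}`, for `p = (r, x')`. -/
def circFiber {n : ℕ} (hn : 2 ≤ n) (p : ℝ × Euc (n - 2)) : Set (Euc n) :=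
  {y : Euc n | prC hn y = p.2 ∧ ‖pr12 hn y‖ = p.1}

/-- The circular slice `E_{(r,x')}`, for `p = (r, x')`. -/
def cslice {n : ℕ} (hn : 2 ≤ n) (E : Set (Euc n)) (p : ℝ × Euc (n - 2)) : Set (Euc n) :=
  E ∩ circFiber hn p

/-- `E` is circularly `ℓ`-distributed. -/
def CircDistrib {n : ℕ} (hn : 2 ≤ n) (ℓ : ℝ × Euc (n - 2) → ℝ) (E : Set (Euc n)) : Prop :=
  ∀ᵐ p ∂(volume.restrict ((Ioi (0:ℝ)) ×ˢ (univ : Set (Euc (n - 2))))),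
    μH[(1:ℝ)] (cslice hn E p) = ENNReal.ofReal (ℓ p)

/-- The circular symmetral `F^ℓ`. -/
def circSymm {n : ℕ} (hn : 2 ≤ n) (ℓ : ℝ × Euc (n - 2) → ℝ) : Set (Euc n) :=
  {x : Euc n | pr12 hn x ≠ 0 ∧
    Real.arccos ⟪hatv (pr12 hn x), e1 2 (by norm_num)⟫
      < ℓ (‖pr12 hn x‖, prC hn x) / (2 * ‖pr12 hn x‖)}

/-- `Φ₁₂(B × S¹)`, for `B ⊆ (0,∞) × ℝ^{n-2}`. -/
def cylSet {n : ℕ} (hn : 2 ≤ n) (B : Set (ℝ × Euc (n - 2))) : Set (Euc n) :=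
  {x : Euc n | pr12 hn x ≠ 0 ∧ (‖pr12 hn x‖, prC hn x) ∈ B}

/-- The component `ν₁₂∥^E(x) = ν₁₂^E(x) - (ν^E(x)·x̂₁₂)x̂₁₂` of the normal. -/
def nu12par {n : ℕ} (hn : 2 ≤ n) (E : Set (Euc n)) (x : Euc n) : Euc 2 :=
  pr12 hn (mtNormal E x) - ⟪pr12 hn (mtNormal E x), hatv (pr12 hn x)⟫ • hatv (pr12 hn x)

/-- Density (with value `t`) at `x` of a subset `A` of the circle `circFiber hn p`,
with respect to the measure `H¹` on that circle. -/
def CircDensityAt {n : ℕ} (hn : 2 ≤ n) (A : Set (Euc n)) (p : ℝ × Euc (n - 2)) (x : Euc n)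
    (t : ℝ≥0∞) : Prop :=
  Tendsto (fun ρ : ℝ => μH[(1:ℝ)] (A ∩ ball x ρ) / μH[(1:ℝ)] (circFiber hn p ∩ ball x ρ))
    (𝓝[>] (0:ℝ)) (𝓝 t)

/-- The essential boundary, within the circle `circFiber hn p`, of a subset `A`. -/
def circEssBoundary {n : ℕ} (hn : 2 ≤ n) (A : Set (Euc n)) (p : ℝ × Euc (n - 2)) :
    Set (Euc n) :=
  {x | x ∈ circFiber hn p ∧ ¬ CircDensityAt hn A p x 0 ∧ ¬ CircDensityAt hn A p x 1}

/-- `f` has locally bounded variation on the open set `Ω`: on every open `U` compactly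
contained in `Ω` the distributional gradient of `f` has finite total variation. -/
def BVlocOn {W : Type*} [NormedAddCommGroup W] [NormedSpace ℝ W] [MeasureSpace W]
    (f : W → ℝ) (Ω : Set W) : Prop :=
  LocallyIntegrableOn f Ω volume ∧
    ∀ U : Set W, IsOpen U → IsCompact (closure U) → closure U ⊆ Ω →
      ∃ C : ℝ, ∀ g : W → W, ContDiff ℝ 1 g → HasCompactSupport g → tsupport g ⊆ U →
        (∀ x, ‖g x‖ ≤ 1) →
        (∫ x in U, f x * LinearMap.trace ℝ W (fderiv ℝ g x).toLinearMap) ≤ C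

/-- `f ∈ W^{1,1}_loc(Ω)` for `Ω ⊆ (0,∞) × ℝ^m`: `f` has a locally integrable weak
gradient `(g1, g2)` on `Ω`. -/
def W11locProd {m : ℕ} (f : ℝ × Euc m → ℝ) (Ω : Set (ℝ × Euc m)) : Prop :=
  ∃ (g1 : ℝ × Euc m → ℝ) (g2 : ℝ × Euc m → Euc m),
    LocallyIntegrableOn f Ω volume ∧ LocallyIntegrableOn g1 Ω volume ∧
      LocallyIntegrableOn g2 Ω volume ∧
      ∀ φ : ℝ × Euc m → ℝ, ContDiff ℝ 1 φ → HasCompactSupport φ → tsupport φ ⊆ Ω →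
        ∀ y : ℝ × Euc m,
          (∫ x in Ω, f x * fderiv ℝ φ x y) = -∫ x in Ω, φ x * (g1 x * y.1 + ⟪g2 x, y.2⟫)

/-- A pair of mutually singular measures `(σp, σm)` supported in `Ω₀ = (0,∞) × ℝ^m`,
locally finite there, representing the partial distributional derivative
`D_r ξ = σp - σm` of `ξ` in the radial variable. -/
def RepDerivR {m : ℕ} (ξ : ℝ × Euc m → ℝ) (σp σm : Measure (ℝ × Euc m)) : Prop :=
  σp ((Ioi (0:ℝ)) ×ˢ (univ : Set (Euc m)))ᶜ = 0 ∧
    σm ((Ioi (0:ℝ)) ×ˢ (univ : Set (Euc m)))ᶜ = 0 ∧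
    (∀ K : Set (ℝ × Euc m), K ⊆ (Ioi (0:ℝ)) ×ˢ univ → IsCompact K → σp K < ⊤ ∧ σm K < ⊤) ∧
    σp.MutuallySingular σm ∧
    ∀ φ : ℝ × Euc m → ℝ, ContDiff ℝ 1 φ → HasCompactSupport φ →
      tsupport φ ⊆ (Ioi (0:ℝ)) ×ˢ (univ : Set (Euc m)) →
      (∫ x in (Ioi (0:ℝ)) ×ˢ (univ : Set (Euc m)), ξ x * fderiv ℝ φ x ((1:ℝ), (0 : Euc m)))
        = (∫ x, φ x ∂σm) - ∫ x, φ x ∂σp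

/-- A polar representation `(τ, h)` (with `‖h‖ = 1` `τ`-a.e.) of the distributional
gradient `D_{x'} f = h τ` of `f` in the `x'` variables, on `Ω₀ = (0,∞) × ℝ^m`. -/
def RepDerivX {m : ℕ} (f : ℝ × Euc m → ℝ) (τ : Measure (ℝ × Euc m))
    (h : ℝ × Euc m → Euc m) : Prop :=
  τ ((Ioi (0:ℝ)) ×ˢ (univ : Set (Euc m)))ᶜ = 0 ∧
    (∀ K : Set (ℝ × Euc m), K ⊆ (Ioi (0:ℝ)) ×ˢ univ → IsCompact K → τ K < ⊤) ∧
    (∀ᵐ x ∂τ, ‖h x‖ = 1) ∧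
    ∀ φ : ℝ × Euc m → ℝ, ContDiff ℝ 1 φ → HasCompactSupport φ →
      tsupport φ ⊆ (Ioi (0:ℝ)) ×ˢ (univ : Set (Euc m)) →
      ∀ y : Euc m,
        (∫ x in (Ioi (0:ℝ)) ×ˢ (univ : Set (Euc m)), f x * fderiv ℝ φ x ((0:ℝ), y))
          = -∫ x, φ x * ⟪h x, y⟫ ∂τ

/-- The barycentre function `b_E(r) = r^{1-n} ∫_{E_r} x̂ dH^{n-1}`. -/
def bary (n : ℕ) (E : Set (Euc n)) (r : ℝ) : Euc n :=
  (r ^ (n - 1))⁻¹ • ∫ x in E ∩ sphere (0 : Euc n) r, hatv x ∂μH[(n : ℝ) - 1]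

/-- The average direction `d_E(r)` of the slice `E_r`. -/
def avgDir (n : ℕ) (α : ℝ → ℝ) (E : Set (Euc n)) (r : ℝ) : Euc n :=
  (omegaBall (n - 1) * Real.sin (α r) ^ (n - 1) * r ^ (n - 1))⁻¹ •
    ∫ x in E ∩ sphere (0 : Euc n) r, hatv x ∂μH[(n : ℝ) - 1]

end

set_option linter.deprecated false
set_option linter.unusedSectionVars false
set_option linter.unusedVariables false

section MZbasics
variable {X Y : Type*} [MetricSpace X] [MeasurableSpace X] [BorelSpace X]
  [MetricSpace Y] [MeasurableSpace Y] [BorelSpace Y]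

/-- `G` has vanishing `d`-dimensional density at `x` w.r.t. `μ`. -/
def MZm (μ : Measure X) (d : ℕ) (G : Set X) (x : X) : Prop :=
  ∀ ε : ℝ, 0 < ε → ∀ᶠ ρ in 𝓝[>] (0:ℝ), μ (G ∩ ball x ρ) ≤ ENNReal.ofReal (ε * ρ ^ d)

/-- `G` has vanishing `d`-dimensional Hausdorff density at `x`. -/
def MZ (d : ℕ) (G : Set X) (x : X) : Prop := MZm (μH[(d:ℝ)]) d G x

/-- metric essential boundary -/
def eB (d : ℕ) (G : Set X) : Set X := {x | ¬ MZ d G x ∧ ¬ MZ d Gᶜ x}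

lemma eB_compl (d : ℕ) (G : Set X) : eB d Gᶜ = eB d G := by
  ext x; simp [eB, and_comm]

lemma MZm_mono {μ : Measure X} {d : ℕ} {G H : Set X} {x : X} (h : G ⊆ H) (hH : MZm μ d H x) :
    MZm μ d G x := fun ε hε => (hH ε hε).mono fun _ hρ =>
  (measure_mono (inter_subset_inter_left _ h)).trans hρ

lemma MZm_of_le {μ ν : Measure X} {d : ℕ} {G : Set X} {x : X} {c : ℝ≥0∞} (hc : c ≠ ⊤)
    (h : ∀ A, μ A ≤ c * ν A) (hH : MZm ν d G x) : MZm μ d G x := by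
  intro ε hε
  have h1 := hH (ε / (c.toReal + 1)) (by positivity)
  refine h1.mono fun ρ hρ => (h _).trans ((mul_le_mul_right hρ c).trans ?_)
  rw [← ENNReal.ofReal_toReal hc, ← ENNReal.ofReal_mul ENNReal.toReal_nonneg]
  have hc0 : 0 ≤ c.toReal := ENNReal.toReal_nonneg
  rcases le_or_gt (ρ ^ d) 0 with h0 | h0
  · rw [ENNReal.toReal_ofReal hc0, ENNReal.ofReal_of_nonpos]
    · exact zero_le
    · have : ε / (c.toReal + 1) * ρ ^ d ≤ 0 := mul_nonpos_of_nonneg_of_nonpos (by positivity) h0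
      exact mul_nonpos_of_nonneg_of_nonpos hc0 this
  · apply ENNReal.ofReal_le_ofReal
    rw [ENNReal.toReal_ofReal hc0]
    rw [← mul_assoc]
    apply mul_le_mul_of_nonneg_right _ h0.le
    rw [← mul_div_assoc, div_le_iff₀ (by positivity)]
    nlinarith

lemma MZm_union {μ : Measure X} {d : ℕ} {G H : Set X} {x : X} (hG : MZm μ d G x)
    (hH : MZm μ d H x) : MZm μ d (G ∪ H) x := by
  intro ε hε
  filter_upwards [hG (ε/2) (by positivity), hH (ε/2) (by positivity), self_mem_nhdsWithin]
    with ρ h1 h2 (h3 : 0 < ρ)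
  rw [union_inter_distrib_right]
  refine (measure_union_le _ _).trans ((add_le_add h1 h2).trans ?_)
  rw [← ENNReal.ofReal_add (by positivity) (by positivity)]
  apply ENNReal.ofReal_le_ofReal; linarith

lemma MZm_comp_mul {μ : Measure X} {d : ℕ} {G : Set X} {x : X} (hG : MZm μ d G x)
    {K : ℝ} (hK : 0 < K) {ε : ℝ} (hε : 0 < ε) :
    ∀ᶠ ρ in 𝓝[>] (0:ℝ), μ (G ∩ ball x (K * ρ)) ≤ ENNReal.ofReal (ε * ρ ^ d) := by
  have h1 := hG (ε / K ^ d) (by positivity)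
  have ht : Tendsto (fun ρ : ℝ => K * ρ) (𝓝[>] 0) (𝓝[>] 0) := by
    apply tendsto_nhdsWithin_of_tendsto_nhds_of_eventually_within
    · have : Tendsto (fun ρ : ℝ => K * ρ) (𝓝 0) (𝓝 (K * 0)) := by
        exact (continuous_const.mul continuous_id).tendsto 0
      rw [mul_zero] at this
      exact this.mono_left nhdsWithin_le_nhds
    · filter_upwards [self_mem_nhdsWithin] with ρ (h : 0 < ρ)
      exact mul_pos hK h
  filter_upwards [ht.eventually h1] with ρ hρ
  refine hρ.trans (le_of_eq ?_)
  congr 1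
  rw [mul_pow]; field_simp

lemma hausdorff_le_of_antilip_on {f : X → Y} {s A : Set X} (K : ℝ≥0) (d : ℕ)
    (hA : ∀ a ∈ s, ∀ b ∈ s, edist a b ≤ K * edist (f a) (f b)) (hAs : A ⊆ s) :
    μH[(d:ℝ)] A ≤ (K:ℝ≥0∞) ^ d * μH[(d:ℝ)] (f '' A) := by
  have h1 : AntilipschitzWith K (A.domRestrict f) := by
    intro a b
    exact hA a (hAs a.2) b (hAs b.2)
  have h2 := h1.le_hausdorffMeasure_image (d := (d:ℝ)) (by positivity) univ
  rw [image_univ, range_domRestrict] at h2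
  have h3 := (isometry_subtype_coe (s := A)).hausdorffMeasure_image (d := (d:ℝ))
    (Or.inl (by positivity)) univ
  rw [image_univ, Subtype.range_coe] at h3
  rw [h3]
  simpa using h2

lemma MZ_preimage {f : X → Y} {s : Set X} {x : X} (hs : s ∈ 𝓝 x) {K : ℝ≥0} {d : ℕ}
    (hL : LipschitzOnWith K f s) (hA : ∀ a ∈ s, ∀ b ∈ s, edist a b ≤ K * edist (f a) (f b))
    {G : Set Y} (hG : MZ d G (f x)) : MZ d (f ⁻¹' G) x := by
  intro ε hε
  obtain ⟨r, hr, hrs⟩ := Metric.mem_nhds_iff.1 hs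
  set K' : ℝ := K + 1
  have hK' : 0 < K' := by positivity
  have h1 := MZm_comp_mul hG hK' (ε := ε / K' ^ d) (by positivity)
  filter_upwards [h1, self_mem_nhdsWithin, nhdsWithin_le_nhds (Iio_mem_nhds hr)]
    with ρ h1 (h2 : 0 < ρ) (h3 : ρ < r)
  have hsub : f ⁻¹' G ∩ ball x ρ ⊆ s := fun y hy => hrs (ball_subset_ball h3.le hy.2)
  have hx : x ∈ s := mem_of_mem_nhds hs
  refine (hausdorff_le_of_antilip_on K d hA hsub).trans ?_
  have him : f '' (f ⁻¹' G ∩ ball x ρ) ⊆ G ∩ ball (f x) (K' * ρ) := by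
    rintro _ ⟨y, hy, rfl⟩
    refine ⟨hy.1, ?_⟩
    have := hL.dist_le_mul y (hsub hy) x hx
    rw [mem_ball]
    have h5 : dist y x < ρ := hy.2
    calc _ ≤ _ := this
      _ ≤ K * ρ := by gcongr
      _ < K' * ρ := by gcongr; simp [K']
  calc _ ≤ (K:ℝ≥0∞) ^ d * ENNReal.ofReal (ε / K' ^ d * ρ ^ d) := by
        gcongr; exact (measure_mono him).trans h1
    _ ≤ ENNReal.ofReal (K' ^ d) * ENNReal.ofReal (ε / K' ^ d * ρ ^ d) := by
        gcongr
        rw [ENNReal.ofReal_pow hK'.le]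
        gcongr
        rw [← ENNReal.ofReal_coe_nnreal]
        exact ENNReal.ofReal_le_ofReal (by simp [K'])
    _ = _ := by
        rw [← ENNReal.ofReal_mul (by positivity)]
        congr 1; field_simp

lemma MZ_image {f : X → Y} {s : Set X} {x : X} (hs : s ∈ 𝓝 x) {K : ℝ≥0} {d : ℕ}
    (hL : LipschitzOnWith K f s) (hA : ∀ a ∈ s, ∀ b ∈ s, edist a b ≤ K * edist (f a) (f b))
    (ho : f '' s ∈ 𝓝 (f x))
    {G : Set Y} (hG : MZ d (f ⁻¹' G) x) : MZ d G (f x) := by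
  intro ε hε
  obtain ⟨r, hr, hrs⟩ := Metric.mem_nhds_iff.1 ho
  set K' : ℝ := K + 1
  have hK' : 0 < K' := by positivity
  have h1 := MZm_comp_mul hG hK' (ε := ε / K' ^ d) (by positivity)
  filter_upwards [h1, self_mem_nhdsWithin, nhdsWithin_le_nhds (Iio_mem_nhds hr)]
    with ρ h1 (h2 : 0 < ρ) (h3 : ρ < r)
  have hx : x ∈ s := mem_of_mem_nhds hs
  have hsub : G ∩ ball (f x) ρ ⊆ f '' (s ∩ (f ⁻¹' G ∩ ball x (K' * ρ))) := by
    rintro z ⟨hz, hzb⟩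
    obtain ⟨y, hy, rfl⟩ := hrs (ball_subset_ball h3.le hzb)
    refine ⟨y, ⟨hy, hz, ?_⟩, rfl⟩
    have h4 := hA y hy x hx
    rw [edist_nndist, edist_nndist, ← ENNReal.coe_mul, ENNReal.coe_le_coe, ← NNReal.coe_le_coe] at h4
    simp only [NNReal.coe_mul, coe_nndist] at h4
    rw [mem_ball] at hzb ⊢
    calc _ ≤ _ := h4
      _ ≤ K * ρ := by gcongr
      _ < K' * ρ := by gcongr; simp [K']
  refine (measure_mono hsub).trans ?_
  have h6 := (hL.mono inter_subset_left :
    LipschitzOnWith K f (s ∩ (f ⁻¹' G ∩ ball x (K' * ρ)))).hausdorffMeasure_image_le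
    (d := (d:ℝ)) (by positivity)
  refine h6.trans ?_
  calc _ ≤ (K:ℝ≥0∞) ^ d * ENNReal.ofReal (ε / K' ^ d * ρ ^ d) := by
        rw [ENNReal.rpow_natCast]
        gcongr; exact (measure_mono inter_subset_right).trans h1
    _ ≤ ENNReal.ofReal (K' ^ d) * ENNReal.ofReal (ε / K' ^ d * ρ ^ d) := by
        gcongr
        rw [ENNReal.ofReal_pow hK'.le]
        gcongr
        rw [← ENNReal.ofReal_coe_nnreal]
        exact ENNReal.ofReal_le_ofReal (by simp [K'])
    _ = _ := by
        rw [← ENNReal.ofReal_mul (by positivity)]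
        congr 1; field_simp

/-- locally bi-Lipschitz open at `x` -/
def LBL (f : X → Y) (x : X) : Prop := ∃ s ∈ 𝓝 x, ∃ K : ℝ≥0, LipschitzOnWith K f s ∧
  (∀ a ∈ s, ∀ b ∈ s, edist a b ≤ K * edist (f a) (f b)) ∧ f '' s ∈ 𝓝 (f x)

lemma LBL.MZ_iff {f : X → Y} {x : X} (h : LBL f x) (d : ℕ) (G : Set Y) :
    MZ d (f ⁻¹' G) x ↔ MZ d G (f x) := by
  obtain ⟨s, hs, K, h1, h2, h3⟩ := h
  exact ⟨MZ_image hs h1 h2 h3, MZ_preimage hs h1 h2⟩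

lemma LBL.mem_eB_iff {f : X → Y} {x : X} (h : LBL f x) (d : ℕ) (G : Set Y) :
    x ∈ eB d (f ⁻¹' G) ↔ f x ∈ eB d G := by
  have h1 := h.MZ_iff d G
  have h2 := h.MZ_iff d Gᶜ
  simp only [eB, mem_setOf_eq, ← preimage_compl, h1, h2]

end MZbasics

lemma LBL_of_linearEquiv {E F : Type*} [NormedAddCommGroup E] [NormedSpace ℝ E]
    [NormedAddCommGroup F] [NormedSpace ℝ F] (Φ : E ≃L[ℝ] F) (x : E) : LBL Φ x := by
  refine ⟨univ, univ_mem, max ‖(Φ : E →L[ℝ] F)‖₊ ‖(Φ.symm : F →L[ℝ] E)‖₊, ?_, ?_, ?_⟩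
  · have h1 := (Φ : E →L[ℝ] F).lipschitz
    exact (h1.weaken (le_max_left _ _)).lipschitzOnWith
  · intro a _ b _
    have h1 := (Φ.antilipschitz) a b
    exact h1.trans (by gcongr; exact_mod_cast le_max_right _ _)
  · rw [image_univ, Φ.surjective.range_eq]; exact univ_mem

section Haar
variable {X : Type*} [NormedAddCommGroup X] [NormedSpace ℝ X] [FiniteDimensional ℝ X]
  [MeasurableSpace X] [BorelSpace X]

lemma haarH {d : ℕ} (hd : Module.finrank ℝ X = d) : (μH[(d:ℝ)] : Measure X).IsAddHaarMeasure := by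
  rw [← hd]; exact isAddHaarMeasure_hausdorffMeasure

lemma MZ_iff_haar {d : ℕ} (hd : Module.finrank ℝ X = d) (μ : Measure X) [μ.IsAddHaarMeasure]
    (G : Set X) (x : X) : MZ d G x ↔ MZm μ d G x := by
  have hH := haarH hd
  constructor
  · refine MZm_of_le (c := Measure.addHaarScalarFactor μ (μH[(d:ℝ)] : Measure X)) (by simp) ?_
    intro A
    conv_lhs => rw [Measure.isAddLeftInvariant_eq_smul μ (μH[(d:ℝ)] : Measure X)]
    simp
  · refine MZm_of_le (c := Measure.addHaarScalarFactor (μH[(d:ℝ)] : Measure X) μ) (by simp) ?_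
    intro A
    conv_lhs => rw [Measure.isAddLeftInvariant_eq_smul (μH[(d:ℝ)] : Measure X) μ]
    simp

lemma MZm_iff_tendsto {d : ℕ} (hd : Module.finrank ℝ X = d) (μ : Measure X) [μ.IsAddHaarMeasure]
    (G : Set X) (x : X) : MZm μ d G x ↔
      Tendsto (fun ρ : ℝ => μ (G ∩ ball x ρ) / μ (ball x ρ)) (𝓝[>] (0:ℝ)) (𝓝 0) := by
  have hb0 : μ (ball (0:X) 1) ≠ 0 := (measure_ball_pos μ 0 one_pos).ne'
  have hbt : μ (ball (0:X) 1) ≠ ⊤ := measure_ball_lt_top.ne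
  rw [ENNReal.tendsto_nhds_zero]
  constructor
  · intro h ε hε
    rcases eq_or_ne ε ⊤ with rfl | hεt
    · simp
    have hpos : 0 < (ε * μ (ball (0:X) 1)).toReal :=
      ENNReal.toReal_pos (mul_ne_zero hε.ne' hb0) (ENNReal.mul_ne_top hεt hbt)
    filter_upwards [h _ hpos, self_mem_nhdsWithin] with ρ h1 (h2 : 0 < ρ)
    rw [Measure.addHaar_ball_of_pos μ x h2, hd]
    apply ENNReal.div_le_of_le_mul
    refine h1.trans ?_
    rw [ENNReal.ofReal_mul hpos.le, ENNReal.ofReal_toReal (ENNReal.mul_ne_top hεt hbt)]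
    apply le_of_eq; ring
  · intro h ε hε
    have := h (ENNReal.ofReal ε / μ (ball (0:X) 1))
      (ENNReal.div_pos (by simpa using hε) hbt)
    filter_upwards [this, self_mem_nhdsWithin] with ρ h1 (h2 : 0 < ρ)
    rw [ENNReal.div_le_iff (measure_ball_pos μ x h2).ne' measure_ball_lt_top.ne] at h1
    refine h1.trans ?_
    rw [Measure.addHaar_ball_of_pos μ x h2, hd, ENNReal.ofReal_mul hε.le]
    rw [mul_comm (ENNReal.ofReal (ρ ^ d)), ← mul_assoc, ENNReal.div_mul_cancel hb0 hbt]

/-- `G` and its complement cannot both have density zero. -/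
lemma not_MZm_both {d : ℕ} (hd : Module.finrank ℝ X = d) (μ : Measure X) [μ.IsAddHaarMeasure]
    (G : Set X) (x : X) (h1 : MZm μ d G x) (h2 : MZm μ d Gᶜ x) : False := by
  have h := MZm_union h1 h2
  rw [union_compl_self, MZm_iff_tendsto hd] at h
  have h3 : Tendsto (fun ρ : ℝ => μ (univ ∩ ball x ρ) / μ (ball x ρ)) (𝓝[>] (0:ℝ)) (𝓝 1) := by
    apply tendsto_const_nhds.congr'
    filter_upwards [self_mem_nhdsWithin] with ρ (h2 : 0 < ρ)
    rw [univ_inter, ENNReal.div_self (measure_ball_pos μ x h2).ne' measure_ball_lt_top.ne]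
  exact zero_ne_one (tendsto_nhds_unique h h3)

lemma density_one_iff {d : ℕ} (hd : Module.finrank ℝ X = d) (μ : Measure X) [μ.IsAddHaarMeasure]
    {G : Set X} (hG : MeasurableSet G) (x : X) :
    Tendsto (fun ρ : ℝ => μ (G ∩ ball x ρ) / μ (ball x ρ)) (𝓝[>] (0:ℝ)) (𝓝 1) ↔
    MZm μ d Gᶜ x := by
  rw [MZm_iff_tendsto hd]
  have key : ∀ᶠ ρ : ℝ in 𝓝[>] (0:ℝ), μ (G ∩ ball x ρ) / μ (ball x ρ) =
      1 - μ (Gᶜ ∩ ball x ρ) / μ (ball x ρ) := by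
    filter_upwards [self_mem_nhdsWithin] with ρ (h2 : 0 < ρ)
    have h5 : μ (ball x ρ) ≠ ⊤ := measure_ball_lt_top.ne
    have h6 : μ (ball x ρ) ≠ 0 := (measure_ball_pos μ x h2).ne'
    have h3 : μ (G ∩ ball x ρ) + μ (Gᶜ ∩ ball x ρ) = μ (ball x ρ) := by
      rw [inter_comm G, inter_comm Gᶜ]
      exact measure_inter_add_diff _ hG
    have h4 : μ (G ∩ ball x ρ) / μ (ball x ρ) + μ (Gᶜ ∩ ball x ρ) / μ (ball x ρ) = 1 := by
      rw [← ENNReal.add_div, h3, ENNReal.div_self h6 h5]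
    rw [← h4, ENNReal.add_sub_cancel_right]
    exact (ENNReal.div_lt_top (ne_top_of_le_ne_top h5 (measure_mono inter_subset_right)) h6).ne
  have key2 : ∀ᶠ ρ : ℝ in 𝓝[>] (0:ℝ), μ (Gᶜ ∩ ball x ρ) / μ (ball x ρ) =
      1 - μ (G ∩ ball x ρ) / μ (ball x ρ) := by
    filter_upwards [self_mem_nhdsWithin, key] with ρ (h2 : 0 < ρ) hk
    rw [hk, ENNReal.sub_sub_cancel ENNReal.one_ne_top]
    apply ENNReal.div_le_of_le_mul
    rw [one_mul]; exact measure_mono inter_subset_right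
  constructor
  · intro h
    have := (ENNReal.Tendsto.sub (tendsto_const_nhds (x := (1:ℝ≥0∞))) h (Or.inl ENNReal.one_ne_top))
    rw [tsub_self] at this
    exact this.congr' (key2.mono fun _ h => h.symm)
  · intro h
    have := (ENNReal.Tendsto.sub (tendsto_const_nhds (x := (1:ℝ≥0∞))) h (Or.inl ENNReal.one_ne_top))
    rw [tsub_zero] at this
    exact this.congr' (key.mono fun _ h => h.symm)

end Haar

lemma essBoundary_eq_eB {n : ℕ} {E : Set (Euc n)} (hE : MeasurableSet E) :
    essBoundary E = eB n E := by
  ext x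
  have hd : Module.finrank ℝ (Euc n) = n := by simp
  simp only [essBoundary, eB, DensityAt, mem_setOf_eq]
  rw [density_one_iff hd volume hE, MZ_iff_haar hd volume, MZ_iff_haar hd volume,
    MZm_iff_tendsto hd, MZm_iff_tendsto hd]

section Haar2
variable {X : Type*} [NormedAddCommGroup X] [NormedSpace ℝ X] [FiniteDimensional ℝ X]
  [MeasurableSpace X] [BorelSpace X]

lemma outer_density (μ : Measure X) [μ.IsAddHaarMeasure] (s : Set X) :
    μ {x | x ∈ s ∧ ¬ Tendsto (fun ρ : ℝ => μ (s ∩ ball x ρ) / μ (ball x ρ)) (𝓝[>] (0:ℝ)) (𝓝 1)}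
      = 0 := by
  have h := Besicovitch.ae_tendsto_measure_inter_div μ s
  rw [ae_iff] at h
  have h2 := Measure.le_restrict_apply (μ := μ) s
    {x | ¬ Tendsto (fun r => μ (s ∩ closedBall x r) / μ (closedBall x r)) (𝓝[>] 0) (𝓝 1)}
  rw [h] at h2
  refine measure_mono_null ?_ (le_antisymm h2 zero_le)
  rintro x ⟨hx, hx2⟩
  refine ⟨fun hx3 => hx2 (hx3.congr' ?_), hx⟩
  filter_upwards [self_mem_nhdsWithin] with ρ (hρ : 0 < ρ)
  have e1 : ball x ρ =ᵐ[μ] closedBall x ρ := by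
    rw [← ball_union_sphere]
    refine (union_ae_eq_left_of_ae_eq_empty ?_).symm
    rw [ae_eq_empty]
    exact Measure.addHaar_sphere_of_ne_zero μ x hρ.ne'
  rw [measure_congr e1, measure_congr ((ae_eq_refl s).inter e1)]

lemma MZ_compl_ae_of_mem {d : ℕ} (hd : Module.finrank ℝ X = d) (μ : Measure X)
    [μ.IsAddHaarMeasure] {G : Set X} (hG : MeasurableSet G) :
    ∀ᵐ x ∂μ, x ∈ G → MZ d Gᶜ x := by
  have h := outer_density μ G
  rw [ae_iff]
  refine measure_mono_null ?_ h
  intro x hx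
  simp only [mem_setOf_eq, Classical.not_imp] at hx ⊢
  refine ⟨hx.1, fun h => hx.2 ?_⟩
  rw [MZ_iff_haar hd μ]
  exact (density_one_iff hd μ hG x).1 h

lemma MZ_ae_of_not_mem {d : ℕ} (hd : Module.finrank ℝ X = d) (μ : Measure X)
    [μ.IsAddHaarMeasure] {G : Set X} (hG : MeasurableSet G) :
    ∀ᵐ x ∂μ, x ∉ G → MZ d G x := by
  have := MZ_compl_ae_of_mem hd μ hG.compl
  simpa using this

end Haar2

section Closed
variable {X : Type*} [MetricSpace X] [MeasurableSpace X] [BorelSpace X]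

lemma isClosed_measure_ball_le (μ : Measure X) (G : Set X) (ρ : ℝ) (c : ℝ≥0∞) :
    IsClosed {x | μ (G ∩ ball x ρ) ≤ c} := by
  rw [← isOpen_compl_iff, Metric.isOpen_iff]
  intro x hx
  simp only [mem_compl_iff, mem_setOf_eq, not_le] at hx
  have hU : G ∩ ball x ρ = ⋃ k : ℕ, G ∩ ball x (ρ - 1 / ((k:ℝ) + 1)) := by
    rw [← inter_iUnion]
    congr 1
    ext y
    simp only [mem_ball, mem_iUnion]
    constructor
    · intro h
      obtain ⟨k, hk⟩ := exists_nat_one_div_lt (sub_pos.2 h)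
      exact ⟨k, by linarith⟩
    · rintro ⟨k, hk⟩
      have : (0:ℝ) < 1 / ((k:ℝ) + 1) := by positivity
      linarith
  have hmono : Monotone fun k : ℕ => G ∩ ball x (ρ - 1 / ((k:ℝ) + 1)) := by
    intro k l hkl
    apply inter_subset_inter_right
    apply ball_subset_ball
    have : (1:ℝ) / ((l:ℝ) + 1) ≤ 1 / ((k:ℝ) + 1) := by
      apply one_div_le_one_div_of_le (by positivity)
      have : (k:ℝ) ≤ l := by exact_mod_cast hkl
      linarith
    linarith
  rw [hU, hmono.measure_iUnion, lt_iSup_iff] at hx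
  obtain ⟨k, hk⟩ := hx
  refine ⟨1 / ((k:ℝ) + 1), by positivity, fun y hy => ?_⟩
  simp only [mem_compl_iff, mem_setOf_eq, not_le]
  refine hk.trans_le (measure_mono (inter_subset_inter_right _ ?_))
  apply ball_subset_ball'
  rw [mem_ball, dist_comm] at hy
  linarith

/-- uniform small density sets -/
def Dset (μ : Measure X) (d : ℕ) (G : Set X) (ε δ : ℝ) : Set X :=
  {x | ∀ ρ ∈ Ioo 0 δ, μ (G ∩ ball x ρ) ≤ ENNReal.ofReal (ε * ρ ^ d)}

lemma isClosed_Dset (μ : Measure X) (d : ℕ) (G : Set X) (ε δ : ℝ) : IsClosed (Dset μ d G ε δ) := by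
  have : Dset μ d G ε δ = ⋂ ρ ∈ Ioo 0 δ, {x | μ (G ∩ ball x ρ) ≤ ENNReal.ofReal (ε * ρ ^ d)} := by
    ext x; simp [Dset]
  rw [this]
  exact isClosed_biInter fun ρ _ => isClosed_measure_ball_le μ G ρ _

lemma MZm_iff_Dset (μ : Measure X) (d : ℕ) (G : Set X) (x : X) :
    MZm μ d G x ↔ ∀ k : ℕ, ∃ j : ℕ, x ∈ Dset μ d G (1 / ((k:ℝ) + 1)) (1 / ((j:ℝ) + 1)) := by
  constructor
  · intro h k
    have := h (1 / ((k:ℝ) + 1)) (by positivity)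
    rw [eventually_nhdsWithin_iff, Metric.eventually_nhds_iff] at this
    obtain ⟨δ, hδ, h2⟩ := this
    obtain ⟨j, hj⟩ := exists_nat_one_div_lt hδ
    refine ⟨j, fun ρ hρ => h2 ?_ hρ.1⟩
    rw [Real.dist_eq, sub_zero, abs_of_pos hρ.1]
    exact hρ.2.trans hj
  · intro h ε hε
    obtain ⟨k, hk⟩ := exists_nat_one_div_lt hε
    obtain ⟨j, hj⟩ := h k
    have hj0 : (0:ℝ) < 1 / ((j:ℝ) + 1) := by positivity
    filter_upwards [Ioo_mem_nhdsGT hj0] with ρ hρ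
    refine (hj ρ hρ).trans (ENNReal.ofReal_le_ofReal ?_)
    have : 0 ≤ ρ ^ d := by have := hρ.1; positivity
    gcongr

lemma MZm_Dset_exists {μ : Measure X} {d : ℕ} {G : Set X} {x : X} (h : MZm μ d G x) {ε : ℝ}
    (hε : 0 < ε) : ∃ j : ℕ, x ∈ Dset μ d G ε (1 / ((j:ℝ) + 1)) := by
  obtain ⟨k, hk⟩ := exists_nat_one_div_lt hε
  obtain ⟨j, hj⟩ := (MZm_iff_Dset μ d G x).1 h k
  refine ⟨j, fun ρ hρ => (hj ρ hρ).trans (ENNReal.ofReal_le_ofReal ?_)⟩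
  have : 0 ≤ ρ ^ d := by have := hρ.1; positivity
  gcongr

lemma measurableSet_MZm (μ : Measure X) (d : ℕ) (G : Set X) : MeasurableSet {x | MZm μ d G x} := by
  have : {x | MZm μ d G x} =
      ⋂ k : ℕ, ⋃ j : ℕ, Dset μ d G (1 / ((k:ℝ) + 1)) (1 / ((j:ℝ) + 1)) := by
    ext x; rw [mem_setOf_eq, MZm_iff_Dset]; simp
  rw [this]
  exact MeasurableSet.iInter fun k => MeasurableSet.iUnion fun j =>
    (isClosed_Dset _ _ _ _ _).measurableSet

lemma measurableSet_eB (d : ℕ) (G : Set X) : MeasurableSet (eB d G) :=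
  (measurableSet_MZm _ d G).compl.inter (measurableSet_MZm _ d Gᶜ).compl

end Closed

lemma volume_sign_Ioo {σ : ℝ} (hσ : σ = 1 ∨ σ = -1) (a b : ℝ) :
    volume {s : ℝ | σ * s ∈ Ioo a b} = ENNReal.ofReal (b - a) := by
  rcases hσ with rfl | rfl
  · simp only [one_mul]; exact Real.volume_Ioo
  · have : {s : ℝ | (-1:ℝ) * s ∈ Ioo a b} = Ioo (-b) (-a) := by
      ext s; simp only [mem_setOf_eq, mem_Ioo]; constructor <;> rintro ⟨h1, h2⟩ <;> constructor <;> linarith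
    rw [this, Real.volume_Ioo]; congr 1; ring

section Federer
variable {W : Type*} [NormedAddCommGroup W] [NormedSpace ℝ W] [FiniteDimensional ℝ W]
  [MeasurableSpace W] [BorelSpace W]

lemma finrank_prodR {m : ℕ} (hm : Module.finrank ℝ W = m) : Module.finrank ℝ (W × ℝ) = m + 1 := by
  simp [hm]

/-- small constant for the Federer lemma -/
noncomputable def fedc (μ : Measure W) (m : ℕ) : ℝ := (μ (ball 0 1)).toReal * (1/2)^m / 16

lemma fedc_pos (μ : Measure W) [μ.IsAddHaarMeasure] (m : ℕ) : 0 < fedc μ m := by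
  have : 0 < (μ (ball (0:W) 1)).toReal :=
    ENNReal.toReal_pos (measure_ball_pos μ 0 one_pos).ne' measure_ball_lt_top.ne
  unfold fedc; positivity

lemma outer_inter_lower (μ : Measure W) {P B C : Set W} (hC : MeasurableSet C) (hCB : C ⊆ B)
    (hBf : μ B ≠ ⊤) (hB : MeasurableSet B) {a : ℝ≥0∞} (h : μ B ≤ μ (P ∩ B) + a) :
    μ C ≤ μ (P ∩ C) + a := by
  have h1 : μ (P ∩ B) ≤ μ (P ∩ C) + μ (B \ C) := by
    refine (measure_mono ?_).trans (measure_union_le _ _)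
    rintro x ⟨h1, h2⟩
    by_cases hx : x ∈ C
    · exact Or.inl ⟨h1, hx⟩
    · exact Or.inr ⟨h2, hx⟩
  have h2 : μ B = μ C + μ (B \ C) := by
    rw [← measure_inter_add_diff B hC, inter_eq_self_of_subset_right hCB]
  have h3 : μ (B \ C) ≠ ⊤ := ne_top_of_le_ne_top hBf (measure_mono diff_subset)
  rw [h2] at h
  have : μ C + μ (B \ C) ≤ (μ (P ∩ C) + a) + μ (B \ C) := by
    calc _ ≤ _ := h
      _ ≤ μ (P ∩ C) + μ (B \ C) + a := by gcongr
      _ = _ := by ring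
  exact (ENNReal.add_le_add_iff_right h3).1 this

lemma half_ball_lower (μ : Measure W) [μ.IsAddHaarMeasure] {m : ℕ} (hm : Module.finrank ℝ W = m)
    {p q : W} {ρ : ℝ} (hρ : 0 < ρ) (hpq : dist q p < ρ) :
    ENNReal.ofReal ((1/2)^m * ρ^m) * μ (ball 0 1) ≤ μ (ball p ρ ∩ ball q ρ) := by
  have hsub : ball (midpoint ℝ p q) (ρ/2) ⊆ ball p ρ ∩ ball q ρ := by
    intro x hx
    rw [mem_ball] at hx
    have h1 : dist (midpoint ℝ p q) p = (1/2) * dist q p := by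
      rw [dist_midpoint_left]; simp [dist_comm]
    have h2 : dist (midpoint ℝ p q) q = (1/2) * dist q p := by
      rw [dist_midpoint_right]; simp [dist_comm]
    have h3 := dist_triangle x (midpoint ℝ p q) p
    have h4 := dist_triangle x (midpoint ℝ p q) q
    exact ⟨by rw [mem_ball]; linarith, by rw [mem_ball]; linarith⟩
  refine le_trans (le_of_eq ?_) (measure_mono hsub)
  rw [Measure.addHaar_ball_of_pos μ (midpoint ℝ p q) (by positivity), hm,
    show (ρ/2)^m = (1/2)^m * ρ^m by rw [← mul_pow]; congr 1; ring]

/-- **Key lemma**: null projection of one-sided bad points. -/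
lemma federer_key (μ : Measure W) [μ.IsAddHaarMeasure] {m : ℕ} (hm : Module.finrank ℝ W = m)
    {G : Set (W × ℝ)} (hG : MeasurableSet G) {σ : ℝ} (hσ : σ = 1 ∨ σ = -1) {δ : ℝ} (hδ : 0 < δ)
    (c : ℝ) :
    μ (Prod.fst '' {z : W × ℝ | z ∈ Dset (μ.prod volume) (m+1) Gᶜ (fedc μ m) δ ∧
      (∀ s ∈ Ioo 0 δ, MZm (μ.prod volume) (m+1) G (z.1, z.2 + σ * s)) ∧
      σ * z.2 ∈ Ioo c (c + δ/2)}) = 0 := by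
  set lam : Measure (W × ℝ) := μ.prod volume
  set A := {z : W × ℝ | z ∈ Dset lam (m+1) Gᶜ (fedc μ m) δ ∧
      (∀ s ∈ Ioo 0 δ, MZm lam (m+1) G (z.1, z.2 + σ * s)) ∧
      σ * z.2 ∈ Ioo c (c + δ/2)} with hA
  have hσ2 : σ * σ = 1 := by rcases hσ with rfl | rfl <;> norm_num
  set P := Prod.fst '' A
  refine measure_mono_null ?_ (outer_density μ P)
  intro p hp
  refine ⟨hp, fun hdens => ?_⟩
  set ω := μ (ball (0:W) 1)
  have hω0 : ω ≠ 0 := (measure_ball_pos μ 0 one_pos).ne'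
  have hωt : ω ≠ ⊤ := measure_ball_lt_top.ne
  have hωr : 0 < ω.toReal := ENNReal.toReal_pos hω0 hωt
  -- scale
  have hlt : (1:ℝ≥0∞) - ENNReal.ofReal ((1/2)^m/2) < 1 :=
    ENNReal.sub_lt_self ENNReal.one_ne_top one_ne_zero (by simp)
  have hev := (hdens.eventually (lt_mem_nhds hlt)).and (Ioo_mem_nhdsGT (half_pos hδ))
  obtain ⟨ρ, hρ1, hρ⟩ := hev.exists
  have hρ0 : 0 < ρ := hρ.1
  have hρδ : ρ < δ/2 := hρ.2
  have hB0 : μ (ball p ρ) ≠ 0 := (measure_ball_pos μ p hρ0).ne'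
  have hBt : μ (ball p ρ) ≠ ⊤ := measure_ball_lt_top.ne
  have hPB : μ (ball p ρ) ≤ μ (P ∩ ball p ρ) + ENNReal.ofReal ((1/2)^m/2) * μ (ball p ρ) := by
    have h1 : (1:ℝ≥0∞) ≤ μ (P ∩ ball p ρ) / μ (ball p ρ) + ENNReal.ofReal ((1/2)^m/2) :=
      tsub_le_iff_right.1 hρ1.le
    calc μ (ball p ρ) = 1 * μ (ball p ρ) := (one_mul _).symm
      _ ≤ (μ (P ∩ ball p ρ) / μ (ball p ρ) + ENNReal.ofReal ((1/2)^m/2)) * μ (ball p ρ) := by gcongr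
      _ = _ := by rw [add_mul, ENNReal.div_mul_cancel hB0 hBt]
  -- the sup of heights
  set H := {t : ℝ | ∃ z ∈ A, z.1 ∈ ball p ρ ∧ t = σ * z.2}
  have hHne : H.Nonempty := by
    obtain ⟨z, hz, rfl⟩ := hp
    exact ⟨σ * z.2, z, hz, mem_ball_self hρ0, rfl⟩
  have hHb : BddAbove H := by
    refine ⟨c + δ/2, ?_⟩
    rintro t ⟨z, hz, _, rfl⟩
    exact hz.2.2.2.le
  obtain ⟨t, ⟨z, hz, hzb, rfl⟩, hzt⟩ := exists_lt_of_lt_csSup hHne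
    (show sSup H - ρ/2 < sSup H by linarith)
  have hall : ∀ z' ∈ A, z'.1 ∈ ball p ρ → σ * z'.2 < σ * z.2 + ρ/2 := by
    intro z' hz' hb
    have : σ * z'.2 ≤ sSup H := le_csSup hHb ⟨z', hz', hb, rfl⟩
    linarith
  -- the null part
  set Q := {x | MZm lam (m+1) G x}
  have hQG : lam (Q ∩ G) = 0 := by
    have h1 := MZ_compl_ae_of_mem (finrank_prodR hm) lam hG
    rw [ae_iff] at h1
    refine measure_mono_null ?_ h1
    rintro x ⟨hx1, hx2⟩
    simp only [mem_setOf_eq, Classical.not_imp]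
    refine ⟨hx2, fun h3 => ?_⟩
    rw [MZ_iff_haar (finrank_prodR hm) lam] at h3
    exact not_MZm_both (finrank_prodR hm) lam G x hx1 h3
  set C := ball p ρ ∩ ball z.1 ρ
  set I := {s : ℝ | σ * s ∈ Ioo (σ * z.2 + ρ/2) (σ * z.2 + ρ)}
  have hsub : (P ∩ C) ×ˢ I ⊆ (Gᶜ ∩ ball z ρ) ∪ (Q ∩ G) := by
    rintro ⟨q, s⟩ ⟨⟨⟨z', hz', hq⟩, hqp, hqz⟩, hs⟩
    simp only at hq hqp hqz
    have hs' : σ * s ∈ Ioo (σ * z.2 + ρ/2) (σ * z.2 + ρ) := hs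
    have hb : (q, s) ∈ ball z ρ := by
      rw [show z = (z.1, z.2) from rfl, ← ball_prod_same]
      refine ⟨hqz, ?_⟩
      rw [mem_ball, Real.dist_eq]
      rcases hσ with rfl | rfl
      · rw [abs_lt]; constructor <;> linarith [hs'.1, hs'.2]
      · rw [abs_lt]; constructor <;> linarith [hs'.1, hs'.2]
    have hQ : (q, s) ∈ Q := by
      have h1 := hall z' hz' (hq ▸ hqp)
      have h2 := hz'.2.1 (σ * s - σ * z'.2) ⟨by linarith [hs'.1], by
        have := hz'.2.2.1; have := hz.2.2.2; linarith [hs'.2]⟩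
      have h3 : z'.2 + σ * (σ * s - σ * z'.2) = s := by
        have : z'.2 + σ * (σ * s - σ * z'.2) = z'.2 + (σ * σ) * (s - z'.2) := by ring
        rw [this, hσ2]; ring
      rw [h3, hq] at h2
      exact h2
    by_cases hg : (q, s) ∈ G
    · exact Or.inr ⟨hQ, hg⟩
    · exact Or.inl ⟨hg, hb⟩
  have h1 : lam ((P ∩ C) ×ˢ I) ≤ ENNReal.ofReal (fedc μ m * ρ ^ (m+1)) := by
    refine (measure_mono hsub).trans ((measure_union_le _ _).trans ?_)
    rw [hQG, add_zero]
    exact hz.1 ρ ⟨hρ0, by linarith⟩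
  rw [Measure.prod_prod, volume_sign_Ioo hσ] at h1
  have h2 : μ C ≤ μ (P ∩ C) + ENNReal.ofReal ((1/2)^m/2) * μ (ball p ρ) :=
    outer_inter_lower μ (measurableSet_ball.inter measurableSet_ball) inter_subset_left hBt
      measurableSet_ball hPB
  have h3 : ENNReal.ofReal ((1/2)^m * ρ^m) * ω ≤ μ C := half_ball_lower μ hm hρ0 hzb
  rw [Measure.addHaar_ball_of_pos μ p hρ0, hm] at h2
  change μ C ≤ μ (P ∩ C) + ENNReal.ofReal ((1 / 2) ^ m / 2) * (ENNReal.ofReal (ρ ^ m) * ω) at h2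
  have hx : μ (P ∩ C) ≠ ⊤ := ne_top_of_le_ne_top hBt
    (measure_mono (inter_subset_right.trans inter_subset_left))
  -- pass to reals
  have h4 := h3.trans h2
  rw [← ENNReal.ofReal_toReal hx, ← ENNReal.ofReal_toReal hωt] at h4
  rw [← ENNReal.ofReal_toReal hx] at h1
  rw [← ENNReal.ofReal_mul (by positivity), ← ENNReal.ofReal_mul (by positivity),
    ← ENNReal.ofReal_mul (by positivity), ← ENNReal.ofReal_add (by positivity) (by positivity),
    ENNReal.ofReal_le_ofReal_iff (by positivity)] at h4
  rw [← ENNReal.ofReal_mul (by positivity), ENNReal.ofReal_le_ofReal_iff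
    (by have := fedc_pos μ m; positivity)] at h1
  have h5 : fedc μ m = ω.toReal * (1/2)^m / 16 := rfl
  rw [h5, pow_succ] at h1
  set a := (1/2:ℝ)^m
  set b := ρ^m
  have ha : 0 < a := by positivity
  have hb : 0 < b := by positivity
  have h6 : a * b * ω.toReal / 2 ≤ (μ (P ∩ C)).toReal := by linarith
  have h7 : (μ (P ∩ C)).toReal * (ρ/2) ≤ (ω.toReal * a / 16 * b) * ρ := by
    calc _ = (μ (P ∩ C)).toReal * (σ * z.2 + ρ - (σ * z.2 + ρ / 2)) := by ring
      _ ≤ _ := h1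
      _ = _ := by ring
  have h8 : (μ (P ∩ C)).toReal ≤ ω.toReal * a / 8 * b := by nlinarith
  have h9 : 0 < a * b * ω.toReal := by positivity
  nlinarith

/-- no point of density one of `G` is adjacent to an interval of density zero points -/
lemma federer_forbid (μ : Measure W) [μ.IsAddHaarMeasure] {m : ℕ} (hm : Module.finrank ℝ W = m)
    {G : Set (W × ℝ)} (hG : MeasurableSet G) {σ : ℝ} (hσ : σ = 1 ∨ σ = -1) :
    ∀ᵐ p ∂μ, ∀ t η : ℝ, 0 < η → MZ (m+1) Gᶜ (p, t) →
      ¬ ∀ s ∈ Ioo 0 η, MZ (m+1) G (p, t + σ * s) := by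
  simp only [MZ_iff_haar (finrank_prodR hm) (μ.prod volume)]
  have h : ∀ j : ℕ, ∀ k : ℤ, ∀ᵐ p ∂μ, p ∉ (Prod.fst '' {z : W × ℝ |
      z ∈ Dset (μ.prod volume) (m+1) Gᶜ (fedc μ m) (1/((j:ℝ)+1)) ∧
      (∀ s ∈ Ioo 0 (1/((j:ℝ)+1)), MZm (μ.prod volume) (m+1) G (z.1, z.2 + σ * s)) ∧
      σ * z.2 ∈ Ioo ((k:ℝ) * (1/((j:ℝ)+1)/4)) ((k:ℝ) * (1/((j:ℝ)+1)/4) + 1/((j:ℝ)+1)/2)}) := by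
    intro j k
    exact measure_eq_zero_iff_ae_notMem.1 (federer_key μ hm hG hσ (by positivity) _)
  filter_upwards [ae_all_iff.2 fun j => ae_all_iff.2 (h j)] with p hp t η hη h1 h2
  obtain ⟨j1, hj1⟩ := MZm_Dset_exists h1 (fedc_pos μ m)
  obtain ⟨j2, hj2⟩ := exists_nat_one_div_lt hη
  set j := max j1 j2
  have ha : (1:ℝ)/((j:ℝ)+1) ≤ 1/((j1:ℝ)+1) := by
    apply one_div_le_one_div_of_le (by positivity)
    have : (j1:ℝ) ≤ j := by exact_mod_cast le_max_left _ _
    linarith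
  have hb : (1:ℝ)/((j:ℝ)+1) ≤ 1/((j2:ℝ)+1) := by
    apply one_div_le_one_div_of_le (by positivity)
    have : (j2:ℝ) ≤ j := by exact_mod_cast le_max_right _ _
    linarith
  set δ : ℝ := 1/((j:ℝ)+1)
  have hδ : 0 < δ := by positivity
  have hk := Int.ceil_lt_add_one (σ * t / (δ/4))
  have hk2 := Int.le_ceil (σ * t / (δ/4))
  set k := ⌈σ * t / (δ/4)⌉
  have e : σ * t = (σ * t / (δ/4)) * (δ/4) := by field_simp
  refine hp j (k - 1) ⟨(p, t), ⟨?_, ?_, ?_⟩, rfl⟩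
  · intro ρ hρ
    exact hj1 ρ ⟨hρ.1, hρ.2.trans_le ha⟩
  · intro s hs
    exact h2 s ⟨hs.1, hs.2.trans (hb.trans_lt hj2)⟩
  · push_cast
    change σ * t ∈ Ioo (((k:ℝ) - 1) * (δ/4)) (((k:ℝ) - 1) * (δ/4) + δ/2)
    constructor
    · rw [e]; apply mul_lt_mul_of_pos_right _ (by positivity); linarith
    · rw [e]; nlinarith

end Federer

/-- topological switch lemma -/
lemma baire_switch {a b : ℝ} {U0 U1 : Set ℝ} (hcover : Ioo a b ⊆ U0 ∪ U1)
    (C : ℕ → Set ℝ) (hC : ∀ k, IsClosed (C k)) (hCc : Ioo a b ⊆ ⋃ k, C k)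
    (hCU : ∀ k, C k ∩ Ioo a b ⊆ U0 ∨ C k ∩ Ioo a b ⊆ U1)
    (hdisj : Disjoint U0 U1)
    (f10 : ∀ σ : ℝ, (σ = 1 ∨ σ = -1) → ∀ t ∈ U1, ∀ η > 0, ¬ ∀ s ∈ Ioo 0 η, t + σ * s ∈ U0)
    (f01 : ∀ σ : ℝ, (σ = 1 ∨ σ = -1) → ∀ t ∈ U0, ∀ η > 0, ¬ ∀ s ∈ Ioo 0 η, t + σ * s ∈ U1) :
    Ioo a b ⊆ U0 ∨ Ioo a b ⊆ U1 := by
  have hsplit : ∀ S : Set ℝ, IsPreconnected S → S ⊆ interior U0 ∪ interior U1 →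
      S ⊆ interior U0 ∨ S ⊆ interior U1 := by
    intro S hS hSU
    exact hS.subset_or_subset isOpen_interior isOpen_interior
      (hdisj.mono interior_subset interior_subset) hSU
  set Z := Ioo a b \ (interior U0 ∪ interior U1) with hZ
  rcases Z.eq_empty_or_nonempty with hZe | hZne
  · rcases hsplit (Ioo a b) isPreconnected_Ioo (by rwa [hZ, diff_eq_empty] at hZe) with h | h
    · exact Or.inl (h.trans interior_subset)
    · exact Or.inr (h.trans interior_subset)
  exfalso
  have hZop : IsOpen (interior U0 ∪ interior U1) := isOpen_interior.union isOpen_interior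
  have hlc : IsLocallyClosed Z := isOpen_Ioo.isLocallyClosed.inter hZop.isClosed_compl.isLocallyClosed
  haveI : LocallyCompactSpace Z := hlc.locallyCompactSpace
  haveI : Nonempty Z := hZne.to_subtype
  obtain ⟨k, hk⟩ := nonempty_interior_of_iUnion_of_closed
    (f := fun k => (Subtype.val ⁻¹' (C k) : Set Z))
    (fun k => (hC k).preimage continuous_subtype_val)
    (by
      rw [← preimage_iUnion, eq_univ_iff_forall]
      intro z
      exact hCc z.2.1)
  obtain ⟨⟨z0, hz0⟩, hz0i⟩ := hk
  rw [mem_interior_iff_mem_nhds, nhds_subtype_eq_comap, mem_comap] at hz0i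
  obtain ⟨N, hN, hNC⟩ := hz0i
  have hN' : N ∩ Ioo a b ∈ 𝓝 z0 := inter_mem hN (isOpen_Ioo.mem_nhds hz0.1)
  obtain ⟨r, hr, hrN⟩ := Metric.mem_nhds_iff.1 hN'
  have hNZ : ∀ z ∈ Z, z ∈ ball z0 r → z ∈ C k ∩ Ioo a b := fun z hz hzb =>
    ⟨hNC (show (⟨z, hz⟩ : Z) ∈ _ from (hrN hzb).1), hz.1⟩
  -- symmetric core
  have core : ∀ A B : Set ℝ, Ioo a b ⊆ A ∪ B → Disjoint A B → (C k ∩ Ioo a b ⊆ B) →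
      Ioo a b \ (interior A ∪ interior B) = Z →
      (∀ σ : ℝ, (σ = 1 ∨ σ = -1) → ∀ t ∈ B, ∀ η > 0, ¬ ∀ s ∈ Ioo 0 η, t + σ * s ∈ A) →
      False := by
    intro A B hAB hd hCB hZ' hf
    have hz0B : z0 ∉ interior B := by
      have : z0 ∈ Ioo a b \ (interior A ∪ interior B) := hZ' ▸ hz0
      exact fun h => this.2 (Or.inr h)
    have : ∃ y ∈ ball z0 r, y ∈ A := by
      by_contra hcon
      push Not at hcon
      apply hz0B
      rw [mem_interior_iff_mem_nhds]
      refine mem_of_superset (ball_mem_nhds z0 hr) fun y hy => ?_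
      rcases hAB (hrN hy).2 with h | h
      · exact absurd h (hcon y hy)
      · exact h
    obtain ⟨y, hy, hyA⟩ := this
    have hsp : ∀ S : Set ℝ, IsPreconnected S → S ⊆ interior A ∪ interior B →
        S ⊆ interior A ∨ S ⊆ interior B := fun S hS hSU =>
      hS.subset_or_subset isOpen_interior isOpen_interior
        (hd.mono interior_subset interior_subset) hSU
    have hZcl : ∀ u v : ℝ, Icc u v ⊆ Ioo a b → IsCompact (Z ∩ Icc u v) := by
      intro u v huv
      have : Z ∩ Icc u v = Icc u v ∩ (interior U0 ∪ interior U1)ᶜ := by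
        ext x; constructor
        · rintro ⟨h1, h2⟩; exact ⟨h2, h1.2⟩
        · rintro ⟨h1, h2⟩; exact ⟨⟨huv h1, h2⟩, h1⟩
      rw [this]
      exact isCompact_Icc.inter_right hZop.isClosed_compl
    have hZB : ∀ z ∈ Z, z ∈ ball z0 r → z ∈ B := fun z hz hzb => hCB (hNZ z hz hzb)
    have hz0b : z0 ∈ ball z0 r := mem_ball_self hr
    have hord : ∀ u v, u ∈ ball z0 r → v ∈ ball z0 r → Icc u v ⊆ ball z0 r := by
      intro u v hu hv
      rw [Real.ball_eq_Ioo] at *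
      intro x hx
      exact ⟨hu.1.trans_le hx.1, hx.2.trans_lt hv.2⟩
    have hyZ : y ∉ Z := fun h => disjoint_left.1 hd hyA (hZB y h hy)
    rcases lt_trichotomy y z0 with hlt | heq | hgt
    · have hI := hord y z0 hy hz0b
      have hcpt := hZcl y z0 (fun x hx => (hrN (hI hx)).2)
      have hne : (Z ∩ Icc y z0).Nonempty := ⟨z0, hz0, hlt.le, le_rfl⟩
      have hmem := hcpt.sInf_mem hne
      set z := sInf (Z ∩ Icc y z0)
      have hzy : y < z := lt_of_le_of_ne hmem.2.1 (fun h => hyZ (h ▸ hmem.1))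
      have hS : Ico y z ⊆ interior A ∪ interior B := by
        intro x hx
        by_contra hcon
        have hxZ : x ∈ Z := hZ' ▸ ⟨(hrN (hI ⟨hx.1, hx.2.le.trans hmem.2.2⟩)).2, hcon⟩
        exact absurd (csInf_le hcpt.bddBelow ⟨hxZ, hx.1, hx.2.le.trans hmem.2.2⟩) (not_le.2 hx.2)
      have hSA : Ico y z ⊆ interior A := by
        rcases hsp _ isPreconnected_Ico hS with h | h
        · exact h
        · exact absurd (interior_subset (h ⟨le_rfl, hzy⟩)) (disjoint_left.1 hd hyA)
      refine hf (-1) (Or.inr rfl) z (hZB z hmem.1 (hI hmem.2)) (z - y) (by linarith) ?_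
      intro s hs
      exact interior_subset (hSA ⟨by linarith [hs.2], by linarith [hs.1]⟩)
    · exact disjoint_left.1 hd hyA (hZB y (heq ▸ hz0) hy)
    · have hI := hord z0 y hz0b hy
      have hcpt := hZcl z0 y (fun x hx => (hrN (hI hx)).2)
      have hne : (Z ∩ Icc z0 y).Nonempty := ⟨z0, hz0, le_rfl, hgt.le⟩
      have hmem := hcpt.sSup_mem hne
      set z := sSup (Z ∩ Icc z0 y)
      have hzy : z < y := lt_of_le_of_ne hmem.2.2 (fun h => hyZ (h ▸ hmem.1))
      have hS : Ioc z y ⊆ interior A ∪ interior B := by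
        intro x hx
        by_contra hcon
        have hxZ : x ∈ Z := hZ' ▸ ⟨(hrN (hI ⟨hmem.2.1.trans hx.1.le, hx.2⟩)).2, hcon⟩
        exact absurd (le_csSup hcpt.bddAbove ⟨hxZ, hmem.2.1.trans hx.1.le, hx.2⟩) (not_le.2 hx.1)
      have hSA : Ioc z y ⊆ interior A := by
        rcases hsp _ isPreconnected_Ioc hS with h | h
        · exact h
        · exact absurd (interior_subset (h ⟨hzy, le_rfl⟩)) (disjoint_left.1 hd hyA)
      refine hf 1 (Or.inl rfl) z (hZB z hmem.1 (hI hmem.2)) (y - z) (by linarith) ?_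
      intro s hs
      exact interior_subset (hSA ⟨by linarith [hs.1], by linarith [hs.2]⟩)
  rcases hCU k with h | h
  · exact core U1 U0 (by rwa [union_comm]) hdisj.symm h (by rw [hZ, union_comm]) f01
  · exact core U0 U1 hcover hdisj h rfl f10

section A3
variable {W : Type*} [NormedAddCommGroup W] [NormedSpace ℝ W] [FiniteDimensional ℝ W]
  [MeasurableSpace W] [BorelSpace W]

lemma line_const (μ : Measure W) [μ.IsAddHaarMeasure] {m : ℕ} (hm : Module.finrank ℝ W = m)
    {G : Set (W × ℝ)} (hG : MeasurableSet G) :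
    ∀ᵐ p ∂μ, ∀ a b : ℝ, (∀ t ∈ Ioo a b, (p, t) ∉ eB (m+1) G) →
      (∀ t ∈ Ioo a b, MZ (m+1) G (p, t)) ∨ (∀ t ∈ Ioo a b, MZ (m+1) Gᶜ (p, t)) := by
  have hd := finrank_prodR hm
  have hGc : MeasurableSet Gᶜ := hG.compl
  filter_upwards [federer_forbid μ hm hG (Or.inl rfl : (1:ℝ) = 1 ∨ _),
    federer_forbid μ hm hG (Or.inr rfl : (-1:ℝ) = 1 ∨ (-1:ℝ) = -1),
    federer_forbid μ hm hGc (Or.inl rfl : (1:ℝ) = 1 ∨ _),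
    federer_forbid μ hm hGc (Or.inr rfl : (-1:ℝ) = 1 ∨ (-1:ℝ) = -1)] with p h1 h2 h3 h4 a b hab
  rw [compl_compl] at h3 h4
  have hiff : ∀ (H : Set (W × ℝ)) x, MZ (m+1) H x ↔ MZm (μ.prod volume) (m+1) H x := fun H x =>
    MZ_iff_haar hd _ H x
  -- separation
  obtain ⟨ε, hε, hsep⟩ : ∃ ε : ℝ, 0 < ε ∧ ∀ (H : Set (W × ℝ)) (x : W × ℝ) (δ : ℝ), 0 < δ →
      x ∈ Dset (μ.prod volume) (m+1) H ε δ → ¬ MZm (μ.prod volume) (m+1) Hᶜ x := by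
    set ω := ((μ.prod volume) (ball (0 : W × ℝ) 1)).toReal with hω
    have hωpos : 0 < ω := ENNReal.toReal_pos (measure_ball_pos _ _ one_pos).ne'
      measure_ball_lt_top.ne
    refine ⟨ω / 4, by positivity, fun H x δ hδ hx hM => ?_⟩
    have := hM (ω/4) (by positivity)
    have h' : ∀ᶠ ρ in 𝓝[>] (0:ℝ), ρ ∈ Ioo 0 δ := Ioo_mem_nhdsGT hδ
    obtain ⟨ρ, hρ1, hρ⟩ := (this.and h').exists
    have hx' := hx ρ hρ
    have hb := Measure.addHaar_ball_of_pos (μ.prod volume) x hρ.1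
    rw [hd] at hb
    have hu : (μ.prod volume) (ball x ρ) ≤ (μ.prod volume) (H ∩ ball x ρ) +
        (μ.prod volume) (Hᶜ ∩ ball x ρ) := by
      refine (measure_mono ?_).trans (measure_union_le _ _)
      intro y hy
      by_cases h : y ∈ H
      · exact Or.inl ⟨h, hy⟩
      · exact Or.inr ⟨h, hy⟩
    have h0 := hρ.1
    have : ENNReal.ofReal (ρ^(m+1) * ω) ≤ ENNReal.ofReal (ω/4 * ρ^(m+1) + ω/4*ρ^(m+1)) := by
      rw [ENNReal.ofReal_add (by positivity) (by positivity), ENNReal.ofReal_mul (by positivity), hω,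
        ENNReal.ofReal_toReal measure_ball_lt_top.ne, ← hω, ← hb]
      exact hu.trans (add_le_add hx' hρ1)
    rw [ENNReal.ofReal_le_ofReal_iff (by positivity)] at this
    have : 0 < ρ^(m+1) * ω := by positivity
    nlinarith
  set U0 : Set ℝ := {t | MZ (m+1) G (p, t)}
  set U1 : Set ℝ := {t | MZ (m+1) Gᶜ (p, t)}
  have hcov : Ioo a b ⊆ U0 ∪ U1 := by
    intro t ht
    have := hab t ht
    simp only [eB, mem_setOf_eq, not_and_or, not_not] at this
    exact this
  set H : ℕ → Set (W × ℝ) := fun k => if k % 2 = 0 then G else Gᶜ with hH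
  set C : ℕ → Set ℝ := fun k => (fun t : ℝ => (p, t)) ⁻¹'
    Dset (μ.prod volume) (m+1) (H k) ε (1 / (((k/2 : ℕ):ℝ) + 1)) with hC
  have key := baire_switch (a := a) (b := b) (U0 := U0) (U1 := U1) hcov C ?_ ?_ ?_ ?_ ?_ ?_
  · exact key
  · intro k
    exact (isClosed_Dset _ _ _ _ _).preimage (by fun_prop)
  · intro t ht
    rcases hcov ht with h | h
    · obtain ⟨j, hj⟩ := MZm_Dset_exists ((hiff _ _).1 h) hε
      refine mem_iUnion.2 ⟨2 * j, ?_⟩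
      simpa [hC, hH] using hj
    · obtain ⟨j, hj⟩ := MZm_Dset_exists ((hiff _ _).1 h) hε
      refine mem_iUnion.2 ⟨2 * j + 1, ?_⟩
      have e1 : (2 * j + 1) / 2 = j := by omega
      have e2 : (2 * j + 1) % 2 = 1 := by omega
      simpa [hC, hH, e1, e2] using hj
  · intro k
    by_cases hk : k % 2 = 0
    · left
      rintro t ⟨htC, ht⟩
      refine (hcov ht).resolve_right fun h1' => ?_
      refine hsep _ _ _ (by positivity) htC ?_
      have : H k = G := by simp [hH, hk]
      rw [this]; exact (hiff _ _).1 h1'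
    · right
      rintro t ⟨htC, ht⟩
      refine (hcov ht).resolve_left fun h1' => ?_
      refine hsep _ _ _ (by positivity) htC ?_
      have : H k = Gᶜ := by simp [hH, hk]
      rw [this, compl_compl]; exact (hiff _ _).1 h1'
  · rw [Set.disjoint_left]
    intro t h0 h1'
    exact not_MZm_both hd (μ.prod volume) G _ ((hiff _ _).1 h0) ((hiff _ _).1 h1')
  · rintro σ (rfl | rfl) t ht η hη
    · exact h1 t η hη ht
    · exact h2 t η hη ht
  · rintro σ (rfl | rfl) t ht η hη
    · exact h3 t η hη ht
    · exact h4 t η hη ht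

/-- If a.e. in an interval the slice is null then every point there is a point of density zero. -/
lemma line_null (μ : Measure W) [μ.IsAddHaarMeasure] {m : ℕ} (hm : Module.finrank ℝ W = m)
    {G : Set (W × ℝ)} (hG : MeasurableSet G) :
    ∀ᵐ p ∂μ, ∀ a b : ℝ, volume {t | t ∈ Ioo a b ∧ (p, t) ∈ G} = 0 →
      ∀ t ∈ Ioo a b, MZ (m+1) G (p, t) := by
  have hd := finrank_prodR hm
  have key : ∀ a b : ℚ, ∀ᵐ p ∂μ, volume {t : ℝ | t ∈ Ioo (a:ℝ) b ∧ (p, t) ∈ G} = 0 →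
      ∀ t ∈ Ioo (a:ℝ) b, MZ (m+1) G (p, t) := by
    intro a b
    set G' : Set (W × ℝ) := G ∩ (univ ×ˢ Ioo (a:ℝ) b) with hG'
    have hG'm : MeasurableSet G' := hG.inter (MeasurableSet.univ.prod measurableSet_Ioo)
    have hfm : Measurable fun p => volume (Prod.mk p ⁻¹' G') := measurable_measure_prodMk_left hG'm
    have hpre : ∀ p, Prod.mk p ⁻¹' G' = {t : ℝ | t ∈ Ioo (a:ℝ) b ∧ (p, t) ∈ G} := by
      intro p; ext t; simp [hG', and_comm]
    set P : Set W := {p | volume (Prod.mk p ⁻¹' G') = 0} with hP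
    have hPm : MeasurableSet P := hfm (measurableSet_singleton 0)
    filter_upwards [MZ_compl_ae_of_mem hm μ hPm] with p hp h0 t ht
    have hpP : p ∈ P := by rw [hP, mem_setOf_eq, hpre]; exact h0
    have h1 := (MZ_iff_haar hm μ _ _).1 (hp hpP)
    rw [MZ_iff_haar hd (μ.prod volume)]
    intro ε hε
    have hnear : ∀ᶠ ρ in 𝓝[>] (0:ℝ), ball t ρ ⊆ Ioo (a:ℝ) b := by
      obtain ⟨δ, hδ, hb⟩ := Metric.isOpen_iff.1 isOpen_Ioo t ht
      filter_upwards [Ioo_mem_nhdsGT hδ] with ρ hρ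
      exact (ball_subset_ball hρ.2.le).trans hb
    filter_upwards [h1 (ε/2) (by positivity), hnear, self_mem_nhdsWithin] with ρ hρ1 hρ2 hρ0
    have hρ0' : 0 < ρ := hρ0
    have hnull : (μ.prod volume) (G' ∩ P ×ˢ univ) = 0 := by
      rw [Measure.measure_prod_null (hG'm.inter (hPm.prod MeasurableSet.univ))]
      refine Eventually.of_forall fun q => ?_
      by_cases hq : q ∈ P
      · exact measure_mono_null (fun t ht => ht.1) hq
      · have : Prod.mk q ⁻¹' (G' ∩ P ×ˢ univ) = ∅ := by
          ext t; simp [hq]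
        simp [this]
    have hsub : G ∩ ball (p, t) ρ ⊆ (G' ∩ P ×ˢ univ) ∪ (Pᶜ ∩ ball p ρ) ×ˢ ball t ρ := by
      rintro ⟨q, τ⟩ ⟨hqG, hq⟩
      rw [← ball_prod_same] at hq
      by_cases hqP : q ∈ P
      · exact Or.inl ⟨⟨hqG, ⟨mem_univ _, hρ2 hq.2⟩⟩, ⟨hqP, mem_univ _⟩⟩
      · exact Or.inr ⟨⟨hqP, hq.1⟩, hq.2⟩
    calc (μ.prod volume) (G ∩ ball (p, t) ρ) ≤ 0 + μ (Pᶜ ∩ ball p ρ) * volume (ball t ρ) := by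
          refine (measure_mono hsub).trans ((measure_union_le _ _).trans ?_)
          rw [hnull, Measure.prod_prod]
      _ ≤ ENNReal.ofReal (ε/2 * ρ^m) * ENNReal.ofReal (2*ρ) := by
          rw [zero_add, Real.volume_ball]; gcongr
      _ = ENNReal.ofReal (ε * ρ^(m+1)) := by
          rw [← ENNReal.ofReal_mul (by positivity)]; congr 1; ring
  have key' : ∀ᵐ p ∂μ, ∀ a b : ℚ, volume {t : ℝ | t ∈ Ioo (a:ℝ) b ∧ (p, t) ∈ G} = 0 →
      ∀ t ∈ Ioo (a:ℝ) b, MZ (m+1) G (p, t) := by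
    rw [ae_all_iff]; intro a; rw [ae_all_iff]; intro b; exact key a b
  filter_upwards [key'] with p hp a b h0 t ht
  obtain ⟨a', ha1, ha2⟩ := exists_rat_btwn ht.1
  obtain ⟨b', hb1, hb2⟩ := exists_rat_btwn ht.2
  refine hp a' b' (measure_mono_null ?_ h0) t ⟨ha2, hb1⟩
  rintro τ ⟨hτ, hg⟩
  exact ⟨⟨ha1.trans hτ.1, hτ.2.trans hb2⟩, hg⟩

lemma line_ae_of_MZ (μ : Measure W) [μ.IsAddHaarMeasure] {m : ℕ} (hm : Module.finrank ℝ W = m)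
    {G : Set (W × ℝ)} (hG : MeasurableSet G) :
    ∀ᵐ p ∂μ, ∀ᵐ t ∂(volume : Measure ℝ), MZ (m+1) G (p, t) → (p, t) ∉ G := by
  have hd := finrank_prodR hm
  have h := MZ_compl_ae_of_mem hd (μ.prod volume) hG
  have h2 := Measure.ae_ae_of_ae_prod h
  filter_upwards [h2] with p hp
  filter_upwards [hp] with t ht h0 hg
  exact not_MZm_both hd (μ.prod volume) G _ ((MZ_iff_haar hd _ _ _).1 h0)
    ((MZ_iff_haar hd _ _ _).1 (ht hg))

/-- essential-boundary-free intervals are exactly those where the slice is null or full -/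
lemma line_iff (μ : Measure W) [μ.IsAddHaarMeasure] {m : ℕ} (hm : Module.finrank ℝ W = m)
    {G : Set (W × ℝ)} (hG : MeasurableSet G) :
    ∀ᵐ p ∂μ, ∀ a b : ℝ, (∀ t ∈ Ioo a b, (p, t) ∉ eB (m+1) G) ↔
      (volume {t | t ∈ Ioo a b ∧ (p, t) ∈ G} = 0 ∨ volume {t | t ∈ Ioo a b ∧ (p, t) ∉ G} = 0) := by
  filter_upwards [line_const μ hm hG, line_null μ hm hG, line_null μ hm hG.compl,
    line_ae_of_MZ μ hm hG, line_ae_of_MZ μ hm hG.compl] with p h1 h2 h3 h4 h5 a b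
  constructor
  · intro h
    rcases h1 a b h with h | h
    · left
      rw [measure_eq_zero_iff_ae_notMem]
      filter_upwards [h4] with t ht
      exact fun hh => ht (h t hh.1) hh.2
    · right
      rw [measure_eq_zero_iff_ae_notMem]
      filter_upwards [h5] with t ht
      exact fun hh => ht (h t hh.1) hh.2
  · rintro (h | h) t ht ⟨h1', h2'⟩
    · exact h1' (h2 a b h t ht)
    · exact h2' (h3 a b h t ht)
end A3

section A4
variable {W : Type*} [NormedAddCommGroup W] [InnerProductSpace ℝ W] [FiniteDimensional ℝ W]
  [MeasurableSpace W] [BorelSpace W]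
variable {V : Type*} [NormedAddCommGroup V] [InnerProductSpace ℝ V] [FiniteDimensional ℝ V]
  [MeasurableSpace V] [BorelSpace V]

/-- orthogonal splitting `V = W ⊕ ℝ` -/
structure OSplit (W V : Type*) [NormedAddCommGroup W] [InnerProductSpace ℝ W]
    [NormedAddCommGroup V] [InnerProductSpace ℝ V] where
  Φ : (W × ℝ) ≃L[ℝ] V
  norm_sq : ∀ w t, ‖Φ (w, t)‖^2 = ‖w‖^2 + t^2

/-- the base projection -/
def OSplit.pr (S : OSplit W V) (x : V) : W := (S.Φ.symm x).1

lemma OSplit.pr_Φ (S : OSplit W V) (z : W × ℝ) : S.pr (S.Φ z) = z.1 := by simp [OSplit.pr]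

lemma OSplit.lip (S : OSplit W V) : LipschitzWith 1 S.pr := by
  refine LipschitzWith.of_dist_le_mul fun x y => ?_
  rw [dist_eq_norm, dist_eq_norm, NNReal.coe_one, one_mul]
  have h : S.pr x - S.pr y = (S.Φ.symm (x - y)).1 := by simp [OSplit.pr]
  have h2 := S.norm_sq (S.Φ.symm (x - y)).1 (S.Φ.symm (x - y)).2
  simp only [Prod.mk.eta, ContinuousLinearEquiv.apply_symm_apply] at h2
  rw [h]
  exact abs_le_of_sq_le_sq' (by nlinarith [sq_nonneg (S.Φ.symm (x - y)).2]) (norm_nonneg _) |>.2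

lemma OSplit.finrank (S : OSplit W V) : Module.finrank ℝ V = Module.finrank ℝ W + 1 := by
  rw [← S.Φ.toLinearEquiv.finrank_eq]; exact finrank_prodR rfl

lemma OSplit.mp (S : OSplit W V) : MeasurePreserving S.Φ (volume.prod volume) volume := by
  let e : WithLp 2 (W × ℝ) ≃ₗᵢ[ℝ] V :=
    { toLinearEquiv := (WithLp.linearEquiv 2 ℝ (W × ℝ)).trans S.Φ.toLinearEquiv
      norm_map' := by
        intro x
        have h := S.norm_sq x.fst x.snd
        have h2 := WithLp.prod_norm_sq_eq_of_L2 x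
        rw [← sq_eq_sq₀ (norm_nonneg _) (norm_nonneg _)]
        rw [h2, Real.norm_eq_abs, sq_abs, ← h]
        rfl }
  have h1 := e.measurePreserving
  have h2 := WithLp.volume_preserving_toLp W ℝ
  exact h1.comp h2

noncomputable def OSplit.ofUnit {v : V} (hv : ‖v‖ = 1) : OSplit ((ℝ ∙ v)ᗮ : Submodule ℝ V) V where
  Φ := LinearEquiv.toContinuousLinearEquiv <| LinearEquiv.ofBijective
    ((((ℝ ∙ v)ᗮ).subtype.comp (LinearMap.fst ℝ _ ℝ)) +
      ((LinearMap.toSpanSingleton ℝ V v).comp (LinearMap.snd ℝ ((ℝ ∙ v)ᗮ : Submodule ℝ V) ℝ))) (by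
      have key : ∀ (w : ((ℝ ∙ v)ᗮ : Submodule ℝ V)) , ⟪(w:V), v⟫ = 0 := fun w => by
        have := Submodule.mem_orthogonal_singleton_iff_inner_left.1 w.2
        exact this
      constructor
      · intro x y hxy
        simp only [LinearMap.add_apply, LinearMap.comp_apply, LinearMap.fst_apply, LinearMap.snd_apply,
          Submodule.subtype_apply, LinearMap.toSpanSingleton_apply] at hxy
        have h2 : x.2 = y.2 := by
          have := congrArg (fun z => ⟪z, v⟫) hxy
          simp only [inner_add_left, key, inner_smul_left, real_inner_self_eq_norm_sq, hv] at this
          simpa using this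
        rw [h2] at hxy
        exact Prod.ext (Subtype.ext (add_right_cancel hxy)) h2
      · intro z
        refine ⟨(⟨z - ⟪z, v⟫ • v, ?_⟩, ⟪z, v⟫), ?_⟩
        · rw [Submodule.mem_orthogonal_singleton_iff_inner_left]
          simp [inner_sub_left, inner_smul_left, real_inner_self_eq_norm_sq, hv]
        · simp)
  norm_sq := by
    intro w t
    have key : ⟪(w:V), v⟫ = 0 := Submodule.mem_orthogonal_singleton_iff_inner_left.1 w.2
    have : ‖(w:V) + t • v‖^2 = ‖(w:V)‖^2 + t^2 := by
      rw [norm_add_sq_real, inner_smul_right, key, norm_smul, hv]; simp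
    exact this

lemma OSplit.ofUnit_apply {v : V} (hv : ‖v‖ = 1) (w : ((ℝ ∙ v)ᗮ : Submodule ℝ V)) (t : ℝ) :
    (OSplit.ofUnit hv).Φ (w, t) = (w:V) + t • v := by
  rfl

lemma euc_volume_image_le {X : Type*} [EMetricSpace X] [MeasurableSpace X] [BorelSpace X] {m : ℕ}
    {Y : Type*} [EMetricSpace Y] [MeasurableSpace Y] [BorelSpace Y]
    {f : X → Y} {s : Set X} {K : ℝ≥0} (hf : LipschitzOnWith K f s) :
    μHE[m] (f '' s) ≤ (K:ℝ≥0∞)^m * μHE[m] s := by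
  simp only [Measure.euclideanHausdorffMeasure_def, Measure.smul_apply]
  have := hf.hausdorffMeasure_image_le (d := m) (by positivity)
  rw [ENNReal.rpow_natCast] at this
  rw [ENNReal.smul_def, ENNReal.smul_def, smul_eq_mul, smul_eq_mul, mul_left_comm]
  gcongr

lemma OSplit.volume_pr_le (S : OSplit W V) {m : ℕ} (hm : Module.finrank ℝ W = m) (A : Set V) :
    volume (S.pr '' A) ≤ μHE[m] A := by
  have := euc_volume_image_le (m := m) (S.lip.lipschitzOnWith (s := A))
  subst hm
  rw [InnerProductSpace.euclideanHausdorffMeasure_eq_volume] at this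
  simpa using this

/-- Eilenberg-type inequality: counting function majorant. -/
lemma OSplit.count (S : OSplit W V) {m : ℕ} (hm : Module.finrank ℝ W = m) (A : Set V) :
    ∃ N : W → ℝ≥0∞, Measurable N ∧ ∫⁻ p, N p ≤ μHE[m] A ∧
      ∀ p, ∀ s : Finset ℝ, (∀ t ∈ s, S.Φ (p, t) ∈ A) → (s.card : ℝ≥0∞) ≤ N p := by
  classical
  set Q : ℕ → ℤ → Set V := fun k j => {x | ⌊(2:ℝ)^k * (S.Φ.symm x).2⌋ = j} with hQ
  have hQm : ∀ k j, MeasurableSet (Q k j) := by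
    intro k j
    have : Measurable fun x : V => ⌊(2:ℝ)^k * (S.Φ.symm x).2⌋ := by
      apply Int.measurable_floor.comp
      apply Measurable.const_mul
      exact (S.Φ.symm.continuous.measurable.snd)
    exact this (measurableSet_singleton j)
  set H : ℕ → ℤ → Set W := fun k j => toMeasurable volume (S.pr '' (A ∩ Q k j)) with hH
  set f : ℕ → W → ℝ≥0∞ := fun k p => ∑' j, (H k j).indicator 1 p with hf
  have hHm : ∀ k j, Measurable ((H k j).indicator (1 : W → ℝ≥0∞)) := fun k j =>
    measurable_one.indicator (measurableSet_toMeasurable _ _)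
  have hfm : ∀ k, Measurable (f k) := fun k => Measurable.ennreal_tsum (hHm k)
  have hintg : ∀ k, ∫⁻ p, f k p ≤ μHE[m] A := by
    intro k
    simp only [hf]
    rw [lintegral_tsum (fun j => (hHm k j).aemeasurable)]
    have : ∀ j, ∫⁻ p, (H k j).indicator 1 p ≤ (μHE[m].restrict A) (Q k j) := by
      intro j
      rw [lintegral_indicator_one (measurableSet_toMeasurable _ _), measure_toMeasurable,
        Measure.restrict_apply (hQm k j), inter_comm]
      exact S.volume_pr_le hm _
    refine (ENNReal.tsum_le_tsum this).trans ?_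
    rw [← measure_iUnion]
    · exact (measure_mono (subset_univ _)).trans (by simp)
    · intro i j hij
      rw [Function.onFun, Set.disjoint_left]
      intro x hx hy
      exact hij (hx.symm.trans hy)
    · exact hQm k
  refine ⟨fun p => liminf (fun k => f k p) atTop, .liminf hfm, ?_, ?_⟩
  · refine (lintegral_liminf_le hfm).trans ?_
    exact liminf_le_of_le (by isBoundedDefault) fun b hb => by
      obtain ⟨k, hk⟩ := hb.exists
      exact hk.trans (hintg k)
  · intro p s hs
    have hinj : ∀ᶠ k : ℕ in atTop, ∀ t ∈ s, ∀ t' ∈ s, ⌊(2:ℝ)^k * t⌋ = ⌊(2:ℝ)^k * t'⌋ → t = t' := by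
      rw [Finset.eventually_all]
      intro t ht
      rw [Finset.eventually_all]
      intro t' ht'
      by_cases htt : t = t'
      · exact Eventually.of_forall fun _ _ => htt
      · have h0 : 0 < |t - t'| := abs_pos.2 (sub_ne_zero.2 htt)
        have : Tendsto (fun k : ℕ => (2:ℝ)^k * |t - t'|) atTop atTop :=
          (tendsto_pow_atTop_atTop_of_one_lt one_lt_two).atTop_mul_const h0
        filter_upwards [this.eventually_gt_atTop 1] with k hk hfl
        have h1 := Int.abs_sub_lt_one_of_floor_eq_floor hfl
        rw [← mul_sub, abs_mul, abs_of_pos (by positivity : (0:ℝ) < 2^k)] at h1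
        linarith
    refine le_liminf_of_le (by isBoundedDefault) ?_
    filter_upwards [hinj] with k hk
    have hcard : (s.image fun t => ⌊(2:ℝ)^k * t⌋).card = s.card :=
      Finset.card_image_of_injOn fun t ht t' ht' h => hk t ht t' ht' h
    calc (s.card : ℝ≥0∞) = ∑ j ∈ s.image fun t => ⌊(2:ℝ)^k * t⌋, (1:ℝ≥0∞) := by
          rw [Finset.sum_const, hcard]; simp
      _ ≤ ∑ j ∈ s.image fun t => ⌊(2:ℝ)^k * t⌋, (H k j).indicator 1 p := by
          refine Finset.sum_le_sum fun j hj => ?_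
          obtain ⟨t, ht, rfl⟩ := Finset.mem_image.1 hj
          have : p ∈ H k ⌊(2:ℝ)^k * t⌋ := by
            refine subset_toMeasurable _ _ ⟨S.Φ (p, t), ⟨hs t ht, ?_⟩, S.pr_Φ _⟩
            simp [hQ]
          rw [Set.indicator_of_mem this]; simp
      _ ≤ _ := ENNReal.sum_le_tsum _

/-- a.e. line meets a set of finite `m`-measure in finitely many points -/
lemma OSplit.ae_finite (S : OSplit W V) {m : ℕ} (hm : Module.finrank ℝ W = m) {A : Set V}
    (hA : μHE[m] A ≠ ⊤) : ∀ᵐ p, {t : ℝ | S.Φ (p, t) ∈ A}.Finite := by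
  obtain ⟨N, hN, hI, hc⟩ := S.count hm A
  filter_upwards [ae_lt_top hN (ne_top_of_le_ne_top hA hI)] with p hp
  by_contra hinf
  have hinf : {t : ℝ | S.Φ (p, t) ∈ A}.Infinite := hinf
  obtain ⟨n, hn⟩ := ENNReal.exists_nat_gt hp.ne
  obtain ⟨s, hs, hcard⟩ := hinf.exists_subset_card_eq n
  have := hc p s (fun t ht => hs ht)
  rw [hcard] at this
  exact absurd hn (not_lt.2 this)
lemma line_segment (μ : Measure W) [μ.IsAddHaarMeasure] {m : ℕ} (hm : Module.finrank ℝ W = m)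
    {G : Set (W × ℝ)} (hG : MeasurableSet G) :
    ∀ᵐ p ∂μ, ∀ a b : ℝ, a < b → (∀ t ∈ Icc a b, (p, t) ∉ eB (m+1) G) →
      (MZ (m+1) G (p, a) ↔ MZ (m+1) G (p, b)) := by
  have hd := finrank_prodR hm
  filter_upwards [line_const μ hm hG, federer_forbid μ hm hG (Or.inl rfl : (1:ℝ) = 1 ∨ _),
    federer_forbid μ hm hG (Or.inr rfl : (-1:ℝ) = 1 ∨ (-1:ℝ) = -1),
    federer_forbid μ hm hG.compl (Or.inl rfl : (1:ℝ) = 1 ∨ _),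
    federer_forbid μ hm hG.compl (Or.inr rfl : (-1:ℝ) = 1 ∨ (-1:ℝ) = -1)]
    with p h0 h1 h2 h3 h4 a b hab h
  rw [compl_compl] at h3 h4
  have hor : ∀ t ∈ Icc a b, MZ (m+1) G (p, t) ∨ MZ (m+1) Gᶜ (p, t) := by
    intro t ht
    have := h t ht
    simpa only [eB, mem_setOf_eq, not_and_or, not_not] using this
  have ha := hor a (left_mem_Icc.2 hab.le)
  have hb := hor b (right_mem_Icc.2 hab.le)
  have hno : ∀ x, MZ (m+1) G x → MZ (m+1) Gᶜ x → False := fun x h h' =>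
    not_MZm_both hd (μ.prod volume) G x ((MZ_iff_haar hd _ _ _).1 h) ((MZ_iff_haar hd _ _ _).1 h')
  have hη : 0 < b - a := sub_pos.2 hab
  rcases h0 a b (fun t ht => h t (Ioo_subset_Icc_self ht)) with h' | h'
  · have e1 : MZ (m+1) G (p, a) := by
      refine ha.resolve_right fun hh => h1 a (b-a) hη hh fun s hs => h' _ ⟨?_, ?_⟩ <;>
        linarith [hs.1, hs.2]
    have e2 : MZ (m+1) G (p, b) := by
      refine hb.resolve_right fun hh => h2 b (b-a) hη hh fun s hs => h' _ ⟨?_, ?_⟩ <;>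
        linarith [hs.1, hs.2]
    exact iff_of_true e1 e2
  · have e1 : MZ (m+1) Gᶜ (p, a) := by
      refine ha.resolve_left fun hh => h3 a (b-a) hη hh fun s hs => h' _ ⟨?_, ?_⟩ <;>
        linarith [hs.1, hs.2]
    have e2 : MZ (m+1) Gᶜ (p, b) := by
      refine hb.resolve_left fun hh => h4 b (b-a) hη hh fun s hs => h' _ ⟨?_, ?_⟩ <;>
        linarith [hs.1, hs.2]
    exact iff_of_false (fun q => hno _ q e1) (fun q => hno _ q e2)

lemma OSplit.T_pos (S : OSplit W V) {m : ℕ} (hm : Module.finrank ℝ W = m) {G : Set V}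
    (hG : MeasurableSet G) {U : Set V} (hU : MeasurableSet U) {s : ℝ} (hs : 0 < s) {A B : Set V}
    (hB : volume (S.pr '' B) = 0)
    (hA : ∀ x ∈ U, ∀ τ ∈ Icc (0:ℝ) 1, x + τ • s • S.Φ (0, 1) ∈ eB (m+1) G →
      x + τ • s • S.Φ (0, 1) ∈ A ∪ B) :
    volume {x | x ∈ U ∧ ¬ (x ∈ G ↔ x + s • S.Φ (0, 1) ∈ G)} ≤ ENNReal.ofReal s * μHE[m] A := by
  have hd := finrank_prodR hm
  obtain ⟨N, hN, hI, hc⟩ := S.count hm A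
  set G' : Set (W × ℝ) := S.Φ ⁻¹' G with hG'
  have hG'm : MeasurableSet G' := S.Φ.continuous.measurable hG
  have hmeas : MeasurableSet {x | x ∈ U ∧ ¬ (x ∈ G ↔ x + s • S.Φ (0, 1) ∈ G)} := by
    have h2 : MeasurableSet ((fun x => x + s • S.Φ (0, 1)) ⁻¹' G) :=
      (measurable_id.add_const _) hG
    have : {x | x ∈ U ∧ ¬ (x ∈ G ↔ x + s • S.Φ (0, 1) ∈ G)} =
      U ∩ symmDiff G ((fun x => x + s • S.Φ (0, 1)) ⁻¹' G) := by
      ext x; simp only [mem_setOf_eq, mem_inter_iff, mem_symmDiff, mem_preimage]; tauto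
    rw [this]; exact hU.inter (hG.symmDiff h2)
  rw [← S.mp.measure_preimage hmeas.nullMeasurableSet,
    Measure.prod_apply (S.Φ.continuous.measurable hmeas)]
  have key : ∀ᵐ p : W, volume (Prod.mk p ⁻¹' (S.Φ ⁻¹'
      {x | x ∈ U ∧ ¬ (x ∈ G ↔ x + s • S.Φ (0, 1) ∈ G)})) ≤ ENNReal.ofReal s * N p := by
    have hB' : ∀ᵐ p : W, p ∉ S.pr '' B := measure_eq_zero_iff_ae_notMem.1 hB
    have hd1 := Measure.ae_ae_of_ae_prod (MZ_compl_ae_of_mem hd (volume.prod volume) hG'm)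
    have hd2 := Measure.ae_ae_of_ae_prod (MZ_ae_of_not_mem hd (volume.prod volume) hG'm)
    filter_upwards [hB', hd1, hd2, line_segment volume hm hG'm] with p hpB h1 h2 h3
    by_cases hNt : N p = ⊤
    · rw [hNt, ENNReal.mul_top (by simpa using hs)]; exact le_top
    have hfin : {t : ℝ | S.Φ (p, t) ∈ A}.Finite := by
      by_contra hinf
      have hinf : {t : ℝ | S.Φ (p, t) ∈ A}.Infinite := hinf
      obtain ⟨n, hn⟩ := ENNReal.exists_nat_gt hNt
      obtain ⟨s, hs, hcard⟩ := hinf.exists_subset_card_eq n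
      have := hc p s (fun t ht => hs ht)
      rw [hcard] at this
      exact absurd hn (not_lt.2 this)
    have hno : ∀ x, MZ (m+1) G' x → MZ (m+1) G'ᶜ x → False := fun x h h' =>
      not_MZm_both hd (volume.prod volume) G' x ((MZ_iff_haar hd _ _ _).1 h)
        ((MZ_iff_haar hd _ _ _).1 h')
    have hsh : ∀ {P : ℝ → Prop}, (∀ᵐ t, P t) → ∀ᵐ t, P (t + s) := fun {P} h =>
      (measurePreserving_add_right volume s).quasiMeasurePreserving.ae h
    have hshift : ∀ t τ : ℝ, S.Φ (p, t) + τ • s • S.Φ (0, 1) = S.Φ (p, t + τ * s) := by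
      intro t τ
      rw [← map_smul, ← map_smul, ← map_add]; simp
    have hae : ∀ᵐ t : ℝ, t ∈ (Prod.mk p ⁻¹' (S.Φ ⁻¹'
        {x | x ∈ U ∧ ¬ (x ∈ G ↔ x + s • S.Φ (0, 1) ∈ G)})) →
        t ∈ ⋃ τ ∈ hfin.toFinset, Icc (τ - s) τ := by
      filter_upwards [h1, h2, hsh h1, hsh h2] with t a1 a2 a3 a4 ht
      obtain ⟨htU, hx⟩ := ht
      have hsh1 : S.Φ (p, t) + s • S.Φ (0, 1) = S.Φ (p, t + s) := by
        have := hshift t 1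
        simpa using this
      have hxx : ¬ ((p, t) ∈ G' ↔ (p, t + s) ∈ G') := by
        rw [hsh1] at hx; exact hx
      have : ∃ τ ∈ Icc t (t + s), (p, τ) ∈ eB (m+1) G' := by
        by_contra! hcon
        have := h3 t (t+s) (by linarith) hcon
        have b1 : (p, t) ∈ G' ↔ ¬ MZ (m+1) G' (p, t) :=
          ⟨fun h h' => hno _ h' (a1 h), fun h => by_contra fun h' => h (a2 h')⟩
        have b2 : (p, t+s) ∈ G' ↔ ¬ MZ (m+1) G' (p, t+s) :=
          ⟨fun h h' => hno _ h' (a3 h), fun h => by_contra fun h' => h (a4 h')⟩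
        exact hxx (by rw [b1, b2, this])
      obtain ⟨τ, hτ, hτe⟩ := this
      have hτe' := ((LBL_of_linearEquiv S.Φ (p, τ)).mem_eB_iff (m+1) G).1 hτe
      have e : S.Φ (p, τ) = S.Φ (p, t) + ((τ - t)/s) • s • S.Φ (0, 1) := by
        rw [hshift]; congr 2; field_simp; ring
      rw [e] at hτe'
      have := hA _ htU ((τ - t)/s) ⟨div_nonneg (by linarith [hτ.1]) hs.le,
        (div_le_one hs).2 (by linarith [hτ.2])⟩ hτe'
      rw [← e] at this
      have hτA : S.Φ (p, τ) ∈ A := this.resolve_right fun h => hpB ⟨_, h, S.pr_Φ _⟩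
      simp only [mem_iUnion]
      exact ⟨τ, by simpa using hτA, by linarith [hτ.2], hτ.1⟩
    calc _ ≤ volume (⋃ τ ∈ hfin.toFinset, Icc (τ - s) τ) := measure_mono_ae hae
      _ ≤ ∑ τ ∈ hfin.toFinset, volume (Icc (τ - s) τ) := measure_biUnion_finset_le _ _
      _ = hfin.toFinset.card * ENNReal.ofReal s := by
        simp [Real.volume_Icc]
      _ ≤ ENNReal.ofReal s * N p := by
        rw [mul_comm]; gcongr
        exact hc p _ fun t ht => by simpa using ht
  refine (lintegral_mono_ae key).trans ?_
  rw [lintegral_const_mul _ hN]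
  gcongr

lemma OSplit.T_signed (S : OSplit W V) {m : ℕ} (hm : Module.finrank ℝ W = m) {G : Set V}
    (hG : MeasurableSet G) {U : Set V} (hU : MeasurableSet U) (s : ℝ) {A B : Set V}
    (hB : volume (S.pr '' B) = 0)
    (hA : ∀ x ∈ U, ∀ τ ∈ Icc (0:ℝ) 1, x + τ • s • S.Φ (0, 1) ∈ eB (m+1) G →
      x + τ • s • S.Φ (0, 1) ∈ A ∪ B) :
    volume {x | x ∈ U ∧ ¬ (x ∈ G ↔ x + s • S.Φ (0, 1) ∈ G)} ≤ ENNReal.ofReal |s| * μHE[m] A := by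
  rcases lt_trichotomy s 0 with h | h | h
  · set z := s • S.Φ (0, 1) with hz
    have hz' : (-s) • S.Φ (0,1) = -z := by rw [hz, neg_smul]
    have hU' : MeasurableSet ((fun x => x - z) ⁻¹' U) := (measurable_id.sub_const _) hU
    have := S.T_pos hm hG hU' (neg_pos.2 h) (A := A) (B := B) hB (by
      intro x hx τ hτ hxe
      have e : x + τ • -s • S.Φ (0, 1) = (x - z) + (1 - τ) • z := by
        rw [hz']; module
      rw [e] at hxe ⊢
      exact hA _ hx (1-τ) ⟨by linarith [hτ.2], by linarith [hτ.1]⟩ hxe)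
    rw [abs_of_neg h]
    refine le_trans (le_of_eq ?_) this
    rw [← measure_preimage_add_right volume (-z) {x | x ∈ U ∧ ¬ (x ∈ G ↔ x + z ∈ G)}]
    congr 1
    ext x
    rw [hz']
    simp only [mem_preimage, mem_setOf_eq, ← sub_eq_add_neg, sub_add_cancel]
    tauto
  · subst h; simp
  · rw [abs_of_pos h]
    exact S.T_pos hm hG hU h hB hA

/-- Translation lemma in an arbitrary direction. -/
lemma T_shift {m : ℕ} (hV : Module.finrank ℝ V = m + 1) {G : Set V}
    (hG : MeasurableSet G) {U : Set V} (hU : MeasurableSet U) (z : V) {A : Set V}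
    (hA : ∀ x ∈ U, ∀ τ ∈ Icc (0:ℝ) 1, x + τ • z ∈ eB (m+1) G → x + τ • z ∈ A) :
    volume {x | x ∈ U ∧ ¬ (x ∈ G ↔ x + z ∈ G)} ≤ ENNReal.ofReal ‖z‖ * μHE[m] A := by
  by_cases hz : z = 0
  · simp [hz]
  have hn : ‖z‖ ≠ 0 := norm_ne_zero_iff.2 hz
  have hv : ‖(‖z‖⁻¹ • z)‖ = 1 := by rw [norm_smul, norm_inv, norm_norm, inv_mul_cancel₀ hn]
  set S := OSplit.ofUnit hv
  have hS : ‖z‖ • S.Φ (0, 1) = z := by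
    rw [OSplit.ofUnit_apply]; simp [smul_smul, mul_inv_cancel₀ hn]
  have := S.T_signed (m := m) (by have := S.finrank; omega) hG hU ‖z‖ (A := A) (B := ∅) (by simp)
    (by rw [hS]; simpa using hA)
  rwa [hS, abs_of_nonneg (norm_nonneg _)] at this
end A4

section A6
variable {V : Type*} [NormedAddCommGroup V] [InnerProductSpace ℝ V] [FiniteDimensional ℝ V]
  [MeasurableSpace V] [BorelSpace V]

lemma cover_null {X : Type*} [MetricSpace X] [SecondCountableTopology X] [MeasurableSpace X]
    [BorelSpace X] (ν : Measure X) [IsFiniteMeasure ν] {m : ℕ} {κ : ℝ} (hκ : 0 < κ)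
    {T : Set X} (hT : ν T = 0)
    (h : ∀ x ∈ T, ∃ᶠ r in 𝓝[>] (0:ℝ), ENNReal.ofReal (κ * r^m) ≤ ν (closedBall x r)) :
    μH[(m:ℝ)] T = 0 := by
  have key : ∀ η : ℝ≥0∞, 0 < η → μH[(m:ℝ)] T ≤ ENNReal.ofReal ((10:ℝ)^m/κ) * η := by
    intro η hη
    obtain ⟨O, hTO, hO, hνO⟩ := T.exists_isOpen_lt_of_lt η (by rw [hT]; exact hη)
    set I : ℕ → Set (X × ℝ) := fun k => {z | z.1 ∈ T ∧ 0 < z.2 ∧ z.2 ≤ 1/((k:ℝ)+1) ∧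
      closedBall z.1 z.2 ⊆ O ∧ ENNReal.ofReal (κ * z.2^m) ≤ ν (closedBall z.1 z.2)} with hI
    have hex : ∀ k, ∀ x ∈ T, ∃ r, (x, r) ∈ I k := by
      intro k x hx
      have h1 : ∀ᶠ r in 𝓝[>] (0:ℝ), r ∈ Ioo (0:ℝ) (1/((k:ℝ)+1)) :=
        Ioo_mem_nhdsGT (by positivity)
      obtain ⟨ε, hε, hb⟩ := Metric.isOpen_iff.1 hO x (hTO hx)
      have h2 : ∀ᶠ r in 𝓝[>] (0:ℝ), r ∈ Ioo (0:ℝ) ε := Ioo_mem_nhdsGT hε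
      obtain ⟨r, hr, hr1, hr2⟩ := ((h x hx).and_eventually (h1.and h2)).exists
      exact ⟨r, hx, hr1.1, hr1.2.le, (closedBall_subset_ball hr2.2).trans hb, hr⟩
    have hV := fun k => Vitali.exists_disjoint_subfamily_covering_enlargement_closedBall (I k)
      (fun z => z.1) (fun z => z.2) (1/((k:ℝ)+1)) (fun a ha => ha.2.2.1) 5 (by norm_num)
    choose u hut hud hcov using hV
    have hc : ∀ k, (u k).Countable := fun k =>
      (hud k).countable_of_nonempty_interior fun a ha =>
        ⟨a.1, ball_subset_interior_closedBall (mem_ball_self (hut k ha).2.1)⟩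
    have : ∀ k, Countable (u k) := fun k => (hc k).to_subtype
    have hdiam : ∀ k, ∀ i : u k, ediam (closedBall i.1.1 (5 * i.1.2)) ≤
        ENNReal.ofReal (10 * i.1.2) := by
      intro k i
      refine ediam_le_of_forall_dist_le fun a ha b hb => ?_
      rw [mem_closedBall] at ha hb
      linarith [dist_triangle_right a b i.1.1]
    refine (Measure.hausdorffMeasure_le_liminf_tsum (ι := fun k => u k) (m:ℝ) T (l := atTop)
      (fun k : ℕ => ENNReal.ofReal (10 * (1/((k:ℝ)+1)))) ?_
      (fun k i => closedBall i.1.1 (5 * i.1.2)) ?_ ?_).trans ?_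
    · rw [← ENNReal.ofReal_zero]
      apply ENNReal.tendsto_ofReal
      simpa using (tendsto_one_div_add_atTop_nhds_zero_nat (𝕜 := ℝ)).const_mul 10
    · refine Eventually.of_forall fun k i => (hdiam k i).trans (ENNReal.ofReal_le_ofReal ?_)
      have := (hut k i.2).2.2.1
      linarith
    · refine Eventually.of_forall fun k x hx => ?_
      obtain ⟨r, hr⟩ := hex k x hx
      obtain ⟨b, hb, hsub⟩ := hcov k _ hr
      exact mem_iUnion.2 ⟨⟨b, hb⟩, hsub (mem_closedBall_self hr.2.1.le)⟩
    · refine liminf_le_of_le (by isBoundedDefault) fun b hb => ?_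
      obtain ⟨k, hk⟩ := hb.exists
      refine hk.trans ?_
      have h1 : ∀ i : u k, ediam (closedBall i.1.1 (5 * i.1.2)) ^ (m:ℝ) ≤
          ENNReal.ofReal ((10:ℝ)^m/κ) * ν (closedBall i.1.1 i.1.2) := by
        intro i
        have hi := hut k i.2
        have h0 := hi.2.1
        calc ediam (closedBall i.1.1 (5 * i.1.2)) ^ (m:ℝ) ≤ ENNReal.ofReal (10 * i.1.2) ^ (m:ℝ) := by
              gcongr; exact hdiam k i
          _ = ENNReal.ofReal ((10:ℝ)^m/κ) * ENNReal.ofReal (κ * i.1.2^m) := by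
              rw [ENNReal.rpow_natCast, ← ENNReal.ofReal_pow (by positivity),
                ← ENNReal.ofReal_mul (by positivity)]
              congr 1; field_simp; rw [mul_pow]
          _ ≤ _ := by gcongr; exact hi.2.2.2.2
      refine (ENNReal.tsum_le_tsum h1).trans ?_
      rw [ENNReal.tsum_mul_left]
      gcongr
      rw [← measure_iUnion]
      · exact (measure_mono (iUnion_subset fun i => (hut k i.2).2.2.2.1)).trans hνO.le
      · intro i j hij
        exact hud k i.2 j.2 (fun h => hij (Subtype.ext h))
      · exact fun i => isClosed_closedBall.measurableSet
  by_contra hne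
  have hpos : 0 < μH[(m:ℝ)] T := pos_iff_ne_zero.2 hne
  set C := ENNReal.ofReal ((10:ℝ)^m/κ) with hC
  have hC0 : C ≠ 0 := by rw [hC]; simp; positivity
  have hCt : C ≠ ⊤ := ENNReal.ofReal_ne_top
  have h1 := key 1 one_pos
  have hfin : μH[(m:ℝ)] T ≠ ⊤ := ne_top_of_le_ne_top (by simpa using hCt) h1
  have h2 := key (μH[(m:ℝ)] T / C / 2) (by
    exact ENNReal.div_pos (ENNReal.div_pos hne hCt).ne' (by simp))
  rw [← mul_div_assoc, ENNReal.mul_div_cancel hC0 hCt] at h2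
  exact absurd h2 (not_le.2 (ENNReal.half_lt_self hne hfin))

/-- double counting by translations -/
lemma double_trans (μ : Measure V) [μ.IsAddHaarMeasure] {P Q : Set V} (hP : MeasurableSet P) (hQ : MeasurableSet Q) {x0 : V} {ρ : ℝ}
    (hPb : P ⊆ ball x0 ρ) (hQb : Q ⊆ ball x0 ρ) :
    μ P * μ Q ≤ ∫⁻ h in ball (0:V) (2*ρ), μ {x | x ∈ P ∧ x + h ∈ Q} ∂μ := by
  set R : Set (V × V) := {z | z.2 ∈ P ∧ z.2 + z.1 ∈ Q} with hR
  have hRm : MeasurableSet R := (measurable_snd hP).inter ((measurable_snd.add measurable_fst) hQ)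
  have h1 : (μ.prod μ) R = μ P * μ Q := by
    rw [Measure.prod_apply_symm hRm]
    have : ∀ x, μ ((fun h => (h, x)) ⁻¹' R) = P.indicator (fun _ => μ Q) x := by
      intro x
      by_cases hx : x ∈ P
      · rw [indicator_of_mem hx]
        have : (fun h => (h, x)) ⁻¹' R = (fun h => x + h) ⁻¹' Q := by
          ext h; simp [hR, hx]
        rw [this, measure_preimage_add]
      · rw [indicator_of_notMem hx]
        have : (fun h => (h, x)) ⁻¹' R = ∅ := by
          ext h; simp [hR, hx]
        rw [this, measure_empty]
    simp_rw [this]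
    rw [lintegral_indicator_const hP, mul_comm]
  rw [← h1, Measure.prod_apply hRm, ← lintegral_indicator measurableSet_ball]
  refine lintegral_mono fun h => ?_
  by_cases hh : h ∈ ball (0:V) (2*ρ)
  · rw [indicator_of_mem hh]; exact le_rfl
  · have : Prod.mk h ⁻¹' R = ∅ := by
      ext x
      simp only [hR, mem_preimage, mem_setOf_eq, mem_empty_iff_false, iff_false]
      rintro ⟨h1, h2⟩
      apply hh
      have h3 := hPb h1
      have h4 := hQb h2
      rw [mem_ball] at h3 h4
      rw [mem_ball_zero_iff]
      have : h = (x + h) - x := by abel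
      rw [this, ← dist_eq_norm]
      linarith [dist_triangle_right (x+h) x x0]
    rw [this, measure_empty]; exact zero_le

lemma chain_shift {m : ℕ} (hV : Module.finrank ℝ V = m + 1) {ι : Type*} [Fintype ι]
    (b : OrthonormalBasis ι ℝ V) {G : Set V} (hG : MeasurableSet G) {S : Set V}
    (hS : ∀ i, volume ((OSplit.ofUnit (b.orthonormal.1 i)).pr '' S) = 0) (x0 : V) {ρ K : ℝ}
    (c : ι → ℝ) (hc : ∀ i, |c i| ≤ K) (s : Finset ι) :
    volume {x | x ∈ ball x0 ρ ∧ ¬ (x ∈ G ↔ x + ∑ i ∈ s, c i • b i ∈ G)} ≤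
      ENNReal.ofReal (s.card * K) *
        μHE[m] ((eB (m+1) G \ S) ∩ ball x0 (ρ + Fintype.card ι * K)) := by
  classical
  induction s using Finset.induction_on with
  | empty => simp
  | insert i s hi ih =>
    have hK : 0 ≤ K := (abs_nonneg _).trans (hc i)
    set z := ∑ i ∈ s, c i • b i with hz
    set M := μHE[m] ((eB (m+1) G \ S) ∩ ball x0 (ρ + Fintype.card ι * K)) with hM
    have hzn : ‖z‖ ≤ s.card * K := by
      refine (norm_sum_le _ _).trans ((Finset.sum_le_card_nsmul _ _ K fun j hj => ?_).trans (by simp))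
      rw [norm_smul, b.orthonormal.1 j, mul_one]; exact hc j
    have hcard : (s.card : ℝ) + 1 ≤ Fintype.card ι := by
      have : s.card + 1 ≤ Fintype.card ι := by
        rw [← Finset.card_insert_of_notMem hi]; exact Finset.card_le_univ _
      exact_mod_cast this
    have hSi : (OSplit.ofUnit (b.orthonormal.1 i)).Φ (0, 1) = b i := by
      rw [OSplit.ofUnit_apply]; simp
    have hU' : MeasurableSet ((fun x => x - z) ⁻¹' ball x0 ρ) := (measurable_id.sub_const _) measurableSet_ball
    have T := (OSplit.ofUnit (b.orthonormal.1 i)).T_signed (m := m)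
      (by have := (OSplit.ofUnit (b.orthonormal.1 i)).finrank; omega) hG hU' (c i)
      (A := (eB (m+1) G \ S) ∩ ball x0 (ρ + Fintype.card ι * K)) (B := S) (hS i) (by
        intro x hx τ hτ hxe
        by_cases hxS : x + τ • c i • (OSplit.ofUnit (b.orthonormal.1 i)).Φ (0, 1) ∈ S
        · exact Or.inr hxS
        · refine Or.inl ⟨⟨hxe, hxS⟩, ?_⟩
          rw [hSi, mem_ball, dist_eq_norm]
          have hx' : ‖x - z - x0‖ < ρ := by rw [← dist_eq_norm]; exact hx
          have e : x + τ • c i • b i - x0 = (x - z - x0) + z + τ • c i • b i := by abel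
          have h3 : ‖τ • c i • b i‖ ≤ K := by
            rw [norm_smul, norm_smul, b.orthonormal.1 i, mul_one, Real.norm_eq_abs, Real.norm_eq_abs,
              abs_of_nonneg hτ.1]
            calc τ * |c i| ≤ 1 * K := mul_le_mul hτ.2 (hc i) (abs_nonneg _) zero_le_one
              _ = K := one_mul K
          rw [e]
          have h4 := norm_add₃_le (a := x - z - x0) (b := z) (c := τ • c i • b i)
          nlinarith)
    rw [hSi] at T
    have hT2 : volume {x | x ∈ ball x0 ρ ∧ ¬ (x + z ∈ G ↔ x + z + c i • b i ∈ G)} ≤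
        ENNReal.ofReal K * M := by
      refine le_trans (le_of_eq ?_) (T.trans (mul_le_mul_left (ENNReal.ofReal_le_ofReal (hc i)) _))
      rw [← measure_preimage_add_right volume z
        {x | x ∈ (fun x => x - z) ⁻¹' ball x0 ρ ∧ ¬ (x ∈ G ↔ x + c i • b i ∈ G)}]
      congr 1
      ext x
      simp only [mem_preimage, mem_setOf_eq, add_sub_cancel_right]
    have hsub : {x | x ∈ ball x0 ρ ∧ ¬ (x ∈ G ↔ x + ∑ i ∈ insert i s, c i • b i ∈ G)} ⊆
        {x | x ∈ ball x0 ρ ∧ ¬ (x ∈ G ↔ x + z ∈ G)} ∪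
        {x | x ∈ ball x0 ρ ∧ ¬ (x + z ∈ G ↔ x + z + c i • b i ∈ G)} := by
      rintro x ⟨hx, h⟩
      rw [Finset.sum_insert hi, add_comm (c i • b i), ← add_assoc] at h
      simp only [mem_union, mem_setOf_eq]
      by_cases h' : x ∈ G ↔ x + z ∈ G
      · right; exact ⟨hx, by rwa [h'] at h⟩
      · left; exact ⟨hx, h'⟩
    refine (measure_mono hsub).trans ((measure_union_le _ _).trans ((add_le_add ih hT2).trans ?_))
    rw [Finset.card_insert_of_notMem hi, ← add_mul, ← ENNReal.ofReal_add (by positivity) hK]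
    apply le_of_eq; congr 2; push_cast; ring

lemma isoper {m : ℕ} (hV : Module.finrank ℝ V = m + 1) {ι : Type*} [Fintype ι]
    (b : OrthonormalBasis ι ℝ V) {G : Set V} (hG : MeasurableSet G) {S : Set V}
    (hS : ∀ i, volume ((OSplit.ofUnit (b.orthonormal.1 i)).pr '' S) = 0) (x0 : V) {ρ : ℝ} :
    volume (G ∩ ball x0 ρ) * volume (Gᶜ ∩ ball x0 ρ) ≤
      volume (ball (0:V) (2*ρ)) * (ENNReal.ofReal ((m+1) * (2*ρ)) *
        μHE[m] ((eB (m+1) G \ S) ∩ ball x0 (ρ + (m+1) * (2*ρ)))) := by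
  have hcard : Fintype.card ι = m + 1 := by rw [← hV, Module.finrank_eq_card_basis b.toBasis]
  refine (double_trans volume (hG.inter measurableSet_ball) (hG.compl.inter measurableSet_ball)
    inter_subset_right inter_subset_right).trans ?_
  refine (setLIntegral_mono' (g := fun _ => ENNReal.ofReal ((m+1) * (2*ρ)) *
        μHE[m] ((eB (m+1) G \ S) ∩ ball x0 (ρ + (m+1) * (2*ρ)))) measurableSet_ball ?_).trans ?_
  · intro h hh
    rw [mem_ball_zero_iff] at hh
    have hc : ∀ i, |b.repr h i| ≤ 2*ρ := by
      intro i
      rw [b.repr_apply_apply]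
      have := abs_real_inner_le_norm (b i) h
      rw [b.orthonormal.1 i, one_mul] at this
      exact this.trans hh.le
    have := chain_shift hV b hG hS x0 (ρ := ρ) (fun i => b.repr h i) hc Finset.univ
    rw [b.sum_repr h, Finset.card_univ, hcard] at this
    push_cast at this
    refine le_trans (measure_mono ?_) this
    rintro x ⟨⟨hx1, hx2⟩, hx3, hx4⟩
    exact ⟨hx2, fun h => hx3 (h.1 hx1)⟩
  · rw [setLIntegral_const, mul_comm]

lemma eB_freq {m : ℕ} (hV : Module.finrank ℝ V = m + 1) {G : Set V} (hG : MeasurableSet G) {x : V}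
    (hx : x ∈ eB (m+1) G) : ∃ c : ℝ, 0 < c ∧ ∃ᶠ ρ in 𝓝[>] (0:ℝ),
      ENNReal.ofReal (c * ρ^(m+1)) ≤ volume (G ∩ ball x ρ) ∧
      ENNReal.ofReal (c * ρ^(m+1)) ≤ volume (Gᶜ ∩ ball x ρ) := by
  have hGx := hx.1
  have hGx' := hx.2
  rw [MZ_iff_haar hV volume] at hGx hGx'
  unfold MZm at hGx hGx'
  push Not at hGx hGx'
  obtain ⟨ε, hε, h1⟩ := hGx
  obtain ⟨ε', hε', h2⟩ := hGx'
  set ω : ℝ := volume.real (ball (0:V) 1) with hω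
  have hω0 : 0 < ω := by
    rw [hω, Measure.real, ENNReal.toReal_pos_iff]
    exact ⟨measure_ball_pos _ _ one_pos, measure_ball_lt_top⟩
  have hball : ∀ ρ, 0 < ρ → volume.real (ball x ρ) = ρ^(m+1) * ω := by
    intro ρ hρ
    rw [Measure.real, Measure.addHaar_ball_of_pos volume x hρ, hV, ENNReal.toReal_mul,
      ENNReal.toReal_ofReal (by positivity)]; rfl
  set f : ℝ → ℝ := fun ρ => volume.real (G ∩ ball x ρ) with hf
  set g : ℝ → ℝ := fun ρ => volume.real (Gᶜ ∩ ball x ρ) with hg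
  have hfg : ∀ ρ, 0 < ρ → f ρ + g ρ = ρ^(m+1) * ω := by
    intro ρ hρ
    rw [← hball ρ hρ, hf, hg]
    have := measureReal_inter_add_diff (μ := volume) (s := ball x ρ) hG (measure_ball_lt_top.ne)
    rw [← this, inter_comm (ball x ρ) G, diff_eq, inter_comm (ball x ρ)]
  have hfm : Monotone f := fun a b hab => measureReal_mono
    (inter_subset_inter_right _ (ball_subset_ball hab)) (measure_ball_lt_top.trans_le' (measure_mono inter_subset_right)).ne
  have hgm : Monotone g := fun a b hab => measureReal_mono
    (inter_subset_inter_right _ (ball_subset_ball hab)) (measure_ball_lt_top.trans_le' (measure_mono inter_subset_right)).ne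
  have hfe : ∀ ρ, ENNReal.ofReal (f ρ) = volume (G ∩ ball x ρ) := fun ρ =>
    ENNReal.ofReal_toReal (measure_ball_lt_top.trans_le' (measure_mono inter_subset_right)).ne
  have hge : ∀ ρ, ENNReal.ofReal (g ρ) = volume (Gᶜ ∩ ball x ρ) := fun ρ =>
    ENNReal.ofReal_toReal (measure_ball_lt_top.trans_le' (measure_mono inter_subset_right)).ne
  have hdist : ∀ a b, 0 < a → 0 < b → dist (f a) (f b) ≤ dist (a^(m+1) * ω) (b^(m+1) * ω) := by
    intro a b ha hb
    rw [← hfg a ha, ← hfg b hb, Real.dist_eq, Real.dist_eq]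
    rcases le_total a b with h | h
    · have := hfm h; have := hgm h
      rw [abs_of_nonpos (by linarith), abs_of_nonpos (by linarith)]; linarith
    · have := hfm h; have := hgm h
      rw [abs_of_nonneg (by linarith), abs_of_nonneg (by linarith)]; linarith
  have hcont : ContinuousOn f (Ioi 0) := by
    intro a ha
    rw [ContinuousWithinAt, tendsto_iff_dist_tendsto_zero]
    have hc : ContinuousWithinAt (fun a : ℝ => a^(m+1) * ω) (Ioi 0) a := by fun_prop
    rw [ContinuousWithinAt, tendsto_iff_dist_tendsto_zero] at hc
    refine squeeze_zero' (Eventually.of_forall fun _ => dist_nonneg) ?_ hc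
    filter_upwards [self_mem_nhdsWithin] with b hb using hdist b a hb ha
  set c := min (min ε ε') (ω/4) with hc
  have hc0 : 0 < c := by positivity
  refine ⟨c, hc0, fun hcon => ?_⟩
  obtain ⟨δ, hδ, hcon⟩ := mem_nhdsGT_iff_exists_Ioo_subset.1 hcon
  have hδ : 0 < δ := hδ
  have hdich : ∀ ρ ∈ Ioo 0 δ, f ρ < c * ρ^(m+1) ∨ g ρ < c * ρ^(m+1) := by
    intro ρ hρ
    by_contra hn
    push Not at hn
    refine hcon hρ ⟨?_, ?_⟩
    · rw [← hfe]; exact ENNReal.ofReal_le_ofReal hn.1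
    · rw [← hge]; exact ENNReal.ofReal_le_ofReal hn.2
  have hpre : IsPreconnected (Ioo 0 δ) := isPreconnected_Ioo
  have hφ : ContinuousOn (fun ρ => f ρ / ρ^(m+1)) (Ioo 0 δ) := by
    apply ContinuousOn.div (hcont.mono Ioo_subset_Ioi_self) (by fun_prop)
    intro ρ hρ; exact (pow_pos hρ.1 _).ne'
  have hside : (∀ ρ ∈ Ioo 0 δ, f ρ < c * ρ^(m+1)) ∨ (∀ ρ ∈ Ioo 0 δ, g ρ < c * ρ^(m+1)) := by
    by_contra hn
    push Not at hn
    obtain ⟨⟨a, ha, ha'⟩, b, hb, hb'⟩ := hn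
    have hpa := pow_pos ha.1 (m+1)
    have hpb := pow_pos hb.1 (m+1)
    have hcω : c ≤ ω/4 := min_le_right _ _
    have hga := (hdich a ha).resolve_left (not_lt.2 ha')
    have hfb := (hdich b hb).resolve_right (not_lt.2 hb')
    have e1 := hfg a ha.1
    have e2 := hfg b hb.1
    have k1 : ω/2 ≤ f a / a^(m+1) := by rw [le_div_iff₀ hpa]; nlinarith
    have k2 : f b / b^(m+1) ≤ ω/2 := by rw [div_le_iff₀ hpb]; nlinarith
    obtain ⟨d, hd, hd'⟩ := hpre.intermediate_value hb ha hφ ⟨k2, k1⟩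
    have hpd := pow_pos hd.1 (m+1)
    have e3 := hfg d hd.1
    have hd'' : f d = ω/2 * d^(m+1) := by rw [← hd']; field_simp
    rcases hdich d hd with h | h <;> nlinarith
  have hev : ∀ᶠ ρ in 𝓝[>] (0:ℝ), ρ ∈ Ioo 0 δ := Ioo_mem_nhdsGT hδ
  rcases hside with h | h
  · obtain ⟨ρ, hρ, hρ'⟩ := (h1.and_eventually hev).exists
    have := h ρ hρ'
    rw [← hfe] at hρ
    have hle : c * ρ^(m+1) ≤ ε * ρ^(m+1) :=
      mul_le_mul_of_nonneg_right ((min_le_left _ _).trans (min_le_left _ _)) (pow_pos hρ'.1 _).le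
    exact absurd hρ (not_lt.2 (ENNReal.ofReal_le_ofReal (this.le.trans hle)))
  · obtain ⟨ρ, hρ, hρ'⟩ := (h2.and_eventually hev).exists
    have := h ρ hρ'
    rw [← hge] at hρ
    have hle : c * ρ^(m+1) ≤ ε' * ρ^(m+1) :=
      mul_le_mul_of_nonneg_right ((min_le_left _ _).trans (min_le_right _ _)) (pow_pos hρ'.1 _).le
    exact absurd hρ (not_lt.2 (ENNReal.ofReal_le_ofReal (this.le.trans hle)))

/-- a subset of the essential boundary with null projections in a full set of directions is null -/
lemma null_of_proj {m : ℕ} (hV : Module.finrank ℝ V = m + 1) {ι : Type*} [Fintype ι]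
    (b : OrthonormalBasis ι ℝ V) {G : Set V} (hG : MeasurableSet G) {O : Set V} (hO : IsOpen O)
    (hfin : μHE[m] (eB (m+1) G ∩ O) ≠ ⊤) {S : Set V} (hSm : MeasurableSet S)
    (hSe : S ⊆ eB (m+1) G ∩ O)
    (hS : ∀ i, volume ((OSplit.ofUnit (b.orthonormal.1 i)).pr '' S) = 0) :
    μHE[m] S = 0 := by
  set D := (eB (m+1) G \ S) ∩ O with hD
  set ν := (μHE[m] : Measure V).restrict D with hν
  have hνf : IsFiniteMeasure ν := ⟨by
    rw [hν, Measure.restrict_apply_univ]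
    exact (measure_mono (inter_subset_inter_left _ diff_subset)).trans_lt (lt_top_iff_ne_top.2 hfin)⟩
  have hνS : ν S = 0 := by
    rw [hν, Measure.restrict_apply hSm]
    have : S ∩ D = ∅ := by
      ext x; simp only [hD, mem_inter_iff, mem_diff, mem_empty_iff_false, iff_false]; tauto
    rw [this, measure_empty]
  set ω : ℝ := volume.real (ball (0:V) 1) with hω
  have hωe : volume (ball (0:V) 1) = ENNReal.ofReal ω := (ENNReal.ofReal_toReal measure_ball_lt_top.ne).symm
  have hω0 : 0 < ω := by
    rw [hω, Measure.real, ENNReal.toReal_pos_iff]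
    exact ⟨measure_ball_pos _ _ one_pos, measure_ball_lt_top⟩
  set L : ℝ := 2*m+3 with hL
  have hL0 : 0 < L := by positivity
  have key : ∀ x ∈ S, ∃ κ : ℝ, 0 < κ ∧ ∃ᶠ r in 𝓝[>] (0:ℝ), ENNReal.ofReal (κ * r^m) ≤ ν (closedBall x r) := by
    intro x hx
    obtain ⟨c, hc, hfr⟩ := eB_freq hV hG (hSe hx).1
    obtain ⟨δ, hδ, hδO⟩ := Metric.isOpen_iff.1 hO x (hSe hx).2
    set Q : ℝ := (2^(m+1) * ω) * ((m+1)*2) with hQ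
    have hQ0 : 0 < Q := by positivity
    refine ⟨c^2/Q/L^m, by positivity, ?_⟩
    have hev : ∀ᶠ ρ in 𝓝[>] (0:ℝ), ρ ∈ Ioo 0 (δ/L) := Ioo_mem_nhdsGT (by positivity)
    have hfr2 : ∃ᶠ ρ in 𝓝[>] (0:ℝ), ENNReal.ofReal (c^2/Q/L^m * (L*ρ)^m) ≤ ν (closedBall x (L*ρ)) := by
      refine (hfr.and_eventually hev).mono ?_
      rintro ρ ⟨⟨h1, h2⟩, hρ⟩
      have hρ0 := hρ.1
      have hi := isoper hV b hG hS x (ρ := ρ)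
      have hsub : (eB (m+1) G \ S) ∩ ball x (ρ + (m+1) * (2*ρ)) ⊆ closedBall x (L*ρ) ∩ D := by
        rintro y ⟨hy1, hy2⟩
        have hy3 : dist y x < L * ρ := by rw [mem_ball] at hy2; rw [hL]; linarith
        have : L * ρ < δ := by have := hρ.2; rw [lt_div_iff₀ hL0] at this; linarith
        exact ⟨hy3.le, hy1, hδO (hy3.trans this)⟩
      have hm := measure_mono (μ := (μHE[m] : Measure V)) hsub
      rw [← Measure.restrict_apply isClosed_closedBall.measurableSet] at hm
      have h3 := (mul_le_mul' h1 h2).trans (hi.trans (mul_le_mul_right (mul_le_mul_right hm _) _))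
      rw [Measure.addHaar_ball_of_pos volume 0 (by positivity : 0 < 2*ρ), hV, hωe, ← ENNReal.ofReal_mul (by positivity),
        ← ENNReal.ofReal_mul (by positivity), ← mul_assoc (ENNReal.ofReal ((2 * ρ) ^ (m + 1) * ω)), ← ENNReal.ofReal_mul (by positivity)] at h3
      have hP : 0 < (2 * ρ) ^ (m + 1) * ω * ((↑m + 1) * (2 * ρ)) := by positivity
      have e : c^2/Q/L^m * (L*ρ)^m = (c * ρ^(m+1) * (c * ρ^(m+1))) / ((2 * ρ) ^ (m + 1) * ω * ((↑m + 1) * (2 * ρ))) := by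
        rw [hQ, mul_pow, mul_pow]; field_simp; ring
      rw [e, ENNReal.ofReal_div_of_pos hP]
      refine ENNReal.div_le_of_le_mul ?_
      rw [mul_comm (ν _)]
      exact h3
    have ht : Tendsto (fun ρ : ℝ => L * ρ) (𝓝[>] 0) (𝓝[>] 0) := by
      refine tendsto_nhdsWithin_of_tendsto_nhds_of_eventually_within _ ?_ ?_
      · have : Tendsto (fun ρ : ℝ => L * ρ) (𝓝 0) (𝓝 (L*0)) := (continuous_const_mul L).tendsto 0
        rw [mul_zero] at this
        exact this.mono_left nhdsWithin_le_nhds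
      · filter_upwards [self_mem_nhdsWithin] with ρ hρ using mul_pos hL0 hρ
    exact ht.frequently hfr2
  have hcov : S ⊆ ⋃ j : ℕ, {x | x ∈ S ∧ ∃ᶠ r in 𝓝[>] (0:ℝ), ENNReal.ofReal (1/((j:ℝ)+1) * r^m) ≤ ν (closedBall x r)} := by
    intro x hx
    obtain ⟨κ, hκ, h⟩ := key x hx
    obtain ⟨j, hj⟩ := exists_nat_one_div_lt hκ
    refine mem_iUnion.2 ⟨j, hx, ?_⟩
    refine (h.and_eventually self_mem_nhdsWithin).mono ?_
    rintro r ⟨hr, hr0⟩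
    refine le_trans (ENNReal.ofReal_le_ofReal ?_) hr
    exact mul_le_mul_of_nonneg_right hj.le (pow_pos hr0 _).le
  have hH : μH[(m:ℝ)] S = 0 := by
    refine measure_mono_null hcov (measure_iUnion_null fun j => ?_)
    exact cover_null ν (by positivity) (measure_mono_null (fun x hx => hx.1) hνS) (fun x hx => hx.2)
  rw [Measure.euclideanHausdorffMeasure_def, Measure.smul_apply, hH, smul_zero]

end A6

section A7
open MeasureTheory.Measure Pointwise in
lemma approx_fderiv_sub_le {E F : Type*} [NormedAddCommGroup E] [NormedSpace ℝ E] [FiniteDimensional ℝ E]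
    [MeasurableSpace E] [BorelSpace E] [NormedAddCommGroup F] [NormedSpace ℝ F] (μ : Measure E)
    [μ.IsAddHaarMeasure] {f : E → F} {s : Set E} {A : E →L[ℝ] F} {δ : ℝ≥0}
    (hf : ApproximatesLinearOn f A s δ) (hs : MeasurableSet s) (f' : E → E →L[ℝ] F)
    (hf' : ∀ x ∈ s, HasFDerivWithinAt f (f' x) s x) : ∀ᵐ x ∂μ.restrict s, ‖f' x - A‖₊ ≤ δ := by
  /- The conclusion will hold at the Lebesgue density points of `s` (which have full measure).
    At such a point `x`, for any `z` and any `ε > 0` one has for small `r`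
    that `{x} + r • closedBall z ε` intersects `s`. At a point `y` in the intersection,
    `f y - f x` is close both to `f' x (r z)` (by differentiability) and to `A (r z)`
    (by linear approximation), so these two quantities are close, i.e., `(f' x - A) z` is small. -/
  filter_upwards [Besicovitch.ae_tendsto_measure_inter_div μ s, ae_restrict_mem hs]
  -- start from a Lebesgue density point `x`, belonging to `s`.
  intro x hx xs
  -- consider an arbitrary vector `z`.
  apply ContinuousLinearMap.opNorm_le_bound _ δ.2 fun z => ?_
  -- to show that `‖(f' x - A) z‖ ≤ δ ‖z‖`, it suffices to do it up to some error that vanishes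
  -- asymptotically in terms of `ε > 0`.
  suffices H : ∀ ε, 0 < ε → ‖(f' x - A) z‖ ≤ (δ + ε) * (‖z‖ + ε) + ‖f' x - A‖ * ε by
    have :
      Tendsto (fun ε : ℝ => ((δ : ℝ) + ε) * (‖z‖ + ε) + ‖f' x - A‖ * ε) (𝓝[>] 0)
        (𝓝 ((δ + 0) * (‖z‖ + 0) + ‖f' x - A‖ * 0)) :=
      Tendsto.mono_left (Continuous.tendsto (by fun_prop) 0) nhdsWithin_le_nhds
    simp only [add_zero, mul_zero] at this
    apply le_of_tendsto_of_tendsto tendsto_const_nhds this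
    filter_upwards [self_mem_nhdsWithin]
    exact H
  -- fix a positive `ε`.
  intro ε εpos
  -- for small enough `r`, the rescaled ball `r • closedBall z ε` intersects `s`, as `x` is a
  -- density point
  have B₁ : ∀ᶠ r in 𝓝[>] (0 : ℝ), (s ∩ ({x} + r • closedBall z ε)).Nonempty :=
    eventually_nonempty_inter_smul_of_density_one μ s x hx _ measurableSet_closedBall
      (measure_closedBall_pos μ z εpos).ne'
  obtain ⟨ρ, ρpos, hρ⟩ :
    ∃ ρ > 0, ball x ρ ∩ s ⊆ {y : E | ‖f y - f x - (f' x) (y - x)‖ ≤ ε * ‖y - x‖} :=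
    mem_nhdsWithin_iff.1 ((hf' x xs).isLittleO.def εpos)
  -- for small enough `r`, the rescaled ball `r • closedBall z ε` is included in the set where
  -- `f y - f x` is well approximated by `f' x (y - x)`.
  have B₂ : ∀ᶠ r in 𝓝[>] (0 : ℝ), {x} + r • closedBall z ε ⊆ ball x ρ := by
    apply nhdsWithin_le_nhds
    exact eventually_singleton_add_smul_subset isBounded_closedBall (ball_mem_nhds x ρpos)
  -- fix a small positive `r` satisfying the above properties, as well as a corresponding `y`.
  obtain ⟨r, ⟨y, ⟨ys, hy⟩⟩, rρ, rpos⟩ :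
    ∃ r : ℝ,
      (s ∩ ({x} + r • closedBall z ε)).Nonempty ∧ {x} + r • closedBall z ε ⊆ ball x ρ ∧ 0 < r :=
    (B₁.and (B₂.and self_mem_nhdsWithin)).exists
  -- write `y = x + r a` with `a ∈ closedBall z ε`.
  obtain ⟨a, az, ya⟩ : ∃ a, a ∈ closedBall z ε ∧ y = x + r • a := by
    simp only [mem_smul_set, image_add_left, mem_preimage, singleton_add] at hy
    rcases hy with ⟨a, az, ha⟩
    exact ⟨a, az, by simp only [ha, add_neg_cancel_left]⟩
  have norm_a : ‖a‖ ≤ ‖z‖ + ε :=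
    calc
      ‖a‖ = ‖z + (a - z)‖ := by simp only [add_sub_cancel]
      _ ≤ ‖z‖ + ‖a - z‖ := norm_add_le _ _
      _ ≤ ‖z‖ + ε := by grw [mem_closedBall_iff_norm.1 az]
  -- use the approximation properties to control `(f' x - A) a`, and then `(f' x - A) z` as `z` is
  -- close to `a`.
  have I : r * ‖(f' x - A) a‖ ≤ r * (δ + ε) * (‖z‖ + ε) :=
    calc
      r * ‖(f' x - A) a‖ = ‖(f' x - A) (r • a)‖ := by
        simp only [map_smul, norm_smul, Real.norm_eq_abs, abs_of_nonneg rpos.le]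
      _ = ‖f y - f x - A (y - x) - (f y - f x - (f' x) (y - x))‖ := by
        simp only [ya, add_sub_cancel_left, sub_sub_sub_cancel_left, FunLike.coe_sub,
          Pi.sub_apply, map_smul, smul_sub]
      _ ≤ ‖f y - f x - A (y - x)‖ + ‖f y - f x - (f' x) (y - x)‖ := norm_sub_le _ _
      _ ≤ δ * ‖y - x‖ + ε * ‖y - x‖ := (add_le_add (hf _ ys _ xs) (hρ ⟨rρ hy, ys⟩))
      _ = r * (δ + ε) * ‖a‖ := by
        simp only [ya, add_sub_cancel_left, norm_smul, Real.norm_eq_abs, abs_of_nonneg rpos.le]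
        ring
      _ ≤ r * (δ + ε) * (‖z‖ + ε) := by gcongr
  calc
    ‖(f' x - A) z‖ = ‖(f' x - A) a + (f' x - A) (z - a)‖ := by
      congr 1
      simp only [FunLike.coe_sub, map_sub, Pi.sub_apply]
      abel
    _ ≤ ‖(f' x - A) a‖ + ‖(f' x - A) (z - a)‖ := norm_add_le _ _
    _ ≤ (δ + ε) * (‖z‖ + ε) + ‖f' x - A‖ * ‖z - a‖ := by
      apply add_le_add
      · rw [mul_assoc] at I; exact (mul_le_mul_iff_right₀ rpos).1 I
      · apply ContinuousLinearMap.le_opNorm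
    _ ≤ (δ + ε) * (‖z‖ + ε) + ‖f' x - A‖ * ε := by
      rw [mem_closedBall_iff_norm'] at az
      gcongr

/-- comparing images -/
lemma image_compare {X Y Z : Type*} [Nonempty X] [MetricSpace Y] [MeasurableSpace Y] [BorelSpace Y]
    [MetricSpace Z] [MeasurableSpace Z] [BorelSpace Z] {m : ℕ} {f : X → Y} {g : X → Z} {s : Set X} {K : ℝ≥0}
    (h : ∀ x ∈ s, ∀ y ∈ s, dist (f x) (f y) ≤ K * dist (g x) (g y)) :
    μHE[m] (f '' s) ≤ (K:ℝ≥0∞)^m * μHE[m] (g '' s) := by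
  set k : Z → Y := fun z => f (Function.invFunOn g s z) with hk
  have hkl : LipschitzOnWith K k (g '' s) := by
    refine LipschitzOnWith.of_dist_le_mul fun a ha b hb => ?_
    have h1 := Function.invFunOn_mem ha
    have h2 := Function.invFunOn_mem hb
    have e1 := Function.invFunOn_eq ha
    have e2 := Function.invFunOn_eq hb
    have := h _ h1 _ h2
    rwa [e1, e2] at this
  have hsub : f '' s ⊆ k '' (g '' s) := by
    rintro _ ⟨x, hx, rfl⟩
    refine ⟨g x, ⟨x, hx, rfl⟩, ?_⟩
    have hm : g x ∈ g '' s := ⟨x, hx, rfl⟩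
    have := h _ (Function.invFunOn_mem hm) x hx
    rw [Function.invFunOn_eq hm, dist_self, mul_zero] at this
    exact dist_le_zero.1 this
  exact (measure_mono hsub).trans (euc_volume_image_le hkl)

variable {W V : Type*} [NormedAddCommGroup W] [InnerProductSpace ℝ W] [FiniteDimensional ℝ W]
  [MeasurableSpace W] [BorelSpace W]
  [NormedAddCommGroup V] [InnerProductSpace ℝ V] [FiniteDimensional ℝ V]
  [MeasurableSpace V] [BorelSpace V]

lemma normDet_le_of_norm_le {m : ℕ} (hm : Module.finrank ℝ W = m) (A B : W →L[ℝ] V) {K : ℝ≥0}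
    (h : ∀ v, ‖A v‖ ≤ K * ‖B v‖) :
    ENNReal.ofReal A.toLinearMap.normDet ≤ (K:ℝ≥0∞)^m * ENNReal.ofReal B.toLinearMap.normDet := by
  subst hm
  have h1 := image_compare (m := Module.finrank ℝ W) (f := A) (g := B) (s := ball (0:W) 1) (K := K) (by
    intro x _ y _
    rw [dist_eq_norm, dist_eq_norm, ← map_sub, ← map_sub]; exact h _)
  have e1 := A.toLinearMap.euclideanHausdorffMeasure_image_eq_normDet_mul_volume (ball 0 1)
  have e2 := B.toLinearMap.euclideanHausdorffMeasure_image_eq_normDet_mul_volume (ball 0 1)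
  simp only [ContinuousLinearMap.coe_coe] at e1 e2
  rw [e1, e2, ← mul_assoc] at h1
  exact (ENNReal.mul_le_mul_iff_left (measure_ball_pos _ _ one_pos).ne' measure_ball_lt_top.ne).1 h1

/-- area formula -/
lemma area_formula {m : ℕ} (hm : Module.finrank ℝ W = m) {f : W → V} {f' : W → W →L[ℝ] V} {s : Set W}
    (hs : MeasurableSet s) (hf : ∀ x ∈ s, HasFDerivWithinAt f (f' x) s x) (hinj : InjOn f s)
    {c : ℝ} (hc : 0 < c) (hlow : ∀ x ∈ s, ∀ v, c * ‖v‖ ≤ ‖f' x v‖) :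
    μHE[m] (f '' s) = ∫⁻ x in s, ENNReal.ofReal (f' x).toLinearMap.normDet := by
  rcases s.eq_empty_or_nonempty with rfl | hne
  · simp
  have main : ∀ K : ℝ≥0, 1 < K →
      μHE[m] (f '' s) ≤ (K:ℝ≥0∞)^(2*m) * ∫⁻ x in s, ENNReal.ofReal (f' x).toLinearMap.normDet ∧
      ∫⁻ x in s, ENNReal.ofReal (f' x).toLinearMap.normDet ≤ (K:ℝ≥0∞)^(2*m) * μHE[m] (f '' s) := by
    intro K hK
    have hK' : (1:ℝ) < K := by exact_mod_cast hK
    have hK0 : (0:ℝ) < K := by linarith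
    set δ : ℝ≥0 := ⟨c * (1 - 1/K), by
      have : 1/(K:ℝ) ≤ 1 := by rw [div_le_one hK0]; exact hK'.le
      exact mul_nonneg hc.le (by linarith)⟩ with hδ
    have hδv : (δ:ℝ) = c * (1 - 1/K) := rfl
    have hKi : 1/(K:ℝ) < 1 := by rw [div_lt_one hK0]; exact hK'
    have hδ0 : δ ≠ 0 := by
      intro h
      have : (δ:ℝ) = 0 := by rw [h]; rfl
      rw [hδv] at this
      have := mul_pos hc (sub_pos.2 hKi)
      linarith
    -- abstract comparison
    have comp : ∀ a b d n : ℝ, c * n ≤ a → |b - a| ≤ δ * n → 0 ≤ n → b ≤ K * a ∧ a ≤ K * b := by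
      intro a b d n h1 h2 h3
      have h4 : δ * n ≤ (1 - 1/K) * a := by
        rw [hδv]
        have := mul_le_mul_of_nonneg_left h1 (sub_pos.2 hKi).le
        linarith
      have ha : 0 ≤ a := (mul_nonneg hc.le h3).trans h1
      have h5 := abs_le.1 (h2.trans h4)
      have hinv : K * (1/(K:ℝ)) = 1 := by field_simp
      constructor
      · have : 2 - 1/(K:ℝ) ≤ K := by
          have : 2 - K ≤ 1/(K:ℝ) := by rw [le_div_iff₀ hK0]; nlinarith [sq_nonneg ((K:ℝ)-1)]
          linarith
        nlinarith [h5.2]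
      · have h6 : 1/(K:ℝ) * a ≤ b := by linarith [h5.1]
        calc a = K * (1/K * a) := by rw [← mul_assoc, hinv, one_mul]
          _ ≤ K * b := by gcongr
    obtain ⟨t, A, htd, htm, hst, hA, hAy⟩ := exists_partition_approximatesLinearOn_of_hasFDerivWithinAt
      f s f' hf (fun _ => δ) (fun _ => hδ0)
    have hAlow : ∀ n v, c * ‖v‖ ≤ ‖A n v‖ := by
      intro n v
      obtain ⟨y, hy, e⟩ := hAy hne n
      rw [e]; exact hlow y hy v
    have hcomp : ∀ n, ∀ x ∈ s ∩ t n, ∀ y ∈ s ∩ t n,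
        dist (f x) (f y) ≤ K * dist (A n x) (A n y) ∧ dist (A n x) (A n y) ≤ K * dist (f x) (f y) := by
      intro n x hx y hy
      have h1 := hA n _ hx _ hy
      simp only [dist_eq_norm]
      rw [← map_sub]
      refine comp _ _ 0 ‖x - y‖ (hAlow n _) ?_ (norm_nonneg _)
      exact (abs_norm_sub_norm_le _ _).trans h1
    have hms : ∀ n, MeasurableSet (s ∩ t n) := fun n => hs.inter (htm n)
    have hvol : ∀ n, μHE[m] (A n '' (s ∩ t n)) = ENNReal.ofReal (A n).toLinearMap.normDet * volume (s ∩ t n) := by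
      intro n; subst hm
      exact (A n).toLinearMap.euclideanHausdorffMeasure_image_eq_normDet_mul_volume _
    have hdet : ∀ n, ∀ᵐ x ∂(volume.restrict (s ∩ t n)),
        ENNReal.ofReal (f' x).toLinearMap.normDet ≤ (K:ℝ≥0∞)^m * ENNReal.ofReal (A n).toLinearMap.normDet ∧
        ENNReal.ofReal (A n).toLinearMap.normDet ≤ (K:ℝ≥0∞)^m * ENNReal.ofReal (f' x).toLinearMap.normDet := by
      intro n
      filter_upwards [approx_fderiv_sub_le volume (hA n) (hms n) f'
        (fun x hx => (hf x hx.1).mono inter_subset_left)] with x hx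
      have hx' : ∀ v, |‖f' x v‖ - ‖A n v‖| ≤ δ * ‖v‖ := by
        intro v
        refine (abs_norm_sub_norm_le _ _).trans ?_
        have := (f' x - A n).le_of_opNorm_le (c := δ) (by exact_mod_cast hx) v
        simpa using this
      exact ⟨normDet_le_of_norm_le hm _ _ fun v => (comp _ _ 0 _ (hAlow n v) (hx' v) (norm_nonneg _)).1,
        normDet_le_of_norm_le hm _ _ fun v => (comp _ _ 0 _ (hAlow n v) (hx' v) (norm_nonneg _)).2⟩
    have hpow : (K:ℝ≥0∞)^(2*m) = (K:ℝ≥0∞)^m * (K:ℝ≥0∞)^m := by rw [two_mul, pow_add]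
    have hsU : s = ⋃ n, s ∩ t n := by rw [← inter_iUnion, inter_eq_left.2 hst]
    have hdisj : Pairwise (Function.onFun Disjoint fun n => s ∩ t n) := fun i j hij =>
      (htd hij).mono inter_subset_right inter_subset_right
    have hfc : ContinuousOn f s := fun x hx => (hf x hx).continuousWithinAt
    have himU : f '' s = ⋃ n, f '' (s ∩ t n) := by rw [← image_iUnion, ← hsU]
    have himd : Pairwise (Function.onFun Disjoint fun n => f '' (s ∩ t n)) := by
      intro i j hij
      refine Set.disjoint_left.2 ?_
      rintro _ ⟨x, hx, rfl⟩ ⟨y, hy, hxy⟩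
      rw [hinj hy.1 hx.1 hxy] at hy
      exact Set.disjoint_left.1 (hdisj hij) hx hy
    have himm : ∀ n, MeasurableSet (f '' (s ∩ t n)) := fun n =>
      (hms n).image_of_continuousOn_injOn (hfc.mono inter_subset_left) (hinj.mono inter_subset_left)
    have hL : μHE[m] (f '' s) = ∑' n, μHE[m] (f '' (s ∩ t n)) := by
      rw [himU]; exact measure_iUnion himd himm
    have hR : ∫⁻ x in s, ENNReal.ofReal (f' x).toLinearMap.normDet =
        ∑' n, ∫⁻ x in s ∩ t n, ENNReal.ofReal (f' x).toLinearMap.normDet := by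
      conv_lhs => rw [hsU]
      exact lintegral_iUnion hms hdisj _
    rw [hL, hR, ← ENNReal.tsum_mul_left, ← ENNReal.tsum_mul_left]
    constructor
    · refine ENNReal.tsum_le_tsum fun n => ?_
      refine (image_compare (K := K) fun x hx y hy => (hcomp n x hx y hy).1).trans ?_
      rw [hvol, hpow, mul_assoc]
      refine mul_le_mul_right ?_ _
      rw [← lintegral_const_mul' _ _ (by simp), ← setLIntegral_const]
      exact lintegral_mono_ae ((hdet n).mono fun x hx => hx.2)
    · refine ENNReal.tsum_le_tsum fun n => ?_
      have h1 := image_compare (m := m) (K := K) fun x hx y hy => (hcomp n x hx y hy).2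
      rw [hvol] at h1
      rw [hpow, mul_assoc]
      refine (lintegral_mono_ae ((hdet n).mono fun x hx => hx.1)).trans ?_
      rw [setLIntegral_const, mul_assoc]
      gcongr
  have hlim : Tendsto (fun j : ℕ => ((1 + 1/((j:ℝ≥0)+1) : ℝ≥0) : ℝ≥0∞)^(2*m)) atTop (𝓝 1) := by
    have h1 : Tendsto (fun j : ℕ => (1 + 1/((j:ℝ≥0)+1) : ℝ≥0)) atTop (𝓝 (1 + 0)) :=
      tendsto_const_nhds.add tendsto_one_div_add_atTop_nhds_zero_nat
    rw [add_zero] at h1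
    have h2 := (ENNReal.tendsto_coe.2 (h1.pow (2*m)))
    simpa using h2
  have hpos : ∀ j : ℕ, (1:ℝ≥0) < 1 + 1/((j:ℝ≥0)+1) := fun j => by
    apply lt_add_of_pos_right; positivity
  apply le_antisymm
  · have := ENNReal.Tendsto.mul_const (b := ∫⁻ x in s, ENNReal.ofReal (f' x).toLinearMap.normDet) hlim (Or.inl one_ne_zero)
    rw [one_mul] at this
    exact ge_of_tendsto' this fun j => (main _ (hpos j)).1
  · have := ENNReal.Tendsto.mul_const (b := μHE[m] (f '' s)) hlim (Or.inl one_ne_zero)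
    rw [one_mul] at this
    exact ge_of_tendsto' this fun j => (main _ (hpos j)).2

end A7

section A8
variable {W : Type*} [NormedAddCommGroup W] [InnerProductSpace ℝ W] [FiniteDimensional ℝ W]
  [MeasurableSpace W] [BorelSpace W]
variable {V : Type*} [NormedAddCommGroup V] [InnerProductSpace ℝ V] [FiniteDimensional ℝ V]
  [MeasurableSpace V] [BorelSpace V]

lemma avg_diff {g : W → ℝ} (hg : LocallyIntegrable g volume) {P Q : Set W} (hP : MeasurableSet P) (hQ : MeasurableSet Q)
    (hPi : IntegrableOn g P) (hQi : IntegrableOn g Q)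
    (hPf : volume P ≠ ⊤) (hQf : volume Q ≠ ⊤) (hP0 : volume P ≠ 0) (hQ0 : volume Q ≠ 0)
    {D : ℝ} (hD0 : 0 ≤ D) (hD : ∫⁻ x in P, ∫⁻ y in Q, ‖g x - g y‖ₑ ≤ ENNReal.ofReal D) :
    |(⨍ x in P, g x) - ⨍ x in Q, g x| * (volume.real P * volume.real Q) ≤ D := by
  have h1 : ∫ x in P, ∫ y in Q, (g x - g y) =
      ((⨍ x in P, g x) - ⨍ x in Q, g x) * (volume.real P * volume.real Q) := by
    have : ∀ x, ∫ y in Q, (g x - g y) = volume.real Q * g x - ∫ y in Q, g y := by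
      intro x
      rw [integral_sub (integrableOn_const (C := g x) hQf (by simp)) hQi, setIntegral_const, smul_eq_mul]
    simp only [this]
    rw [integral_sub (hPi.const_mul _) (integrableOn_const (C := ∫ y in Q, g y) hPf (by simp)), setIntegral_const, smul_eq_mul,
      integral_const_mul, setAverage_eq, setAverage_eq, smul_eq_mul, smul_eq_mul]
    have hp : volume.real P ≠ 0 := (ENNReal.toReal_pos hP0 hPf).ne'
    have hq : volume.real Q ≠ 0 := (ENNReal.toReal_pos hQ0 hQf).ne'
    field_simp
  have h2 : ‖∫ x in P, ∫ y in Q, (g x - g y)‖ₑ ≤ ENNReal.ofReal D := by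
    refine (enorm_integral_le_lintegral_enorm _).trans (le_trans (lintegral_mono fun x => ?_) hD)
    exact enorm_integral_le_lintegral_enorm _
  rw [h1, ← ofReal_norm, ENNReal.ofReal_le_ofReal_iff hD0, norm_mul, Real.norm_eq_abs,
    Real.norm_of_nonneg (by positivity)] at h2
  exact h2

/-- Lusin type Lipschitz approximation -/
lemma lusin_lip {m : ℕ} (hm : Module.finrank ℝ W = m) {g : W → ℝ} (hg : LocallyIntegrable g volume)
    (ν : Measure W) [IsFiniteMeasure ν] {U : Set W} (hU : IsOpen U)
    (hP : ∀ x0 ρ, 0 < ρ → ball x0 ρ ⊆ U → ∀ P Q : Set W, MeasurableSet P → MeasurableSet Q →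
      P ⊆ ball x0 ρ → Q ⊆ ball x0 ρ →
      ∫⁻ x in P, ∫⁻ y in Q, ‖g x - g y‖ₑ ≤ ENNReal.ofReal (2*ρ) * volume (ball (0:W) (2*ρ)) * ν (ball x0 ρ)) :
    ∃ F : ℕ → W → ℝ, (∀ j, ∃ K, LipschitzWith K (F j)) ∧ ∀ᵐ p, p ∈ U → ∃ j, g p = F j p := by
  set ω := volume.real (ball (0:W) 1) with hω
  have hω0 : 0 < ω := ENNReal.toReal_pos (measure_ball_pos _ _ one_pos).ne' measure_ball_lt_top.ne
  have hcb : ∀ (x : W) ρ, 0 ≤ ρ → volume.real (closedBall x ρ) = ρ^m * ω := by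
    intro x ρ hρ
    rw [Measure.real, Measure.addHaar_closedBall _ _ hρ, hm, ENNReal.toReal_mul,
      ENNReal.toReal_ofReal (by positivity)]; rfl
  have hob : ∀ (x : W) ρ, 0 < ρ → volume (ball x ρ) = ENNReal.ofReal (ρ^m * ω) := by
    intro x ρ hρ
    rw [Measure.addHaar_ball_of_pos _ _ hρ, hm, ENNReal.ofReal_mul (by positivity)]
    congr 1
    rw [hω, Measure.real, ENNReal.ofReal_toReal measure_ball_lt_top.ne]
  have hgi : ∀ (x : W) ρ, IntegrableOn g (closedBall x ρ) := fun x ρ =>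
    hg.integrableOn_isCompact (isCompact_closedBall x ρ)
  set a : W → ℝ → ℝ := fun p ρ => ⨍ x in closedBall p ρ, g x with ha
  -- the basic estimate
  have key : ∀ (k : ℕ) x0 ρ, 0 < ρ → ball x0 ρ ⊆ U → ν (ball x0 ρ) ≤ ENNReal.ofReal (k * ρ^m) →
      ∀ p q r s, ρ/4 ≤ r → ρ/4 ≤ s → closedBall p r ⊆ ball x0 ρ → closedBall q s ⊆ ball x0 ρ →
      |a p r - a q s| ≤ (2 * 2^m * 16^m * k / ω) * ρ := by
    intro k x0 ρ hρ hUb hν p q r s hr hs hpr hqs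
    have hr0 : 0 < r := by linarith
    have hs0 : 0 < s := by linarith
    have h1 := hP x0 ρ hρ hUb _ _ measurableSet_closedBall measurableSet_closedBall hpr hqs
    have h2 : ENNReal.ofReal (2*ρ) * volume (ball (0:W) (2*ρ)) * ν (ball x0 ρ) ≤
        ENNReal.ofReal ((2*ρ) * ((2*ρ)^m * ω) * (k * ρ^m)) := by
      rw [hob _ _ (by positivity), ENNReal.ofReal_mul (p := (2*ρ) * ((2*ρ)^m * ω)) (by positivity),
        ENNReal.ofReal_mul (p := 2*ρ) (by positivity)]
      gcongr
    have h3 := avg_diff hg measurableSet_closedBall measurableSet_closedBall (hgi p r) (hgi q s)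
      measure_closedBall_lt_top.ne measure_closedBall_lt_top.ne
      (measure_closedBall_pos _ _ hr0).ne' (measure_closedBall_pos _ _ hs0).ne' (by positivity) (h1.trans h2)
    rw [hcb _ _ hr0.le, hcb _ _ hs0.le] at h3
    have h4 : (ρ/4)^m * ω * ((ρ/4)^m * ω) ≤ r^m * ω * (s^m * ω) := by gcongr
    have h5 : |a p r - a q s| * ((ρ/4)^m * ω * ((ρ/4)^m * ω)) ≤ (2*ρ) * ((2*ρ)^m * ω) * (k * ρ^m) :=
      (mul_le_mul_of_nonneg_left h4 (abs_nonneg _)).trans h3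
    rw [← le_div_iff₀ (by positivity)] at h5
    refine h5.trans (le_of_eq ?_)
    have : (16:ℝ)^m = 4^m * 4^m := by rw [← mul_pow]; norm_num
    rw [div_pow, mul_pow, this]
    field_simp
  -- the good sets
  set Z : ℕ → Set W := fun k => {p | (∀ R : ℝ, 0 < R → Tendsto (fun j : ℕ => a p (R / 2^j)) atTop (𝓝 (g p))) ∧
    ball p (1/((k:ℝ)+1)) ⊆ U ∧ ∀ ρ, 0 < ρ → ρ ≤ 1/((k:ℝ)+1) → ν (ball p ρ) ≤ ENNReal.ofReal (((k+1:ℕ):ℝ) * ρ^m)} with hZ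
  have hZae : ∀ᵐ p, p ∈ U → ∃ k, p ∈ Z k := by
    filter_upwards [IsUnifLocDoublingMeasure.ae_tendsto_average (μ := (volume : Measure W)) hg 1,
      Besicovitch.ae_tendsto_rnDeriv ν (volume : Measure W), Measure.rnDeriv_lt_top ν (volume : Measure W)] with p h1 h2 h3 hpU
    have hL : ∀ R : ℝ, 0 < R → Tendsto (fun j : ℕ => a p (R / 2^j)) atTop (𝓝 (g p)) := by
      intro R hR
      refine h1 (l := atTop) (fun _ => p) (fun j : ℕ => R/2^j) ?_ (Eventually.of_forall fun j => mem_closedBall_self (by positivity))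
      refine tendsto_nhdsWithin_iff.2 ⟨?_, Eventually.of_forall fun j => by simp only [mem_Ioi]; positivity⟩
      have := (tendsto_pow_atTop_nhds_zero_of_lt_one (r := (1/2:ℝ)) (by norm_num) (by norm_num)).const_mul R
      simp only [mul_zero] at this
      refine this.congr fun j => ?_
      rw [one_div, inv_pow]; rfl
    obtain ⟨N, hN⟩ := ENNReal.exists_nat_gt h3.ne
    have h4 := (h2.eventually (gt_mem_nhds hN))
    obtain ⟨δ, hδ, hδ'⟩ := mem_nhdsGT_iff_exists_Ioo_subset.1 h4
    obtain ⟨r0, hr0, hr0'⟩ := Metric.isOpen_iff.1 hU p hpU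
    obtain ⟨k, hk⟩ := exists_nat_gt (max (1/δ) (max (1/r0) (N * ω)))
    have hk1 : 1/δ < k := (le_max_left _ _).trans_lt hk
    have hk2 : 1/r0 < k := ((le_max_left _ _).trans (le_max_right _ _)).trans_lt hk
    have hk3 : N * ω < k := ((le_max_right _ _).trans (le_max_right _ _)).trans_lt hk
    have hδ0 : 0 < δ := hδ
    have hd : 1/((k:ℝ)+1) < δ := by
      rw [div_lt_iff₀ (by positivity)]; rw [div_lt_iff₀ hδ0] at hk1; nlinarith
    have hd2 : 1/((k:ℝ)+1) < r0 := by
      rw [div_lt_iff₀ (by positivity)]; rw [div_lt_iff₀ hr0] at hk2; nlinarith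
    refine ⟨k, hL, (ball_subset_ball hd2.le).trans hr0', ?_⟩
    · intro ρ hρ hρk
      have h5 : ν (closedBall p ρ) / volume (closedBall p ρ) < N := hδ' ⟨hρ, hρk.trans_lt hd⟩
      refine (measure_mono ball_subset_closedBall).trans ?_
      have h6 := (ENNReal.div_le_iff (measure_closedBall_pos _ _ hρ).ne' measure_closedBall_lt_top.ne).1 h5.le
      refine h6.trans ?_
      rw [← ENNReal.ofReal_toReal (a := volume (closedBall p ρ)) measure_closedBall_lt_top.ne,
        ← Measure.real, hcb _ _ hρ.le, ← ENNReal.ofReal_natCast, ← ENNReal.ofReal_mul (by positivity)]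
      apply ENNReal.ofReal_le_ofReal
      have : (0:ℝ) < ρ^m := by positivity
      push_cast
      nlinarith
  have hZL : ∀ k, ∀ p ∈ Z k, ∀ q ∈ Z k, dist p q ≤ 1/(4*((k:ℝ)+1)) →
      |g p - g q| ≤ 12 * (2 * 2^m * 16^m * (k+1:ℕ) / ω) * dist p q := by
    intro k p hp q hq hpq
    rcases eq_or_ne p q with rfl | hne
    · simp
    set R := dist p q with hR
    have hR0 : 0 < R := dist_pos.2 hne
    set C := (2 * 2^m * 16^m * ((k+1:ℕ):ℝ) / ω) with hC
    have hC0 : 0 ≤ C := by positivity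
    have h4R : 4 * R ≤ 1/((k:ℝ)+1) := by
      have : 1/(4*((k:ℝ)+1)) = 1/((k:ℝ)+1)/4 := by field_simp
      rw [this] at hpq; linarith
    have tel : ∀ p ∈ Z k, |a p R - g p| ≤ 4 * C * R := by
      intro p hp
      have h1 := dist_le_of_le_geometric_two_of_tendsto₀ (C := 4*C*R) (f := fun j : ℕ => a p (R / 2^j)) (fun j => by
        rw [Real.dist_eq]
        have hj : R / 2^j ≤ R := div_le_self hR0.le (one_le_pow₀ (by norm_num))
        have hj0 : 0 < R / 2^j := by positivity
        have hs : R / 2^(j+1) = R/2^j/2 := by rw [pow_succ]; field_simp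
        refine (key (k+1) p (2*(R/2^j)) (by positivity) ((ball_subset_ball (by linarith)).trans hp.2.1)
          (hp.2.2 _ (by positivity) (by linarith)) p p _ _ ?_ ?_ ?_ ?_).trans (le_of_eq ?_)
        · linarith
        · rw [hs]; linarith
        · exact closedBall_subset_ball (by linarith)
        · rw [hs]; exact closedBall_subset_ball (by linarith)
        · rw [← hC]; field_simp; norm_num) (hp.1 R hR0)
      rw [Real.dist_eq] at h1
      simpa using h1
    have h1 := tel p hp
    have h2 := tel q hq
    have h3 := key (k+1) p (4*R) (by positivity) ((ball_subset_ball h4R).trans hp.2.1)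
          (hp.2.2 _ (by positivity) h4R) p q R R (by linarith) (by linarith)
          (closedBall_subset_ball (by linarith))
          (closedBall_subset_ball' (by rw [dist_comm]; linarith))
    rw [← hC] at h3
    rw [abs_le] at *
    constructor <;> linarith [h1.1, h1.2, h2.1, h2.2, h3.1, h3.2]
  -- countable family
  have hext : ∀ (k : ℕ) (c : W), ∃ f : W → ℝ, (∃ K, LipschitzWith K f) ∧
      EqOn g f (Z k ∩ ball c (1/(8*((k:ℝ)+1)))) := by
    intro k c
    have hl : LipschitzOnWith ⟨12 * (2 * 2^m * 16^m * (k+1:ℕ) / ω), by positivity⟩ g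
        (Z k ∩ ball c (1/(8*((k:ℝ)+1)))) := by
      refine LipschitzOnWith.of_dist_le_mul fun p hp q hq => ?_
      refine hZL k p hp.1 q hq.1 ?_
      have := dist_triangle_right p q c
      have h1 := hp.2; have h2 := hq.2
      rw [mem_ball] at h1 h2
      have e : 1/(4*((k:ℝ)+1)) = 1/(8*((k:ℝ)+1)) + 1/(8*((k:ℝ)+1)) := by field_simp; norm_num
      linarith
    obtain ⟨f, hf, he⟩ := hl.extend_real
    exact ⟨f, ⟨_, hf⟩, he⟩
  choose f hf hfe using hext
  have hden := TopologicalSpace.exists_countable_dense W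
  set d := TopologicalSpace.denseSeq W
  refine ⟨fun j => f j.unpair.1 (d j.unpair.2), fun j => hf _ _, ?_⟩
  filter_upwards [hZae] with p hp hpU
  obtain ⟨k, hk⟩ := hp hpU
  obtain ⟨i, hi⟩ := (TopologicalSpace.denseRange_denseSeq W).exists_mem_open (isOpen_ball (x := p) (ε := 1/(8*((k:ℝ)+1)))) ⟨p, mem_ball_self (by positivity)⟩
  refine ⟨Nat.pair k i, ?_⟩
  simp only [Nat.unpair_pair]
  exact hfe k _ ⟨hk, mem_ball_comm.1 hi⟩

/-- measure of slices -/
noncomputable def slm (S : OSplit W V) (G : Set V) (a b : ℝ) (p : W) : ℝ :=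
  (volume {t | t ∈ Ioo a b ∧ S.Φ (p, t) ∈ G}).toReal

lemma slice_fin (H : ℝ → Prop) (a b : ℝ) : volume {t | t ∈ Ioo a b ∧ H t} ≠ ⊤ :=
  ne_top_of_le_ne_top (measure_Ioo_lt_top (a := a) (b := b)).ne (measure_mono fun t ht => ht.1)

lemma slm_meas (S : OSplit W V) {G : Set V} (hG : MeasurableSet G) (a b : ℝ) : Measurable (slm S G a b) := by
  have hR : MeasurableSet {z : W × ℝ | z.2 ∈ Ioo a b ∧ S.Φ z ∈ G} :=
    (measurable_snd measurableSet_Ioo).inter (S.Φ.continuous.measurable hG)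
  exact (measurable_measure_prodMk_left (ν := (volume : Measure ℝ)) hR).ennreal_toReal

lemma slm_nonneg (S : OSplit W V) (G : Set V) (a b : ℝ) (p : W) : 0 ≤ slm S G a b p := ENNReal.toReal_nonneg

lemma slm_le (S : OSplit W V) (G : Set V) {a b : ℝ} (hab : a ≤ b) (p : W) : slm S G a b p ≤ b - a := by
  have : volume {t | t ∈ Ioo a b ∧ S.Φ (p, t) ∈ G} ≤ ENNReal.ofReal (b - a) := by
    rw [← Real.volume_Ioo]; exact measure_mono fun t ht => ht.1
  exact ENNReal.toReal_le_of_le_ofReal (by linarith) this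

lemma slm_diff (S : OSplit W V) {G : Set V} (hG : MeasurableSet G) (a b : ℝ) (x y : W) :
    ‖slm S G a b x - slm S G a b y‖ₑ ≤
      volume {t | t ∈ Ioo a b ∧ ¬ (S.Φ (x, t) ∈ G ↔ S.Φ (y, t) ∈ G)} := by
  have key : ∀ x y : W, slm S G a b x ≤ slm S G a b y +
      (volume {t | t ∈ Ioo a b ∧ ¬ (S.Φ (x, t) ∈ G ↔ S.Φ (y, t) ∈ G)}).toReal := by
    intro x y
    unfold slm
    rw [← ENNReal.toReal_add (slice_fin (fun t => S.Φ (y,t) ∈ G) a b) (slice_fin (fun t => ¬ (S.Φ (x, t) ∈ G ↔ S.Φ (y, t) ∈ G)) a b)]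
    refine ENNReal.toReal_mono (ENNReal.add_ne_top.2 ⟨slice_fin (fun t => S.Φ (y,t) ∈ G) a b, slice_fin (fun t => ¬ (S.Φ (x, t) ∈ G ↔ S.Φ (y, t) ∈ G)) a b⟩) ?_
    refine (measure_mono ?_).trans (measure_union_le _ _)
    intro t ht
    by_cases h : S.Φ (y, t) ∈ G
    · exact Or.inl ⟨ht.1, h⟩
    · exact Or.inr ⟨ht.1, fun hh => h (hh.1 ht.2)⟩
  rw [← ofReal_norm, Real.norm_eq_abs]
  refine ENNReal.ofReal_le_of_le_toReal ?_
  rw [abs_sub_le_iff]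
  have h1 := key x y
  have h2 := key y x
  have e : {t | t ∈ Ioo a b ∧ ¬ (S.Φ (y, t) ∈ G ↔ S.Φ (x, t) ∈ G)} =
    {t | t ∈ Ioo a b ∧ ¬ (S.Φ (x, t) ∈ G ↔ S.Φ (y, t) ∈ G)} := by
    ext t; simp only [mem_setOf_eq, iff_comm]
  rw [e] at h2
  constructor <;> linarith

lemma slm_poincare (S : OSplit W V) {m : ℕ} (hm : Module.finrank ℝ W = m) {G : Set V} (hG : MeasurableSet G)
    (a b : ℝ) (x0 : W) {ρ : ℝ} (hρ : 0 < ρ) {P Q : Set W} (hP : MeasurableSet P) (hQ : MeasurableSet Q)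
    (hPb : P ⊆ ball x0 ρ) (hQb : Q ⊆ ball x0 ρ) :
    ∫⁻ x in P, ∫⁻ y in Q, ‖slm S G a b x - slm S G a b y‖ₑ ≤
      ENNReal.ofReal (2*ρ) * volume (ball (0:W) (2*ρ)) *
        μHE[m] (eB (m+1) G ∩ S.Φ '' (ball x0 ρ ×ˢ Ioo a b)) := by
  set R : Set ((W × W) × ℝ) := {z | z.1.2 ∈ P ∧ z.1.2 + z.1.1 ∈ Q ∧ z.2 ∈ Ioo a b ∧
    ¬ (S.Φ (z.1.2, z.2) ∈ G ↔ S.Φ (z.1.2 + z.1.1, z.2) ∈ G)} with hR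
  have hRm : MeasurableSet R := by
    have m1 : Measurable fun z : (W × W) × ℝ => z.1.2 := by fun_prop
    have m2 : Measurable fun z : (W × W) × ℝ => z.1.2 + z.1.1 := by fun_prop
    have m3 : Measurable fun z : (W × W) × ℝ => S.Φ (z.1.2, z.2) := by
      have : Continuous fun z : (W × W) × ℝ => S.Φ (z.1.2, z.2) := by fun_prop
      exact this.measurable
    have m4 : Measurable fun z : (W × W) × ℝ => S.Φ (z.1.2 + z.1.1, z.2) := by
      have : Continuous fun z : (W × W) × ℝ => S.Φ (z.1.2 + z.1.1, z.2) := by fun_prop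
      exact this.measurable
    refine (m1 hP).inter ((m2 hQ).inter ((measurable_snd measurableSet_Ioo).inter ?_))
    have h1 : MeasurableSet {z : (W × W) × ℝ | S.Φ (z.1.2, z.2) ∈ G} := m3 hG
    have h2 : MeasurableSet {z : (W × W) × ℝ | S.Φ (z.1.2 + z.1.1, z.2) ∈ G} := m4 hG
    exact (h1.iff h2).compl
  set N : W × W → ℝ≥0∞ := fun z => volume {t | (z, t) ∈ R} with hN
  have hNm : Measurable N := measurable_measure_prodMk_left (ν := (volume : Measure ℝ)) hRm
  have step1 : ∫⁻ x in P, ∫⁻ y in Q, ‖slm S G a b x - slm S G a b y‖ₑ ≤ ∫⁻ x, ∫⁻ h, N (h, x) := by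
    have : ∀ x ∈ P, ∫⁻ y in Q, ‖slm S G a b x - slm S G a b y‖ₑ ≤ ∫⁻ h, N (h, x) := by
      intro x hx
      rw [← lintegral_sub_right_eq_self (fun h => N (h, x)) x]
      refine le_trans ?_ (setLIntegral_le_lintegral Q _)
      refine setLIntegral_mono' hQ fun y hy => ?_
      refine (slm_diff S hG a b x y).trans (measure_mono fun t ht => ?_)
      exact ⟨hx, by simpa using hy, ht.1, by simpa using ht.2⟩
    exact (setLIntegral_mono' hP this).trans (setLIntegral_le_lintegral P _)
  refine step1.trans ?_
  rw [lintegral_lintegral_swap (by exact (hNm.comp measurable_swap).aemeasurable)]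
  set c := ENNReal.ofReal (2*ρ) * μHE[m] (eB (m+1) G ∩ S.Φ '' (ball x0 ρ ×ˢ Ioo a b)) with hc
  have step2 : ∀ h, ∫⁻ x, N (h, x) ≤ (ball (0:W) (2*ρ)).indicator (fun _ => c) h := by
    intro h
    by_cases hh : h ∈ ball (0:W) (2*ρ)
    · rw [indicator_of_mem hh]
      set Uh : Set V := {z | S.pr z ∈ P ∧ S.pr z + h ∈ Q ∧ (S.Φ.symm z).2 ∈ Ioo a b} with hUh
      have hprm : Measurable S.pr := S.lip.continuous.measurable
      have hUm : MeasurableSet Uh := by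
        refine (hprm hP).inter (((hprm.add_const h) hQ).inter ?_)
        have : Measurable fun z : V => (S.Φ.symm z).2 := by
          have : Continuous fun z : V => (S.Φ.symm z).2 := by fun_prop
          exact this.measurable
        exact this measurableSet_Ioo
      have hVr : Module.finrank ℝ V = m + 1 := by rw [S.finrank, hm]
      have hT := T_shift hVr hG hUm (S.Φ (h, 0)) (A := eB (m+1) G ∩ S.Φ '' (ball x0 ρ ×ˢ Ioo a b)) (by
        intro z hz τ hτ hze
        refine ⟨hze, ((S.pr z + τ • h), (S.Φ.symm z).2), ⟨?_, hz.2.2⟩, ?_⟩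
        · have h1 := (convex_ball x0 ρ).add_smul_mem (hPb hz.1) (hQb hz.2.1) hτ
          exact h1
        · have : ((S.pr z + τ • h), (S.Φ.symm z).2) = S.Φ.symm z + τ • (h, (0:ℝ)) := by
            ext <;> simp [OSplit.pr]
          rw [this, map_add, map_smul, ContinuousLinearEquiv.apply_symm_apply])
      have hnorm : ‖S.Φ (h, 0)‖ = ‖h‖ := by
        have := S.norm_sq h 0
        rw [← sq_eq_sq₀ (norm_nonneg _) (norm_nonneg _), this]; ring
      rw [hnorm] at hT
      have hNe : ∫⁻ x, N (h, x) = volume {x | x ∈ Uh ∧ ¬ (x ∈ G ↔ x + S.Φ (h, 0) ∈ G)} := by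
        have hms : MeasurableSet {x | x ∈ Uh ∧ ¬ (x ∈ G ↔ x + S.Φ (h, 0) ∈ G)} :=
          hUm.inter ((hG.iff ((measurable_add_const _) hG)).compl)
        rw [← S.mp.measure_preimage hms.nullMeasurableSet, Measure.prod_apply (S.Φ.continuous.measurable hms)]
        refine lintegral_congr fun x => ?_
        rw [hN]; dsimp only
        congr 1
        ext t
        have : S.Φ (x, t) + S.Φ (h, 0) = S.Φ (x + h, t) := by rw [← map_add]; simp
        simp only [hR, mem_setOf_eq, mem_preimage, hUh, S.pr_Φ, ContinuousLinearEquiv.symm_apply_apply, this]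
        tauto
      rw [hNe]
      refine hT.trans ?_
      rw [hc]
      refine mul_le_mul_left (ENNReal.ofReal_le_ofReal ?_) _
      exact (mem_ball_zero_iff.1 hh).le
    · rw [indicator_of_notMem hh]
      have : ∀ x, N (h, x) = 0 := by
        intro x
        have : {t | ((h, x), t) ∈ R} = ∅ := by
          ext t
          simp only [mem_setOf_eq, mem_empty_iff_false, iff_false]
          rintro ⟨h1, h2, -⟩
          apply hh
          rw [mem_ball_zero_iff]
          have e1 := hPb h1; have e2 := hQb h2
          simp only [mem_ball, dist_eq_norm] at e1 e2
          have : h = (x + h - x0) - (x - x0) := by abel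
          rw [this]
          exact (norm_sub_le _ _).trans_lt (by linarith)
        rw [hN]; dsimp only; rw [this]; simp
      simp [this]
  refine (lintegral_mono step2).trans ?_
  rw [lintegral_indicator measurableSet_ball, setLIntegral_const, hc]
  exact le_of_eq (by ring)

lemma GLbox (S : OSplit W V) {m : ℕ} (hm : Module.finrank ℝ W = m) {G : Set V} (hG : MeasurableSet G)
    {a b : ℝ} {U : Set W} (hU : IsOpen U)
    (hfin : μHE[m] (eB (m+1) G ∩ S.Φ '' (U ×ˢ Ioo a b)) ≠ ⊤) :
    ∃ F : ℕ → W → ℝ, (∀ j, ∃ K, LipschitzWith K (F j)) ∧ ∀ᵐ p, p ∈ U → ∃ j, slm S G a b p = F j p := by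
  rcases le_total b a with hab | hab
  · refine ⟨fun _ _ => 0, fun _ => ⟨0, LipschitzWith.const 0⟩, Eventually.of_forall fun p _ => ⟨0, ?_⟩⟩
    simp [slm, Ioo_eq_empty (not_lt.2 hab)]
  set T := eB (m+1) G ∩ S.Φ '' (U ×ˢ Ioo a b) with hT
  have hTf : IsFiniteMeasure ((μHE[m] : Measure V).restrict T) := ⟨by
    rw [Measure.restrict_apply_univ]; exact lt_top_iff_ne_top.2 hfin⟩
  have hprm : Measurable S.pr := S.lip.continuous.measurable
  have hli : LocallyIntegrable (slm S G a b) volume := by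
    refine (locallyIntegrable_const (b - a)).mono (slm_meas S hG a b).aestronglyMeasurable ?_
    refine Eventually.of_forall fun p => ?_
    rw [Real.norm_of_nonneg (slm_nonneg S G a b p), Real.norm_of_nonneg (by linarith)]
    exact slm_le S G hab p
  refine lusin_lip hm hli (((μHE[m] : Measure V).restrict T).map S.pr) hU ?_
  intro x0 ρ hρ hb P Q hP hQ hPb hQb
  refine (slm_poincare S hm hG a b x0 hρ hP hQ hPb hQb).trans ?_
  refine mul_le_mul_right ?_ _
  rw [Measure.map_apply hprm measurableSet_ball, Measure.restrict_apply (hprm measurableSet_ball)]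
  refine measure_mono ?_
  rintro x ⟨h1, z, hz, rfl⟩
  refine ⟨?_, h1, z, ⟨hb hz.1, hz.2⟩, rfl⟩
  simp only [mem_preimage, S.pr_Φ]; exact hz.1

/-- one dimensional slices: `J` is the jump set of `H` -/
def LineOK (H J : Set ℝ) : Prop := ∀ a b : ℝ, (∀ t ∈ Ioo a b, t ∉ J) ↔
  (volume {t | t ∈ Ioo a b ∧ t ∈ H} = 0 ∨ volume {t | t ∈ Ioo a b ∧ t ∉ H} = 0)

lemma null_glue {Q : ℝ → Prop} {a t b : ℝ} (h1 : volume {s | s ∈ Ioo a t ∧ Q s} = 0)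
    (h2 : volume {s | s ∈ Ioo t b ∧ Q s} = 0) : volume {s | s ∈ Ioo a b ∧ Q s} = 0 := by
  have : {s | s ∈ Ioo a b ∧ Q s} ⊆ ({s | s ∈ Ioo a t ∧ Q s} ∪ {s | s ∈ Ioo t b ∧ Q s}) ∪ {t} := by
    rintro s ⟨hs, hq⟩
    rcases lt_trichotomy s t with h | h | h
    · exact Or.inl (Or.inl ⟨⟨hs.1, h⟩, hq⟩)
    · exact Or.inr h
    · exact Or.inl (Or.inr ⟨⟨h, hs.2⟩, hq⟩)
  refine measure_mono_null this ?_
  rw [measure_union_null_iff, measure_union_null_iff]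
  exact ⟨⟨h1, h2⟩, by simp⟩

lemma LineOK.jump {H J : Set ℝ} (h : LineOK H J) {a t b : ℝ} (hat : a < t) (htb : t < b)
    (htJ : t ∈ J) (hJ : ∀ s ∈ Ioo a b, s ∈ J → s = t) :
    (volume {s | s ∈ Ioo a t ∧ s ∉ H} = 0 ∧ volume {s | s ∈ Ioo t b ∧ s ∈ H} = 0) ∨
    (volume {s | s ∈ Ioo a t ∧ s ∈ H} = 0 ∧ volume {s | s ∈ Ioo t b ∧ s ∉ H} = 0) := by
  have h1 := (h a t).1 fun s hs hsJ => hs.2.ne (hJ s ⟨hs.1, hs.2.trans htb⟩ hsJ)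
  have h2 := (h t b).1 fun s hs hsJ => hs.1.ne' (hJ s ⟨hat.trans hs.1, hs.2⟩ hsJ)
  have h3 : ¬ (volume {t | t ∈ Ioo a b ∧ t ∈ H} = 0 ∨ volume {t | t ∈ Ioo a b ∧ t ∉ H} = 0) := by
    intro hh
    exact (h a b).2 hh t ⟨hat, htb⟩ htJ
  push Not at h3
  rcases h1 with h1 | h1 <;> rcases h2 with h2 | h2
  · exact absurd (null_glue (Q := (· ∈ H)) h1 h2) h3.1
  · exact Or.inr ⟨h1, h2⟩
  · exact Or.inl ⟨h1, h2⟩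
  · exact absurd (null_glue (Q := (· ∉ H)) h1 h2) h3.2

lemma vol_left {H : Set ℝ} {a t b : ℝ} (hat : a ≤ t) (htb : t ≤ b)
    (h1 : volume {s | s ∈ Ioo a t ∧ s ∉ H} = 0) (h2 : volume {s | s ∈ Ioo t b ∧ s ∈ H} = 0) :
    volume {s | s ∈ Ioo a b ∧ s ∈ H} = ENNReal.ofReal (t - a) := by
  apply le_antisymm
  · have : {s | s ∈ Ioo a b ∧ s ∈ H} ⊆ (Ioo a t ∪ {s | s ∈ Ioo t b ∧ s ∈ H}) ∪ {t} := by
      rintro s ⟨hs, hq⟩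
      rcases lt_trichotomy s t with h | h | h
      · exact Or.inl (Or.inl ⟨hs.1, h⟩)
      · exact Or.inr h
      · exact Or.inl (Or.inr ⟨⟨h, hs.2⟩, hq⟩)
    refine (measure_mono this).trans ((measure_union_le _ _).trans ?_)
    refine (add_le_add (measure_union_le _ _) le_rfl).trans ?_
    rw [h2, Real.volume_Ioo]; simp
  · have : Ioo a t ⊆ {s | s ∈ Ioo a b ∧ s ∈ H} ∪ {s | s ∈ Ioo a t ∧ s ∉ H} := by
      intro s hs
      by_cases h : s ∈ H
      · exact Or.inl ⟨⟨hs.1, hs.2.trans_le htb⟩, h⟩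
      · exact Or.inr ⟨hs, h⟩
    rw [← Real.volume_Ioo]
    refine (measure_mono this).trans ((measure_union_le _ _).trans ?_)
    rw [h1, add_zero]

lemma vol_right {H : Set ℝ} {a t b : ℝ} (hat : a ≤ t) (htb : t ≤ b)
    (h1 : volume {s | s ∈ Ioo a t ∧ s ∈ H} = 0) (h2 : volume {s | s ∈ Ioo t b ∧ s ∉ H} = 0) :
    volume {s | s ∈ Ioo a b ∧ s ∈ H} = ENNReal.ofReal (b - t) := by
  apply le_antisymm
  · have : {s | s ∈ Ioo a b ∧ s ∈ H} ⊆ ({s | s ∈ Ioo a t ∧ s ∈ H} ∪ Ioo t b) ∪ {t} := by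
      rintro s ⟨hs, hq⟩
      rcases lt_trichotomy s t with h | h | h
      · exact Or.inl (Or.inl ⟨⟨hs.1, h⟩, hq⟩)
      · exact Or.inr h
      · exact Or.inl (Or.inr ⟨h, hs.2⟩)
    refine (measure_mono this).trans ((measure_union_le _ _).trans ?_)
    refine (add_le_add (measure_union_le _ _) le_rfl).trans ?_
    rw [h1, Real.volume_Ioo]; simp
  · have : Ioo t b ⊆ {s | s ∈ Ioo a b ∧ s ∈ H} ∪ {s | s ∈ Ioo t b ∧ s ∉ H} := by
      intro s hs
      by_cases h : s ∈ H
      · exact Or.inl ⟨⟨hat.trans_lt hs.1, hs.2⟩, h⟩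
      · exact Or.inr ⟨hs, h⟩
    rw [← Real.volume_Ioo]
    refine (measure_mono this).trans ((measure_union_le _ _).trans ?_)
    rw [h2, add_zero]

lemma isolate {J : Set ℝ} {a0 t b0 : ℝ} (hat : a0 < t) (htb : t < b0)
    (hfin : {s | s ∈ Ioo a0 b0 ∧ s ∈ J}.Finite) :
    ∃ a b : ℚ, (a:ℝ) < t ∧ t < b ∧ a0 < a ∧ b < b0 ∧ ∀ s ∈ Ioo (a:ℝ) b, s ∈ J → s = t := by
  have h1 : ({s | s ∈ Ioo a0 b0 ∧ s ∈ J} \ {t})ᶜ ∈ 𝓝 t :=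
    ((hfin.subset diff_subset).isClosed.isOpen_compl).mem_nhds (by simp)
  obtain ⟨ε, hε, hb⟩ := Metric.mem_nhds_iff.1 h1
  obtain ⟨a, ha1, ha2⟩ := exists_rat_btwn (show max a0 (t - ε) < t from max_lt hat (by linarith))
  obtain ⟨b, hb1, hb2⟩ := exists_rat_btwn (show t < min b0 (t + ε) from lt_min htb (by linarith))
  have := (max_lt_iff.1 ha1); have h3 := (lt_min_iff.1 hb2)
  refine ⟨a, b, ha2, hb1, this.1, h3.1, ?_⟩
  intro s hs hsJ
  by_contra hne
  have : s ∈ ball t ε := by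
    rw [Real.ball_eq_Ioo]; exact ⟨by linarith [hs.1], by linarith [hs.2]⟩
  exact hb this ⟨⟨⟨by linarith [hs.1], by linarith [hs.2]⟩, hsJ⟩, hne⟩

lemma ae_lineOK (S : OSplit W V) {m : ℕ} (hm : Module.finrank ℝ W = m) {G : Set V} (hG : MeasurableSet G) :
    ∀ᵐ p, LineOK {t | S.Φ (p, t) ∈ G} {t | S.Φ (p, t) ∈ eB (m+1) G} := by
  filter_upwards [line_iff volume hm (S.Φ.continuous.measurable hG)] with p hp a b
  have := hp a b
  simp only [mem_preimage] at this
  have e : ∀ t, (p, t) ∈ eB (m+1) (S.Φ ⁻¹' G) ↔ S.Φ (p, t) ∈ eB (m+1) G := fun t =>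
    (LBL_of_linearEquiv S.Φ (p, t)).mem_eB_iff _ _
  simp only [e] at this
  exact this

/-- local finiteness of the essential boundary in `Ω` -/
def LocFin (m : ℕ) (G Ω : Set V) : Prop :=
  ∀ x ∈ Ω, ((μHE[m] : Measure V).restrict (eB (m+1) G)).FiniteAtFilter (𝓝 x)

lemma locFin_of_finite {m : ℕ} {G Ω : Set V} (hΩ : IsOpen Ω) (hfin : μHE[m] (eB (m+1) G ∩ Ω) ≠ ⊤) :
    LocFin m G Ω := by
  intro x hx
  refine ⟨Ω, hΩ.mem_nhds hx, ?_⟩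
  rw [Measure.restrict_apply hΩ.measurableSet, inter_comm]
  exact lt_top_iff_ne_top.2 hfin

lemma GL2 (S : OSplit W V) {m : ℕ} (hm : Module.finrank ℝ W = m) {G : Set V} (hG : MeasurableSet G)
    {Ω : Set V} (hΩ : LocFin m G Ω) :
    ∃ F : ℚ → ℚ → ℕ → W → ℝ, (∀ a b j, ∃ K, LipschitzWith K (F a b j)) ∧
      ∀ᵐ p, ∀ a b : ℚ, (∀ t ∈ Icc (a:ℝ) b, S.Φ (p, t) ∈ Ω) →
        (∃ j, slm S G a b p = F a b j p) ∧ {t | t ∈ Ioo (a:ℝ) b ∧ S.Φ (p, t) ∈ eB (m+1) G}.Finite := by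
  classical
  obtain ⟨B, hBc, -, hB⟩ := TopologicalSpace.exists_countable_basis W
  have hBne : B.Nonempty := by
    obtain ⟨s, hs, -⟩ := hB.exists_subset_of_mem_open (mem_univ (0:W)) isOpen_univ
    exact ⟨s, hs⟩
  obtain ⟨β, hβ⟩ := hBc.exists_eq_range hBne
  have hβo : ∀ i, IsOpen (β i) := fun i => hB.isOpen (hβ ▸ mem_range_self i)
  have hex : ∀ (a b : ℚ) (i : ℕ), ∃ F : ℕ → W → ℝ, (∀ j, ∃ K, LipschitzWith K (F j)) ∧
      (μHE[m] (eB (m+1) G ∩ S.Φ '' (β i ×ˢ Ioo (a:ℝ) b)) ≠ ⊤ → ∀ᵐ p, p ∈ β i → (∃ j, slm S G a b p = F j p)) := by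
    intro a b i
    by_cases h : μHE[m] (eB (m+1) G ∩ S.Φ '' (β i ×ˢ Ioo (a:ℝ) b)) ≠ ⊤
    · obtain ⟨F, h1, h2⟩ := GLbox S hm hG (hβo i) h
      exact ⟨F, h1, fun _ => h2⟩
    · exact ⟨fun _ _ => 0, fun _ => ⟨0, LipschitzWith.const 0⟩, fun hh => absurd hh h⟩
  choose F hF1 hF2 using hex
  have hfi : ∀ (a b : ℚ) (i : ℕ), μHE[m] (eB (m+1) G ∩ S.Φ '' (β i ×ˢ Ioo (a:ℝ) b)) ≠ ⊤ →
      ∀ᵐ p, p ∈ β i → {t | t ∈ Ioo (a:ℝ) b ∧ S.Φ (p, t) ∈ eB (m+1) G}.Finite := by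
    intro a b i h
    filter_upwards [S.ae_finite hm h] with p hp hpi
    refine hp.subset ?_
    rintro t ⟨ht, hte⟩
    exact ⟨hte, (p, t), ⟨hpi, ht⟩, rfl⟩
  refine ⟨fun a b j => F a b j.unpair.1 j.unpair.2, fun a b j => hF1 _ _ _ _, ?_⟩
  have A1 : ∀ᵐ p, ∀ (a b : ℚ) (i : ℕ), μHE[m] (eB (m+1) G ∩ S.Φ '' (β i ×ˢ Ioo (a:ℝ) b)) ≠ ⊤ → p ∈ β i →
      (∃ j, slm S G a b p = F a b i j p) := by
    rw [ae_all_iff]; intro a; rw [ae_all_iff]; intro b; rw [ae_all_iff]; intro i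
    by_cases h : μHE[m] (eB (m+1) G ∩ S.Φ '' (β i ×ˢ Ioo (a:ℝ) b)) ≠ ⊤
    · filter_upwards [hF2 a b i h] with p hp _ using hp
    · exact Eventually.of_forall fun p hh => absurd hh h
  have A2 : ∀ᵐ p, ∀ (a b : ℚ) (i : ℕ), μHE[m] (eB (m+1) G ∩ S.Φ '' (β i ×ˢ Ioo (a:ℝ) b)) ≠ ⊤ → p ∈ β i →
      {t | t ∈ Ioo (a:ℝ) b ∧ S.Φ (p, t) ∈ eB (m+1) G}.Finite := by
    rw [ae_all_iff]; intro a; rw [ae_all_iff]; intro b; rw [ae_all_iff]; intro i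
    by_cases h : μHE[m] (eB (m+1) G ∩ S.Φ '' (β i ×ˢ Ioo (a:ℝ) b)) ≠ ⊤
    · filter_upwards [hfi a b i h] with p hp _ using hp
    · exact Eventually.of_forall fun p hh => absurd hh h
  filter_upwards [A1, A2] with p h1 h2 a b hab
  have hK : IsCompact (S.Φ '' (({p} : Set W) ×ˢ Icc (a:ℝ) b)) :=
    (isCompact_singleton.prod isCompact_Icc).image S.Φ.continuous
  obtain ⟨O, hKO, hO, hOf⟩ := hK.exists_open_superset_measure_lt_top'
    (μ := (μHE[m] : Measure V).restrict (eB (m+1) G)) (by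
      rintro _ ⟨⟨q, t⟩, ⟨hq, ht⟩, rfl⟩
      rw [mem_singleton_iff] at hq
      simp only at hq ht
      subst hq
      exact hΩ _ (hab t ht))
  obtain ⟨u, v, hu, hv, hpu, hIv, huv⟩ := generalized_tube_lemma (isCompact_singleton (x := p)) (isCompact_Icc (a := (a:ℝ)) (b := b))
    (hO.preimage S.Φ.continuous) (image_subset_iff.1 hKO)
  obtain ⟨s, hs, hps, hsu⟩ := hB.exists_subset_of_mem_open (singleton_subset_iff.1 hpu) hu
  rw [hβ] at hs
  obtain ⟨i, rfl⟩ := hs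
  have hfin : μHE[m] (eB (m+1) G ∩ S.Φ '' (β i ×ˢ Ioo (a:ℝ) b)) ≠ ⊤ := by
    refine ne_top_of_le_ne_top hOf.ne ?_
    rw [Measure.restrict_apply hO.measurableSet, inter_comm]
    refine measure_mono (inter_subset_inter_left _ ?_)
    rintro _ ⟨z, hz, rfl⟩
    exact huv ⟨hsu hz.1, hIv (Ioo_subset_Icc_self hz.2)⟩
  obtain ⟨j, hj⟩ := h1 a b i hfin hps
  refine ⟨⟨Nat.pair i j, ?_⟩, h2 a b i hfin hps⟩
  simpa using hj

lemma GL1 (S : OSplit W V) {m : ℕ} (hm : Module.finrank ℝ W = m) {G : Set V} (hG : MeasurableSet G)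
    {Ω : Set V} (hΩo : IsOpen Ω) (hΩ : LocFin m G Ω) :
    ∃ f : ℕ → W → ℝ, (∀ j, ∃ K, LipschitzWith K (f j)) ∧
      ∀ᵐ p, ∀ t, S.Φ (p, t) ∈ eB (m+1) G ∩ Ω → ∃ j, t = f j p := by
  obtain ⟨F, hF, hae⟩ := GL2 S hm hG hΩ
  have hcount : Countable (ℚ × ℚ × ℕ × Bool) := inferInstance
  obtain ⟨e, he⟩ := exists_surjective_nat (ℚ × ℚ × ℕ × Bool)
  set φ : ℚ × ℚ × ℕ × Bool → W → ℝ := fun z p =>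
    if z.2.2.2 then (z.1:ℝ) + F z.1 z.2.1 z.2.2.1 p else (z.2.1:ℝ) - F z.1 z.2.1 z.2.2.1 p with hφ
  refine ⟨fun j => φ (e j), fun j => ?_, ?_⟩
  · obtain ⟨K, hK⟩ := hF (e j).1 (e j).2.1 (e j).2.2.1
    refine ⟨K, ?_⟩
    rcases hb : (e j).2.2.2 with _ | _
    · simp only [hφ, hb]
      refine LipschitzWith.of_dist_le_mul fun x y => ?_
      have := hK.dist_le_mul x y
      simp only [Bool.false_eq_true, if_false]
      rw [dist_sub_left]; exact this
    · simp only [hφ, hb]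
      refine LipschitzWith.of_dist_le_mul fun x y => ?_
      have := hK.dist_le_mul x y
      simpa [dist_add_left] using this
  · filter_upwards [hae, ae_lineOK S hm hG] with p h1 h2 t ht
    have hopen : IsOpen {s : ℝ | S.Φ (p, s) ∈ Ω} := hΩo.preimage (by fun_prop)
    obtain ⟨ε, hε, hb⟩ := Metric.isOpen_iff.1 hopen t ht.2
    obtain ⟨a0, ha1, ha2⟩ := exists_rat_btwn (show t - ε < t by linarith)
    obtain ⟨b0, hb1, hb2⟩ := exists_rat_btwn (show t < t + ε by linarith)
    have hin : ∀ s ∈ Icc (a0:ℝ) b0, S.Φ (p, s) ∈ Ω := fun s hs => hb (by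
      rw [Real.ball_eq_Ioo]; exact ⟨by linarith [hs.1], by linarith [hs.2]⟩)
    obtain ⟨a, b, hat, htb, haa, hbb, hJ⟩ := isolate ha2 hb1 (h1 a0 b0 hin).2
    obtain ⟨j, hj⟩ := (h1 a b fun s hs => hin s ⟨by linarith [hs.1], by linarith [hs.2]⟩).1
    rcases h2.jump hat htb ht.1 hJ with ⟨h3, h4⟩ | ⟨h3, h4⟩
    · have := vol_left hat.le htb.le h3 h4
      obtain ⟨i, hi⟩ := he (a, b, j, true)
      refine ⟨i, ?_⟩
      simp only [hi, hφ, if_true]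
      have hs : slm S G a b p = t - a := by
        unfold slm; simp only [mem_setOf_eq] at this; rw [this, ENNReal.toReal_ofReal (by linarith)]
      rw [← hj, hs]; ring
    · have := vol_right hat.le htb.le h3 h4
      obtain ⟨i, hi⟩ := he (a, b, j, false)
      refine ⟨i, ?_⟩
      simp only [hi, hφ]
      have hs : slm S G a b p = b - t := by
        unfold slm; simp only [mem_setOf_eq] at this; rw [this, ENNReal.toReal_ofReal (by linarith)]
      rw [← hj, hs]; simp

lemma one_dim_tendsto {f : ℝ → ℝ} (hf : LocallyIntegrable f volume) {s : ℕ → ℝ} (hs0 : ∀ j, 0 < s j)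
    (hs : Tendsto s atTop (𝓝 0)) :
    ∀ᵐ u : ℝ, Tendsto (fun j => (s j)⁻¹ * ∫ t in u..(u + s j), f t) atTop (𝓝 (f u)) := by
  filter_upwards [IsUnifLocDoublingMeasure.ae_tendsto_average (μ := (volume : Measure ℝ)) hf 1] with u hu
  have := hu (l := atTop) (fun j : ℕ => u + s j / 2) (fun j => s j / 2) (by
    refine tendsto_nhdsWithin_iff.2 ⟨by simpa using hs.div_const 2, Eventually.of_forall fun j => ?_⟩
    have := hs0 j
    simp only [mem_Ioi]; positivity) (Eventually.of_forall fun j => by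
      have := hs0 j
      rw [Real.closedBall_eq_Icc]; constructor <;> linarith)
  refine this.congr fun j => ?_
  have h := hs0 j
  rw [Real.closedBall_eq_Icc, setAverage_eq, integral_Icc_eq_integral_Ioc, intervalIntegral.integral_of_le (by linarith)]
  have e1 : u + s j / 2 - s j / 2 = u := by ring
  have e2 : u + s j / 2 + s j / 2 = u + s j := by ring
  rw [e1, e2, smul_eq_mul]
  congr 2
  rw [Measure.real, Real.volume_Icc, ENNReal.toReal_ofReal (by linarith)]; ring

lemma one_dim_key {f : ℝ → ℝ} (hf : LocallyIntegrable f volume) (u w s : ℝ)  :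
    (∫ t in w..(w+s), f t) - ∫ t in u..(u+s), f t = ∫ t in u..w, (f (t + s) - f t) := by
  have hi : ∀ a b, IntervalIntegrable f volume a b := fun a b =>
    (hf.integrableOn_isCompact isCompact_uIcc).intervalIntegrable
  have hi2 : ∀ a b, IntervalIntegrable (fun t => f (t + s)) volume a b := fun a b => by
    have := (hi (a + s) (b + s)).comp_add_right s
    simpa using this
  rw [intervalIntegral.integral_sub (hi2 _ _) (hi _ _), intervalIntegral.integral_comp_add_right]
  have h1 := intervalIntegral.integral_add_adjacent_intervals (hi u (u+s)) (hi (u+s) (w+s))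
  have h2 := intervalIntegral.integral_add_adjacent_intervals (hi u w) (hi w (w+s))
  linarith

lemma one_dim_xor {H : Set ℝ} (hH : MeasurableSet H) {a b : ℝ}
    (h1 : volume {t | t ∈ Ioo a b ∧ t ∈ H} ≠ 0) (h2 : volume {t | t ∈ Ioo a b ∧ t ∉ H} ≠ 0)
    {s : ℕ → ℝ} (hs0 : ∀ j, 0 < s j) (hs : Tendsto s atTop (𝓝 0)) :
    1 ≤ liminf (fun j => volume {t | t ∈ Ioo a b ∧ ¬ (t ∈ H ↔ t + s j ∈ H)} / ENNReal.ofReal (s j)) atTop := by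
  set f : ℝ → ℝ := H.indicator 1 with hf
  have hfm : Measurable f := measurable_one.indicator hH
  have hfl : LocallyIntegrable f volume := by
    refine (locallyIntegrable_const (1:ℝ)).mono hfm.aestronglyMeasurable (Eventually.of_forall fun t => ?_)
    by_cases h : t ∈ H <;> simp [hf, h]
  have hae := one_dim_tendsto hfl hs0 hs
  obtain ⟨u, hu, hut⟩ : ∃ u ∈ {t | t ∈ Ioo a b ∧ t ∈ H}, Tendsto (fun j => (s j)⁻¹ * ∫ t in u..(u + s j), f t) atTop (𝓝 (f u)) := by
    by_contra hcon
    push Not at hcon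
    exact h1 (measure_mono_null (fun t ht => hcon t ht) (ae_iff.1 hae))
  obtain ⟨w, hw, hwt⟩ : ∃ u ∈ {t | t ∈ Ioo a b ∧ t ∉ H}, Tendsto (fun j => (s j)⁻¹ * ∫ t in u..(u + s j), f t) atTop (𝓝 (f u)) := by
    by_contra hcon
    push Not at hcon
    exact h2 (measure_mono_null (fun t ht => hcon t ht) (ae_iff.1 hae))
  have hfu : f u = 1 := by simp [hf, hu.2]
  have hfw : f w = 0 := by simp [hf, hw.2]
  have ht : Tendsto (fun j => ENNReal.ofReal (|(s j)⁻¹ * (∫ t in w..(w + s j), f t) - (s j)⁻¹ * ∫ t in u..(u + s j), f t|)) atTop (𝓝 1) := by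
    have := ENNReal.tendsto_ofReal ((hwt.sub hut).abs)
    simpa [hfu, hfw] using this
  rw [← ht.liminf_eq]
  refine liminf_le_liminf (Eventually.of_forall fun j => ?_)
  rw [← mul_sub, one_dim_key hfl, abs_mul, abs_of_pos (inv_pos.2 (hs0 j)), ENNReal.div_eq_inv_mul,
    ENNReal.ofReal_mul (inv_pos.2 (hs0 j)).le, ENNReal.ofReal_inv_of_pos (hs0 j)]
  refine mul_le_mul_right ?_ _
  rw [← Real.norm_eq_abs, ofReal_norm]
  have hb : ∀ c d, c ∈ Ioo a b → d ∈ Ioo a b → ∫⁻ t in Ioc c d, ‖f (t + s j) - f t‖ₑ ≤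
      volume {t | t ∈ Ioo a b ∧ ¬ (t ∈ H ↔ t + s j ∈ H)} := by
    intro c d hc hd
    have hm : MeasurableSet {t | t ∈ Ioo a b ∧ ¬ (t ∈ H ↔ t + s j ∈ H)} :=
      measurableSet_Ioo.inter ((hH.iff ((measurable_add_const _) hH)).compl)
    rw [← lintegral_indicator_one hm, ← lintegral_indicator measurableSet_Ioc]
    refine lintegral_mono fun t => ?_
    by_cases ht : t ∈ Ioc c d
    · have htab : t ∈ Ioo a b := ⟨hc.1.trans ht.1, ht.2.trans_lt hd.2⟩
      have e1 := htab.1; have e2 := htab.2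
      by_cases q1 : t ∈ H <;> by_cases q2 : t + s j ∈ H <;> simp [ht, hf, indicator, q1, q2, e1, e2]
    · simp [ht]
  rcases le_total u w with huw | huw
  · rw [intervalIntegral.integral_of_le huw]
    exact (enorm_integral_le_lintegral_enorm _).trans (hb u w hu.1 hw.1)
  · rw [intervalIntegral.integral_of_ge huw, enorm_neg]
    exact (enorm_integral_le_lintegral_enorm _).trans (hb w u hw.1 hu.1)

lemma flat_liminf (S : OSplit W V) {m : ℕ} (hm : Module.finrank ℝ W = m) {G : Set V} (hG : MeasurableSet G)
    {C U : Set V} (hC : IsCompact C) (hCe : C ⊆ eB (m+1) G) (hU : IsOpen U) (hCU : C ⊆ U)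
    {s : ℕ → ℝ} (hs0 : ∀ j, 0 < s j) (hs : Tendsto s atTop (𝓝 0)) :
    volume (S.pr '' C) ≤ liminf (fun j => volume {x | x ∈ U ∧ ¬ (x ∈ G ↔ x + s j • S.Φ (0, 1) ∈ G)} / ENNReal.ofReal (s j)) atTop := by
  have hms : ∀ j, MeasurableSet {x | x ∈ U ∧ ¬ (x ∈ G ↔ x + s j • S.Φ (0, 1) ∈ G)} := fun j =>
    hU.measurableSet.inter ((hG.iff ((measurable_add_const _) hG)).compl)
  set φ : ℕ → W → ℝ≥0∞ := fun j p =>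
    volume {t | S.Φ (p, t) ∈ U ∧ ¬ (S.Φ (p, t) ∈ G ↔ S.Φ (p, t + s j) ∈ G)} / ENNReal.ofReal (s j) with hφ
  have hadd : ∀ p t r, S.Φ (p, t) + r • S.Φ (0, 1) = S.Φ (p, t + r) := by
    intro p t r; rw [← map_smul, ← map_add]; simp
  have hpre : ∀ j, S.Φ ⁻¹' {x | x ∈ U ∧ ¬ (x ∈ G ↔ x + s j • S.Φ (0, 1) ∈ G)} =
      {z | S.Φ z ∈ U ∧ ¬ (S.Φ z ∈ G ↔ S.Φ (z.1, z.2 + s j) ∈ G)} := by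
    intro j; ext ⟨p, t⟩
    simp only [mem_preimage, mem_setOf_eq, hadd]
  have hmp : ∀ j, MeasurableSet {z : W × ℝ | S.Φ z ∈ U ∧ ¬ (S.Φ z ∈ G ↔ S.Φ (z.1, z.2 + s j) ∈ G)} := fun j => by
    rw [← hpre]; exact S.Φ.continuous.measurable (hms j)
  have hφm : ∀ j, Measurable (φ j) := fun j =>
    (measurable_measure_prodMk_left (ν := (volume : Measure ℝ)) (hmp j)).div_const _
  have hφi : ∀ j, ∫⁻ p, φ j p = volume {x | x ∈ U ∧ ¬ (x ∈ G ↔ x + s j • S.Φ (0, 1) ∈ G)} / ENNReal.ofReal (s j) := by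
    intro j
    simp only [hφ, ENNReal.div_eq_inv_mul]
    rw [lintegral_const_mul' _ _ (by simpa using hs0 j), ← S.mp.measure_preimage (hms j).nullMeasurableSet, hpre,
      Measure.prod_apply (hmp j)]
    rfl
  simp only [← hφi]
  refine le_trans ?_ (lintegral_liminf_le hφm)
  have hCm : MeasurableSet (S.pr '' C) := (hC.image S.lip.continuous).measurableSet
  rw [← lintegral_indicator_one hCm]
  refine lintegral_mono_ae ?_
  filter_upwards [ae_lineOK S hm hG] with p hp
  by_cases hpC : p ∈ S.pr '' C
  swap
  · rw [indicator_of_notMem hpC]; exact zero_le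
  rw [indicator_of_mem hpC, Pi.one_apply]
  obtain ⟨x, hx, rfl⟩ := hpC
  set p := S.pr x
  have hxe : S.Φ (p, (S.Φ.symm x).2) = x := by simp [p, OSplit.pr]
  set t0 := (S.Φ.symm x).2
  have hopen : IsOpen {t : ℝ | S.Φ (p, t) ∈ U} := hU.preimage (by fun_prop)
  obtain ⟨ε, hε, hb⟩ := Metric.isOpen_iff.1 hopen t0 (by simp only [mem_setOf_eq, hxe]; exact hCU hx)
  rw [Real.ball_eq_Ioo] at hb
  have hnot : ¬ (volume {t | t ∈ Ioo (t0-ε) (t0+ε) ∧ t ∈ {t | S.Φ (p, t) ∈ G}} = 0 ∨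
      volume {t | t ∈ Ioo (t0-ε) (t0+ε) ∧ t ∉ {t | S.Φ (p, t) ∈ G}} = 0) := by
    intro h
    refine (hp _ _).2 h t0 ⟨by linarith, by linarith⟩ ?_
    simp only [mem_setOf_eq, hxe]; exact hCe hx
  push Not at hnot
  have hHm : MeasurableSet {t | S.Φ (p, t) ∈ G} := by
    have : Continuous fun t : ℝ => S.Φ (p, t) := by fun_prop
    exact this.measurable hG
  refine (one_dim_xor hHm hnot.1 hnot.2 hs0 hs).trans ?_
  refine liminf_le_liminf (Eventually.of_forall fun j => ?_)
  simp only [hφ]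
  refine ENNReal.div_le_div_right (measure_mono ?_) _
  rintro t ⟨h1, h2⟩
  exact ⟨hb h1, h2⟩

lemma OSplit.inner (S : OSplit W V) (w w' : W) (t t' : ℝ) :
    ⟪S.Φ (w, t), S.Φ (w', t')⟫ = ⟪w, w'⟫ + t * t' := by
  have h := norm_add_sq_real (S.Φ (w, t)) (S.Φ (w', t'))
  rw [← map_add, Prod.mk_add_mk, S.norm_sq, S.norm_sq, S.norm_sq, norm_add_sq_real] at h
  linarith

lemma flat_graph (S : OSplit W V) {f : W → ℝ} {A : W →L[ℝ] ℝ} {D : Set W} {δ : ℝ≥0} {K : ℝ≥0}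
    (hA : ApproximatesLinearOn f A D δ) (hK : 1 ≤ (K:ℝ)^2 * (1 - (δ:ℝ)^2)) :
    ∃ (v : V) (hv : ‖v‖ = 1), ∀ w ∈ D, ∀ w' ∈ D,
      dist (S.Φ (w, f w)) (S.Φ (w', f w')) ≤
        K * dist ((OSplit.ofUnit hv).pr (S.Φ (w, f w))) ((OSplit.ofUnit hv).pr (S.Φ (w', f w'))) := by
  set a := (InnerProductSpace.toDual ℝ W).symm A with ha
  set v0 := S.Φ (-a, 1) with hv0
  have hn0 : 1 ≤ ‖v0‖ := by
    have := S.norm_sq (-a) 1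
    nlinarith [sq_nonneg ‖-a‖, norm_nonneg v0]
  have hn : ‖v0‖ ≠ 0 := by positivity
  have hv : ‖(‖v0‖⁻¹ • v0)‖ = 1 := by rw [norm_smul, norm_inv, norm_norm, inv_mul_cancel₀ hn]
  refine ⟨_, hv, fun w hw w' hw' => ?_⟩
  set T := OSplit.ofUnit hv with hT
  set X := S.Φ (w, f w) - S.Φ (w', f w') with hX
  have hX' : X = S.Φ (w - w', f w - f w') := by rw [hX, ← map_sub]; rfl
  have h1 : |⟪X, ‖v0‖⁻¹ • v0⟫| ≤ δ * ‖X‖ := by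
    rw [inner_smul_right, abs_mul, abs_inv, abs_norm]
    have h2 : ⟪X, v0⟫ = f w - f w' - A (w - w') := by
      rw [hX', hv0, S.inner, inner_neg_right, real_inner_comm, ha, InnerProductSpace.toDual_symm_apply]
      ring
    have h3 : |⟪X, v0⟫| ≤ δ * ‖w - w'‖ := by
      rw [h2]; exact hA w hw w' hw'
    have h4 : ‖w - w'‖ ≤ ‖X‖ := by
      have := S.norm_sq (w - w') (f w - f w')
      rw [← hX'] at this
      exact abs_le_of_sq_le_sq' (by nlinarith [sq_nonneg (f w - f w')]) (norm_nonneg _) |>.2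
    calc ‖v0‖⁻¹ * |⟪X, v0⟫| ≤ 1 * |⟪X, v0⟫| := by
          gcongr; exact inv_le_one_of_one_le₀ hn0
      _ ≤ δ * ‖X‖ := by rw [one_mul]; exact h3.trans (by gcongr)
  have h5 : ‖X‖^2 = ‖T.pr X‖^2 + ⟪X, ‖v0‖⁻¹ • v0⟫^2 := by
    have := T.norm_sq (T.Φ.symm X).1 (T.Φ.symm X).2
    simp only [Prod.mk.eta, ContinuousLinearEquiv.apply_symm_apply] at this
    rw [this]
    congr 2
    have h6 : X = T.Φ ((T.Φ.symm X).1, (T.Φ.symm X).2) := by simp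
    conv_rhs => rw [h6]
    rw [hT, OSplit.ofUnit_apply, inner_add_left, inner_smul_left, real_inner_self_eq_norm_sq, hv,
      Submodule.mem_orthogonal_singleton_iff_inner_left.1 ((OSplit.ofUnit hv).Φ.symm X).1.2]
    simp
  rw [dist_eq_norm, dist_eq_norm]
  have h7 : T.pr (S.Φ (w, f w)) - T.pr (S.Φ (w', f w')) = T.pr X := by simp [OSplit.pr, hX]
  rw [h7, ← hX]
  refine abs_le_of_sq_le_sq' ?_ (by positivity) |>.2
  have h8 : ⟪X, ‖v0‖⁻¹ • v0⟫^2 ≤ (δ * ‖X‖)^2 := sq_le_sq' (by linarith [abs_le.1 h1]) (abs_le.1 h1).2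
  have h9 : (1 - (δ:ℝ)^2) * ‖X‖^2 ≤ ‖T.pr X‖^2 := by nlinarith
  calc ‖X‖^2 = 1 * ‖X‖^2 := (one_mul _).symm
    _ ≤ ((K:ℝ)^2 * (1 - (δ:ℝ)^2)) * ‖X‖^2 := by gcongr
    _ = (K:ℝ)^2 * ((1 - (δ:ℝ)^2) * ‖X‖^2) := by ring
    _ ≤ (K:ℝ)^2 * ‖T.pr X‖^2 := by gcongr
    _ = _ := by ring

lemma flat_measure (S : OSplit W V) {m : ℕ} (hm : Module.finrank ℝ W = m) {K : ℝ≥0} {C : Set V}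
    (h : ∀ x ∈ C, ∀ y ∈ C, dist x y ≤ K * dist (S.pr x) (S.pr y)) :
    μHE[m] C ≤ (K:ℝ≥0∞)^m * volume (S.pr '' C) := by
  classical
  rcases C.eq_empty_or_nonempty with rfl | ⟨x0, _⟩
  · simp
  have : Nonempty V := ⟨x0⟩
  have hinj : InjOn S.pr C := by
    intro x hx y hy hxy
    have := h x hx y hy
    rw [hxy, dist_self, mul_zero] at this
    exact dist_le_zero.1 this
  set g := Function.invFunOn S.pr C
  have hg : ∀ x ∈ C, g (S.pr x) = x := fun x hx => hinj.leftInvOn_invFunOn hx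
  have hl : LipschitzOnWith K g (S.pr '' C) := by
    refine LipschitzOnWith.of_dist_le_mul ?_
    rintro _ ⟨x, hx, rfl⟩ _ ⟨y, hy, rfl⟩
    rw [hg x hx, hg y hy]; exact h x hx y hy
  have := euc_volume_image_le (m := m) hl
  have himg : g '' (S.pr '' C) = C := by
    rw [image_image]
    exact (image_congr hg).trans (image_id' C)
  subst hm
  rw [himg, InnerProductSpace.euclideanHausdorffMeasure_eq_volume] at this
  exact this

lemma flat_decomp {m : ℕ} (hV : Module.finrank ℝ V = m + 1) {G : Set V} (hG : MeasurableSet G)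
    {O : Set V} (hO : IsOpen O) (hfin : μHE[m] (eB (m+1) G ∩ O) ≠ ⊤) {K : ℝ≥0} (hK : 1 < K) :
    ∃ (P : ℕ → Set V) (v : ℕ → V) (hv : ∀ k, ‖v k‖ = 1), (∀ k, MeasurableSet (P k)) ∧
      (∀ k, ∀ x ∈ P k, ∀ y ∈ P k,
        dist x y ≤ K * dist ((OSplit.ofUnit (hv k)).pr x) ((OSplit.ofUnit (hv k)).pr y)) ∧
      μHE[m] ((eB (m+1) G ∩ O) \ ⋃ k, P k) = 0 := by
  set b := stdOrthonormalBasis ℝ V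
  have hLF := locFin_of_finite hO hfin
  have hfr : ∀ i, Module.finrank ℝ ((ℝ ∙ (b i))ᗮ : Submodule ℝ V) = m := fun i => by
    have := (OSplit.ofUnit (b.orthonormal.1 i)).finrank
    omega
  choose f hfL hfae using fun i => GL1 (OSplit.ofUnit (b.orthonormal.1 i)) (hfr i) hG hO hLF
  obtain ⟨δ, hδ0, hδ⟩ : ∃ δ : ℝ≥0, δ ≠ 0 ∧ 1 ≤ (K:ℝ)^2 * (1 - (δ:ℝ)^2) := by
    have h1 : Tendsto (fun δ : ℝ => (K:ℝ)^2 * (1 - δ^2)) (𝓝[>] 0) (𝓝 ((K:ℝ)^2 * (1 - 0^2))) := by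
      refine Tendsto.mono_left ?_ nhdsWithin_le_nhds
      exact Continuous.tendsto (by fun_prop) _
    have hK' : (1:ℝ) < (K:ℝ)^2 * (1 - 0^2) := by
      have : (1:ℝ) < K := by exact_mod_cast hK
      nlinarith
    obtain ⟨δ, h2, h3⟩ := ((h1.eventually (lt_mem_nhds hK')).and self_mem_nhdsWithin).exists
    refine ⟨⟨δ, (mem_Ioi.1 h3).le⟩, ?_, h2.le⟩
    have : (0:ℝ) < δ := h3
    exact fun hh => this.ne' (congrArg NNReal.toReal hh)
  set D := fun i j => {p | DifferentiableAt ℝ (f i j) p} with hD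
  have hDm : ∀ i j, MeasurableSet (D i j) := fun i j => measurableSet_of_differentiableAt ℝ _
  choose t A ht1 htm htc hta _ using fun i j =>
    exists_partition_approximatesLinearOn_of_hasFDerivWithinAt (f i j) (D i j) (fderiv ℝ (f i j))
      (fun x hx => (DifferentiableAt.hasFDerivAt hx).hasFDerivWithinAt) (fun _ => δ) (fun _ => hδ0)
  choose v hv hvd using fun (z : Fin (Module.finrank ℝ V) × ℕ × ℕ) =>
    flat_graph (OSplit.ofUnit (b.orthonormal.1 z.1)) (hta z.1 z.2.1 z.2.2) hδ
  set P : Fin (Module.finrank ℝ V) × ℕ × ℕ → Set V := fun z =>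
    {x | ((OSplit.ofUnit (b.orthonormal.1 z.1)).Φ.symm x).1 ∈ D z.1 z.2.1 ∩ t z.1 z.2.1 z.2.2 ∧
      ((OSplit.ofUnit (b.orthonormal.1 z.1)).Φ.symm x).2 = f z.1 z.2.1 ((OSplit.ofUnit (b.orthonormal.1 z.1)).Φ.symm x).1} with hP
  have hPm : ∀ z, MeasurableSet (P z) := by
    intro z
    have hs1 : Measurable fun x => ((OSplit.ofUnit (b.orthonormal.1 z.1)).Φ.symm x).1 :=
      ((OSplit.ofUnit (b.orthonormal.1 z.1)).Φ.symm.continuous.fst).measurable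
    have hs2 : Measurable fun x => ((OSplit.ofUnit (b.orthonormal.1 z.1)).Φ.symm x).2 :=
      ((OSplit.ofUnit (b.orthonormal.1 z.1)).Φ.symm.continuous.snd).measurable
    obtain ⟨L, hL⟩ := hfL z.1 z.2.1
    exact (hs1 ((hDm _ _).inter (htm _ _ _))).inter (measurableSet_eq_fun hs2 (hL.continuous.measurable.comp hs1))
  have hPd : ∀ z, ∀ x ∈ P z, ∀ y ∈ P z,
      dist x y ≤ K * dist ((OSplit.ofUnit (hv z)).pr x) ((OSplit.ofUnit (hv z)).pr y) := by
    intro z x hx y hy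
    have hx' : x = (OSplit.ofUnit (b.orthonormal.1 z.1)).Φ (((OSplit.ofUnit (b.orthonormal.1 z.1)).Φ.symm x).1, f z.1 z.2.1 ((OSplit.ofUnit (b.orthonormal.1 z.1)).Φ.symm x).1) := by
      rw [← hx.2]; simp
    have hy' : y = (OSplit.ofUnit (b.orthonormal.1 z.1)).Φ (((OSplit.ofUnit (b.orthonormal.1 z.1)).Φ.symm y).1, f z.1 z.2.1 ((OSplit.ofUnit (b.orthonormal.1 z.1)).Φ.symm y).1) := by
      rw [← hy.2]; simp
    have := hvd z _ hx.1 _ hy.1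
    rw [← hx', ← hy'] at this
    exact this
  have hne : Nonempty (Fin (Module.finrank ℝ V) × ℕ × ℕ) := ⟨⟨⟨0, by omega⟩, 0, 0⟩⟩
  obtain ⟨e, he⟩ := exists_surjective_nat (Fin (Module.finrank ℝ V) × ℕ × ℕ)
  refine ⟨fun k => P (e k), fun k => v (e k), fun k => hv (e k), fun k => hPm _, fun k => hPd _, ?_⟩
  refine null_of_proj hV b hG hO hfin
    (((measurableSet_eB _ _).inter hO.measurableSet).diff (MeasurableSet.iUnion fun k => hPm _)) diff_subset ?_
  intro i
  have hdiff : ∀ᵐ p, ∀ j, p ∈ D i j := by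
    rw [ae_all_iff]; intro j
    obtain ⟨L, hL⟩ := hfL i j
    exact hL.ae_differentiableAt
  rw [measure_eq_zero_iff_ae_notMem]
  filter_upwards [hdiff, hfae i] with p hp1 hp2
  rintro ⟨x, ⟨hx1, hx2⟩, rfl⟩
  apply hx2
  obtain ⟨j, hj⟩ := hp2 ((OSplit.ofUnit (b.orthonormal.1 i)).Φ.symm x).2 (by
    have : (OSplit.ofUnit (b.orthonormal.1 i)).Φ ((OSplit.ofUnit (b.orthonormal.1 i)).pr x, ((OSplit.ofUnit (b.orthonormal.1 i)).Φ.symm x).2) = x := by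
      simp [OSplit.pr]
    rw [this]; exact hx1)
  obtain ⟨k, hk⟩ := mem_iUnion.1 (htc i j (hp1 j))
  obtain ⟨l, hl⟩ := he (i, j, k)
  refine mem_iUnion.2 ⟨l, ?_⟩
  rw [hl]
  exact ⟨⟨hp1 j, hk⟩, hj⟩

lemma sep_thick {N : ℕ} {C : ℕ → Set V} (hC : ∀ k, IsCompact (C k)) (hd : Pairwise (Function.onFun Disjoint C))
    {O : Set V} (hO : IsOpen O) (hCO : ∀ k, C k ⊆ O) :
    ∃ δ : ℝ, 0 < δ ∧ (∀ k ∈ Finset.range N, thickening δ (C k) ⊆ O) ∧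
      ∀ k ∈ Finset.range N, ∀ l ∈ Finset.range N, k ≠ l → Disjoint (thickening δ (C k)) (thickening δ (C l)) := by
  have h1 : ∀ᶠ δ : ℝ in 𝓝[>] 0, ∀ k ∈ Finset.range N, thickening δ (C k) ⊆ O := by
    rw [Filter.eventually_all_finset]
    intro k _
    obtain ⟨δ, h0, h⟩ := (hC k).exists_thickening_subset_open hO (hCO k)
    filter_upwards [Ioo_mem_nhdsGT h0] with r hr
    exact (thickening_mono hr.2.le _).trans h
  have h2 : ∀ᶠ δ : ℝ in 𝓝[>] 0, ∀ k ∈ Finset.range N, ∀ l ∈ Finset.range N, k ≠ l →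
      Disjoint (thickening δ (C k)) (thickening δ (C l)) := by
    rw [Filter.eventually_all_finset]
    intro k _
    rw [Filter.eventually_all_finset]
    intro l _
    by_cases hkl : k = l
    · exact Eventually.of_forall fun _ h => absurd hkl h
    obtain ⟨δ, h0, h⟩ := (hd hkl).exists_thickenings (hC k) (hC l).isClosed
    filter_upwards [Ioo_mem_nhdsGT h0] with r hr _
    exact h.mono (thickening_mono hr.2.le _) (thickening_mono hr.2.le _)
  obtain ⟨δ, ⟨h3, h4⟩, h5⟩ := ((h1.and h2).and self_mem_nhdsWithin).exists
  exact ⟨δ, h5, h3, h4⟩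

lemma compact_pieces {m : ℕ} {M : Set V} (hM : MeasurableSet M) (hfin : μHE[m] M ≠ ⊤)
    {P : ℕ → Set V} (hP : ∀ k, MeasurableSet (P k)) (hnull : μHE[m] (M \ ⋃ k, P k) = 0)
    {c : ℝ≥0∞} (hc : c < μHE[m] M) :
    ∃ (N : ℕ) (C : ℕ → Set V), (∀ k, IsCompact (C k)) ∧ (∀ k, C k ⊆ M ∩ P k) ∧
      Pairwise (Function.onFun Disjoint C) ∧ c < ∑ k ∈ Finset.range N, μHE[m] (C k) := by
  set ν := (μHE[m] : Measure V).restrict M with hν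
  have hνf : IsFiniteMeasure ν := ⟨by
    rw [hν, Measure.restrict_apply MeasurableSet.univ, univ_inter]; exact lt_top_iff_ne_top.2 hfin⟩
  set Q := fun k => M ∩ disjointed P k with hQ
  have hQm : ∀ k, MeasurableSet (Q k) := fun k => hM.inter (MeasurableSet.disjointed hP k)
  have hQd : Pairwise (Function.onFun Disjoint Q) := fun k l hkl =>
    (disjoint_disjointed P hkl).mono inter_subset_right inter_subset_right
  have h1 : c < ∑' k, ν (Q k) := by
    rw [← measure_iUnion hQd hQm]
    refine hc.trans_le ?_
    have h2 : μHE[m] M ≤ ν (⋃ k, Q k) + μHE[m] (M \ ⋃ k, P k) := by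
      rw [hν, Measure.restrict_apply (MeasurableSet.iUnion hQm)]
      refine (measure_mono ?_).trans (measure_union_le _ _)
      intro x hx
      by_cases hxP : x ∈ ⋃ k, P k
      · left
        rw [← iUnion_disjointed] at hxP
        obtain ⟨k, hk⟩ := mem_iUnion.1 hxP
        exact ⟨mem_iUnion.2 ⟨k, hx, hk⟩, hx⟩
      · exact Or.inr ⟨hx, hxP⟩
    rwa [hnull, add_zero] at h2
  rw [ENNReal.tsum_eq_iSup_nat, lt_iSup_iff] at h1
  obtain ⟨N, hN⟩ := h1
  obtain ⟨ε, hε0, hε⟩ := ENNReal.exists_pos_sum_of_countable (tsub_pos_of_lt hN).ne' ℕ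
  choose C hC1 hC2 hC3 using fun k => (hQm k).exists_isCompact_lt_add (μ := ν) (measure_ne_top _ _)
    (ENNReal.coe_ne_zero.2 (hε0 k).ne')
  refine ⟨N, C, hC2, fun k => (hC1 k).trans (inter_subset_inter_right _ (disjointed_subset P k)),
    fun k l hkl => (hQd hkl).mono (hC1 k) (hC1 l), ?_⟩
  have hνC : ∀ k, ν (C k) = μHE[m] (C k) := fun k => by
    rw [hν, Measure.restrict_apply (hC2 k).measurableSet,
      inter_eq_self_of_subset_left ((hC1 k).trans inter_subset_left)]
  simp_rw [← hνC]
  by_contra hcon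
  push Not at hcon
  have h3 : ∑ k ∈ Finset.range N, ν (Q k) ≤ ∑ k ∈ Finset.range N, ν (C k) + ∑' k, (ε k : ℝ≥0∞) := by
    refine (Finset.sum_le_sum fun k _ => (hC3 k).le).trans ?_
    rw [Finset.sum_add_distrib]
    gcongr
    exact ENNReal.sum_le_tsum _
  have hcf : c ≠ ⊤ := (hc.trans_le le_top).ne
  have h4 : ∑ k ∈ Finset.range N, ν (C k) + ∑' k, (ε k : ℝ≥0∞) < ∑ k ∈ Finset.range N, ν (Q k) := by
    calc _ ≤ c + ∑' k, (ε k : ℝ≥0∞) := by gcongr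
      _ < c + (∑ k ∈ Finset.range N, ν (Q k) - c) := ENNReal.add_lt_add_left hcf hε
      _ = _ := add_tsub_cancel_of_le hN.le
  exact absurd h3 (not_le.2 h4)

lemma lsc {m : ℕ} (hV : Module.finrank ℝ V = m + 1) {F : Set V} (hF : MeasurableSet F)
    {O : Set V} (hO : IsOpen O) (hfin : μHE[m] (eB (m+1) F ∩ O) ≠ ⊤) {c : ℝ≥0∞}
    (hc : c < μHE[m] (eB (m+1) F ∩ O)) :
    ∃ η : ℝ≥0, 0 < η ∧ ∀ A : Set V, MeasurableSet A → volume (symmDiff A F ∩ O) ≤ η →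
      c ≤ μHE[m] (eB (m+1) A ∩ O) := by
  have hcf : c ≠ ⊤ := (hc.trans_le le_top).ne
  obtain ⟨K, hcK, hK⟩ : ∃ K : ℝ≥0, c * (K:ℝ≥0∞)^(m+1) < μHE[m] (eB (m+1) F ∩ O) ∧ 1 < K := by
    have h1 : Tendsto (fun K : ℝ≥0 => c * (K:ℝ≥0∞)^(m+1)) (𝓝[>] 1) (𝓝 (c * ((1:ℝ≥0):ℝ≥0∞)^(m+1))) := by
      refine Tendsto.mono_left ?_ nhdsWithin_le_nhds
      refine ENNReal.Tendsto.const_mul ?_ (Or.inr hcf)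
      exact ((ENNReal.continuous_pow (m+1)).comp ENNReal.continuous_coe).tendsto 1
    have h2 : c * ((1:ℝ≥0):ℝ≥0∞)^(m+1) < μHE[m] (eB (m+1) F ∩ O) := by simpa using hc
    exact ((h1.eventually (gt_mem_nhds h2)).and self_mem_nhdsWithin).exists
  have hK0 : (K:ℝ≥0∞) ≠ 0 := by simpa using (zero_lt_one.trans hK).ne'
  obtain ⟨P, v, hv, hPm, hPd, hPn⟩ := flat_decomp hV hF hO hfin hK
  obtain ⟨N, C, hCc, hCs, hCd, hCsum⟩ := compact_pieces ((measurableSet_eB _ _).inter hO.measurableSet)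
    hfin hPm hPn hcK
  have hfr : ∀ k, Module.finrank ℝ ((ℝ ∙ (v k))ᗮ : Submodule ℝ V) = m := fun k => by
    have := (OSplit.ofUnit (hv k)).finrank
    omega
  set S := fun k => OSplit.ofUnit (hv k) with hS
  obtain ⟨δ, hδ0, hδO, hδd⟩ := sep_thick (N := N) hCc hCd hO (fun k => (hCs k).trans (inter_subset_left.trans inter_subset_right))
  set U := fun k => thickening (δ/2) (C k) with hU
  set s : ℕ → ℝ := fun j => 1 / ((j:ℝ) + 1) with hs
  have hs0 : ∀ j, 0 < s j := fun j => by rw [hs]; positivity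
  have hst : Tendsto s atTop (𝓝 0) := tendsto_one_div_add_atTop_nhds_zero_nat
  set X := fun (B : Set V) k j => volume {x | x ∈ U k ∧ ¬ (x ∈ B ↔ x + s j • v k ∈ B)} with hX
  have hΦ : ∀ k, (S k).Φ (0, 1) = v k := fun k => by simp [hS, OSplit.ofUnit_apply]
  have hCfin : ∀ k, volume ((S k).pr '' C k) ≠ ⊤ := fun k =>
    ((((S k).volume_pr_le (hfr k) (C k)).trans (measure_mono ((hCs k).trans inter_subset_left))).trans_lt
      (lt_top_iff_ne_top.2 hfin)).ne
  have hev : ∀ᶠ j in atTop, ∀ k ∈ Finset.range N, volume ((S k).pr '' C k) ≤ K * (X F k j / ENNReal.ofReal (s j)) := by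
    rw [Filter.eventually_all_finset]
    intro k _
    by_cases h0 : volume ((S k).pr '' C k) = 0
    · exact Eventually.of_forall fun j => by rw [h0]; exact zero_le
    have h1 := flat_liminf (S k) (hfr k) hF (hCc k) ((hCs k).trans (inter_subset_left.trans inter_subset_left))
      isOpen_thickening (self_subset_thickening (half_pos hδ0) (C k)) hs0 hst
    rw [hΦ] at h1
    have h2 : (K:ℝ≥0∞)⁻¹ * volume ((S k).pr '' C k) < volume ((S k).pr '' C k) := by
      conv_rhs => rw [← one_mul (volume ((S k).pr '' C k))]
      refine ENNReal.mul_lt_mul_left h0 (hCfin k) ?_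
      rw [ENNReal.inv_lt_one]; exact_mod_cast hK
    filter_upwards [eventually_lt_of_lt_liminf (h2.trans_le h1)] with j hj
    calc volume ((S k).pr '' C k) = K * ((K:ℝ≥0∞)⁻¹ * volume ((S k).pr '' C k)) := by
          rw [← mul_assoc (K:ℝ≥0∞), ENNReal.mul_inv_cancel hK0 ENNReal.coe_ne_top, one_mul]
      _ ≤ _ := by gcongr
  obtain ⟨j, hj1, hj2⟩ := (hev.and (hst.eventually (gt_mem_nhds (half_pos hδ0)))).exists
  have hsj0 : ENNReal.ofReal (s j) ≠ 0 := by simpa using hs0 j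
  have hgap : c * ENNReal.ofReal (s j) < ∑ k ∈ Finset.range N, X F k j := by
    have h1 : c * (K:ℝ≥0∞)^(m+1) < (∑ k ∈ Finset.range N, X F k j) / ENNReal.ofReal (s j) * (K:ℝ≥0∞)^(m+1) := by
      refine hCsum.trans_le ?_
      rw [div_eq_mul_inv, Finset.sum_mul, Finset.sum_mul]
      refine Finset.sum_le_sum fun k hk => ?_
      refine (flat_measure (S k) (hfr k) (K := K) fun x hx y hy => hPd k x (hCs k hx).2 y (hCs k hy).2).trans ?_
      calc (K:ℝ≥0∞)^m * volume ((S k).pr '' C k) ≤ (K:ℝ≥0∞)^m * (K * (X F k j / ENNReal.ofReal (s j))) := by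
            gcongr; exact hj1 k hk
        _ = _ := by rw [div_eq_mul_inv]; ring
    have h2 := lt_of_mul_lt_mul_right h1 zero_le
    rwa [ENNReal.lt_div_iff_mul_lt (Or.inl hsj0) (Or.inl ENNReal.ofReal_ne_top)] at h2
  obtain ⟨r, hr0, hr⟩ := ENNReal.lt_iff_exists_add_pos_lt.1 hgap
  refine ⟨r / 2, half_pos hr0, fun A hA hAF => ?_⟩
  set O' := fun k => thickening δ (C k) with hO'
  have hUO : ∀ k, U k ⊆ O' k := fun k => thickening_mono (by linarith) _
  have hUs : ∀ k, ∀ x ∈ U k, ∀ τ ∈ Icc (0:ℝ) 1, x + τ • (s j • v k) ∈ O' k := by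
    intro k x hx τ hτ
    obtain ⟨z, hz, hxz⟩ := mem_thickening_iff.1 hx
    refine mem_thickening_iff.2 ⟨z, hz, ?_⟩
    have : ‖τ • (s j • v k)‖ ≤ δ / 2 := by
      rw [norm_smul, norm_smul, hv k, Real.norm_of_nonneg hτ.1, Real.norm_of_nonneg (hs0 j).le, mul_one]
      nlinarith [hτ.1, hτ.2, hs0 j]
    calc dist (x + τ • (s j • v k)) z ≤ dist (x + τ • (s j • v k)) x + dist x z := dist_triangle _ _ _
      _ < δ := by rw [dist_self_add_left]; linarith
  have hAFm : MeasurableSet (symmDiff A F) := hA.symmDiff hF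
  have hXle : ∀ k, X F k j ≤ ENNReal.ofReal (s j) * μHE[m] (eB (m+1) A ∩ O' k) + (volume (symmDiff A F ∩ O' k) + volume (symmDiff A F ∩ O' k)) := by
    intro k
    have h1 : X A k j ≤ ENNReal.ofReal (s j) * μHE[m] (eB (m+1) A ∩ O' k) := by
      have := T_shift hV hA (U := U k) isOpen_thickening.measurableSet (s j • v k) (A := eB (m+1) A ∩ O' k)
        (fun x hx τ hτ hh => ⟨hh, hUs k x hx τ hτ⟩)
      rwa [norm_smul, hv k, mul_one, Real.norm_of_nonneg (hs0 j).le] at this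
    have h2 : volume ((fun x => x + s j • v k) ⁻¹' (symmDiff A F ∩ O' k)) = volume (symmDiff A F ∩ O' k) :=
      measure_preimage_add_right _ _ _
    calc X F k j ≤ volume ({x | x ∈ U k ∧ ¬ (x ∈ A ↔ x + s j • v k ∈ A)} ∪ ((symmDiff A F ∩ O' k) ∪ (fun x => x + s j • v k) ⁻¹' (symmDiff A F ∩ O' k))) := by
          refine measure_mono ?_
          rintro x ⟨hx1, hx2⟩
          have h3 := hUO k hx1
          have h4 := hUs k x hx1 1 ⟨zero_le_one, le_rfl⟩
          rw [one_smul] at h4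
          simp only [mem_union, mem_setOf_eq, mem_inter_iff, mem_preimage, mem_symmDiff]
          tauto
      _ ≤ X A k j + (volume (symmDiff A F ∩ O' k) + volume (symmDiff A F ∩ O' k)) := by
          refine (measure_union_le _ _).trans ?_
          gcongr
          refine (measure_union_le _ _).trans ?_
          rw [h2]
      _ ≤ _ := by gcongr
  have hsum : ∀ (μ : Measure V) (B : Set V), MeasurableSet B → ∑ k ∈ Finset.range N, μ (B ∩ O' k) ≤ μ (B ∩ O) := by
    intro μ B hB
    rw [← measure_biUnion_finset]
    · refine measure_mono (iUnion₂_subset fun k hk => inter_subset_inter_right _ (hδO k hk))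
    · intro k hk l hl hkl
      exact (hδd k hk l hl hkl).mono inter_subset_right inter_subset_right
    · exact fun k _ => hB.inter isOpen_thickening.measurableSet
  have hfinal : c * ENNReal.ofReal (s j) + r < ENNReal.ofReal (s j) * μHE[m] (eB (m+1) A ∩ O) + r := by
    refine hr.trans_le ((Finset.sum_le_sum fun k _ => hXle k).trans ?_)
    rw [Finset.sum_add_distrib, Finset.sum_add_distrib, ← Finset.mul_sum]
    have hrr : (r:ℝ≥0∞) = ((r/2 : ℝ≥0):ℝ≥0∞) + ((r/2 : ℝ≥0):ℝ≥0∞) := by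
      rw [← ENNReal.coe_add, add_halves]
    rw [hrr]
    have h5 := (hsum volume _ hAFm).trans hAF
    have h6 := hsum μHE[m] _ (measurableSet_eB (m+1) A)
    gcongr
  have h7 := lt_of_add_lt_add_right hfinal
  rw [mul_comm] at h7
  exact (lt_of_mul_lt_mul_left h7 zero_le).le

end A8

section A13
set_option linter.unusedSimpArgs false
variable {W : Type*} [NormedAddCommGroup W] [InnerProductSpace ℝ W] [FiniteDimensional ℝ W]
  [MeasurableSpace W] [BorelSpace W]
variable {V : Type*} [NormedAddCommGroup V] [InnerProductSpace ℝ V] [FiniteDimensional ℝ V]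
  [MeasurableSpace V] [BorelSpace V]

/-- polarization of `A` with respect to the reflection `σ` and the half space `0 < h` -/
def pol (σ : V → V) (h : V → ℝ) (A : Set V) : Set V :=
  {x | (0 < h x ∧ (x ∈ A ∨ σ x ∈ A)) ∨ (h x ≤ 0 ∧ x ∈ A ∧ σ x ∈ A)}

lemma MZ_local {d : ℕ} {G G' U : Set V} (hU : IsOpen U) (h : G ∩ U ⊆ G') {x : V} (hx : x ∈ U)
    (hG : MZ d G' x) : MZ d G x := by
  intro ε hε
  obtain ⟨r, hr0, hr⟩ := Metric.isOpen_iff.1 hU x hx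
  filter_upwards [hG ε hε, Ioo_mem_nhdsGT hr0] with ρ h1 h2
  refine (measure_mono ?_).trans h1
  intro y hy
  exact ⟨h ⟨hy.1, hr (ball_subset_ball h2.2.le hy.2)⟩, hy.2⟩

lemma eB_local {d : ℕ} {G G' U : Set V} (hU : IsOpen U) (h : ∀ x ∈ U, (x ∈ G ↔ x ∈ G')) :
    eB d G ∩ U = eB d G' ∩ U := by
  have key : ∀ A B : Set V, (∀ x ∈ U, (x ∈ A ↔ x ∈ B)) → eB d A ∩ U ⊆ eB d B ∩ U := by
    rintro A B hAB x ⟨⟨h1, h2⟩, hx⟩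
    refine ⟨⟨fun h3 => h1 (MZ_local hU ?_ hx h3), fun h3 => h2 (MZ_local hU ?_ hx h3)⟩, hx⟩
    · exact fun y hy => (hAB y hy.2).1 hy.1
    · exact fun y hy hyB => hy.1 ((hAB y hy.2).2 hyB)
  exact (key _ _ h).antisymm (key _ _ fun x hx => (h x hx).symm)

lemma eB_union_sub (d : ℕ) (A C : Set V) : eB d (A ∪ C) ⊆ eB d A ∪ eB d C := by
  rintro x ⟨h1, h2⟩
  have hA : ¬ MZ d Aᶜ x := fun h => h2 (MZm_mono (by rw [compl_union]; exact inter_subset_left) h)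
  have hC : ¬ MZ d Cᶜ x := fun h => h2 (MZm_mono (by rw [compl_union]; exact inter_subset_right) h)
  by_cases h : MZ d A x
  · right
    exact ⟨fun h3 => h1 (MZm_union h h3), hC⟩
  · exact Or.inl ⟨h, hA⟩

lemma eB_inter_sub (d : ℕ) (A C : Set V) : eB d (A ∩ C) ⊆ eB d A ∪ eB d C := by
  have := eB_union_sub d Aᶜ Cᶜ
  rwa [← compl_inter, eB_compl, eB_compl, eB_compl] at this

lemma eB_union_inter_sub (d : ℕ) (A C : Set V) : eB d (A ∪ C) ∩ eB d (A ∩ C) ⊆ eB d A ∩ eB d C := by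
  rintro x ⟨⟨h1, h2⟩, h3, h4⟩
  refine ⟨⟨fun h => h3 (MZm_mono inter_subset_left h), fun h => h2 (MZm_mono ?_ h)⟩,
    fun h => h3 (MZm_mono inter_subset_right h), fun h => h2 (MZm_mono ?_ h)⟩
  · rw [compl_union]; exact inter_subset_left
  · rw [compl_union]; exact inter_subset_right

lemma meas_submod {μ : Measure V} {P1 P2 Q1 Q2 B : Set V} (hP2 : MeasurableSet P2) (hQ2 : MeasurableSet Q2)
    (hB : MeasurableSet B)
    (h1 : P1 ∪ P2 ⊆ Q1 ∪ Q2) (h2 : P1 ∩ P2 ⊆ Q1 ∩ Q2) :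
    μ (P1 ∩ B) + μ (P2 ∩ B) ≤ μ (Q1 ∩ B) + μ (Q2 ∩ B) := by
  rw [← measure_union_add_inter (P1 ∩ B) (hP2.inter hB), ← measure_union_add_inter (Q1 ∩ B) (hQ2.inter hB)]
  gcongr ?_ + ?_
  · refine measure_mono ?_
    rw [← union_inter_distrib_right, ← union_inter_distrib_right]
    exact inter_subset_inter_left _ h1
  · refine measure_mono ?_
    rw [← inter_inter_distrib_right, ← inter_inter_distrib_right]
    exact inter_subset_inter_left _ h2

lemma three_split {μ : Measure V} {h : V → ℝ} (hh : Continuous h) (B : Set V) :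
    μ B = μ (B ∩ {x | 0 < h x}) + μ (B ∩ {x | h x < 0}) + μ (B ∩ {x | h x = 0}) := by
  have m1 : MeasurableSet {x | 0 < h x} := measurableSet_lt measurable_const hh.measurable
  have m2 : MeasurableSet {x | h x < 0} := measurableSet_lt hh.measurable measurable_const
  rw [← measure_inter_add_diff B m1, add_assoc, ← measure_inter_add_diff (B \ {x | 0 < h x}) m2]
  congr 2
  · congr 1; ext x; simp only [mem_inter_iff, mem_diff, mem_setOf_eq]
    constructor
    · rintro ⟨⟨a, b⟩, c⟩; exact ⟨a, c⟩
    · rintro ⟨a, c⟩; exact ⟨⟨a, by linarith⟩, c⟩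
  · congr 1; ext x; simp only [mem_inter_iff, mem_diff, mem_setOf_eq, not_lt]
    constructor
    · rintro ⟨⟨a, b⟩, c⟩; exact ⟨a, le_antisymm b c⟩
    · rintro ⟨a, c⟩; exact ⟨⟨a, by linarith⟩, by linarith⟩

lemma pol_perim {m : ℕ} (σ : V ≃ₗᵢ[ℝ] V) (hσ : ∀ x, σ (σ x) = x) {h : V → ℝ} (hh : Continuous h)
    (hneg : ∀ x, h (σ x) = - h x) (h0 : ∀ x, h x = 0 → σ x = x) {A B : Set V}
    (hB : MeasurableSet B) (hBσ : ∀ x, σ x ∈ B ↔ x ∈ B) :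
    μHE[m] (eB (m+1) (pol σ h A) ∩ B) ≤ μHE[m] (eB (m+1) A ∩ B) := by
  set H := {x | 0 < h x} with hH
  set H' := {x | h x < 0} with hH'
  set Z := {x | h x = 0} with hZ
  have hHo : IsOpen H := isOpen_lt continuous_const hh
  have hHo' : IsOpen H' := isOpen_lt hh continuous_const
  set C := σ ⁻¹' A with hC
  have heσ : ∀ G : Set V, ∀ x, x ∈ eB (m+1) (σ ⁻¹' G) ↔ σ x ∈ eB (m+1) G := fun G x =>
    (LBL_of_linearEquiv σ.toContinuousLinearEquiv x).mem_eB_iff (m+1) G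
  have hμσ : ∀ T : Set V, μHE[m] (σ ⁻¹' T) = μHE[m] T := by
    intro T
    have h1 := σ.isometry.euclideanHausdorffMeasure_image (d := m) (σ ⁻¹' T)
    rw [image_preimage_eq _ σ.surjective] at h1
    exact h1.symm
  have hmH := hHo.measurableSet
  rw [three_split hh (eB (m+1) (pol σ h A) ∩ B), three_split hh (eB (m+1) A ∩ B)]
  have e1 : eB (m+1) (pol σ h A) ∩ B ∩ H = eB (m+1) (A ∪ C) ∩ (B ∩ H) := by
    have := eB_local (d := m+1) (G := pol σ h A) (G' := A ∪ C) hHo (by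
      intro x hx
      have hx : 0 < h x := hx
      simp only [pol, mem_setOf_eq, mem_union, hC, mem_preimage, hx, true_and, not_le.2 hx, false_and, or_false])
    rw [inter_assoc, inter_comm B H, ← inter_assoc, this, inter_assoc]
  have e2 : eB (m+1) (pol σ h A) ∩ B ∩ H' = eB (m+1) (A ∩ C) ∩ (B ∩ H') := by
    have := eB_local (d := m+1) (G := pol σ h A) (G' := A ∩ C) hHo' (by
      intro x hx
      have hx : h x < 0 := hx
      simp only [pol, mem_setOf_eq, mem_inter_iff, hC, mem_preimage, hx.le, true_and, not_lt.2 hx.le, false_and, false_or])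
    rw [inter_assoc, inter_comm B H', ← inter_assoc, this, inter_assoc]
  have e3 : μHE[m] (eB (m+1) (A ∩ C) ∩ (B ∩ H')) = μHE[m] (eB (m+1) (A ∩ C) ∩ (B ∩ H)) := by
    rw [← hμσ (eB (m+1) (A ∩ C) ∩ (B ∩ H'))]
    congr 1
    ext x
    have hx1 : σ ⁻¹' (A ∩ C) = A ∩ C := by
      ext y; simp only [hC, mem_preimage, mem_inter_iff, hσ]; tauto
    have hx2 := heσ (A ∩ C) x
    rw [hx1] at hx2
    simp only [mem_preimage, mem_inter_iff, ← hx2, hBσ, hH, hH', mem_setOf_eq, hneg, Left.neg_neg_iff]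
  have e4 : μHE[m] (eB (m+1) A ∩ B ∩ H') = μHE[m] (eB (m+1) C ∩ (B ∩ H)) := by
    rw [← hμσ (eB (m+1) A ∩ B ∩ H')]
    congr 1
    ext x
    simp only [mem_preimage, mem_inter_iff, hC, heσ, hBσ, hH, hH', mem_setOf_eq, hneg, Left.neg_neg_iff, and_assoc]
  rw [e1, e2, e3, e4, inter_assoc (eB (m+1) A) B H]
  gcongr ?_ + ?_
  · exact meas_submod (measurableSet_eB _ _) (measurableSet_eB _ _) (hB.inter hmH)
      (union_subset (eB_union_sub _ _ _) (eB_inter_sub _ _ _)) (eB_union_inter_sub _ _ _)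
  · refine measure_mono ?_
    rintro x ⟨⟨⟨hx1, hx2⟩, hxB⟩, hxZ⟩
    have hfix : σ x = x := h0 x hxZ
    have key : ∀ G : Set V, MZ (m+1) G x → MZ (m+1) (G ∪ σ ⁻¹' G) x := by
      intro G hG
      refine MZm_union hG ?_
      refine ((LBL_of_linearEquiv σ.toContinuousLinearEquiv x).MZ_iff (m+1) G).2 ?_
      show MZ (m+1) G (σ x)
      rw [hfix]; exact hG
    refine ⟨⟨⟨fun hA => hx1 (MZm_mono ?_ (key _ hA)), fun hA => hx2 (MZm_mono ?_ (key _ hA))⟩, hxB⟩, hxZ⟩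
    · rintro y (⟨_, h1 | h1⟩ | ⟨_, h1, _⟩)
      · exact Or.inl h1
      · exact Or.inr h1
      · exact Or.inl h1
    · intro y hy
      by_contra hcon
      simp only [mem_union, mem_compl_iff, mem_preimage, not_or, not_not] at hcon
      refine hy ?_
      rcases lt_or_ge 0 (h y) with h1 | h1
      · exact Or.inl ⟨h1, Or.inl hcon.1⟩
      · exact Or.inr ⟨h1, hcon⟩

lemma pol_meas (σ : V ≃ₗᵢ[ℝ] V) {h : V → ℝ} (hh : Continuous h) {A : Set V} (hA : MeasurableSet A) :
    MeasurableSet (pol σ h A) := by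
  have m1 : MeasurableSet {x | 0 < h x} := measurableSet_lt measurable_const hh.measurable
  have m2 : MeasurableSet {x | h x ≤ 0} := measurableSet_le hh.measurable measurable_const
  have mC : MeasurableSet (σ ⁻¹' A) := σ.continuous.measurable hA
  exact (m1.inter (hA.union mC)).union (m2.inter (hA.inter mC))

lemma pol_vol (σ : V ≃ₗᵢ[ℝ] V) (hσ : ∀ x, σ (σ x) = x) {h : V → ℝ} (hh : Continuous h)
    (hneg : ∀ x, h (σ x) = - h x) (h0 : ∀ x, h x = 0 → σ x = x) {A B : Set V} (hA : MeasurableSet A)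
    (hB : MeasurableSet B) (hBσ : ∀ x, σ x ∈ B ↔ x ∈ B) :
    volume (pol σ h A ∩ B) = volume (A ∩ B) := by
  have mC : MeasurableSet (σ ⁻¹' A) := σ.continuous.measurable hA
  have m1 : MeasurableSet {x | 0 < h x} := measurableSet_lt measurable_const hh.measurable
  have hμσ : ∀ T : Set V, MeasurableSet T → volume (σ ⁻¹' T) = volume T := fun T hT =>
    σ.measurePreserving.measure_preimage hT.nullMeasurableSet
  have m2 : MeasurableSet {x | h x < 0} := measurableSet_lt hh.measurable measurable_const
  rw [three_split hh (pol σ h A ∩ B), three_split hh (A ∩ B)]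
  have e1 : pol σ h A ∩ B ∩ {x | 0 < h x} = (A ∩ B ∩ {x | 0 < h x}) ∪ (σ ⁻¹' A ∩ B ∩ {x | 0 < h x}) := by
    ext x; simp only [pol, mem_inter_iff, mem_union, mem_setOf_eq, mem_preimage]
    constructor
    · rintro ⟨⟨h1 | h1, h2⟩, h3⟩
      · tauto
      · linarith [h1.1]
    · tauto
  have e2 : volume (pol σ h A ∩ B ∩ {x | h x < 0}) = volume ((A ∩ B ∩ {x | 0 < h x}) ∩ (σ ⁻¹' A ∩ B ∩ {x | 0 < h x})) := by
    rw [← hμσ _ (((pol_meas σ hh hA).inter hB).inter m2)]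
    congr 1
    ext x
    simp only [pol, mem_preimage, mem_inter_iff, hBσ, mem_setOf_eq, hneg, Left.neg_neg_iff, hσ]
    constructor
    · rintro ⟨⟨h1 | h1, h2⟩, h3⟩
      · linarith [h1.1]
      · tauto
    · rintro ⟨⟨⟨h1, h2⟩, h3⟩, ⟨h4, h5⟩, h6⟩
      exact ⟨⟨Or.inr ⟨by linarith, h4, h1⟩, h2⟩, h3⟩
  have e3 : volume (A ∩ B ∩ {x | h x < 0}) = volume (σ ⁻¹' A ∩ B ∩ {x | 0 < h x}) := by
    rw [← hμσ _ ((hA.inter hB).inter m2)]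
    congr 1; ext x
    simp only [mem_preimage, mem_inter_iff, hBσ, mem_setOf_eq, hneg, Left.neg_neg_iff]
  have e4 : pol σ h A ∩ B ∩ {x | h x = 0} = A ∩ B ∩ {x | h x = 0} := by
    ext x; simp only [pol, mem_inter_iff, mem_setOf_eq]
    constructor
    · rintro ⟨⟨h1 | h1, h2⟩, h3⟩
      · linarith [h1.1]
      · tauto
    · rintro ⟨⟨h1, h2⟩, h3⟩
      exact ⟨⟨Or.inr ⟨h3.le, h1, by rw [h0 x h3]; exact h1⟩, h2⟩, h3⟩
  rw [e1, e2, e3, e4, measure_union_add_inter _ ((mC.inter hB).inter m1)]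

lemma xor_aux (p q : Prop) : (p ∧ ¬ q ∨ q ∧ ¬ p) ↔ ¬ (p ↔ q) := by tauto

lemma ite_key (a b f g : Prop) (h : g → f) (p1 p2 p3 p4 p5 : Prop) [Decidable p1] [Decidable p2] [Decidable p3]
    [Decidable p4] [Decidable p5] (h1 : p1 ↔ ¬ ((a ∨ b) ↔ f)) (h2 : p2 ↔ ¬ ((a ∧ b) ↔ g)) (h3 : p3 ↔ ¬ (a ↔ f))
    (h4 : p4 ↔ ¬ (b ↔ g)) (h5 : p5 ↔ (f ∧ ¬ a ∧ b ∧ ¬ g)) :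
    (if p1 then (1:ℝ≥0∞) else 0) + (if p2 then 1 else 0) + 2 * (if p5 then 1 else 0) ≤
      (if p3 then 1 else 0) + (if p4 then 1 else 0) := by
  by_cases b1 : a <;> by_cases b2 : b <;> by_cases b3 : f <;> by_cases b4 : g <;>
    simp only [b1, b2, b3, b4, true_or, or_true, or_false, iff_true, not_true, true_and, and_true, and_false,
      false_and, iff_false, not_false_iff, not_not, or_self, iff_self, true_implies] at h h1 h2 h3 h4 h5 <;>
    simp only [h1, h2, h3, h4, h5, if_true, if_false] <;> norm_num

/-- gain of the polarization in symmetric difference -/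
lemma pol_gain (σ : V ≃ₗᵢ[ℝ] V) (hσ : ∀ x, σ (σ x) = x) {h : V → ℝ} (hh : Continuous h)
    (hneg : ∀ x, h (σ x) = - h x) (h0 : ∀ x, h x = 0 → σ x = x) {A B F : Set V} (hA : MeasurableSet A)
    (hF : MeasurableSet F) (hFm : ∀ x, 0 < h x → σ x ∈ F → x ∈ F)
    (hB : MeasurableSet B) (hBσ : ∀ x, σ x ∈ B ↔ x ∈ B) :
    volume (symmDiff (pol σ h A) F ∩ B) + 2 * volume ({x | x ∈ F ∧ x ∉ A ∧ σ x ∈ A ∧ σ x ∉ F} ∩ B) ≤ volume (symmDiff A F ∩ B) := by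
  have mC : MeasurableSet (σ ⁻¹' A) := σ.continuous.measurable hA
  have mF : MeasurableSet (σ ⁻¹' F) := σ.continuous.measurable hF
  have m1 : MeasurableSet {x | 0 < h x} := measurableSet_lt measurable_const hh.measurable
  have m2 : MeasurableSet {x | h x < 0} := measurableSet_lt hh.measurable measurable_const
  have hμσ : ∀ T : Set V, MeasurableSet T → volume (σ ⁻¹' T) = volume T := fun T hT =>
    σ.measurePreserving.measure_preimage hT.nullMeasurableSet
  have hgm : MeasurableSet {x | x ∈ F ∧ x ∉ A ∧ σ x ∈ A ∧ σ x ∉ F} :=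
    hF.inter (hA.compl.inter (mC.inter mF.compl))
  set g := {x | x ∈ F ∧ x ∉ A ∧ σ x ∈ A ∧ σ x ∉ F} with hg
  have hgpos : ∀ x ∈ g, 0 < h x := by
    rintro x ⟨h1, h2, h3, h4⟩
    by_contra hcon
    rcases lt_or_eq_of_le (not_lt.1 hcon) with h5 | h5
    · exact h4 (hFm (σ x) (by rw [hneg]; linarith) (by rwa [hσ]))
    · rw [h0 x h5] at h4; exact h4 h1
  have hpm := pol_meas σ hh hA
  have hdiff : ∀ T : Set V, MeasurableSet T → volume (T ∩ B ∩ {x | h x < 0}) = volume (σ ⁻¹' T ∩ (B ∩ {x | 0 < h x})) := by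
    intro T hT
    rw [← hμσ _ ((hT.inter hB).inter m2)]
    congr 1; ext x
    simp only [mem_preimage, mem_inter_iff, hBσ, mem_setOf_eq, hneg, Left.neg_neg_iff, and_assoc]
  rw [three_split hh (symmDiff (pol σ h A) F ∩ B), three_split hh (symmDiff A F ∩ B), hdiff _ (hpm.symmDiff hF),
    hdiff _ (hA.symmDiff hF), inter_assoc, inter_assoc (symmDiff A F)]
  have e0 : symmDiff (pol σ h A) F ∩ B ∩ {x | h x = 0} = symmDiff A F ∩ B ∩ {x | h x = 0} := by
    ext x
    simp only [mem_inter_iff, mem_setOf_eq, mem_symmDiff]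
    have : h x = 0 → (x ∈ pol σ h A ↔ x ∈ A) := by
      intro h3
      simp [pol, h3, h0 x h3]
    tauto
  have hgB : g ∩ B = g ∩ (B ∩ {x | 0 < h x}) := by
    ext x; simp only [mem_inter_iff, mem_setOf_eq]
    constructor
    · rintro ⟨h1, h2⟩; exact ⟨h1, h2, hgpos x h1⟩
    · tauto
  set R := B ∩ {x | 0 < h x} with hR
  have hRm : MeasurableSet R := hB.inter m1
  have hcomb : ∀ x ∈ R, (x ∈ pol σ h A ↔ (x ∈ A ∨ σ x ∈ A)) ∧ (σ x ∈ pol σ h A ↔ (x ∈ A ∧ σ x ∈ A)) := by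
    rintro x ⟨_, hx⟩
    have hx : 0 < h x := hx
    have hx2 : ¬ h x ≤ 0 := not_le.2 hx
    have hx3 : h (σ x) ≤ 0 := by rw [hneg]; linarith
    have hx4 : ¬ 0 < h (σ x) := not_lt.2 hx3
    simp only [pol, mem_setOf_eq, hx, hx2, hx3, hx4, hσ, true_and, false_and, or_false, false_or, true_and]
    tauto
  set P1 := symmDiff (pol σ h A) F ∩ R
  set P2 := σ ⁻¹' symmDiff (pol σ h A) F ∩ R
  set Q1 := symmDiff A F ∩ R
  set Q2 := σ ⁻¹' symmDiff A F ∩ R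
  have mP1 : MeasurableSet P1 := (hpm.symmDiff hF).inter hRm
  have mP2 : MeasurableSet P2 := (σ.continuous.measurable (hpm.symmDiff hF)).inter hRm
  have mQ1 : MeasurableSet Q1 := (hA.symmDiff hF).inter hRm
  have mQ2 : MeasurableSet Q2 := (σ.continuous.measurable (hA.symmDiff hF)).inter hRm
  have mg : MeasurableSet (g ∩ R) := hgm.inter hRm
  have main : volume P1 + volume P2 + 2 * volume (g ∩ R) ≤ volume Q1 + volume Q2 := by
    have hi : ∀ T : Set V, MeasurableSet T → volume T = ∫⁻ x, T.indicator 1 x := fun T hT => (lintegral_indicator_one hT).symm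
    have mi : ∀ T : Set V, MeasurableSet T → Measurable (T.indicator (1 : V → ℝ≥0∞)) := fun T hT => measurable_one.indicator hT
    rw [hi _ mP1, hi _ mP2, hi _ mQ1, hi _ mQ2, hi _ mg, ← lintegral_const_mul _ (mi _ mg), ← lintegral_add_left (mi _ mP1),
      ← lintegral_add_left (mi _ mQ1), ← lintegral_add_left (f := fun a => P1.indicator 1 a + P2.indicator 1 a) ((mi _ mP1).add (mi _ mP2))]
    refine lintegral_mono fun x => ?_
    by_cases hxR : x ∈ R
    · obtain ⟨c1, c2⟩ := hcomb x hxR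
      have c3 := hFm x hxR.2
      have a1 : x ∈ P1 ↔ ¬ ((x ∈ A ∨ σ x ∈ A) ↔ x ∈ F) := by
        simp only [P1, mem_inter_iff, mem_symmDiff, hxR, and_true, c1]; exact xor_aux _ _
      have a2 : x ∈ P2 ↔ ¬ ((x ∈ A ∧ σ x ∈ A) ↔ σ x ∈ F) := by
        simp only [P2, mem_inter_iff, mem_preimage, mem_symmDiff, hxR, and_true, c2]; exact xor_aux _ _
      have a3 : x ∈ Q1 ↔ ¬ (x ∈ A ↔ x ∈ F) := by
        simp only [Q1, mem_inter_iff, mem_symmDiff, hxR, and_true]; exact xor_aux _ _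
      have a4 : x ∈ Q2 ↔ ¬ (σ x ∈ A ↔ σ x ∈ F) := by
        simp only [Q2, mem_inter_iff, mem_preimage, mem_symmDiff, hxR, and_true]; exact xor_aux _ _
      have a5 : x ∈ g ∩ R ↔ (x ∈ F ∧ x ∉ A ∧ σ x ∈ A ∧ σ x ∉ F) := by
        simp only [hg, mem_inter_iff, hxR, and_true, mem_setOf_eq]
      simp only [indicator_apply, Pi.one_apply]
      exact @ite_key _ _ _ _ c3 _ _ _ _ _ (_) (_) (_) (_) (_) a1 a2 a3 a4 a5
    · have a1 : x ∉ P1 := fun hx => hxR hx.2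
      have a2 : x ∉ P2 := fun hx => hxR hx.2
      have a5 : x ∉ g ∩ R := fun hx => hxR hx.2
      simp [a1, a2, a5]
  rw [e0, hgB]
  calc _ = (volume P1 + volume P2 + 2 * volume (g ∩ R)) + volume (symmDiff A F ∩ B ∩ {x | h x = 0}) := by ring
    _ ≤ _ := by gcongr

end A13

section A14
variable {Y : Type*} [NormedAddCommGroup Y] [InnerProductSpace ℝ Y] [FiniteDimensional ℝ Y]
  [MeasurableSpace Y] [BorelSpace Y]

/-- the ambient space `ℂ × Y` with the Euclidean structure -/
abbrev CV (Y : Type*) := WithLp 2 (ℂ × Y)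

/-- the base projection -/
noncomputable def cpi (x : CV Y) : ℝ × Y := (‖x.fst‖, x.snd)

/-- a plane isometry acting on the first factor -/
noncomputable def prodL (e : ℂ ≃ₗᵢ[ℝ] ℂ) : CV Y ≃ₗᵢ[ℝ] CV Y where
  toLinearEquiv := (WithLp.linearEquiv 2 ℝ (ℂ × Y)).trans
    ((e.toLinearEquiv.prodCongr (LinearEquiv.refl ℝ Y)).trans (WithLp.linearEquiv 2 ℝ (ℂ × Y)).symm)
  norm_map' := by
    intro x
    rw [← sq_eq_sq₀ (norm_nonneg _) (norm_nonneg _), WithLp.prod_norm_sq_eq_of_L2, WithLp.prod_norm_sq_eq_of_L2]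
    simp

lemma prodL_apply (e : ℂ ≃ₗᵢ[ℝ] ℂ) (x : CV Y) : prodL e x = WithLp.toLp 2 (e x.fst, x.snd) := rfl

noncomputable def rotL (c : Circle) : CV Y ≃ₗᵢ[ℝ] CV Y := prodL (rotation c)
noncomputable def sigL (c : Circle) : CV Y ≃ₗᵢ[ℝ] CV Y := prodL (Complex.conjLIE.trans (rotation c))

lemma cv_ext {x y : CV Y} (h1 : x.fst = y.fst) (h2 : x.snd = y.snd) : x = y :=
  WithLp.ofLp_injective 2 (Prod.ext h1 h2)

lemma rotL_apply (c : Circle) (x : CV Y) :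
    rotL c x = WithLp.toLp 2 (Circle.coeHom c * x.fst, x.snd) := rfl
lemma sigL_apply (c : Circle) (x : CV Y) :
    sigL c x = WithLp.toLp 2 (Circle.coeHom c * (starRingEnd ℂ) x.fst, x.snd) := rfl

lemma cpi_rotL (c : Circle) (x : CV Y) : cpi (rotL c x) = cpi x := by
  have h : ‖Circle.coeHom c‖ = 1 := Circle.norm_coe c
  simp [cpi, rotL_apply, h]
lemma cpi_sigL (c : Circle) (x : CV Y) : cpi (sigL c x) = cpi x := by
  have h : ‖Circle.coeHom c‖ = 1 := Circle.norm_coe c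
  simp [cpi, sigL_apply, h]

lemma cpi_cont : Continuous (cpi (Y := Y)) := by
  unfold cpi; fun_prop

lemma sigL_sigL (c : Circle) (x : CV Y) : sigL c (sigL c x) = x := by
  refine cv_ext ?_ rfl
  have : (c:ℂ) * (starRingEnd ℂ) ((c:ℂ) * (starRingEnd ℂ) x.fst) = x.fst := by
    rw [map_mul, Complex.conj_conj, ← mul_assoc, Complex.mul_conj, Circle.normSq_coe]; simp
  exact this

lemma toCircle_surj (c : Circle) : ∃ s : UnitAddCircle, AddCircle.toCircle s = c := by
  obtain ⟨s, hs⟩ := (AddCircle.homeomorphCircle one_ne_zero).surjective c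
  exact ⟨s, by rw [← hs, AddCircle.homeomorphCircle_apply]⟩

/-- section of the base projection -/
noncomputable def csec (p : ℝ × Y) : CV Y := WithLp.toLp 2 ((p.1 : ℂ), p.2)

lemma csec_cont : Continuous (csec (Y := Y)) := by
  unfold csec; fun_prop

lemma exists_rot (x : CV Y) : ∃ s : UnitAddCircle, x = rotL (AddCircle.toCircle s) (csec (cpi x)) := by
  by_cases hz : x.fst = 0
  · refine ⟨0, ?_⟩
    rw [rotL_apply]
    refine cv_ext ?_ ?_ <;> simp [csec, cpi, hz]
  · have hn : ‖x.fst‖ ≠ 0 := norm_ne_zero_iff.2 hz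
    obtain ⟨s, hs⟩ := toCircle_surj ⟨x.fst / ‖x.fst‖, by
      rw [Submonoid.unitSphere, ]; simp [hn]⟩
    refine ⟨s, ?_⟩
    rw [rotL_apply, hs]
    refine cv_ext ?_ rfl
    have : x.fst / (‖x.fst‖:ℂ) * (‖x.fst‖:ℂ) = x.fst := div_mul_cancel₀ _ (by exact_mod_cast hn)
    exact this.symm

lemma rotL_mul (s t : UnitAddCircle) (x : CV Y) :
    rotL (AddCircle.toCircle s) (rotL (AddCircle.toCircle t) x) = rotL (AddCircle.toCircle (s + t)) x := by
  simp [rotL_apply, AddCircle.toCircle_add, mul_assoc]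

/-- circular averages -/
noncomputable def cavg (A : Set (CV Y)) (x : CV Y) : ℝ≥0∞ :=
  volume {s : UnitAddCircle | rotL (AddCircle.toCircle s) x ∈ A}

lemma rot_joint : Continuous fun z : CV Y × UnitAddCircle => rotL (AddCircle.toCircle z.2) z.1 := by
  simp only [rotL_apply]
  have := AddCircle.continuous_toCircle (T := 1)
  fun_prop

lemma sig_joint : Continuous fun z : CV Y × UnitAddCircle => sigL (AddCircle.toCircle z.2) z.1 := by
  simp only [sigL_apply]
  have := AddCircle.continuous_toCircle (T := 1)
  have h2 : Continuous (starRingEnd ℂ) := Complex.continuous_conj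
  fun_prop

lemma cavg_le_one (A : Set (CV Y)) (x : CV Y) : cavg A x ≤ 1 :=
  (measure_mono (subset_univ _)).trans (by simp)

lemma cavg_meas {A : Set (CV Y)} (hA : MeasurableSet A) : Measurable (cavg A) :=
  measurable_measure_prodMk_left (rot_joint.measurable hA)

lemma cavg_rot (A : Set (CV Y)) (t : UnitAddCircle) (x : CV Y) :
    cavg A (rotL (AddCircle.toCircle t) x) = cavg A x := by
  unfold cavg
  simp_rw [rotL_mul]
  exact measure_preimage_add_right (volume : Measure UnitAddCircle) t {s | rotL (AddCircle.toCircle s) x ∈ A}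

lemma cavg_sec (A : Set (CV Y)) (x : CV Y) : cavg A x = cavg A (csec (cpi x)) := by
  obtain ⟨s, hs⟩ := exists_rot x
  conv_lhs => rw [hs]
  exact cavg_rot A s _

lemma cavg_congr (A : Set (CV Y)) {x y : CV Y} (h : cpi x = cpi y) : cavg A x = cavg A y := by
  rw [cavg_sec A x, cavg_sec A y, h]

lemma cavg_sig (A : Set (CV Y)) (x : CV Y) :
    volume {s : UnitAddCircle | sigL (AddCircle.toCircle s) x ∈ A} = cavg A x := by
  have : ∀ s : UnitAddCircle, sigL (AddCircle.toCircle s) x = rotL (AddCircle.toCircle s) (sigL 1 x) := by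
    intro s; simp [rotL_apply, sigL_apply]
  simp_rw [this]
  exact cavg_congr A (cpi_sigL 1 x)

lemma lint_rot {f : CV Y → ℝ≥0∞} (hf : Measurable f) :
    ∫⁻ x, f x = ∫⁻ x, ∫⁻ s : UnitAddCircle, f (rotL (AddCircle.toCircle s) x) := by
  rw [lintegral_lintegral_swap (f := fun x s => f (rotL (AddCircle.toCircle s) x)) (hf.comp rot_joint.measurable).aemeasurable]
  have : ∀ s : UnitAddCircle, ∫⁻ x, f (rotL (AddCircle.toCircle s) x) = ∫⁻ x, f x := fun s =>
    (rotL (AddCircle.toCircle s)).measurePreserving.lintegral_comp hf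
  simp [this]

lemma lint_cyl {A : Set (CV Y)} (hA : MeasurableSet A) {g : ℝ × Y → ℝ≥0∞} (hg : Measurable g) :
    ∫⁻ x in A, g (cpi x) = ∫⁻ x, cavg A x * g (cpi x) := by
  rw [← lintegral_indicator hA, lint_rot (f := A.indicator fun x => g (cpi x)) ((hg.comp cpi_cont.measurable).indicator hA)]
  refine lintegral_congr fun x => ?_
  have h1 : ∀ s : UnitAddCircle, A.indicator (fun x => g (cpi x)) (rotL (AddCircle.toCircle s) x)
      = {s : UnitAddCircle | rotL (AddCircle.toCircle s) x ∈ A}.indicator (fun _ => g (cpi x)) s := by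
    intro s
    by_cases h : rotL (AddCircle.toCircle s) x ∈ A
    · rw [indicator_of_mem h, indicator_of_mem (by exact h), cpi_rotL]
    · rw [indicator_of_notMem h, indicator_of_notMem (by exact h)]
  have hm : MeasurableSet {s : UnitAddCircle | rotL (AddCircle.toCircle s) x ∈ A} :=
    (rot_joint.comp (Continuous.prodMk_right x)).measurable hA
  simp_rw [h1]
  rw [lintegral_indicator hm, setLIntegral_const, mul_comm]
  rfl

lemma vol_cyl {A : Set (CV Y)} (hA : MeasurableSet A) {b : Set (ℝ × Y)} (hb : MeasurableSet b) :
    volume (A ∩ cpi ⁻¹' b) = ∫⁻ x in cpi ⁻¹' b, cavg A x := by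
  have hB : MeasurableSet (cpi ⁻¹' b : Set (CV Y)) := cpi_cont.measurable hb
  have := lint_cyl hA (g := b.indicator 1) (measurable_one.indicator hb)
  rw [← lintegral_indicator hB]
  have h1 : ∀ x, (cpi ⁻¹' b).indicator (fun x => cavg A x) x = cavg A x * b.indicator 1 (cpi x) := by
    intro x; by_cases h : cpi x ∈ b <;> simp [h]
  simp_rw [h1]
  rw [← this]
  have h2 : ∀ x : CV Y, b.indicator (1 : ℝ × Y → ℝ≥0∞) (cpi x) = (cpi ⁻¹' b).indicator 1 x := fun x => rfl
  simp_rw [h2]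
  rw [lintegral_indicator_one hB, Measure.restrict_apply hB, inter_comm]

lemma gain_int {P Q : Set (CV Y)} (hP : MeasurableSet P) (hQ : MeasurableSet Q) {b : Set (ℝ × Y)} (hb : MeasurableSet b) :
    ∫⁻ s : UnitAddCircle, volume ({x | x ∈ P ∧ sigL (AddCircle.toCircle s) x ∈ Q} ∩ cpi ⁻¹' b) =
      ∫⁻ x in cpi ⁻¹' b, cavg P x * cavg Q x := by
  have hB : MeasurableSet (cpi ⁻¹' b : Set (CV Y)) := cpi_cont.measurable hb
  have hZ : MeasurableSet {z : CV Y × UnitAddCircle | z.1 ∈ P ∩ cpi ⁻¹' b ∧ sigL (AddCircle.toCircle z.2) z.1 ∈ Q} :=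
    (measurable_fst (hP.inter hB)).inter (sig_joint.measurable hQ)
  have e1 : ∫⁻ s : UnitAddCircle, volume ({x | x ∈ P ∧ sigL (AddCircle.toCircle s) x ∈ Q} ∩ cpi ⁻¹' b) =
      (volume.prod volume) {z : CV Y × UnitAddCircle | z.1 ∈ P ∩ cpi ⁻¹' b ∧ sigL (AddCircle.toCircle z.2) z.1 ∈ Q} := by
    rw [Measure.prod_apply_symm hZ]
    refine lintegral_congr fun s => ?_
    congr 1; ext x; simp only [mem_inter_iff, mem_setOf_eq, mem_preimage]; tauto
  rw [e1, Measure.prod_apply hZ]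
  have hgm : Measurable fun p : ℝ × Y => b.indicator (fun p => cavg Q (csec p)) p :=
    ((cavg_meas hQ).comp csec_cont.measurable).indicator hb
  have e2 := lint_cyl hP hgm
  have e3 : ∀ x : CV Y, volume (Prod.mk x ⁻¹' {z : CV Y × UnitAddCircle | z.1 ∈ P ∩ cpi ⁻¹' b ∧ sigL (AddCircle.toCircle z.2) z.1 ∈ Q})
      = P.indicator (fun x => b.indicator (fun p => cavg Q (csec p)) (cpi x)) x := by
    intro x
    by_cases h1 : x ∈ P <;> by_cases h2 : cpi x ∈ b
    · simp only [mem_inter_iff, preimage_setOf_eq, h1, h2, true_and, mem_preimage, indicator_of_mem, ← cavg_sec]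
      exact cavg_sig Q x
    · simp [h1, h2]
    · simp [h1, h2]
    · simp [h1, h2]
  simp_rw [e3]
  rw [lintegral_indicator hP, e2, ← lintegral_indicator hB]
  refine lintegral_congr fun x => ?_
  by_cases h2 : cpi x ∈ b
  · simp [h2, ← cavg_sec]
  · simp [h2]

/-- the height function of the reflection `sigL c` -/
noncomputable def sigh (c : Circle) (x : CV Y) : ℝ := x.fst.re - (sigL c x).fst.re

lemma sigh_cont (c : Circle) : Continuous (sigh (Y := Y) c) := by
  have h1 : Continuous fun x : CV Y => x.fst := by fun_prop
  have h2 : Continuous fun x : CV Y => (sigL c x).fst := h1.comp (sigL c).continuous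
  exact (Complex.continuous_re.comp h1).sub (Complex.continuous_re.comp h2)

lemma sigh_neg (c : Circle) (x : CV Y) : sigh c (sigL c x) = - sigh c x := by
  unfold sigh; rw [sigL_sigL]; ring

lemma sigh_zero {c : Circle} (hc : c ≠ 1) (x : CV Y) (h : sigh c x = 0) : sigL c x = x := by
  refine cv_ext ?_ rfl
  have hre : x.fst.re = (sigL c x).fst.re := sub_eq_zero.1 h
  have hn : ‖(sigL c x).fst‖ = ‖x.fst‖ := congrArg Prod.fst (cpi_sigL c x)
  have hsq : (sigL c x).fst.im ^ 2 = x.fst.im ^ 2 := by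
    have h1 := Complex.sq_norm (sigL c x).fst
    have h2 := Complex.sq_norm x.fst
    rw [Complex.normSq_apply] at h1 h2
    rw [hn, h2, ← hre] at h1
    nlinarith
  rcases sq_eq_sq_iff_eq_or_eq_neg.1 hsq with h1 | h1
  · exact Complex.ext hre.symm h1
  · have h2 : (sigL c x).fst = (starRingEnd ℂ) x.fst := Complex.ext hre.symm h1
    have h3 : (c:ℂ) * (starRingEnd ℂ) x.fst = (starRingEnd ℂ) x.fst := h2
    by_cases hz : (starRingEnd ℂ) x.fst = 0
    · have : x.fst = 0 := by simpa using hz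
      rw [h2, hz, this]
    · exfalso; apply hc
      have : (c:ℂ) = 1 := mul_right_cancel₀ hz (h3.trans (one_mul _).symm)
      exact Circle.ext this

lemma cavg_ae_eq {P Q : Set (CV Y)} (hP : MeasurableSet P) (hQ : MeasurableSet Q) {b : Set (ℝ × Y)}
    (hb : MeasurableSet b) (hfin : volume (cpi ⁻¹' b : Set (CV Y)) ≠ ⊤)
    (h : ∀ b' : Set (ℝ × Y), MeasurableSet b' → b' ⊆ b → volume (P ∩ cpi ⁻¹' b') = volume (Q ∩ cpi ⁻¹' b')) :
    ∀ᵐ x ∂(volume.restrict (cpi ⁻¹' b : Set (CV Y))), cavg P x = cavg Q x := by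
  have hB : MeasurableSet (cpi ⁻¹' b : Set (CV Y)) := cpi_cont.measurable hb
  set ν := (volume.restrict (cpi ⁻¹' b : Set (CV Y))).map cpi with hν
  have : IsFiniteMeasure (volume.restrict (cpi ⁻¹' b : Set (CV Y))) := ⟨by
    rw [Measure.restrict_apply_univ]; exact hfin.lt_top⟩
  have hmP : Measurable fun p => cavg P (csec p) := (cavg_meas hP).comp csec_cont.measurable
  have hmQ : Measurable fun p => cavg Q (csec p) := (cavg_meas hQ).comp csec_cont.measurable
  have key : ∀ {R : Set (CV Y)}, MeasurableSet R → ∀ b' : Set (ℝ × Y), MeasurableSet b' →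
      ∫⁻ p in b', cavg R (csec p) ∂ν = volume (R ∩ cpi ⁻¹' (b' ∩ b)) := by
    intro R hR b' hb'
    rw [hν, setLIntegral_map (f := fun p => cavg R (csec p)) hb' ((cavg_meas hR).comp csec_cont.measurable) cpi_cont.measurable,
      vol_cyl hR (hb'.inter hb), Measure.restrict_restrict (cpi_cont.measurable hb'), preimage_inter]
    simp_rw [← cavg_sec]
  have hae : (fun p => cavg P (csec p)) =ᵐ[ν] fun p => cavg Q (csec p) := by
    refine ae_eq_of_forall_setLIntegral_eq_of_sigmaFinite hmP hmQ ?_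
    intro b' hb' _
    rw [key hP b' hb', key hQ b' hb']
    exact h _ (hb'.inter hb) inter_subset_right
  have := ae_of_ae_map cpi_cont.measurable.aemeasurable hae
  filter_upwards [this] with x hx
  rw [cavg_sec P, cavg_sec Q]; exact hx

lemma symm_split (A F : Set (CV Y)) (hA : MeasurableSet A) (hF : MeasurableSet F) {B : Set (CV Y)}
    (hB : MeasurableSet B) :
    volume (symmDiff A F ∩ B) = volume ((A \ F) ∩ B) + volume ((F \ A) ∩ B) := by
  rw [← measure_union _ ((hF.diff hA).inter hB)]
  · congr 1; ext x; simp only [Set.mem_symmDiff, mem_inter_iff, mem_union, mem_diff]; tauto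
  · rw [Set.disjoint_left]; rintro x ⟨⟨h1, h2⟩, _⟩ ⟨⟨h3, _⟩, _⟩; exact h2 h3

lemma diff_cyl {A F : Set (CV Y)} (hA : MeasurableSet A) (hF : MeasurableSet F) {b : Set (ℝ × Y)}
    (hfin : volume (cpi ⁻¹' b : Set (CV Y)) ≠ ⊤)
    (h : ∀ b' : Set (ℝ × Y), MeasurableSet b' → volume (A ∩ cpi ⁻¹' b') = volume (F ∩ cpi ⁻¹' b')) :
    ∀ b' : Set (ℝ × Y), MeasurableSet b' → b' ⊆ b → volume ((F \ A) ∩ cpi ⁻¹' b') = volume ((A \ F) ∩ cpi ⁻¹' b') := by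
  intro b' hb' hs
  have e1 : volume ((A ∩ F) ∩ cpi ⁻¹' b') + volume ((A \ F) ∩ cpi ⁻¹' b') = volume (A ∩ cpi ⁻¹' b') := by
    rw [← measure_inter_add_diff (A ∩ cpi ⁻¹' b') hF]
    congr 2 <;> (ext x; simp only [mem_inter_iff, mem_diff]; tauto)
  have e2 : volume ((A ∩ F) ∩ cpi ⁻¹' b') + volume ((F \ A) ∩ cpi ⁻¹' b') = volume (F ∩ cpi ⁻¹' b') := by
    rw [← measure_inter_add_diff (F ∩ cpi ⁻¹' b') hA]
    congr 2 <;> (ext x; simp only [mem_inter_iff, mem_diff]; tauto)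
  have hf : volume ((A ∩ F) ∩ cpi ⁻¹' b' : Set (CV Y)) ≠ ⊤ :=
    ne_top_of_le_ne_top hfin (measure_mono (inter_subset_right.trans (preimage_mono hs)))
  have h' := h b' hb'
  rw [← e1, ← e2] at h'
  exact ((ENNReal.add_right_inj hf).1 h').symm

lemma gain_lower {A F : Set (CV Y)} (hA : MeasurableSet A) (hF : MeasurableSet F) {b : Set (ℝ × Y)}
    (hb : MeasurableSet b) (hfin : volume (cpi ⁻¹' b : Set (CV Y)) ≠ ⊤)
    (h : ∀ b' : Set (ℝ × Y), MeasurableSet b' → volume (A ∩ cpi ⁻¹' b') = volume (F ∩ cpi ⁻¹' b'))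
    {l : ℝ≥0∞} :
    l * volume (symmDiff A F ∩ cpi ⁻¹' b) ≤ 2 * ((∫⁻ x in cpi ⁻¹' b, cavg (F \ A) x * cavg (A \ F) x) + l * l * volume (cpi ⁻¹' b : Set (CV Y))) := by
  have hB : MeasurableSet (cpi ⁻¹' b : Set (CV Y)) := cpi_cont.measurable hb
  have hPQ := diff_cyl hA hF hfin h
  have hae := cavg_ae_eq (hF.diff hA) (hA.diff hF) hb hfin hPQ
  have e1 : volume (symmDiff A F ∩ cpi ⁻¹' b) = 2 * ∫⁻ x in cpi ⁻¹' b, cavg (F \ A) x := by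
    rw [symm_split A F hA hF hB, ← hPQ b hb le_rfl, vol_cyl (hF.diff hA) hb, two_mul]
  have e2 : ∫⁻ x in cpi ⁻¹' b, cavg (F \ A) x * cavg (A \ F) x = ∫⁻ x in cpi ⁻¹' b, cavg (F \ A) x * cavg (F \ A) x :=
    lintegral_congr_ae (hae.mono fun x hx => by simp only [hx])
  rw [e1, e2, mul_left_comm]
  refine mul_le_mul_right ?_ 2
  rw [← setLIntegral_const, ← lintegral_add_right _ measurable_const,
    ← lintegral_const_mul _ (cavg_meas (hF.diff hA))]
  refine lintegral_mono fun x => ?_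
  rcases le_total l (cavg (F \ A) x) with h1 | h1
  · exact (mul_le_mul_left h1 _).trans le_self_add
  · exact (mul_le_mul_right h1 _).trans le_add_self

variable {m : ℕ}

/-- monotone rearranged sets -/
def CMono (F : Set (CV Y)) : Prop := ∀ x y : CV Y, cpi x = cpi y → x.fst.re ≤ y.fst.re → x ∈ F → y ∈ F

/-- admissible competitors -/
def CAdm (m : ℕ) (E F A : Set (CV Y)) : Prop := MeasurableSet A ∧
  (∀ b' : Set (ℝ × Y), MeasurableSet b' → volume (A ∩ cpi ⁻¹' b') = volume (F ∩ cpi ⁻¹' b')) ∧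
  (∀ b' : Set (ℝ × Y), MeasurableSet b' → μHE[m] (eB (m+1) A ∩ cpi ⁻¹' b') ≤ μHE[m] (eB (m+1) E ∩ cpi ⁻¹' b'))

lemma adm_step {E F A : Set (CV Y)} (hF : MeasurableSet F) (hFm : CMono F)
    (hA : CAdm m E F A) {b : Set (ℝ × Y)} (hb : MeasurableSet b)
    {g : ℝ≥0∞} (hg0 : g ≠ 0)
    (hg : g < ∫⁻ x in cpi ⁻¹' b, cavg (F \ A) x * cavg (A \ F) x) :
    ∃ A', CAdm m E F A' ∧ volume (symmDiff A' F ∩ cpi ⁻¹' b) + 2 * g ≤ volume (symmDiff A F ∩ cpi ⁻¹' b) := by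
  obtain ⟨hAm, hAv, hAp⟩ := hA
  rw [← gain_int (hF.diff hAm) (hAm.diff hF) hb] at hg
  obtain ⟨s, hs⟩ : ∃ s : UnitAddCircle, g < volume ({x | x ∈ F \ A ∧ sigL (AddCircle.toCircle s) x ∈ A \ F} ∩ cpi ⁻¹' b) := by
    by_contra hcon
    push Not at hcon
    refine absurd hg (not_lt.2 ?_)
    calc _ ≤ ∫⁻ s : UnitAddCircle, g := lintegral_mono hcon
      _ = g := by simp
  set c := AddCircle.toCircle s with hc
  have hc1 : c ≠ 1 := by
    intro h1
    have : {x : CV Y | x ∈ F \ A ∧ sigL c x ∈ A \ F} ∩ cpi ⁻¹' b = ∅ := by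
      rw [eq_empty_iff_forall_notMem]
      rintro x ⟨⟨⟨h2, _⟩, _, h3⟩, _⟩
      apply h3
      refine hFm x _ (cpi_sigL c x).symm (le_of_eq ?_) h2
      rw [h1]; change _ = ((1:ℂ) * (starRingEnd ℂ) x.fst).re; simp
    rw [this] at hs
    simp at hs
  have hinv : ∀ b' : Set (ℝ × Y), ∀ x : CV Y, sigL c x ∈ (cpi ⁻¹' b' : Set (CV Y)) ↔ x ∈ (cpi ⁻¹' b' : Set (CV Y)) := by
    intro b' x; rw [mem_preimage, cpi_sigL, mem_preimage]
  have hcm : ∀ b' : Set (ℝ × Y), MeasurableSet b' → MeasurableSet (cpi ⁻¹' b' : Set (CV Y)) :=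
    fun b' hb' => cpi_cont.measurable hb'
  have hF' : ∀ x : CV Y, 0 < sigh c x → sigL c x ∈ F → x ∈ F := fun x hx hxF =>
    hFm _ x (cpi_sigL c x) (by unfold sigh at hx; linarith) hxF
  have k1 : ∀ x : CV Y, sigL c (sigL c x) = x := sigL_sigL c
  have k2 := sigh_cont (Y := Y) c
  have k3 : ∀ x : CV Y, sigh c (sigL c x) = - sigh c x := sigh_neg c
  have k4 : ∀ x : CV Y, sigh c x = 0 → sigL c x = x := fun x => sigh_zero hc1 x
  generalize hσ : (sigL c : CV Y ≃ₗᵢ[ℝ] CV Y) = σ at *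
  generalize hh' : (sigh c : CV Y → ℝ) = h at *
  refine ⟨pol σ h A, ⟨pol_meas σ k2 hAm, ?_, ?_⟩, ?_⟩
  · intro b' hb'
    exact (pol_vol σ k1 k2 k3 k4 hAm (hcm b' hb') (hinv b')).trans (hAv b' hb')
  · intro b' hb'
    exact (pol_perim σ k1 k2 k3 k4 (hcm b' hb') (hinv b')).trans (hAp b' hb')
  · have := pol_gain σ k1 k2 k3 k4 hAm hF hF' (hcm b hb) (hinv b)
    refine le_trans (add_le_add le_rfl (mul_le_mul_right (hs.le.trans (measure_mono ?_)) 2)) this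
    rintro x ⟨⟨⟨h1, h2⟩, h3, h4⟩, h5⟩
    exact ⟨⟨h1, h2, h3, h4⟩, h5⟩

lemma pol_approx {E F : Set (CV Y)} (hE : MeasurableSet E) (hF : MeasurableSet F) (hFm : CMono F)
    (hEF : ∀ b' : Set (ℝ × Y), MeasurableSet b' → volume (E ∩ cpi ⁻¹' b') = volume (F ∩ cpi ⁻¹' b'))
    {b : Set (ℝ × Y)} (hb : MeasurableSet b) (hfin : volume (cpi ⁻¹' b : Set (CV Y)) ≠ ⊤) {η : ℝ≥0} (hη : 0 < η) :
    ∃ A, CAdm m E F A ∧ volume (symmDiff A F ∩ cpi ⁻¹' b) ≤ η := by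
  by_contra hcon
  push Not at hcon
  set D : Set (CV Y) → ℝ≥0∞ := fun A => volume (symmDiff A F ∩ cpi ⁻¹' b) with hD
  obtain ⟨V, hV⟩ : ∃ V : ℝ≥0, volume (cpi ⁻¹' b : Set (CV Y)) = V := ⟨_, (ENNReal.coe_toNNReal hfin).symm⟩
  set l : ℝ≥0 := η / (4 * (V + 1)) with hl
  have hlpos : 0 < l := by positivity
  set g : ℝ≥0 := l * η / 8 with hg
  have hgpos : 0 < g := by positivity
  have hgl : ∀ A, CAdm m E F A → (g:ℝ≥0∞) < ∫⁻ x in cpi ⁻¹' b, cavg (F \ A) x * cavg (A \ F) x := by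
    intro A hA
    by_contra hle
    push Not at hle
    have h1 := gain_lower hA.1 hF hb hfin hA.2.1 (l := l)
    have h2 : (l:ℝ≥0∞) * η ≤ 2 * (g + l * l * V) := by
      rw [← hV]
      exact (mul_le_mul_right (hcon A hA).le _).trans (h1.trans (by gcongr))
    have h3 : l * η ≤ 2 * (g + l * l * V) := by exact_mod_cast h2
    have h4 : l * V ≤ η / 4 := by
      rw [hl, div_mul_eq_mul_div, div_le_div_iff₀ (by positivity) (by positivity)]
      have : (0:ℝ≥0) ≤ η := hη.le
      calc η * V * 4 = η * (4 * V) := by ring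
        _ ≤ η * (4 * (V+1)) := by gcongr; exact le_self_add
    have h5 : l * l * V ≤ l * η / 4 := by
      calc l * l * V = l * (l * V) := by ring
        _ ≤ l * (η / 4) := by gcongr
        _ = l * η / 4 := by ring
    have h6 : l * η ≤ 2 * (l * η / 8 + l * η / 4) := h3.trans (by gcongr)
    have h7 : 0 < l * η := by positivity
    have h8 : (l * η : ℝ) ≤ 2 * (l * η / 8 + l * η / 4) := by exact_mod_cast h6
    have h9 : (0:ℝ) < l * η := by exact_mod_cast h7
    linarith
  have hE0 : CAdm m E F E := ⟨hE, hEF, fun _ _ => le_rfl⟩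
  set d : ℝ≥0∞ := ⨅ A : {A // CAdm m E F A}, D A.1 with hd
  have hdle : ∀ A, CAdm m E F A → d ≤ D A := fun A hA => iInf_le (fun A : {A // CAdm m E F A} => D A.1) ⟨A, hA⟩
  have hDfin : ∀ A, D A ≠ ⊤ := fun A => ne_top_of_le_ne_top hfin (measure_mono inter_subset_right)
  have hdfin : d ≠ ⊤ := ne_top_of_le_ne_top (hDfin E) (hdle E hE0)
  have hlt : d < d + 2 * g := ENNReal.lt_add_right hdfin (by simp [hgpos.ne'])
  obtain ⟨⟨A, hA⟩, hA2⟩ := iInf_lt_iff.1 hlt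
  obtain ⟨A', hA', hle⟩ := adm_step hF hFm hA hb (by exact_mod_cast hgpos.ne') (hgl A hA)
  have := (add_le_add (hdle A' hA') le_rfl).trans hle
  exact absurd hA2 (not_lt.2 this)

lemma cyl_bdd (N : ℝ) (b : Set (ℝ × Y)) : volume (cpi ⁻¹' (b ∩ ball 0 N) : Set (CV Y)) ≠ ⊤ := by
  have : Bornology.IsBounded (cpi ⁻¹' (b ∩ ball 0 N) : Set (CV Y)) := by
    refine (Metric.isBounded_ball (x := (0:CV Y)) (r := 2 * N)).subset ?_
    rintro x ⟨_, hx⟩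
    rw [mem_ball_zero_iff, Prod.norm_def, max_lt_iff] at hx
    have h1 : ‖x.fst‖ < N := by simpa [cpi] using hx.1
    have h2 : ‖x.snd‖ < N := hx.2
    rw [mem_ball_zero_iff]
    have h3 := WithLp.prod_norm_sq_eq_of_L2 x
    refine abs_lt_of_sq_lt_sq' ?_ ?_ |>.2
    · have := norm_nonneg x.fst; have := norm_nonneg x.snd
      rw [h3]; nlinarith
    · have := norm_nonneg x.fst; linarith
  exact this.measure_lt_top.ne

lemma cyl_open_le (hV : Module.finrank ℝ (CV Y) = m+1) {E F : Set (CV Y)} (hE : MeasurableSet E) (hF : MeasurableSet F) (hFm : CMono F)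
    (hEF : ∀ b' : Set (ℝ × Y), MeasurableSet b' → volume (E ∩ cpi ⁻¹' b') = volume (F ∩ cpi ⁻¹' b'))
    (hPF : μHE[m] (eB (m+1) F) ≠ ⊤)
    {o : Set (ℝ × Y)} (ho : IsOpen o) (hfin : volume (cpi ⁻¹' o : Set (CV Y)) ≠ ⊤) :
    μHE[m] (eB (m+1) F ∩ cpi ⁻¹' o) ≤ μHE[m] (eB (m+1) E ∩ cpi ⁻¹' o) := by
  refine le_of_forall_lt fun c hc => ?_
  obtain ⟨c', hc1, hc2⟩ := exists_between hc
  have hcfin : c' ≠ ⊤ := (hc2.trans_le le_top).ne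
  obtain ⟨η, hη, h⟩ := lsc hV hF (ho.preimage cpi_cont)
    (ne_top_of_le_ne_top hPF (measure_mono inter_subset_left)) hc2
  obtain ⟨A, hA, hA2⟩ := pol_approx (m := m) hE hF hFm hEF ho.measurableSet hfin hη
  exact hc1.trans_le ((h A hA.1 hA2).trans (hA.2.2 o ho.measurableSet))

theorem cyl_eq (hV : Module.finrank ℝ (CV Y) = m+1) {E F : Set (CV Y)} (hE : MeasurableSet E) (hF : MeasurableSet F) (hFm : CMono F)
    (hEF : ∀ b' : Set (ℝ × Y), MeasurableSet b' → volume (E ∩ cpi ⁻¹' b') = volume (F ∩ cpi ⁻¹' b'))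
    (hPE : μHE[m] (eB (m+1) E) ≠ ⊤) (hPF : μHE[m] (eB (m+1) F) = μHE[m] (eB (m+1) E))
    {b : Set (ℝ × Y)} (hb : MeasurableSet b) :
    μHE[m] (eB (m+1) F ∩ cpi ⁻¹' b) = μHE[m] (eB (m+1) E ∩ cpi ⁻¹' b) := by
  set M : Set (CV Y) → Measure (ℝ × Y) := fun G => ((μHE[m]).restrict (eB (m+1) G)).map cpi with hM
  have hMa : ∀ G (b : Set (ℝ × Y)), MeasurableSet b → M G b = μHE[m] (eB (m+1) G ∩ cpi ⁻¹' b) := by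
    intro G b hb
    rw [hM]
    simp only
    rw [Measure.map_apply cpi_cont.measurable hb, Measure.restrict_apply (cpi_cont.measurable hb), inter_comm]
  have hfE : IsFiniteMeasure (M E) := ⟨by rw [hMa E _ MeasurableSet.univ]; simpa using hPE.lt_top⟩
  have hfF : IsFiniteMeasure (M F) := ⟨by rw [hMa F _ MeasurableSet.univ]; simpa [hPF] using hPE.lt_top⟩
  have hopen : ∀ o, IsOpen o → M F o ≤ M E o := by
    intro o ho
    have hu : o = ⋃ N : ℕ, o ∩ ball 0 N := by rw [← inter_iUnion, iUnion_ball_nat, inter_univ]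
    have hmono : Monotone fun N : ℕ => o ∩ ball (0 : ℝ × Y) N := fun a b hab =>
      inter_subset_inter_right _ (ball_subset_ball (by exact_mod_cast hab))
    rw [hu, hmono.measure_iUnion]
    refine iSup_le fun N => ?_
    refine le_trans ?_ (measure_mono (subset_iUnion _ N))
    have hoN : IsOpen (o ∩ ball (0 : ℝ × Y) N) := ho.inter isOpen_ball
    rw [hMa F _ hoN.measurableSet, hMa E _ hoN.measurableSet]
    exact cyl_open_le hV hE hF hFm hEF (hPF ▸ hPE) hoN (cyl_bdd _ _)
  have hle : ∀ b, M F b ≤ M E b := by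
    intro b
    rw [Set.measure_eq_iInf_isOpen b (M E)]
    refine le_iInf₂ fun o ho => le_iInf fun hoo => ?_
    exact (measure_mono ho).trans (hopen o hoo)
  rw [← hMa F b hb, ← hMa E b hb]
  refine le_antisymm (hle b) ?_
  have h1 := measure_add_measure_compl (μ := M E) hb
  have h2 := measure_add_measure_compl (μ := M F) hb
  have h3 : M E univ = M F univ := by
    rw [hMa E _ MeasurableSet.univ, hMa F _ MeasurableSet.univ]; simp [hPF]
  rw [← h1, ← h2] at h3
  by_contra hlt
  push Not at hlt
  have : M F b + M F bᶜ < M E b + M E bᶜ :=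
    ENNReal.add_lt_add_of_lt_of_le (measure_ne_top _ _) hlt (hle bᶜ)
  exact absurd h3 this.ne'

end A14

section A16

lemma LBL_of_strict {X Z : Type*} [NormedAddCommGroup X] [InnerProductSpace ℝ X] [FiniteDimensional ℝ X]
    [NormedAddCommGroup Z] [InnerProductSpace ℝ Z] [FiniteDimensional ℝ Z]
    [MeasurableSpace X] [BorelSpace X] [MeasurableSpace Z] [BorelSpace Z]
    (hd : Module.finrank ℝ X = Module.finrank ℝ Z) {f : X → Z} {f' : X →L[ℝ] Z} {x : X}
    (hf : HasStrictFDerivAt f f' x) (hinj : Function.Injective f') : LBL f x := by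
  have : CompleteSpace X := FiniteDimensional.complete ℝ X
  set e : X ≃L[ℝ] Z := (LinearEquiv.ofInjectiveOfFinrankEq (f' : X →ₗ[ℝ] Z) hinj hd).toContinuousLinearEquiv with he
  have hef : (e : X →L[ℝ] Z) = f' := by ext v; rfl
  rw [← hef] at hf
  obtain ⟨s, hxs, hs, hap⟩ := hf.approximates_deriv_on_open_nhds
  have hc : Subsingleton X ∨ ‖(e.symm : Z →L[ℝ] X)‖₊⁻¹ / 2 < ‖(e.symm : Z →L[ℝ] X)‖₊⁻¹ := by
    rcases e.subsingleton_or_nnnorm_symm_pos with h | h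
    · exact Or.inl h
    · exact Or.inr (NNReal.half_lt_self (inv_ne_zero h.ne'))
  have h1 := hap.lipschitz
  have h2 := hap.antilipschitz hc
  refine ⟨s, hs.mem_nhds hxs, max (‖(e : X →L[ℝ] Z)‖₊ + ‖(e.symm : Z →L[ℝ] X)‖₊⁻¹ / 2) (‖(e.symm : Z →L[ℝ] X)‖₊⁻¹ - ‖(e.symm : Z →L[ℝ] X)‖₊⁻¹ / 2)⁻¹, ?_, ?_, ?_⟩
  · exact fun a ha b hb => (h1.weaken (le_max_left _ _)) ⟨a, ha⟩ ⟨b, hb⟩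
  · intro a ha b hb
    refine (h2 ⟨a, ha⟩ ⟨b, hb⟩).trans ?_
    exact mul_le_mul_left (by exact_mod_cast le_max_right _ _) _
  · rw [← hf.map_nhds_eq_of_equiv]
    exact image_mem_map (hs.mem_nhds hxs)

variable {Y : Type*} [NormedAddCommGroup Y] [InnerProductSpace ℝ Y] [FiniteDimensional ℝ Y]
  [MeasurableSpace Y] [BorelSpace Y]

/-- the Euclidean base -/
abbrev PB (Y : Type*) := WithLp 2 (ℝ × Y)
/-- the polar parameter space -/
abbrev PV (Y : Type*) := WithLp 2 (PB Y × ℝ)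

noncomputable def psplit : OSplit (PB Y) (PV Y) where
  Φ := (WithLp.prodContinuousLinearEquiv 2 ℝ (PB Y) ℝ).symm
  norm_sq := by
    intro w t
    rw [WithLp.prodContinuousLinearEquiv_symm_apply, WithLp.prod_norm_sq_eq_of_L2]
    simp

lemma psplit_fst (w : PB Y) (t : ℝ) : (psplit.Φ (w, t)).fst = w := rfl
lemma psplit_snd (w : PB Y) (t : ℝ) : (psplit.Φ (w, t)).snd = t := rfl

/-- the unit circle parametrisation with period `1` -/
noncomputable def pe (t : ℝ) : ℂ := Complex.exp ((2 * Real.pi * t : ℝ) * Complex.I)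

lemma pe_norm (t : ℝ) : ‖pe t‖ = 1 := Complex.norm_exp_ofReal_mul_I _

lemma pe_toCircle (t : ℝ) : pe t = ((AddCircle.toCircle (t : UnitAddCircle) : Circle) : ℂ) := by
  rw [AddCircle.toCircle_apply_mk, Circle.coe_exp, pe]
  simp

lemma pe_add (s t : ℝ) : pe (s + t) = pe s * pe t := by
  unfold pe; rw [← Complex.exp_add]; congr 1; push_cast; ring

lemma pe_re (t : ℝ) : (pe t).re = Real.cos (2 * Real.pi * t) := Complex.exp_ofReal_mul_I_re _
lemma pe_im (t : ℝ) : (pe t).im = Real.sin (2 * Real.pi * t) := Complex.exp_ofReal_mul_I_im _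

lemma pe_deriv (t : ℝ) : HasDerivAt pe ((2 * Real.pi : ℝ) * (Complex.I * pe t)) t := by
  have h1 : HasDerivAt (fun t : ℝ => ((2 * Real.pi * t : ℝ) : ℂ) * Complex.I) ((2 * Real.pi : ℝ) * Complex.I) t := by
    have h := ((hasDerivAt_id t).const_mul (2 * Real.pi)).ofReal_comp
    simpa using h.mul_const Complex.I
  have := h1.cexp
  refine this.congr_deriv ?_
  change Complex.exp _ * _ = _ * (Complex.I * Complex.exp _)
  ring

lemma pe_contDiff : ContDiff ℝ 1 pe := by
  unfold pe
  have h : ContDiff ℝ 1 fun t : ℝ => ((2 * Real.pi * t : ℝ) : ℂ) :=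
    Complex.ofRealCLM.contDiff.comp (contDiff_const.mul contDiff_id)
  exact (h.mul contDiff_const).cexp

lemma pe_int (t : ℝ) (k : ℤ) : pe (t + k) = pe t := by
  rw [pe_toCircle, pe_toCircle]
  congr 2
  rw [AddCircle.coe_add]
  simp

lemma pe_eq_iff {s t : ℝ} : pe s = pe t ↔ ∃ k : ℤ, s = t + k := by
  constructor
  · intro h
    rw [pe, pe, Complex.exp_eq_exp_iff_exists_int] at h
    obtain ⟨n, hn⟩ := h
    refine ⟨n, ?_⟩
    have h2 := congrArg Complex.im hn
    simp at h2
    have hp := Real.pi_pos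
    have : 2 * Real.pi * s = 2 * Real.pi * (t + n) := by linarith
    exact mul_left_cancel₀ (by positivity) this
  · rintro ⟨k, rfl⟩; exact pe_int t k

/-- polar coordinates -/
noncomputable def Th (w : PB Y) (t : ℝ) : CV Y := WithLp.toLp 2 ((w.fst : ℂ) * pe t, w.snd)
noncomputable def theta (v : PV Y) : CV Y := Th v.fst v.snd

lemma theta_Φ (w : PB Y) (t : ℝ) : theta (psplit.Φ (w, t)) = Th w t := rfl

lemma Th_int (w : PB Y) (t : ℝ) (k : ℤ) : Th w (t + k) = Th w t := by
  unfold Th; rw [pe_int]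

lemma cpi_Th {w : PB Y} (hw : 0 ≤ w.fst) (t : ℝ) : cpi (Th w t) = WithLp.ofLp w := by
  refine Prod.ext ?_ rfl
  change ‖(w.fst : ℂ) * pe t‖ = w.fst
  rw [norm_mul, pe_norm, mul_one, Complex.norm_real, Real.norm_of_nonneg hw]

lemma Th_rot (w : PB Y) (t s : ℝ) : rotL (AddCircle.toCircle (s : UnitAddCircle)) (Th w t) = Th w (s + t) := by
  refine cv_ext ?_ rfl
  change ((AddCircle.toCircle (s : UnitAddCircle) : Circle) : ℂ) * ((w.fst : ℂ) * pe t) = (w.fst : ℂ) * pe (s + t)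
  rw [← pe_toCircle, pe_add]; ring

lemma Th_inj {w : PB Y} (hw : w.fst ≠ 0) {s t : ℝ} (h : Th w s = Th w t) : ∃ k : ℤ, s = t + k := by
  have h1 : (w.fst : ℂ) * pe s = (w.fst : ℂ) * pe t := congrArg WithLp.fst h
  exact pe_eq_iff.1 (mul_left_cancel₀ (by exact_mod_cast hw) h1)

lemma Th_surj (x : CV Y) (a : ℝ) : ∃ t ∈ Ico a (a + 1), x = Th (WithLp.toLp 2 (cpi x)) t := by
  obtain ⟨s, hs⟩ := exists_rot x
  obtain ⟨t0, rfl⟩ := QuotientAddGroup.mk_surjective s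
  have h1 : x = Th (WithLp.toLp 2 (cpi x)) t0 := by
    conv_lhs => rw [hs]
    have : csec (cpi x) = Th (WithLp.toLp 2 (cpi x)) 0 := by
      refine cv_ext ?_ rfl
      change ((cpi x).1 : ℂ) = ((cpi x).1 : ℂ) * pe 0
      simp [pe]
    rw [this]
    have := Th_rot (WithLp.toLp 2 (cpi x)) 0 t0
    rw [add_zero] at this
    exact this
  refine ⟨toIcoMod one_pos a t0, toIcoMod_mem_Ico _ _ _, ?_⟩
  have h2 : toIcoMod one_pos a t0 = t0 + ((- toIcoDiv one_pos a t0 : ℤ) : ℝ) := by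
    rw [toIcoMod]; simp; ring
  rw [h2, Th_int]; exact h1

lemma finrank_CV : Module.finrank ℝ (PV Y) = Module.finrank ℝ (CV Y) := by
  rw [(WithLp.linearEquiv 2 ℝ (PB Y × ℝ)).finrank_eq, Module.finrank_prod,
    (WithLp.linearEquiv 2 ℝ (ℝ × Y)).finrank_eq, (WithLp.linearEquiv 2 ℝ (ℂ × Y)).finrank_eq,
    Module.finrank_prod, Module.finrank_prod]
  simp [Complex.finrank_real_complex]; ring

/-- derivative of the polar map -/
noncomputable def Dth (r t : ℝ) : PV Y →L[ℝ] CV Y :=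
  ((WithLp.prodContinuousLinearEquiv 2 ℝ ℂ Y).symm : ℂ × Y →L[ℝ] CV Y).comp
    (((((WithLp.fstL 2 ℝ ℝ Y).comp (WithLp.fstL 2 ℝ (PB Y) ℝ)).smulRight (pe t) +
      (WithLp.sndL 2 ℝ (PB Y) ℝ).smulRight ((r : ℂ) * ((2 * Real.pi : ℝ) * (Complex.I * pe t))))).prod
      ((WithLp.sndL 2 ℝ ℝ Y).comp (WithLp.fstL 2 ℝ (PB Y) ℝ)))

lemma Dth_apply (r t : ℝ) (v : PV Y) : Dth r t v =
    WithLp.toLp 2 (((v.fst.fst : ℂ) + (r * (2 * Real.pi) * v.snd : ℝ) * Complex.I) * pe t, v.fst.snd) := by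
  refine cv_ext ?_ rfl
  change v.fst.fst • pe t + v.snd • ((r : ℂ) * ((2 * Real.pi : ℝ) * (Complex.I * pe t))) = _
  simp only [Complex.real_smul, WithLp.toLp_fst]
  push_cast; ring

lemma Dth_norm (r t : ℝ) (v : PV Y) :
    ‖Dth r t v‖^2 = ‖v.fst‖^2 + (2 * Real.pi * r * v.snd)^2 := by
  rw [Dth_apply, WithLp.prod_norm_sq_eq_of_L2, WithLp.prod_norm_sq_eq_of_L2]
  simp only [WithLp.toLp_fst, WithLp.toLp_snd, norm_mul, pe_norm, mul_one]
  rw [Complex.sq_norm, Complex.normSq_add_mul_I, Real.norm_eq_abs, sq_abs]; ring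

lemma theta_fderiv (v : PV Y) : HasFDerivAt theta (Dth v.fst.fst v.snd) v := by
  have h1 : HasFDerivAt (fun v : PV Y => ((v.fst.fst : ℝ) : ℂ)) (Complex.ofRealCLM.comp ((WithLp.fstL 2 ℝ ℝ Y).comp (WithLp.fstL 2 ℝ (PB Y) ℝ))) v :=
    (Complex.ofRealCLM.comp ((WithLp.fstL 2 ℝ ℝ Y).comp (WithLp.fstL 2 ℝ (PB Y) ℝ))).hasFDerivAt
  have h2 : HasFDerivAt (fun v : PV Y => pe v.snd) _ v :=
    (pe_deriv v.snd).hasFDerivAt.comp v (WithLp.sndL 2 ℝ (PB Y) ℝ).hasFDerivAt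
  have h3 : HasFDerivAt (fun v : PV Y => v.fst.snd) ((WithLp.sndL 2 ℝ ℝ Y).comp (WithLp.fstL 2 ℝ (PB Y) ℝ)) v :=
    ((WithLp.sndL 2 ℝ ℝ Y).comp (WithLp.fstL 2 ℝ (PB Y) ℝ)).hasFDerivAt
  have h4 := (((WithLp.prodContinuousLinearEquiv 2 ℝ ℂ Y).symm : ℂ × Y →L[ℝ] CV Y).hasFDerivAt).comp v ((h1.mul h2).prodMk h3)
  refine h4.congr_fderiv ?_
  ext u
  refine cv_ext ?_ rfl
  rw [Dth_apply]
  simp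
  ring

lemma theta_contDiff : ContDiff ℝ 1 (theta (Y := Y)) := by
  have h1 : ContDiff ℝ 1 (fun v : PV Y => ((v.fst.fst : ℝ) : ℂ)) :=
    (Complex.ofRealCLM.comp ((WithLp.fstL 2 ℝ ℝ Y).comp (WithLp.fstL 2 ℝ (PB Y) ℝ))).contDiff
  have h2 : ContDiff ℝ 1 (fun v : PV Y => pe v.snd) := pe_contDiff.comp (WithLp.sndL 2 ℝ (PB Y) ℝ).contDiff
  have h3 : ContDiff ℝ 1 (fun v : PV Y => v.fst.snd) :=
    ((WithLp.sndL 2 ℝ ℝ Y).comp (WithLp.fstL 2 ℝ (PB Y) ℝ)).contDiff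
  have h12 : ContDiff ℝ 1 (fun v : PV Y => ((v.fst.fst : ℝ) : ℂ) * pe v.snd) := ContDiff.mul h1 h2
  have h123 := h12.prodMk h3
  have h4 : ContDiff ℝ 1 (fun q : ℂ × Y => (WithLp.toLp 2 q : CV Y)) :=
    ((WithLp.prodContinuousLinearEquiv 2 ℝ ℂ Y).symm : ℂ × Y →L[ℝ] CV Y).contDiff
  exact h4.comp h123

lemma theta_cont : Continuous (theta (Y := Y)) := theta_contDiff.continuous

lemma theta_LBL {v : PV Y} (hv : 0 < v.fst.fst) : LBL theta v := by
  have h0 : HasStrictFDerivAt (theta (Y := Y)) (Dth v.fst.fst v.snd) v :=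
    (theta_contDiff (Y := Y)).contDiffAt.hasStrictFDerivAt' (theta_fderiv v) one_ne_zero
  refine LBL_of_strict (finrank_CV (Y := Y)) h0 ?_
  refine (injective_iff_map_eq_zero _).2 fun u hu => ?_
  have h := Dth_norm v.fst.fst v.snd u
  rw [hu] at h
  simp only [norm_zero, ne_eq, OfNat.ofNat_ne_zero, not_false_eq_true, zero_pow] at h
  have hp := Real.pi_pos
  have h1 : ‖u.fst‖^2 = 0 := by nlinarith [sq_nonneg ‖u.fst‖, sq_nonneg (2 * Real.pi * v.fst.fst * u.snd)]
  have h2 : (2 * Real.pi * v.fst.fst * u.snd)^2 = 0 := by nlinarith [sq_nonneg ‖u.fst‖, sq_nonneg (2 * Real.pi * v.fst.fst * u.snd)]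
  have h3 : u.fst = 0 := norm_eq_zero.1 (pow_eq_zero_iff two_ne_zero |>.1 h1)
  have h4 : u.snd = 0 := by
    have := pow_eq_zero_iff two_ne_zero |>.1 h2
    have hne : 2 * Real.pi * v.fst.fst ≠ 0 := by positivity
    exact (mul_eq_zero.1 this).resolve_left hne
  exact WithLp.ofLp_injective 2 (Prod.ext h3 h4)

lemma theta_eB {w : PB Y} (hw : 0 < w.fst) (t : ℝ) (d : ℕ) (G : Set (CV Y)) :
    psplit.Φ (w, t) ∈ eB d (theta ⁻¹' G) ↔ Th w t ∈ eB d G :=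
  (theta_LBL (v := psplit.Φ (w, t)) hw).mem_eB_iff d G

end A16

section A17
variable {W : Type*} [NormedAddCommGroup W] [InnerProductSpace ℝ W] [FiniteDimensional ℝ W]
variable {V : Type*} [NormedAddCommGroup V] [InnerProductSpace ℝ V] [FiniteDimensional ℝ V]

lemma normDet_rank1 (L : W →L[ℝ] V) (a : W →L[ℝ] ℝ) (κ : ℝ)
    (h : ∀ v, ‖L v‖^2 = ‖v‖^2 + (κ * a v)^2) :
    L.toLinearMap.normDet = Real.sqrt (1 + κ^2 * ‖a‖^2) := by
  have hin : ∀ u v, ⟪L u, L v⟫ = ⟪u, v⟫ + (κ * a u) * (κ * a v) := by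
    intro u v
    have h1 := h (u + v)
    have h2 := h u
    have h3 := h v
    rw [map_add, map_add, norm_add_sq_real, norm_add_sq_real] at h1
    nlinarith
  set b := stdOrthonormalBasis ℝ W with hb
  have h2 := LinearMap.normDet_sq_eq_det_gram L.toLinearMap b
  have h3 : Matrix.gram ℝ (fun i => L.toLinearMap (b i)) =
      1 + Matrix.replicateCol Unit (fun i => κ * a (b i)) * Matrix.replicateRow Unit (fun i => κ * a (b i)) := by
    ext i j
    rw [Matrix.gram_apply, Matrix.add_apply, Matrix.mul_apply]
    change ⟪L (b i), L (b j)⟫ = _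
    rw [hin, orthonormal_iff_ite.1 b.orthonormal, Matrix.one_apply]
    simp
  rw [h3, Matrix.det_one_add_replicateCol_mul_replicateRow] at h2
  have h4 : ∑ i, (a (b i))^2 = ‖a‖^2 := by
    have h5 := b.sum_sq_norm_inner_right ((InnerProductSpace.toDual ℝ W).symm a)
    rw [LinearIsometryEquiv.norm_map] at h5
    rw [← h5]
    refine Finset.sum_congr rfl fun i _ => ?_
    rw [real_inner_comm, InnerProductSpace.toDual_symm_apply, Real.norm_eq_abs, sq_abs]
  have h6 : (fun i => κ * a (b i)) ⬝ᵥ (fun i => κ * a (b i)) = κ^2 * ‖a‖^2 := by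
    rw [← h4, Finset.mul_sum]
    refine Finset.sum_congr rfl fun i _ => by ring
  rw [h6] at h2
  rw [← h2]
  exact (Real.sqrt_sq (LinearMap.normDet_nonneg _)).symm

/-- elementary inequality -/
lemma elem_ineq {N : ℕ} (v : ℕ → W)
    (h : ∑ i ∈ Finset.range N, Real.sqrt (1 + ‖v i‖^2) ≤ 2 * Real.sqrt (1 + ‖∑ i ∈ Finset.range N, v i‖^2 / 4)) :
    N ≤ 2 ∧ (N = 2 → v 0 = v 1) := by
  set u := ∑ i ∈ Finset.range N, v i with hu
  set A := Real.sqrt (4 + ‖u‖^2) with hA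
  have hA0 : 0 < A := Real.sqrt_pos.2 (by positivity)
  have hA2 : A^2 = 4 + ‖u‖^2 := Real.sq_sqrt (by positivity)
  have hr : 2 * Real.sqrt (1 + ‖u‖^2/4) = A := by
    rw [hA, show (4:ℝ) + ‖u‖^2 = 2^2 * (1 + ‖u‖^2/4) by ring, Real.sqrt_mul (by positivity), Real.sqrt_sq (by norm_num)]
  rw [hr] at h
  have hid : ∀ i, (1 + ‖v i‖^2) * (4 + ‖u‖^2) = (2 + ⟪v i, u⟫)^2 + (‖(2:ℝ) • v i - u‖^2 + (‖v i‖^2 * ‖u‖^2 - ⟪v i, u⟫^2)) := by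
    intro i
    rw [norm_sub_sq_real, norm_smul, inner_smul_left]
    simp; ring
  have hcs : ∀ i, 0 ≤ ‖v i‖^2 * ‖u‖^2 - ⟪v i, u⟫^2 := by
    intro i
    have := abs_real_inner_le_norm (v i) u
    have h2 := sq_le_sq' (by linarith [abs_nonneg ⟪v i, u⟫, neg_abs_le ⟪v i, u⟫]) this
    rw [sq_abs, mul_pow] at h2; linarith
  have hs : ∀ i, Real.sqrt (1 + ‖v i‖^2) ^2 = 1 + ‖v i‖^2 := fun i => Real.sq_sqrt (by positivity)
  have hp : ∀ i, 0 < Real.sqrt (1 + ‖v i‖^2) := fun i => Real.sqrt_pos.2 (by positivity)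
  have key : ∀ i, 2 + ⟪v i, u⟫ ≤ Real.sqrt (1 + ‖v i‖^2) * A := by
    intro i
    refine le_of_sq_le_sq ?_ (by positivity)
    rw [mul_pow, hs, hA2, hid]
    nlinarith [hcs i, sq_nonneg ‖(2:ℝ) • v i - u‖]
  have hsum : (∑ i ∈ Finset.range N, (2 + ⟪v i, u⟫)) = 2 * N + ‖u‖^2 := by
    rw [Finset.sum_add_distrib, ← sum_inner, ← hu, real_inner_self_eq_norm_sq]
    simp; ring
  have hle : (∑ i ∈ Finset.range N, (2 + ⟪v i, u⟫)) ≤ ∑ i ∈ Finset.range N, Real.sqrt (1 + ‖v i‖^2) * A :=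
    Finset.sum_le_sum fun i _ => key i
  have hle2 : ∑ i ∈ Finset.range N, Real.sqrt (1 + ‖v i‖^2) * A ≤ A^2 := by
    rw [← Finset.sum_mul, sq]
    exact mul_le_mul_of_nonneg_right h hA0.le
  have hN : (N:ℝ) ≤ 2 := by nlinarith
  refine ⟨by exact_mod_cast hN, fun h2 => ?_⟩
  have heq : ∀ i ∈ Finset.range N, 2 + ⟪v i, u⟫ = Real.sqrt (1 + ‖v i‖^2) * A := by
    refine (Finset.sum_eq_sum_iff_of_le fun i _ => key i).1 (le_antisymm hle ?_)
    have h2' : (N:ℝ) = 2 := by rw [h2]; norm_num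
    rw [hsum, h2']
    linarith
  have hfin : ∀ i ∈ Finset.range N, (2:ℝ) • v i = u := by
    intro i hi
    have e := congrArg (·^2) (heq i hi)
    simp only [mul_pow] at e
    rw [hs, hA2, hid] at e
    have : ‖(2:ℝ) • v i - u‖^2 = 0 := by nlinarith [hcs i, sq_nonneg ‖(2:ℝ) • v i - u‖]
    exact sub_eq_zero.1 (norm_eq_zero.1 (pow_eq_zero_iff two_ne_zero |>.1 this))
  have e0 := hfin 0 (by simp [h2])
  have e1 := hfin 1 (by simp [h2])
  exact smul_right_injective W (two_ne_zero (α := ℝ)) (e0.trans e1.symm)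

variable {Y : Type*} [NormedAddCommGroup Y] [InnerProductSpace ℝ Y] [FiniteDimensional ℝ Y]
  [MeasurableSpace Y] [BorelSpace Y]

/-- area of a graph in polar coordinates -/
lemma graph_area {m : ℕ} (hm : Module.finrank ℝ (PB Y) = m) {t : PB Y → ℝ} {Z : Set (PB Y)} (hZ : MeasurableSet Z)
    (hpos : ∀ p ∈ Z, 0 < p.fst) (ht : ∀ p ∈ Z, DifferentiableAt ℝ t p) :
    μHE[m] ((fun p => Th p (t p)) '' Z) =
      ∫⁻ p in Z, ENNReal.ofReal (Real.sqrt (1 + (2 * Real.pi * p.fst)^2 * ‖fderiv ℝ t p‖^2)) := by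
  set D : PB Y → PB Y →L[ℝ] CV Y := fun p => (Dth p.fst (t p)).comp
    (((psplit (Y := Y)).Φ : PB Y × ℝ →L[ℝ] PV Y).comp ((ContinuousLinearMap.id ℝ (PB Y)).prod (fderiv ℝ t p))) with hD
  have hDn : ∀ p v, ‖D p v‖^2 = ‖v‖^2 + ((2 * Real.pi * p.fst) * fderiv ℝ t p v)^2 := fun p v => Dth_norm _ _ _
  rw [area_formula hm hZ (f' := D) (c := 1) ?_ ?_ one_pos ?_]
  · refine setLIntegral_congr_fun hZ fun p hp => ?_
    rw [normDet_rank1 (D p) (fderiv ℝ t p) (2 * Real.pi * p.fst) (hDn p)]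
  · intro p hp
    have h1 : HasFDerivAt (fun p => psplit.Φ (p, t p)) (((psplit (Y := Y)).Φ : PB Y × ℝ →L[ℝ] PV Y).comp ((ContinuousLinearMap.id ℝ (PB Y)).prod (fderiv ℝ t p))) p :=
      (((psplit (Y := Y)).Φ : PB Y × ℝ →L[ℝ] PV Y).hasFDerivAt).comp p ((hasFDerivAt_id p).prodMk (ht p hp).hasFDerivAt)
    exact ((theta_fderiv (psplit.Φ (p, t p))).comp p h1).hasFDerivWithinAt
  · intro p hp p' hp' h
    have := congrArg cpi h
    simp only [cpi_Th (hpos p hp).le, cpi_Th (hpos p' hp').le] at this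
    exact WithLp.ofLp_injective 2 this
  · intro p hp v
    rw [one_mul]
    refine le_of_sq_le_sq ?_ (norm_nonneg _)
    rw [hDn]; nlinarith [sq_nonneg ((2 * Real.pi * p.fst) * fderiv ℝ t p v)]

lemma cavg_line {E : Set (CV Y)} (hE : MeasurableSet E) (p : PB Y) (a : ℝ) :
    volume {t | t ∈ Ioo a (a+1) ∧ Th p t ∈ E} = cavg E (Th p 0) := by
  have hm := UnitAddCircle.measurePreserving_mk a
  have hS : MeasurableSet {s : UnitAddCircle | rotL (AddCircle.toCircle s) (Th p 0) ∈ E} := by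
    generalize Th p 0 = x
    have h1 : MeasurableSet ((fun z : CV Y × UnitAddCircle => rotL (AddCircle.toCircle z.2) z.1) ⁻¹' E) := rot_joint.measurable hE
    exact measurable_prodMk_left (x := x) h1
  unfold cavg
  rw [← hm.measure_preimage hS.nullMeasurableSet, Measure.restrict_apply (hm.measurable hS)]
  have : (QuotientAddGroup.mk : ℝ → UnitAddCircle) ⁻¹' {s : UnitAddCircle | rotL (AddCircle.toCircle s) (Th p 0) ∈ E} ∩ Ioc a (a+1)
    = {t | t ∈ Ioc a (a+1) ∧ Th p t ∈ E} := by
    ext t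
    have := Th_rot p 0 t
    rw [add_zero] at this
    rw [mem_inter_iff, mem_preimage, mem_setOf_eq, mem_setOf_eq, and_comm]
    exact and_congr_right fun _ => by rw [← this]
  rw [this]
  refine measure_congr ?_
  have h0 : ∀ᵐ t : ℝ, t ≠ a + 1 := by simp [ae_iff]
  filter_upwards [h0] with t ht
  refine propext ⟨fun h => ⟨⟨h.1.1, h.1.2.le⟩, h.2⟩, fun h => ⟨⟨h.1.1, lt_of_le_of_ne h.1.2 ht⟩, h.2⟩⟩

end A17

section A18

/-- `H` is full on `(a,t)` and empty on `(t,b)` -/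
def JL (H : Set ℝ) (a t b : ℝ) : Prop := a < t ∧ t < b ∧
  volume {s | s ∈ Ioo a t ∧ s ∉ H} = 0 ∧ volume {s | s ∈ Ioo t b ∧ s ∈ H} = 0

def sg {α : Type*} (σ : Bool) (G : Set α) : Set α := if σ then G else Gᶜ
noncomputable def tt (σ : Bool) (a b F : ℝ) : ℝ := if σ then a + F else b - F

lemma LineOK.sg {H J : Set ℝ} (h : LineOK H J) (σ : Bool) : LineOK (sg σ H) J := by
  cases σ
  · intro a b
    rw [h a b, or_comm]
    simp [_root_.sg]
  · exact h

lemma not_full_null {H : Set ℝ} {a b c d e f : ℝ} (h1 : a ≤ c) (h2 : c < d) (h3 : d ≤ b)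
    (h4 : a ≤ e) (h5 : e < f) (h6 : f ≤ b)
    (hc : volume {s | s ∈ Ioo c d ∧ s ∉ H} = 0) (hn : volume {s | s ∈ Ioo e f ∧ s ∈ H} = 0) :
    ¬ (volume {t | t ∈ Ioo a b ∧ t ∈ H} = 0 ∨ volume {t | t ∈ Ioo a b ∧ t ∉ H} = 0) := by
  have aux : ∀ (Q : ℝ → Prop) {c d : ℝ}, a ≤ c → c < d → d ≤ b → volume {s | s ∈ Ioo c d ∧ Q s} = 0 →
      volume {s | s ∈ Ioo a b ∧ ¬ Q s} = 0 → False := by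
    intro Q c d h1 h2 h3 hc h
    have : volume (Ioo c d) = 0 := by
      refine measure_mono_null (t := {s | s ∈ Ioo c d ∧ Q s} ∪ {s | s ∈ Ioo a b ∧ ¬ Q s}) ?_ ?_
      · intro s hs
        by_cases hQ : Q s
        · exact Or.inl ⟨hs, hQ⟩
        · exact Or.inr ⟨⟨h1.trans_lt hs.1, hs.2.trans_le h3⟩, hQ⟩
      · exact measure_union_null hc h
    rw [Real.volume_Ioo, ENNReal.ofReal_eq_zero] at this
    linarith
  rintro (h | h)
  · exact aux (fun s => s ∉ H) h1 h2 h3 hc (by simpa using h)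
  · exact aux (fun s => s ∈ H) h4 h5 h6 hn h

lemma JL.mem {H J : Set ℝ} (h : LineOK H J) {a t b : ℝ} (hj : JL H a t b) :
    t ∈ J ∧ ∀ s ∈ Ioo a b, s ∈ J → s = t := by
  obtain ⟨h1, h2, h3, h4⟩ := hj
  have hl := (h a t).2 (Or.inr h3)
  have hr := (h t b).2 (Or.inl h4)
  have hu : ∀ s ∈ Ioo a b, s ∈ J → s = t := by
    intro s hs hJ
    rcases lt_trichotomy s t with h | h | h
    · exact absurd hJ (hl s ⟨hs.1, h⟩)
    · exact h
    · exact absurd hJ (hr s ⟨h, hs.2⟩)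
  refine ⟨?_, hu⟩
  have hn : ¬ ∀ s ∈ Ioo a b, s ∉ J := fun hh =>
    not_full_null le_rfl h1 h2.le h1.le h2 le_rfl h3 h4 ((h a b).1 hh)
  push Not at hn
  obtain ⟨s, hs, hJ⟩ := hn
  rwa [← hu s hs hJ]

lemma JL.slm {H : Set ℝ} {σ : Bool} {a b F : ℝ} (hj : JL (sg σ H) a (tt σ a b F) b) :
    (volume {s | s ∈ Ioo a b ∧ s ∈ H}).toReal = F := by
  obtain ⟨h1, h2, h3, h4⟩ := hj
  cases σ
  · simp only [sg, tt, Bool.false_eq_true, if_false, mem_compl_iff, not_not] at *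
    rw [vol_right h1.le h2.le h3 h4, ENNReal.toReal_ofReal (by linarith)]; ring
  · simp only [sg, tt, if_true] at *
    rw [vol_left h1.le h2.le h3 h4, ENNReal.toReal_ofReal (by linarith)]; ring

lemma vol_add_mid (H : Set ℝ) {a c b : ℝ} (h1 : a ≤ c) (h2 : c ≤ b) :
    (volume {s | s ∈ Ioo a b ∧ s ∈ H}).toReal = (volume {s | s ∈ Ioo a c ∧ s ∈ H}).toReal + (volume {s | s ∈ Ioo c b ∧ s ∈ H}).toReal := by
  rw [← ENNReal.toReal_add (slice_fin (· ∈ H) a c) (slice_fin (· ∈ H) c b)]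
  congr 1
  have e1 : volume {s | s ∈ Ioo a b ∧ s ∈ H} = (volume.restrict H) (Ioo a b) := by
    rw [Measure.restrict_apply measurableSet_Ioo]; rfl
  have e2 : volume {s | s ∈ Ioo a c ∧ s ∈ H} = (volume.restrict H) (Ioo a c) := by
    rw [Measure.restrict_apply measurableSet_Ioo]; rfl
  have e3 : volume {s | s ∈ Ioo c b ∧ s ∈ H} = (volume.restrict H) (Ioo c b) := by
    rw [Measure.restrict_apply measurableSet_Ioo]; rfl
  rw [e1, e2, e3,
    measure_congr (Ioo_ae_eq_Ioc (μ := volume.restrict H) (a := a) (b := b)),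
    measure_congr (Ioo_ae_eq_Ioc (μ := volume.restrict H) (a := a) (b := c)),
    measure_congr (Ioo_ae_eq_Ioc (μ := volume.restrict H) (a := c) (b := b)),
    ← measure_union (by
      refine Set.disjoint_left.2 fun x hx hx' => ?_
      exact absurd hx.2 (not_le.2 hx'.1)) measurableSet_Ioc, Ioc_union_Ioc_eq_Ioc h1 h2]

lemma vol_sum (H : Set ℝ) {q : ℕ → ℝ} {N : ℕ} (hq : ∀ i < N, q i ≤ q (i+1)) :
    q 0 ≤ q N ∧ (volume {s | s ∈ Ioo (q 0) (q N) ∧ s ∈ H}).toReal =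
      ∑ i ∈ Finset.range N, (volume {s | s ∈ Ioo (q i) (q (i+1)) ∧ s ∈ H}).toReal := by
  induction N with
  | zero => simp
  | succ k ih =>
    obtain ⟨h1, h2⟩ := ih fun i hi => hq i (by omega)
    refine ⟨h1.trans (hq k (by omega)), ?_⟩
    rw [Finset.sum_range_succ, ← h2, ← vol_add_mid H h1 (hq k (by omega))]

variable {W : Type*} [NormedAddCommGroup W] [InnerProductSpace ℝ W] [FiniteDimensional ℝ W]
  [MeasurableSpace W] [BorelSpace W]
variable {V : Type*} [NormedAddCommGroup V] [InnerProductSpace ℝ V] [FiniteDimensional ℝ V]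
  [MeasurableSpace V] [BorelSpace V]

lemma JL_meas (S : OSplit W V) {G : Set V} (hG : MeasurableSet G) (a b : ℝ) {t : W → ℝ} (ht : Measurable t) :
    MeasurableSet {p | JL {s | S.Φ (p, s) ∈ G} a (t p) b} := by
  have hGm : MeasurableSet {z : W × ℝ | S.Φ z ∈ G} := S.Φ.continuous.measurable hG
  have ht1 : Measurable fun z : W × ℝ => t z.1 := ht.comp measurable_fst
  have m1 : MeasurableSet {z : W × ℝ | z.2 ∈ Ioo a (t z.1) ∧ S.Φ z ∉ G} :=
    ((measurableSet_lt measurable_const measurable_snd).inter (measurableSet_lt measurable_snd ht1)).inter hGm.compl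
  have m2 : MeasurableSet {z : W × ℝ | z.2 ∈ Ioo (t z.1) b ∧ S.Φ z ∈ G} :=
    ((measurableSet_lt ht1 measurable_snd).inter (measurableSet_lt measurable_snd measurable_const)).inter hGm
  have n1 := measurable_measure_prodMk_left (ν := (volume : Measure ℝ)) m1
  have n2 := measurable_measure_prodMk_left (ν := (volume : Measure ℝ)) m2
  exact (measurableSet_lt measurable_const ht).inter ((measurableSet_lt ht measurable_const).inter
    ((n1 (measurableSet_singleton 0)).inter (n2 (measurableSet_singleton 0))))

end A18

section A19
variable {Y : Type*} [NormedAddCommGroup Y] [InnerProductSpace ℝ Y] [FiniteDimensional ℝ Y]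
  [MeasurableSpace Y] [BorelSpace Y]

lemma clm_norm_smul {W : Type*} [NormedAddCommGroup W] [InnerProductSpace ℝ W] (c : ℝ) (a : W →L[ℝ] ℝ) :
    ‖c • a‖ = |c| * ‖a‖ := by rw [norm_smul, Real.norm_eq_abs]

lemma clm_norm_neg {W : Type*} [NormedAddCommGroup W] [InnerProductSpace ℝ W] (a : W →L[ℝ] ℝ) :
    ‖-a‖ = ‖a‖ := norm_neg a

lemma Th_cont : Continuous fun z : PB Y × ℝ => Th z.1 z.2 :=
  theta_cont.comp psplit.Φ.continuous

lemma PB_fst_cont : Continuous fun p : PB Y => p.fst := (WithLp.fstL 2 ℝ ℝ Y).continuous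

lemma fderiv_tt {f : PB Y → ℝ} {p : PB Y} (σ : Bool) (a b : ℝ) (hf : DifferentiableAt ℝ f p) :
    DifferentiableAt ℝ (fun p => tt σ a b (f p)) p ∧
    fderiv ℝ (fun p => tt σ a b (f p)) p = (if σ then fderiv ℝ f p else - fderiv ℝ f p) := by
  cases σ
  · simp only [tt, Bool.false_eq_true, if_false]
    exact ⟨hf.const_sub b, fderiv_const_sub b⟩
  · simp only [tt, if_true]
    exact ⟨hf.const_add a, fderiv_const_add a⟩

lemma slope_ineq {m : ℕ} (hm : Module.finrank ℝ (PB Y) = m) {E F : Set (CV Y)} (hE : MeasurableSet E)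
    (hcyl : ∀ b, MeasurableSet b → μHE[m] (eB (m+1) F ∩ cpi ⁻¹' b) = μHE[m] (eB (m+1) E ∩ cpi ⁻¹' b))
    (hF : ∀ᵐ p : PB Y, 0 < p.fst → ∀ t, Th p t ∈ eB (m+1) F →
      Th p t = Th p ((cavg E (Th p 0)).toReal / 2) ∨ Th p t = Th p (-((cavg E (Th p 0)).toReal / 2)))
    (N : ℕ) (q : ℕ → ℚ) (hq : (q N : ℝ) = q 0 + 1) (f : ℕ → PB Y → ℝ) (hf : ∀ i, ∃ K, LipschitzWith K (f i))
    (σ : ℕ → Bool) :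
    ∀ᵐ p : PB Y, 0 < p.fst →
      (∀ i < N, JL (sg (σ i) {s | Th p s ∈ E}) (q i) (tt (σ i) (q i) (q (i+1)) (f i p)) (q (i+1))) →
      (∀ i, DifferentiableAt ℝ (f i) p) ∧
      ∑ i ∈ Finset.range N, Real.sqrt (1 + (2 * Real.pi * p.fst)^2 * ‖fderiv ℝ (f i) p‖^2) ≤
        2 * Real.sqrt (1 + (2 * Real.pi * p.fst)^2 * ‖∑ i ∈ Finset.range N, fderiv ℝ (f i) p‖^2 / 4) := by
  classical
  have hcont : ∀ i, Continuous (f i) := fun i => (hf i).choose_spec.continuous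
  set tf : ℕ → PB Y → ℝ := fun i p => tt (σ i) (q i) (q (i+1)) (f i p) with htf
  have htc : ∀ i, Continuous (tf i) := by
    intro i
    simp only [htf, tt]
    have := hcont i
    split_ifs <;> fun_prop
  have hdiff : ∀ᵐ p : PB Y, ∀ i, DifferentiableAt ℝ (f i) p :=
    ae_all_iff.2 fun i => (hf i).choose_spec.ae_differentiableAt
  have hL := ae_lineOK (psplit (Y := Y)) hm (theta_cont.measurable hE)
  obtain ⟨A, hA0, hAm, hA⟩ : ∃ A : Set (PB Y), (∀ᵐ p, p ∈ A) ∧ MeasurableSet A ∧ ∀ p ∈ A,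
      (0 < p.fst → ∀ t, Th p t ∈ eB (m+1) F →
        Th p t = Th p ((cavg E (Th p 0)).toReal / 2) ∨ Th p t = Th p (-((cavg E (Th p 0)).toReal / 2))) ∧
      (∀ i, DifferentiableAt ℝ (f i) p) ∧
      LineOK {t | psplit.Φ (p, t) ∈ theta ⁻¹' E} {t | psplit.Φ (p, t) ∈ eB (m+1) (theta ⁻¹' E)} := by
    have hall := hF.and (hdiff.and hL)
    obtain ⟨B, hB1, hB2, hB3⟩ := exists_measurable_superset_of_null (ae_iff.1 hall)
    refine ⟨Bᶜ, measure_eq_zero_iff_ae_notMem.1 hB3, hB2.compl, fun p hp => ?_⟩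
    by_contra hcon
    exact hp (hB1 hcon)
  set Z : Set (PB Y) := A ∩ {p | 0 < p.fst ∧ ∀ i < N, JL (sg (σ i) {s | Th p s ∈ E}) (q i) (tf i p) (q (i+1))} with hZ
  have hZm : MeasurableSet Z := by
    refine hAm.inter ((measurableSet_lt measurable_const PB_fst_cont.measurable).inter ?_)
    have : {p : PB Y | ∀ i < N, JL (sg (σ i) {s | Th p s ∈ E}) (q i) (tf i p) (q (i+1))} =
        ⋂ i, ⋂ (_ : i < N), {p | JL {s | psplit.Φ (p, s) ∈ sg (σ i) (theta ⁻¹' E)} (q i) (tf i p) (q (i+1))} := by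
      ext p
      simp only [mem_setOf_eq, mem_iInter]
      refine forall_congr' fun i => forall_congr' fun _ => ?_
      cases σ i <;> rfl
    change MeasurableSet {p : PB Y | ∀ i < N, JL (sg (σ i) {s | Th p s ∈ E}) (q i) (tf i p) (q (i+1))}
    rw [this]
    refine MeasurableSet.iInter fun i => MeasurableSet.iInter fun _ => JL_meas _ ?_ _ _ (htc i).measurable
    cases σ i
    · exact (theta_cont.measurable hE).compl
    · exact theta_cont.measurable hE
  set lhs : PB Y → ℝ≥0∞ := fun p => ∑ i ∈ Finset.range N, ENNReal.ofReal (Real.sqrt (1 + (2 * Real.pi * p.fst)^2 * ‖fderiv ℝ (f i) p‖^2)) with hlhs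
  set rhs : PB Y → ℝ≥0∞ := fun p => 2 * ENNReal.ofReal (Real.sqrt (1 + (2 * Real.pi * p.fst)^2 * ‖∑ i ∈ Finset.range N, fderiv ℝ (f i) p‖^2 / 4)) with hrhs
  have hmi : ∀ i, Measurable fun p : PB Y => ENNReal.ofReal (Real.sqrt (1 + (2 * Real.pi * p.fst)^2 * ‖fderiv ℝ (f i) p‖^2)) := by
    intro i
    have h1 := (measurable_fderiv ℝ (f i)).norm
    have h2 := (PB_fst_cont (Y := Y)).measurable
    exact (((measurable_const.mul h2).pow_const 2).mul (h1.pow_const 2)).const_add 1 |>.sqrt.ennreal_ofReal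
  have hlm : Measurable lhs := Finset.measurable_sum _ fun i _ => hmi i
  have hintg : ∀ s, MeasurableSet s → s ⊆ Z → ∫⁻ p in s, lhs p ≤ ∫⁻ p in s, rhs p := by
    intro s hs hsZ
    have hpos : ∀ p ∈ s, 0 < p.fst := fun p hp => (hsZ hp).2.1
    set b : Set (ℝ × Y) := (WithLp.toLp 2) ⁻¹' s with hb
    have hbm : MeasurableSet b := WithLp.measurable_toLp 2 _ hs
    -- lower bound
    have low : ∫⁻ p in s, lhs p ≤ μHE[m] (eB (m+1) E ∩ cpi ⁻¹' b) := by
      rw [hlhs, lintegral_finset_sum _ fun i _ => hmi i]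
      have e1 : ∀ i, ∫⁻ p in s, ENNReal.ofReal (Real.sqrt (1 + (2 * Real.pi * p.fst)^2 * ‖fderiv ℝ (f i) p‖^2)) =
          μHE[m] ((fun p => Th p (tf i p)) '' s) := by
        intro i
        rw [graph_area hm hs hpos fun p hp => (fderiv_tt (σ i) (q i) (q (i+1)) ((hA p (hsZ hp).1).2.1 i)).1]
        refine setLIntegral_congr_fun hs fun p hp => ?_
        have : ‖fderiv ℝ (tf i) p‖ = ‖fderiv ℝ (f i) p‖ := by
          rw [(fderiv_tt (σ i) (q i) (q (i+1)) ((hA p (hsZ hp).1).2.1 i)).2]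
          split_ifs
          · rfl
          · exact clm_norm_neg _
        rw [this]
      rw [Finset.sum_congr rfl fun i _ => e1 i]
      rw [← measure_biUnion_finset]
      · refine measure_mono ?_
        refine iUnion₂_subset fun i hi => ?_
        rintro _ ⟨p, hp, rfl⟩
        have hi' := Finset.mem_range.1 hi
        refine ⟨?_, ?_⟩
        · have h1 := ((hA p (hsZ hp).1).2.2.sg (σ i))
          have h2 : JL (sg (σ i) {t | psplit.Φ (p, t) ∈ theta ⁻¹' E}) (q i) (tf i p) (q (i+1)) := (hsZ hp).2.2 i hi'
          exact (theta_eB (hpos p hp) _ _ _).1 (h2.mem h1).1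
        · change cpi (Th p (tf i p)) ∈ b
          rw [cpi_Th (hpos p hp).le]; exact hp
      · have aux : ∀ i j, i < j → j < N → Disjoint ((fun p => Th p (tf i p)) '' s) ((fun p => Th p (tf j p)) '' s) := by
          intro i j hij hj
          refine Set.disjoint_left.2 ?_
          rintro _ ⟨p, hp, rfl⟩ ⟨p', hp', he⟩
          have hpp : p' = p := by
            have := congrArg cpi he
            simp only [cpi_Th (hpos p hp).le, cpi_Th (hpos p' hp').le] at this
            exact WithLp.ofLp_injective 2 this
          subst hpp
          obtain ⟨k, hk⟩ := Th_inj (hpos p' hp').ne' he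
          have hJ := (hsZ hp').2.2
          have mono : ∀ l k, k + l ≤ N → (q k : ℝ) ≤ q (k + l) := by
            intro l
            induction l with
            | zero => intro k _; simp
            | succ l ih =>
              intro k hkl
              have := hJ (k+l) (by omega)
              exact (ih k (by omega)).trans (this.1.trans this.2.1).le
          have a1 := (hJ i (by omega)).1
          have a2 := (hJ i (by omega)).2.1
          have a3 := (hJ j hj).1
          have a4 := (hJ j hj).2.1
          have b1 : (q 0:ℝ) ≤ q i := by have := mono i 0 (by omega); simpa using this
          have b2 : (q (i+1):ℝ) ≤ q j := by have := mono (j - (i+1)) (i+1) (by omega); rwa [show i + 1 + (j - (i+1)) = j by omega] at this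
          have b3 : (q (j+1):ℝ) ≤ q N := by have := mono (N - (j+1)) (j+1) (by omega); rwa [show j + 1 + (N - (j+1)) = N by omega] at this
          have c1 : (0:ℝ) < k := by linarith
          have c2 : (k:ℝ) < 1 := by linarith
          have c1' : 0 < k := by exact_mod_cast c1
          have c2' : k < 1 := by exact_mod_cast c2
          omega
        intro i hi j hj hij
        have hi' := Finset.mem_range.1 hi
        have hj' := Finset.mem_range.1 hj
        rcases lt_or_gt_of_ne hij with h | h
        · exact aux i j h hj'
        · exact (aux j i h hi').symm
      · intro i _
        refine hs.image_of_continuousOn_injOn ?_ ?_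
        · exact (Th_cont.comp (continuous_id.prodMk (htc i))).continuousOn
        · intro p hp p' hp' h
          have := congrArg cpi h
          simp only [cpi_Th (hpos p hp).le, cpi_Th (hpos p' hp').le] at this
          exact WithLp.ofLp_injective 2 this
    -- upper bound
    set g : PB Y → ℝ := fun p => ∑ i ∈ Finset.range N, f i p with hg
    have hgd : ∀ p ∈ s, HasFDerivAt g (∑ i ∈ Finset.range N, fderiv ℝ (f i) p) p := fun p hp =>
      HasFDerivAt.fun_sum fun i _ => ((hA p (hsZ hp).1).2.1 i).hasFDerivAt
    have hgc : ∀ p ∈ s, (cavg E (Th p 0)).toReal = g p := by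
      intro p hp
      have hJ := (hsZ hp).2.2
      have h1 := (vol_sum {t | Th p t ∈ E} (q := fun i => (q i : ℝ)) (N := N) fun i hi => ((hJ i hi).1.trans (hJ i hi).2.1).le).2
      rw [← cavg_line hE p (q 0)]
      rw [hq] at h1
      refine h1.trans (Finset.sum_congr rfl fun i hi => ?_)
      exact JL.slm (hJ i (Finset.mem_range.1 hi))
    have gen : ∀ c : ℝ, |c| = 1/2 → μHE[m] ((fun p => Th p (c * g p)) '' s) =
        ∫⁻ p in s, ENNReal.ofReal (Real.sqrt (1 + (2 * Real.pi * p.fst)^2 * ‖∑ i ∈ Finset.range N, fderiv ℝ (f i) p‖^2 / 4)) := by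
      intro c hc
      rw [graph_area hm hs hpos fun p hp => ((hgd p hp).const_mul c).differentiableAt]
      refine setLIntegral_congr_fun hs fun p hp => ?_
      have h1 : ‖fderiv ℝ (fun p => c * g p) p‖ = 1/2 * ‖∑ i ∈ Finset.range N, fderiv ℝ (f i) p‖ := by
        rw [((hgd p hp).const_mul c).fderiv, clm_norm_smul, hc]
      simp only [h1]
      congr 3; ring
    have up : μHE[m] (eB (m+1) F ∩ cpi ⁻¹' b) ≤ ∫⁻ p in s, rhs p := by
      have hsub : eB (m+1) F ∩ cpi ⁻¹' b ⊆ (fun p => Th p ((1/2) * g p)) '' s ∪ (fun p => Th p ((-1/2) * g p)) '' s := by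
        rintro x ⟨hx, hxb⟩
        obtain ⟨t, -, ht⟩ := Th_surj x 0
        set p : PB Y := WithLp.toLp 2 (cpi x) with hp
        have hps : p ∈ s := hxb
        have := (hA p (hsZ hps).1).1 (hpos p hps) t (by rw [← ht]; exact hx)
        rw [hgc p hps] at this
        rcases this with h | h
        · refine Or.inl ⟨p, hps, ?_⟩
          rw [ht, h]; congr 1; ring
        · refine Or.inr ⟨p, hps, ?_⟩
          rw [ht, h]; congr 1; ring
      refine (measure_mono hsub).trans ((measure_union_le _ _).trans ?_)
      rw [gen (1/2) (by norm_num), gen (-1/2) (by rw [abs_div]; norm_num), hrhs, lintegral_const_mul' _ _ (by norm_num)]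
      exact (two_mul _).ge
    rw [hcyl b hbm] at up
    exact low.trans up
  have hae : lhs ≤ᵐ[volume.restrict Z] rhs := by
    refine ae_le_of_forall_setLIntegral_le_of_sigmaFinite hlm fun s hs _ => ?_
    rw [Measure.restrict_restrict hs]
    exact hintg _ (hs.inter hZm) inter_subset_right
  rw [EventuallyLE, ae_restrict_iff' hZm] at hae
  filter_upwards [hae, hA0] with p hp hpA hp0 hJ
  refine ⟨(hA p hpA).2.1, ?_⟩
  have := hp ⟨hpA, hp0, hJ⟩
  simp only [hlhs, hrhs] at this
  have h2e : (2:ℝ≥0∞) * ENNReal.ofReal √(1 + (2 * Real.pi * p.fst) ^ 2 * ‖∑ i ∈ Finset.range N, fderiv ℝ (f i) p‖ ^ 2 / 4) = ENNReal.ofReal 2 * ENNReal.ofReal √(1 + (2 * Real.pi * p.fst) ^ 2 * ‖∑ i ∈ Finset.range N, fderiv ℝ (f i) p‖ ^ 2 / 4) := by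
    congr 1; simp
  rw [← ENNReal.ofReal_sum_of_nonneg fun i _ => Real.sqrt_nonneg _, h2e,
    ← ENNReal.ofReal_mul (by norm_num)] at this
  exact (ENNReal.ofReal_le_ofReal_iff (by positivity)).1 this

end A19

section A20

lemma partition_exists {H J : Set ℝ} (h : LineOK H J) : ∀ (N : ℕ) (a b : ℚ), (a:ℝ) ∉ J →
    {s | s ∈ Ioo (a:ℝ) b ∧ s ∈ J}.Finite → {s | s ∈ Ioo (a:ℝ) b ∧ s ∈ J}.ncard = N + 1 →
    ∃ (q : ℕ → ℚ) (σ : ℕ → Bool) (t : ℕ → ℝ), q 0 = a ∧ q (N+1) = b ∧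
      ∀ i < N + 1, (q i : ℝ) ∉ J ∧ JL (sg (σ i) H) (q i) (t i) (q (i+1)) := by
  have single : ∀ (a b t : ℝ), a < t → t < b → t ∈ J → (∀ s ∈ Ioo a b, s ∈ J → s = t) →
      ∃ σ : Bool, JL (sg σ H) a t b := by
    intro a b t h1 h2 h3 h4
    rcases h.jump h1 h2 h3 h4 with hh | hh
    · exact ⟨true, h1, h2, hh.1, hh.2⟩
    · exact ⟨false, h1, h2, by simpa [sg] using hh.1, hh.2⟩
  intro N
  induction N with
  | zero =>
    intro a b ha hfin hc
    obtain ⟨t, ht⟩ := ncard_eq_one.1 hc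
    have htm : t ∈ {s | s ∈ Ioo (a:ℝ) b ∧ s ∈ J} := by rw [ht]; rfl
    obtain ⟨σ, hσ⟩ := single a b t htm.1.1 htm.1.2 htm.2 fun s hs hJ => by
      have : s ∈ {s | s ∈ Ioo (a:ℝ) b ∧ s ∈ J} := ⟨hs, hJ⟩
      rw [ht] at this; exact this
    refine ⟨fun i => if i = 0 then a else b, fun _ => σ, fun _ => t, by simp, by simp, fun i hi => ?_⟩
    have : i = 0 := by omega
    subst this
    simpa using ⟨ha, hσ⟩
  | succ N ih =>
    intro a b ha hfin hc
    set S := {s | s ∈ Ioo (a:ℝ) b ∧ s ∈ J} with hS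
    have hne : S.Nonempty := nonempty_of_ncard_ne_zero (by omega)
    obtain ⟨t0, ht0, hmin0⟩ := S.exists_min_image id hfin hne
    have hc1 : (S \ {t0}).ncard = N + 1 := by rw [ncard_diff_singleton_of_mem ht0, hc]; rfl
    have hfin1 : (S \ {t0}).Finite := hfin.subset diff_subset
    obtain ⟨t1, ht1, hmin1⟩ := (S \ {t0}).exists_min_image id hfin1 (nonempty_of_ncard_ne_zero (by omega))
    have h01 : t0 < t1 := lt_of_le_of_ne (hmin0 t1 ht1.1) fun hh => ht1.2 hh.symm
    obtain ⟨c, hc0, hc1'⟩ := exists_rat_btwn h01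
    have hcb : (c:ℝ) < b := hc1'.trans ht1.1.1.2
    have hac : (a:ℝ) < c := ht0.1.1.trans hc0
    have hcJ : (c:ℝ) ∉ J := by
      intro hh
      exact absurd (hmin1 c ⟨⟨⟨hac, hcb⟩, hh⟩, hc0.ne'⟩) (not_le.2 hc1')
    have hset : {s | s ∈ Ioo (c:ℝ) b ∧ s ∈ J} = S \ {t0} := by
      ext s
      constructor
      · rintro ⟨hs, hJ⟩
        exact ⟨⟨⟨hac.trans hs.1, hs.2⟩, hJ⟩, (hc0.trans hs.1).ne'⟩
      · intro hs
        exact ⟨⟨hc1'.trans_le (hmin1 s hs), hs.1.1.2⟩, hs.1.2⟩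
    obtain ⟨q, σ, t, hq0, hqN, hq⟩ := ih c b hcJ (hset ▸ hfin1) (hset ▸ hc1)
    obtain ⟨σ0, hσ0⟩ := single a c t0 ht0.1.1 hc0 ht0.2 fun s hs hJ => by
      by_contra hne
      exact absurd (hmin1 s ⟨⟨⟨hs.1, hs.2.trans hcb⟩, hJ⟩, hne⟩) (not_le.2 (hs.2.trans hc1'))
    refine ⟨fun i => Nat.casesOn i a q, fun i => Nat.casesOn i σ0 σ, fun i => Nat.casesOn i t0 t, rfl, hqN, ?_⟩
    intro i hi
    cases i with
    | zero =>
      refine ⟨ha, ?_⟩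
      change JL (sg σ0 H) a t0 (q 0)
      rw [hq0]; exact hσ0
    | succ i => exact hq i (by omega)

lemma JL.t_eq {H : Set ℝ} {σ : Bool} {a t b : ℝ} (hj : JL (sg σ H) a t b) :
    t = tt σ a b (volume {s | s ∈ Ioo a b ∧ s ∈ H}).toReal := by
  obtain ⟨h1, h2, h3, h4⟩ := hj
  cases σ
  · simp only [sg, tt, Bool.false_eq_true, if_false, mem_compl_iff, not_not] at *
    rw [vol_right h1.le h2.le h3 h4, ENNReal.toReal_ofReal (by linarith)]; ring
  · simp only [sg, tt, if_true] at *
    rw [vol_left h1.le h2.le h3 h4, ENNReal.toReal_ofReal (by linarith)]; ring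

lemma elem_dual {W : Type*} [NormedAddCommGroup W] [InnerProductSpace ℝ W] [FiniteDimensional ℝ W]
    {N : ℕ} {κ : ℝ} (hκ : 0 < κ) (a : ℕ → W →L[ℝ] ℝ)
    (h : ∑ i ∈ Finset.range N, Real.sqrt (1 + κ^2 * ‖a i‖^2) ≤
      2 * Real.sqrt (1 + κ^2 * ‖∑ i ∈ Finset.range N, a i‖^2 / 4)) :
    N ≤ 2 ∧ (N = 2 → a 0 = a 1) := by
  have : CompleteSpace W := FiniteDimensional.complete ℝ W
  set T := (InnerProductSpace.toDual ℝ W).symm with hT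
  have hn : ∀ b, ‖κ • T b‖^2 = κ^2 * ‖b‖^2 := by
    intro b
    rw [norm_smul, LinearIsometryEquiv.norm_map, mul_pow, Real.norm_eq_abs, sq_abs]
  obtain ⟨h1, h2⟩ := elem_ineq (N := N) (fun i => κ • T (a i)) (by
    rw [← Finset.smul_sum, ← map_sum]
    simp only [hn]
    exact h)
  refine ⟨h1, fun h3 => ?_⟩
  exact T.injective (smul_right_injective W hκ.ne' (h2 h3))

/-- periodic line sets -/
def Per (J : Set ℝ) : Prop := ∀ (t : ℝ) (k : ℤ), t + (k:ℝ) ∈ J ↔ t ∈ J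

lemma Per.vol {H : Set ℝ} (h : Per H) (a b : ℝ) (k : ℤ) :
    volume {s | s ∈ Ioo (a + k) (b + k) ∧ s ∈ H} = volume {s | s ∈ Ioo a b ∧ s ∈ H} := by
  rw [← measure_preimage_add_right volume (k:ℝ)]
  congr 1
  ext s
  simp [h s k]

lemma Per.compl {H : Set ℝ} (h : Per H) : Per Hᶜ := fun t k => not_congr (h t k)

lemma Per.empty {J : Set ℝ} (h : Per J) {a : ℝ} (ha : a ∉ J) (hJ : ∀ s ∈ Ioo a (a+1), s ∉ J) : J = ∅ := by
  refine eq_empty_of_forall_notMem fun t ht => ?_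
  have h1 := toIcoMod_mem_Ico one_pos a t
  have h2 : toIcoMod one_pos a t ∈ J := by
    have e : toIcoMod one_pos a t = t + ((- toIcoDiv one_pos a t : ℤ) : ℝ) := by
      rw [toIcoMod]; simp; ring
    rw [e, h]; exact ht
  rcases h1.1.eq_or_lt with h3 | h3
  · rw [← h3] at h2; exact ha h2
  · exact hJ _ ⟨h3, h1.2⟩ h2

lemma not_one_jump {H J : Set ℝ} (h : LineOK H J) (hH : Per H) (hJ : Per J) {a t : ℝ} (ha : a ∉ J)
    (hj : JL H a t (a+1)) : False := by
  have h0 := hj.mem h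
  obtain ⟨h1, h2, h3, h4⟩ := hj
  have hno : ∀ s ∈ Ioo t (t+1), s ∉ J := by
    intro s hs hsJ
    rcases lt_trichotomy s (a+1) with hh | hh | hh
    · exact hs.1.ne' (h0.2 s ⟨h1.trans hs.1, hh⟩ hsJ)
    · rw [hh] at hsJ
      exact ha ((hJ a 1).1 (by simpa using hsJ))
    · have e : s - 1 ∈ J := by
        have := (hJ (s-1) 1).1 (by simpa using hsJ)
        exact this
      have := h0.2 (s-1) ⟨by linarith, by linarith [hs.2]⟩ e
      linarith [hs.2]
  have hc := (h t (t+1)).1 hno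
  have hv := hH.compl.vol a t 1
  refine not_full_null (c := a+1) (d := t+1) (e := t) (f := a+1) (by linarith) (by linarith) le_rfl le_rfl (by linarith) (by linarith) ?_ h4 hc
  have : volume {s | s ∈ Ioo (a + ((1:ℤ):ℝ)) (t + ((1:ℤ):ℝ)) ∧ s ∈ Hᶜ} = 0 := hv.trans h3
  simpa using this

lemma not_same_type {H J : Set ℝ} (h : LineOK H J) {a t b t' c : ℝ} (hb : b ∉ J) (h1 : JL H a t b) (h2 : JL H b t' c) : False := by
  have m1 := h1.mem h
  have m2 := h2.mem h
  have hno : ∀ s ∈ Ioo t t', s ∉ J := by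
    intro s hs hsJ
    rcases lt_trichotomy s b with hh | hh | hh
    · exact hs.1.ne' (m1.2 s ⟨h1.1.trans hs.1, hh⟩ hsJ)
    · rw [hh] at hsJ; exact hb hsJ
    · exact hs.2.ne (m2.2 s ⟨hh, hs.2.trans h2.2.1⟩ hsJ)
  exact not_full_null (c := b) (d := t') (e := t) (f := b) h1.2.1.le h2.1 le_rfl le_rfl h1.2.1 h2.1.le h2.2.2.1 h1.2.2.2
    ((h t t').1 hno)

end A20

section A21
variable {Y : Type*} [NormedAddCommGroup Y] [InnerProductSpace ℝ Y] [FiniteDimensional ℝ Y]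
  [MeasurableSpace Y] [BorelSpace Y]

lemma theta_locFin {m : ℕ} {E : Set (CV Y)} (hE : μHE[m] (eB (m+1) E) ≠ ⊤) :
    LocFin m (theta ⁻¹' E) {v : PV Y | 0 < v.fst.fst} := by
  intro v hv
  obtain ⟨s, hs, K, -, hK, -⟩ := theta_LBL (v := v) hv
  have hΩ : IsOpen {v : PV Y | 0 < v.fst.fst} :=
    isOpen_lt continuous_const (PB_fst_cont.comp (WithLp.fstL 2 ℝ (PB Y) ℝ).continuous)
  set U := interior s ∩ {v : PV Y | 0 < v.fst.fst} with hU
  have hUo : IsOpen U := isOpen_interior.inter hΩ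
  refine ⟨U, hUo.mem_nhds ⟨mem_interior_iff_mem_nhds.2 hs, hv⟩, ?_⟩
  rw [Measure.restrict_apply hUo.measurableSet]
  have h1 := hausdorff_le_of_antilip_on (f := theta) (A := U ∩ eB (m+1) (theta ⁻¹' E)) K m hK
    (fun x hx => interior_subset hx.1.1)
  have h2 : theta '' (U ∩ eB (m+1) (theta ⁻¹' E)) ⊆ eB (m+1) E := by
    rintro _ ⟨x, ⟨hxU, hx⟩, rfl⟩
    exact (theta_eB (w := x.fst) hxU.2 x.snd (m+1) E).1 hx
  rw [Measure.euclideanHausdorffMeasure_def] at hE ⊢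
  rw [Measure.smul_apply] at hE ⊢
  have h3 : μH[(m:ℝ)] (eB (m+1) E) ≠ ⊤ := by
    intro hcon
    rw [hcon] at hE
    refine hE ?_
    rw [ENNReal.smul_def, smul_eq_mul, ENNReal.mul_top]
    exact_mod_cast (Measure.addHaarScalarFactor_volume_hausdorffMeasure_ne_zero m)
  have h4 : μH[(m:ℝ)] (U ∩ eB (m+1) (theta ⁻¹' E)) < ⊤ :=
    (h1.trans (mul_le_mul_right (measure_mono h2) _)).trans_lt
      (ENNReal.mul_lt_top (ENNReal.pow_lt_top ENNReal.coe_lt_top) h3.lt_top)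
  rw [ENNReal.smul_def, smul_eq_mul]
  exact ENNReal.mul_lt_top ENNReal.coe_lt_top h4

lemma fibre_structure {m : ℕ} (hm : Module.finrank ℝ (PB Y) = m) {E F : Set (CV Y)} (hE : MeasurableSet E)
    (hfinE : μHE[m] (eB (m+1) E) ≠ ⊤)
    (hcyl : ∀ b, MeasurableSet b → μHE[m] (eB (m+1) F ∩ cpi ⁻¹' b) = μHE[m] (eB (m+1) E ∩ cpi ⁻¹' b))
    (hF : ∀ᵐ p : PB Y, 0 < p.fst → ∀ t, Th p t ∈ eB (m+1) F →
      Th p t = Th p ((cavg E (Th p 0)).toReal / 2) ∨ Th p t = Th p (-((cavg E (Th p 0)).toReal / 2))) :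
    ∀ᵐ p : PB Y, 0 < p.fst →
      LineOK {t | Th p t ∈ E} {t | Th p t ∈ eB (m+1) E} ∧
      ({t | Th p t ∈ eB (m+1) E} = ∅ ∨
      ∃ (q : ℕ → ℚ) (σ : ℕ → Bool) (f : ℕ → PB Y → ℝ), (q 2 : ℝ) = q 0 + 1 ∧ (∀ i, Continuous (f i)) ∧
        (∀ i, DifferentiableAt ℝ (f i) p) ∧ fderiv ℝ (f 0) p = fderiv ℝ (f 1) p ∧
        ∀ i < 2, Th p (q i) ∉ eB (m+1) E ∧
          JL (sg (σ i) {s | Th p s ∈ E}) (q i) (tt (σ i) (q i) (q (i+1)) (f i p)) (q (i+1)) ∧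
          MZ m {p' | JL (sg (σ i) {s | Th p' s ∈ E}) (q i) (tt (σ i) (q i) (q (i+1)) (f i p')) (q (i+1))}ᶜ p) := by
  classical
  have hG : MeasurableSet (theta ⁻¹' E) := theta_cont.measurable hE
  obtain ⟨Fn, hFl, hFae⟩ := GL2 (psplit (Y := Y)) hm hG (theta_locFin hfinE)
  have hL := ae_lineOK (psplit (Y := Y)) hm hG
  have hcount : Countable (ℕ × List (ℚ × ℕ × Bool)) := inferInstance
  set qq : List (ℚ × ℕ × Bool) → ℕ → ℚ := fun l i => (l[i]?.getD (0,0,true)).1 with hqq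
  set jj : List (ℚ × ℕ × Bool) → ℕ → ℕ := fun l i => (l[i]?.getD (0,0,true)).2.1 with hjj
  set ss : List (ℚ × ℕ × Bool) → ℕ → Bool := fun l i => (l[i]?.getD (0,0,true)).2.2 with hss
  have hslope : ∀ᵐ p : PB Y, ∀ z : ℕ × List (ℚ × ℕ × Bool), ((qq z.2 z.1 : ℚ) : ℝ) = qq z.2 0 + 1 → 0 < p.fst →
      (∀ i < z.1, JL (sg (ss z.2 i) {s | Th p s ∈ E}) (qq z.2 i) (tt (ss z.2 i) (qq z.2 i) (qq z.2 (i+1)) (Fn (qq z.2 i) (qq z.2 (i+1)) (jj z.2 i) p)) (qq z.2 (i+1))) →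
      (∀ i, DifferentiableAt ℝ (Fn (qq z.2 i) (qq z.2 (i+1)) (jj z.2 i)) p) ∧
      z.1 ≤ 2 ∧ (z.1 = 2 → fderiv ℝ (Fn (qq z.2 0) (qq z.2 (0+1)) (jj z.2 0)) p = fderiv ℝ (Fn (qq z.2 1) (qq z.2 (1+1)) (jj z.2 1)) p) := by
    rw [ae_all_iff]
    rintro ⟨N, l⟩
    by_cases hq : ((qq l N : ℚ) : ℝ) = qq l 0 + 1
    · filter_upwards [slope_ineq hm hE hcyl hF N (qq l) hq (fun i => Fn (qq l i) (qq l (i+1)) (jj l i)) (fun i => hFl _ _ _) (ss l)] with p hp _ h0 hJ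
      obtain ⟨h1, h2⟩ := hp h0 hJ
      exact ⟨h1, elem_dual (κ := 2 * Real.pi * p.fst) (by have := Real.pi_pos; positivity)
        (fun i => fderiv ℝ (Fn (qq l i) (qq l (i+1)) (jj l i)) p) h2⟩
    · exact Eventually.of_forall fun p h => absurd h hq
  have hdens : ∀ᵐ p : PB Y, ∀ z : ℚ × ℚ × ℕ × Bool,
      p ∈ {p' | JL (sg z.2.2.2 {s | Th p' s ∈ E}) z.1 (tt z.2.2.2 z.1 z.2.1 (Fn z.1 z.2.1 z.2.2.1 p')) z.2.1} →
      MZ m {p' | JL (sg z.2.2.2 {s | Th p' s ∈ E}) z.1 (tt z.2.2.2 z.1 z.2.1 (Fn z.1 z.2.1 z.2.2.1 p')) z.2.1}ᶜ p := by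
    rw [ae_all_iff]
    rintro ⟨a, b, j, σ⟩
    refine MZ_compl_ae_of_mem hm volume ?_
    have hc : Continuous (Fn a b j) := (hFl a b j).choose_spec.continuous
    have htc : Continuous fun p => tt σ a b (Fn a b j p) := by
      simp only [tt]; split_ifs <;> fun_prop
    cases σ
    · exact JL_meas psplit hG.compl a b htc.measurable
    · exact JL_meas psplit hG a b htc.measurable
  filter_upwards [hFae, hL, hslope, hdens] with p h1 h2 h3 h4 hp
  have hJset : {t | psplit.Φ (p, t) ∈ eB (m+1) (theta ⁻¹' E)} = {t | Th p t ∈ eB (m+1) E} := by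
    ext t; exact theta_eB hp t _ _
  rw [hJset] at h2
  have h2 : LineOK {t | Th p t ∈ E} {t | Th p t ∈ eB (m+1) E} := h2
  refine ⟨h2, ?_⟩
  set H := {t | Th p t ∈ E} with hH
  set J := {t | Th p t ∈ eB (m+1) E} with hJ
  have hPH : Per H := fun t k => by simp only [hH, mem_setOf_eq, Th_int]
  have hPJ : Per J := fun t k => by simp only [hJ, mem_setOf_eq, Th_int]
  have hfin : ∀ a b : ℚ, {t | t ∈ Ioo (a:ℝ) b ∧ t ∈ J}.Finite := by
    intro a b
    have := (h1 a b fun t _ => hp).2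
    refine this.subset fun t ht => ⟨ht.1, (theta_eB hp t _ _).2 ht.2⟩
  have hslm : ∀ a b : ℚ, ∃ j, (volume {s | s ∈ Ioo (a:ℝ) b ∧ s ∈ H}).toReal = Fn a b j p := fun a b =>
    (h1 a b fun t _ => hp).1
  -- a rational base point off `J`
  obtain ⟨q0, hq0⟩ : ∃ q0 : ℚ, (q0:ℝ) ∉ J := by
    by_contra hcon
    push Not at hcon
    have hinf : (Ioo (0:ℚ) 1).Infinite := Ioo_infinite one_pos
    refine hinf ?_
    have h5 := (hfin 0 1).preimage (f := fun q : ℚ => (q:ℝ)) (Rat.cast_injective.injOn)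
    refine h5.subset fun q hq => ⟨⟨?_, ?_⟩, hcon q⟩
    · show ((0:ℚ):ℝ) < (q:ℝ)
      exact_mod_cast hq.1
    · show (q:ℝ) < ((1:ℚ):ℝ)
      exact_mod_cast hq.2
  rcases Nat.eq_zero_or_pos ({t | t ∈ Ioo (q0:ℝ) ((q0+1:ℚ):ℝ) ∧ t ∈ J}.ncard) with hz | hpos
  · left
    have := (ncard_eq_zero (hfin q0 (q0+1))).1 hz
    refine hPJ.empty hq0 fun s hs hsJ => ?_
    have h6 : s ∈ {t | t ∈ Ioo (q0:ℝ) ((q0+1:ℚ):ℝ) ∧ t ∈ J} := ⟨by push_cast; exact hs, hsJ⟩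
    rw [this] at h6; exact h6
  right
  obtain ⟨N, hN⟩ : ∃ N, {t | t ∈ Ioo (q0:ℝ) ((q0+1:ℚ):ℝ) ∧ t ∈ J}.ncard = N + 1 := ⟨_, (Nat.sub_add_cancel hpos).symm⟩
  obtain ⟨q, σ, t, hqa, hqb, hq⟩ := partition_exists h2 N q0 (q0+1) hq0 (hfin _ _) hN
  choose j hj using hslm
  set l : List (ℚ × ℕ × Bool) := (List.range (N+2)).map fun i => (q i, j (q i) (q (i+1)), σ i) with hl
  have hli : ∀ i < N + 2, l[i]?.getD (0,0,true) = (q i, j (q i) (q (i+1)), σ i) := by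
    intro i hi
    simp [hl, List.getElem?_map, List.getElem?_range hi]
  have e1 : ∀ i < N + 2, qq l i = q i := fun i hi => by simp only [hqq, hli i hi]
  have e2 : ∀ i < N + 2, jj l i = j (q i) (q (i+1)) := fun i hi => by simp only [hjj, hli i hi]
  have e3 : ∀ i < N + 2, ss l i = σ i := fun i hi => by simp only [hss, hli i hi]
  have hJL : ∀ i < N + 1, JL (sg (ss l i) H) (qq l i) (tt (ss l i) (qq l i) (qq l (i+1)) (Fn (qq l i) (qq l (i+1)) (jj l i) p)) (qq l (i+1)) := by
    intro i hi
    rw [e1 i (by omega), e1 (i+1) (by omega), e2 i (by omega), e3 i (by omega), ← hj]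
    have := (hq i hi).2
    rw [← this.t_eq]; exact this
  have hper : ((qq l (N+1) : ℚ) : ℝ) = qq l 0 + 1 := by
    rw [e1 (N+1) (by omega), e1 0 (by omega), hqa, hqb]; push_cast; rfl
  obtain ⟨g1, g2, g3⟩ := h3 (N+1, l) hper hp hJL
  simp only at g1 g2 g3
  have hN1 : N = 1 := by
    rcases Nat.eq_zero_or_pos N with h0 | h0
    · exfalso
      subst h0
      have a1 := hJL 0 (by omega)
      rw [hper] at a1
      refine not_one_jump (h2.sg (ss l 0)) ?_ hPJ ?_ a1
      · cases ss l 0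
        · exact hPH.compl
        · exact hPH
      · rw [e1 0 (by omega)]; exact (hq 0 (by omega)).1
    · omega
  subst hN1
  refine ⟨qq l, ss l, fun i => Fn (qq l i) (qq l (i+1)) (jj l i), hper, fun i => (hFl _ _ _).choose_spec.continuous, g1, g3 rfl, fun i hi => ⟨?_, hJL i hi, ?_⟩⟩
  · rw [e1 i (by omega)]; exact (hq i hi).1
  · exact h4 (qq l i, qq l (i+1), jj l i, ss l i) (hJL i hi)

end A21

section A22
open scoped Pointwise
variable {X : Type*} [NormedAddCommGroup X] [NormedSpace ℝ X] [FiniteDimensional ℝ X]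
  [MeasurableSpace X] [BorelSpace X]

lemma cone_not_MZ {d : ℕ} (hd : Module.finrank ℝ X = d) {K : Set X} (hK : IsOpen K) (hne : K.Nonempty)
    (hc : ∀ c : ℝ, 0 < c → ∀ z ∈ K, c • z ∈ K) (x : X) : ¬ MZ d {y | y - x ∈ K} x := by
  intro h
  have hH := haarH hd
  set μ : Measure X := μH[(d:ℝ)] with hμ
  have hb : 0 < μ (K ∩ ball 0 1) := by
    refine (hK.inter isOpen_ball).measure_pos μ ?_
    obtain ⟨z, hz⟩ := hne
    refine ⟨(1/(‖z‖+1)) • z, hc _ (by positivity) z hz, ?_⟩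
    rw [mem_ball_zero_iff, norm_smul, Real.norm_of_nonneg (by positivity), one_div, ← div_eq_inv_mul,
      div_lt_one (by positivity)]
    linarith
  have hbt : μ (K ∩ ball 0 1) ≠ ⊤ := ((measure_mono inter_subset_right).trans_lt measure_ball_lt_top).ne
  have hp := ENNReal.toReal_pos hb.ne' hbt
  obtain ⟨ρ, hρ, hρ0⟩ := ((h ((μ (K ∩ ball 0 1)).toReal / 2) (by positivity)).and self_mem_nhdsWithin).exists
  have hρ0 : 0 < ρ := hρ0
  have hsub : (fun z => x + ρ • z) '' (K ∩ ball 0 1) ⊆ {y | y - x ∈ K} ∩ ball x ρ := by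
    rintro _ ⟨z, ⟨hz, hz1⟩, rfl⟩
    refine ⟨by simpa using hc ρ hρ0 z hz, ?_⟩
    rw [mem_ball_iff_norm, add_sub_cancel_left, norm_smul, Real.norm_of_nonneg hρ0.le]
    rw [mem_ball_zero_iff] at hz1
    nlinarith
  have h2 : μ ((fun z => x + ρ • z) '' (K ∩ ball 0 1)) = ENNReal.ofReal (ρ^d) * μ (K ∩ ball 0 1) := by
    have : (fun z => x + ρ • z) '' (K ∩ ball 0 1) = (fun z => x + z) '' (ρ • (K ∩ ball 0 1)) := by
      rw [← image_smul, image_image]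
    rw [this, image_add_left, measure_preimage_add, Measure.addHaar_smul, hd, abs_of_pos (by positivity)]
  have h3 := (measure_mono hsub).trans hρ
  rw [h2] at h3
  have h4 := ENNReal.toReal_mono (by simp) h3
  rw [ENNReal.toReal_mul, ENNReal.toReal_ofReal (by positivity), ENNReal.toReal_ofReal (by positivity)] at h4
  have : 0 < ρ^d * (μ (K ∩ ball 0 1)).toReal := by positivity
  linarith

lemma strip_MZ {d : ℕ} (hd : Module.finrank ℝ X = d) {φ : X → ℝ} {L : X →L[ℝ] ℝ} {x : X}
    (hφ : HasFDerivAt φ L x) (h0 : φ x = 0) (hL : L ≠ 0) : MZ d {y | 0 ≤ φ y ∧ L (y - x) ≤ 0} x := by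
  have hH := haarH hd
  set μ : Measure X := μH[(d:ℝ)] with hμ
  intro ε hε
  have hS : ∃ k : ℕ, μ {z ∈ ball (0:X) 1 | |L z| ≤ 1/((k:ℝ)+1)} ≤ ENNReal.ofReal ε := by
    have hanti : Antitone fun k : ℕ => {z ∈ ball (0:X) 1 | |L z| ≤ 1/((k:ℝ)+1)} := by
      intro i j hij z hz
      refine ⟨hz.1, hz.2.trans ?_⟩
      have : (i:ℝ) ≤ j := by exact_mod_cast hij
      exact one_div_le_one_div_of_le (by positivity) (by linarith)
    have ht := tendsto_measure_iInter_atTop (μ := μ) (s := fun k : ℕ => {z ∈ ball (0:X) 1 | |L z| ≤ 1/((k:ℝ)+1)})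
      (fun k => (measurableSet_ball.inter (measurableSet_le (f := fun z => |L z|) (L.continuous.abs.measurable) measurable_const)).nullMeasurableSet)
      hanti ⟨0, ((measure_mono fun z hz => hz.1).trans_lt (measure_ball_lt_top (x := (0:X)) (r := 1))).ne⟩
    have hz : μ (⋂ k : ℕ, {z ∈ ball (0:X) 1 | |L z| ≤ 1/((k:ℝ)+1)}) = 0 := by
      have hne : LinearMap.ker (L : X →ₗ[ℝ] ℝ) ≠ ⊤ := by
        intro h
        refine hL ?_
        ext z
        have : z ∈ LinearMap.ker (L : X →ₗ[ℝ] ℝ) := by rw [h]; trivial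
        exact this
      refine measure_mono_null ?_ (Measure.addHaar_submodule μ _ hne)
      intro z hz
      rw [mem_iInter] at hz
      have h1 : |L z| ≤ 0 := by
        refine ge_of_tendsto' (tendsto_one_div_add_atTop_nhds_zero_nat (𝕜 := ℝ)) fun k => (hz k).2
      exact abs_nonpos_iff.1 h1
    rw [hz] at ht
    exact ((ENNReal.tendsto_nhds_zero.1 ht) (ENNReal.ofReal ε) (by simpa using hε)).exists
  obtain ⟨k, hk⟩ := hS
  have h1 := (hasFDerivAt_iff_isLittleO.1 hφ).def (c := 1/((k:ℝ)+1)) (by positivity)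
  obtain ⟨r, hr, hrb⟩ := Metric.eventually_nhds_iff_ball.1 h1
  filter_upwards [Ioo_mem_nhdsGT hr] with ρ hρ
  have hρ0 : 0 < ρ := hρ.1
  have hsub : {y | 0 ≤ φ y ∧ L (y - x) ≤ 0} ∩ ball x ρ ⊆ (fun z => x + z) '' (ρ • {z ∈ ball (0:X) 1 | |L z| ≤ 1/((k:ℝ)+1)}) := by
    rintro y ⟨⟨hy1, hy2⟩, hyb⟩
    have h3 := hrb y (ball_subset_ball hρ.2.le hyb)
    rw [mem_ball_iff_norm] at hyb
    rw [h0, sub_zero, Real.norm_eq_abs, map_sub, ← map_sub] at h3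
    have h4 : |L (y - x)| ≤ 1/((k:ℝ)+1) * ρ := by
      rw [abs_of_nonpos hy2]
      have := (le_abs_self _).trans h3
      have h5 : 1/((k:ℝ)+1) * ‖y - x‖ ≤ 1/((k:ℝ)+1) * ρ := by gcongr
      linarith
    refine ⟨y - x, ⟨ρ⁻¹ • (y - x), ⟨?_, ?_⟩, by simp [smul_smul, hρ0.ne']⟩, by simp⟩
    · rw [mem_ball_zero_iff, norm_smul, norm_inv, Real.norm_of_nonneg hρ0.le, inv_mul_lt_iff₀ hρ0]; linarith
    · rw [map_smul, smul_eq_mul, abs_mul, abs_inv, abs_of_pos hρ0, inv_mul_le_iff₀ hρ0]; linarith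
  refine (measure_mono hsub).trans ?_
  rw [image_add_left, measure_preimage_add, Measure.addHaar_smul, hd, abs_of_pos (by positivity), mul_comm ε,
    ENNReal.ofReal_mul (by positivity)]
  exact mul_le_mul_right hk _

lemma strip_swap {d : ℕ} (hd : Module.finrank ℝ X = d) {φ : X → ℝ} {L : X →L[ℝ] ℝ} {x : X}
    (hφ : HasFDerivAt φ L x) (h0 : φ x = 0) (hL : L ≠ 0) (G : Set X) :
    MZ d {y | y ∈ G ∧ 0 < φ y} x ↔ MZ d {y | y ∈ G ∧ 0 < L (y - x)} x := by
  have h1 := strip_MZ hd hφ h0 hL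
  have h2 := strip_MZ hd (φ := fun y => -φ y) (L := -L) hφ.neg (by simp [h0]) (neg_ne_zero.2 hL)
  constructor
  · intro h
    refine MZm_mono ?_ (MZm_union h h2)
    rintro y ⟨hy, hy2⟩
    rcases lt_or_ge 0 (φ y) with h | h
    · exact Or.inl ⟨hy, h⟩
    · exact Or.inr ⟨by simpa using h, by simpa using hy2.le⟩
  · intro h
    refine MZm_mono ?_ (MZm_union h h1)
    rintro y ⟨hy, hy2⟩
    rcases lt_or_ge 0 (L (y - x)) with h | h
    · exact Or.inl ⟨hy, h⟩
    · exact Or.inr ⟨hy2.le, h⟩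

/-- blow-up of `G` at `x` is the half space `{L ≤ 0}` -/
def BU (d : ℕ) (G : Set X) (x : X) (L : X →L[ℝ] ℝ) : Prop :=
  MZ d {y | y ∈ G ∧ 0 < L (y - x)} x ∧ MZ d {y | y ∉ G ∧ L (y - x) < 0} x

lemma BU.neg {d : ℕ} {G : Set X} {x : X} {L L' : X →L[ℝ] ℝ} (h : BU d Gᶜ x L) (hL : L' = -L) : BU d G x L' := by
  subst hL
  refine ⟨MZm_mono ?_ h.2, MZm_mono ?_ h.1⟩
  · rintro y ⟨h1, h2⟩; exact ⟨fun h => h h1, by simpa using h2⟩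
  · rintro y ⟨h1, h2⟩; exact ⟨h1, by simpa using h2⟩

lemma BU_swap {d : ℕ} (hd : Module.finrank ℝ X = d) {φ : X → ℝ} {L : X →L[ℝ] ℝ} {x : X}
    (hφ : HasFDerivAt φ L x) (h0 : φ x = 0) (hL : L ≠ 0) (G : Set X) :
    (MZ d {y | y ∈ G ∧ 0 < φ y} x ∧ MZ d {y | y ∉ G ∧ φ y < 0} x) ↔ BU d G x L := by
  have := strip_swap hd (φ := fun y => -φ y) (L := -L) hφ.neg (by simp [h0]) (neg_ne_zero.2 hL) Gᶜ
  simp only [mem_compl_iff, Left.neg_pos_iff, ContinuousLinearMap.neg_apply] at this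
  exact and_congr (strip_swap hd hφ h0 hL G) this

lemma BU.mem_eB {d : ℕ} (hd : Module.finrank ℝ X = d) {G : Set X} {x : X} {L : X →L[ℝ] ℝ} (h : BU d G x L)
    (hL : L ≠ 0) : x ∈ eB d G := by
  obtain ⟨z, hz⟩ : ∃ z, 0 < L z := by
    by_contra hcon
    push Not at hcon
    refine hL (ContinuousLinearMap.ext fun z => le_antisymm (hcon z) ?_)
    have := hcon (-z)
    rw [map_neg] at this
    simpa using this
  constructor
  · intro hG
    refine cone_not_MZ hd (K := {z | L z < 0}) (isOpen_lt L.continuous continuous_const) ⟨-z, by simpa using hz⟩ ?_ x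
      (MZm_mono ?_ (MZm_union h.2 hG))
    · intro c hc w hw
      simpa using mul_neg_of_pos_of_neg hc hw
    · intro y hy
      by_cases hyG : y ∈ G
      · exact Or.inr hyG
      · exact Or.inl ⟨hyG, hy⟩
  · intro hG
    refine cone_not_MZ hd (K := {z | 0 < L z}) (isOpen_lt continuous_const L.continuous) ⟨z, hz⟩ ?_ x
      (MZm_mono ?_ (MZm_union h.1 hG))
    · intro c hc w hw
      simpa using mul_pos hc hw
    · intro y hy
      by_cases hyG : y ∈ G
      · exact Or.inl ⟨hyG, hy⟩
      · exact Or.inr hyG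

lemma BU.unique {V : Type*} [NormedAddCommGroup V] [InnerProductSpace ℝ V] [FiniteDimensional ℝ V]
    [MeasurableSpace V] [BorelSpace V] {d : ℕ} (hd : Module.finrank ℝ V = d) {G : Set V} {x ν ν' : V}
    (h : BU d G x (innerSL ℝ ν)) (h' : BU d G x (innerSL ℝ ν')) (hν : ‖ν‖ = 1) (hν' : ‖ν'‖ = 1) : ν = ν' := by
  by_contra hne
  have hlt : ⟪ν, ν'⟫ < 1 := (inner_lt_one_iff_real_of_norm_eq_one hν hν').2 hne
  refine cone_not_MZ hd (K := {z | 0 < ⟪ν, z⟫ ∧ ⟪ν', z⟫ < 0}) ?_ ⟨ν - ν', ?_, ?_⟩ ?_ x (MZm_mono ?_ (MZm_union h.1 h'.2))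
  · exact (isOpen_lt continuous_const (innerSL ℝ ν).continuous).inter (isOpen_lt (innerSL ℝ ν').continuous continuous_const)
  · rw [inner_sub_right, real_inner_self_eq_norm_sq, hν]; linarith
  · rw [inner_sub_right, real_inner_self_eq_norm_sq, hν', real_inner_comm]; linarith
  · rintro c hc z ⟨h1, h2⟩
    refine ⟨?_, ?_⟩
    · rw [inner_smul_right]; exact mul_pos hc h1
    · rw [inner_smul_right]; exact mul_neg_of_pos_of_neg hc h2
  · intro y hy
    by_cases hyG : y ∈ G
    · exact Or.inl ⟨hyG, hy.1⟩
    · exact Or.inr ⟨hyG, hy.2⟩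

end A22

section A23
variable {W : Type*} [NormedAddCommGroup W] [InnerProductSpace ℝ W] [FiniteDimensional ℝ W]
  [MeasurableSpace W] [BorelSpace W]
variable {V : Type*} [NormedAddCommGroup V] [InnerProductSpace ℝ V] [FiniteDimensional ℝ V]
  [MeasurableSpace V] [BorelSpace V]

lemma cyl_MZ {m : ℕ} (hm : Module.finrank ℝ W = m) {Z : Set W} {p : W} (h : MZ m Z p) (t : ℝ) :
    MZ (m+1) {y : W × ℝ | y.1 ∈ Z} (p, t) := by
  have hh : (volume : Measure (W × ℝ)).IsAddHaarMeasure := Measure.prod.instIsAddHaarMeasure _ _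
  rw [MZ_iff_haar (finrank_prodR hm) volume]
  rw [MZ_iff_haar hm volume] at h
  intro ε hε
  filter_upwards [h (ε/2) (by positivity), self_mem_nhdsWithin] with ρ h1 (h2 : 0 < ρ)
  have : {y : W × ℝ | y.1 ∈ Z} ∩ ball (p, t) ρ = (Z ∩ ball p ρ) ×ˢ ball t ρ := by
    rw [← ball_prod_same]; ext y; simp [and_assoc]
  rw [this, Measure.volume_eq_prod, Measure.prod_prod, Real.volume_ball]
  refine (mul_le_mul_left h1 _).trans ?_
  rw [← ENNReal.ofReal_mul (by positivity)]
  apply ENNReal.ofReal_le_ofReal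
  rw [pow_succ]; apply le_of_eq; ring

lemma MZm_null {X : Type*} [MetricSpace X] [MeasurableSpace X] {μ : Measure X} {d : ℕ} {G : Set X} (h : μ G = 0) (x : X) :
    MZm μ d G x := fun ε _ => Eventually.of_forall fun ρ => by
  rw [measure_mono_null inter_subset_left h]; exact zero_le

lemma graph_MZ (S : OSplit W V) {m : ℕ} (hm : Module.finrank ℝ W = m) {G : Set V} (hG : MeasurableSet G) {a b : ℝ}
    {t : W → ℝ} (ht : Measurable t) {p : W} (hp : JL {s | S.Φ (p, s) ∈ G} a (t p) b)
    (hZ : MZ m {p' | JL {s | S.Φ (p', s) ∈ G} a (t p') b}ᶜ p) :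
    MZ (m+1) {y | y ∈ G ∧ 0 < (S.Φ.symm y).2 - t (S.Φ.symm y).1} (S.Φ (p, t p)) ∧
    MZ (m+1) {y | y ∉ G ∧ (S.Φ.symm y).2 - t (S.Φ.symm y).1 < 0} (S.Φ (p, t p)) := by
  set Z := {p' | JL {s | S.Φ (p', s) ∈ G} a (t p') b} with hZd
  have hZm : MeasurableSet Z := JL_meas S hG a b ht
  have hGm : MeasurableSet {z : W × ℝ | S.Φ z ∈ G} := S.Φ.continuous.measurable hG
  have ht1 : Measurable fun z : W × ℝ => t z.1 := ht.comp measurable_fst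
  have m1 : MeasurableSet {z : W × ℝ | z.2 ∈ Ioo a (t z.1) ∧ S.Φ z ∉ G} :=
    ((measurableSet_lt measurable_const measurable_snd).inter (measurableSet_lt measurable_snd ht1)).inter hGm.compl
  have m2 : MeasurableSet {z : W × ℝ | z.2 ∈ Ioo (t z.1) b ∧ S.Φ z ∈ G} :=
    ((measurableSet_lt ht1 measurable_snd).inter (measurableSet_lt measurable_snd measurable_const)).inter hGm
  have mZ : MeasurableSet {z : W × ℝ | z.1 ∈ Z} := measurable_fst hZm
  have hh : (volume : Measure (W × ℝ)).IsAddHaarMeasure := Measure.prod.instIsAddHaarMeasure _ _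
  have hcyl := cyl_MZ hm hZ (t p)
  have key : ∀ A B : Set (W × ℝ), MeasurableSet A → (∀ w ∈ Z, volume {s | (w, s) ∈ A} = 0) →
      B ⊆ {y | y.1 ∈ Zᶜ} ∪ A → MZ (m+1) B (p, t p) := by
    intro A B hA hA0 hB
    have h0 : volume (A ∩ {z : W × ℝ | z.1 ∈ Z}) = 0 := by
      rw [Measure.volume_eq_prod, Measure.measure_prod_null (hA.inter mZ)]
      refine Eventually.of_forall fun w => ?_
      by_cases hw : w ∈ Z
      · exact measure_mono_null (fun s hs => hs.1) (hA0 w hw)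
      · refine measure_mono_null (t := ∅) (fun s hs => hw hs.2) measure_empty
    have h1 : MZ (m+1) (A ∩ {z : W × ℝ | z.1 ∈ Z}) (p, t p) :=
      (MZ_iff_haar (finrank_prodR hm) volume _ _).2 (MZm_null h0 _)
    refine MZm_mono ?_ (MZm_union hcyl h1)
    intro z hz
    by_cases hw : z.1 ∈ Z
    · rcases hB hz with h | h
      · exact absurd hw h
      · exact Or.inr ⟨h, hw⟩
    · exact Or.inl hw
  have hc : Continuous fun y => (S.Φ.symm y).2 := continuous_snd.comp S.Φ.symm.continuous
  constructor
  · refine MZ_local (U := {y | (S.Φ.symm y).2 < b}) (isOpen_lt hc continuous_const)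
      (G' := {y | y ∈ G ∧ 0 < (S.Φ.symm y).2 - t (S.Φ.symm y).1 ∧ (S.Φ.symm y).2 < b})
      (fun y hy => ⟨hy.1.1, hy.1.2, hy.2⟩) (by simpa using hp.2.1) ?_
    refine ((LBL_of_linearEquiv S.Φ (p, t p)).MZ_iff (m+1) _).1 (key _ _ m2 (fun w hw => hw.2.2.2) ?_)
    rintro z ⟨h1, h2, h3⟩
    simp only [ContinuousLinearEquiv.symm_apply_apply] at h2 h3
    exact Or.inr ⟨⟨by linarith, h3⟩, h1⟩
  · refine MZ_local (U := {y | a < (S.Φ.symm y).2}) (isOpen_lt continuous_const hc)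
      (G' := {y | y ∉ G ∧ (S.Φ.symm y).2 - t (S.Φ.symm y).1 < 0 ∧ a < (S.Φ.symm y).2})
      (fun y hy => ⟨hy.1.1, hy.1.2, hy.2⟩) (by simpa using hp.1) ?_
    refine ((LBL_of_linearEquiv S.Φ (p, t p)).MZ_iff (m+1) _).1 (key _ _ m1 (fun w hw => hw.2.2.1) ?_)
    rintro z ⟨h1, h2, h3⟩
    simp only [ContinuousLinearEquiv.symm_apply_apply] at h2 h3
    exact Or.inr ⟨⟨h3, by linarith⟩, h1⟩

variable {Y : Type*} [NormedAddCommGroup Y] [InnerProductSpace ℝ Y] [FiniteDimensional ℝ Y]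
  [MeasurableSpace Y] [BorelSpace Y]

/-- unnormalised normal -/
noncomputable def nvec (g : PB Y) (κ t : ℝ) : CV Y := WithLp.toLp 2 (((-g.fst : ℝ) + (κ : ℝ) * Complex.I) * pe t, -g.snd)

lemma cinner_pe (a b c d t : ℝ) : ⟪((a:ℂ) + b * Complex.I) * pe t, ((c:ℂ) + d * Complex.I) * pe t⟫ = a * c + b * d := by
  have h : pe t * (starRingEnd ℂ) (pe t) = 1 := by
    rw [Complex.mul_conj, Complex.normSq_eq_norm_sq, pe_norm]; simp
  rw [Complex.inner, map_mul, show (((c:ℂ) + d * Complex.I) * pe t) * ((starRingEnd ℂ) ((a:ℂ) + b * Complex.I) * (starRingEnd ℂ) (pe t))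
    = (starRingEnd ℂ) ((a:ℂ) + b * Complex.I) * ((c:ℂ) + d * Complex.I) * (pe t * (starRingEnd ℂ) (pe t)) by ring, h]
  simp

lemma nvec_inner (g : PB Y) (κ t r : ℝ) (v : PV Y) :
    ⟪nvec g κ t, Dth r t v⟫ = κ * (2 * Real.pi * r) * v.snd - ⟪g, v.fst⟫ := by
  rw [Dth_apply, nvec, WithLp.prod_inner_apply, WithLp.prod_inner_apply]
  simp only [cinner_pe]
  rw [inner_neg_left]
  simp
  ring

lemma BU_theta {m : ℕ} (hm : Module.finrank ℝ (PB Y) = m) {E : Set (CV Y)} (hE : MeasurableSet E) {a b : ℝ}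
    {t : PB Y → ℝ} (ht : Measurable t) {p g : PB Y} (hp0 : 0 < p.fst) (hp : JL {s | Th p s ∈ E} a (t p) b)
    (hZ : MZ m {p' | JL {s | Th p' s ∈ E} a (t p') b}ᶜ p) (hd : HasFDerivAt t (innerSL ℝ g) p) :
    BU (m+1) E (Th p (t p)) (innerSL ℝ (nvec g (1/(2*Real.pi*p.fst)) (t p))) := by
  have hG : MeasurableSet (theta ⁻¹' E) := theta_cont.measurable hE
  have h1 := graph_MZ (psplit (Y := Y)) hm hG ht hp hZ
  have hV : Module.finrank ℝ (PV Y) = m + 1 := by rw [(psplit (Y := Y)).finrank, hm]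
  set v : PV Y := psplit.Φ (p, t p) with hv
  set N : CV Y →L[ℝ] ℝ := innerSL ℝ (nvec g (1/(2*Real.pi*p.fst)) (t p)) with hN
  set L : PV Y →L[ℝ] ℝ := N.comp (Dth p.fst (t p)) with hL
  have hk : 1/(2*Real.pi*p.fst) * (2 * Real.pi * p.fst) = 1 := by
    have := Real.pi_pos; field_simp
  have hLa : ∀ u : PV Y, L u = u.snd - ⟪g, u.fst⟫ := by
    intro u
    have := nvec_inner g (1/(2*Real.pi*p.fst)) (t p) p.fst u
    rw [hk, one_mul] at this
    exact this
  have hL0 : L ≠ 0 := by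
    intro h
    have h2 := hLa (psplit.Φ (0, 1))
    rw [h, psplit_snd, psplit_fst] at h2
    simp at h2
  have hφ : HasFDerivAt (fun y : PV Y => (psplit.Φ.symm y).2 - t (psplit.Φ.symm y).1) L v := by
    have h3 : HasFDerivAt (fun y : PV Y => t (WithLp.fstL 2 ℝ (PB Y) ℝ y)) ((innerSL ℝ g).comp (WithLp.fstL 2 ℝ (PB Y) ℝ)) v :=
      HasFDerivAt.comp v (by exact hd) (WithLp.fstL 2 ℝ (PB Y) ℝ).hasFDerivAt
    have h4 := (WithLp.sndL 2 ℝ (PB Y) ℝ).hasFDerivAt (x := v) |>.sub h3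
    refine h4.congr_fderiv (ContinuousLinearMap.ext fun u => ?_)
    rw [hLa]; rfl
  have h0 : (psplit.Φ.symm v).2 - t (psplit.Φ.symm v).1 = 0 := by
    rw [hv]; simp
  have h2 := (BU_swap hV hφ h0 hL0 _).1 h1
  have hψ : HasFDerivAt (fun y : PV Y => N (theta y - theta v)) L v := by
    have := N.hasFDerivAt.comp v ((theta_fderiv v).sub_const (theta v))
    exact this
  have h3 := (BU_swap hV hψ (by simp) hL0 _).2 h2
  have hlbl := theta_LBL (v := v) hp0
  exact ⟨(hlbl.MZ_iff (m+1) _).1 h3.1, (hlbl.MZ_iff (m+1) _).1 h3.2⟩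

lemma BU_jump {m : ℕ} (hm : Module.finrank ℝ (PB Y) = m) {E : Set (CV Y)} (hE : MeasurableSet E) {a b : ℝ} {σ : Bool}
    {f : PB Y → ℝ} (hf : Continuous f) {p g : PB Y} (hp0 : 0 < p.fst)
    (hp : JL (sg σ {s | Th p s ∈ E}) a (tt σ a b (f p)) b)
    (hZ : MZ m {p' | JL (sg σ {s | Th p' s ∈ E}) a (tt σ a b (f p')) b}ᶜ p) (hd : HasFDerivAt f (innerSL ℝ g) p) :
    BU (m+1) E (Th p (tt σ a b (f p)))
      (innerSL ℝ (nvec g ((if σ then 1 else -1) * (1/(2*Real.pi*p.fst))) (tt σ a b (f p)))) := by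
  cases σ
  · have h := BU_theta hm hE.compl (a := a) (b := b) (t := fun p => tt false a b (f p)) (g := -g)
      (by simp only [tt]; exact (by fun_prop : Continuous fun p => b - f p).measurable) hp0 hp hZ
      (by
        simp only [tt]
        refine (hd.const_sub b).congr_fderiv ?_
        exact (map_neg (innerSL ℝ) g).symm)
    refine h.neg ?_
    rw [← map_neg]
    congr 1
    refine cv_ext ?_ ?_
    · simp [nvec]; ring
    · simp [nvec]
  · have h := BU_theta hm hE (a := a) (b := b) (t := fun p => tt true a b (f p)) (g := g)
      (by simp only [tt]; exact (by fun_prop : Continuous fun p => a + f p).measurable) hp0 hp hZ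
      (by
        simp only [tt]
        exact hd.const_add a)
    simpa using h

end A23

section A24
variable {Y : Type*} [NormedAddCommGroup Y] [InnerProductSpace ℝ Y] [FiniteDimensional ℝ Y]
  [MeasurableSpace Y] [BorelSpace Y]

lemma muHE_one {X : Type*} [EMetricSpace X] [MeasurableSpace X] [BorelSpace X] (A : Set X) :
    (μHE[1] : Measure X) A = μH[1] A := by
  have h1 : (μHE[1] : Measure ℝ) = volume := by
    have := InnerProductSpace.euclideanHausdorffMeasure_eq_volume (V := ℝ)
    rwa [Module.finrank_self] at this
  rw [Measure.euclideanHausdorffMeasure_def] at h1 ⊢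
  generalize (volume : Measure (EuclideanSpace ℝ (Fin 1))).addHaarScalarFactor μH[((1:ℕ):ℝ)] = c at h1 ⊢
  rw [Nat.cast_one] at h1 ⊢
  rw [hausdorffMeasure_real] at h1
  have h2 := congrArg (fun μ : Measure ℝ => μ (Ioo 0 1)) h1
  simp only [Measure.smul_apply, Real.volume_Ioo, sub_zero, ENNReal.ofReal_one] at h2
  rw [Measure.smul_apply]
  rw [ENNReal.smul_def, smul_eq_mul, mul_one] at h2
  rw [ENNReal.smul_def, smul_eq_mul, h2, one_mul]

/-- the fibre of the base projection -/
def fib (p : PB Y) : Set (CV Y) := {x | cpi x = WithLp.ofLp p}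

lemma H1_image {p : PB Y} (hp : 0 < p.fst) {A : Set ℝ} (hA : MeasurableSet A) {a : ℝ} (hAs : A ⊆ Ico a (a+1)) :
    μH[1] (Th p '' A) = ENNReal.ofReal (2 * Real.pi * p.fst) * volume A := by
  set c := 2 * Real.pi * p.fst with hc
  have hc0 : 0 < c := by have := Real.pi_pos; positivity
  set B : Set ℝ := (fun s => c⁻¹ * s) ⁻¹' A with hB
  have hBm : MeasurableSet B := (measurable_const_mul _) hA
  have e1 : Th p '' A = (fun s => theta (psplit.Φ (p, c⁻¹ * s))) '' B := by
    ext x; constructor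
    · rintro ⟨s, hs, rfl⟩
      have hh : c⁻¹ * (c * s) = s := by field_simp
      exact ⟨c * s, by rw [hB, mem_preimage, hh]; exact hs, by simp only [hh]; rfl⟩
    · rintro ⟨s, hs, rfl⟩; exact ⟨_, hs, rfl⟩
  have e2 : volume B = ENNReal.ofReal c * volume A := by
    rw [hB, Real.volume_preimage_mul_left (inv_ne_zero hc0.ne'), inv_inv, abs_of_pos hc0]
  rw [← e2, e1, ← muHE_one]
  set D : ℝ → ℝ →L[ℝ] CV Y := fun s => (Dth p.fst (c⁻¹ * s)).comp
    (((psplit (Y := Y)).Φ : PB Y × ℝ →L[ℝ] PV Y).comp ((0 : ℝ →L[ℝ] PB Y).prod (c⁻¹ • ContinuousLinearMap.id ℝ ℝ))) with hD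
  have hDn : ∀ s v, ‖D s v‖^2 = ‖v‖^2 := fun s v => by
    have h := Dth_norm p.fst (c⁻¹ * s) ((psplit (Y := Y)).Φ (0, c⁻¹ * v))
    rw [psplit_fst, psplit_snd, ← hc] at h
    have h3 : c * (c⁻¹ * v) = v := by field_simp
    have h4 : ‖D s v‖^2 = _ := h
    rw [h4, h3]; simp
  rw [area_formula (W := ℝ) (m := 1) (by simp) hBm (f' := D) (c := 1) ?_ ?_ one_pos ?_]
  · have : ∀ s ∈ B, ENNReal.ofReal (D s).toLinearMap.normDet = 1 := by
      intro s _
      rw [normDet_rank1 (D s) 0 0 (fun v => by rw [hDn]; simp)]; simp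
    rw [setLIntegral_congr_fun hBm this]; simp
  · intro s _
    have h1 : HasFDerivAt (fun s : ℝ => psplit.Φ (p, c⁻¹ * s)) (((psplit (Y := Y)).Φ : PB Y × ℝ →L[ℝ] PV Y).comp ((0 : ℝ →L[ℝ] PB Y).prod (c⁻¹ • ContinuousLinearMap.id ℝ ℝ))) s :=
      (((psplit (Y := Y)).Φ : PB Y × ℝ →L[ℝ] PV Y).hasFDerivAt).comp s ((hasFDerivAt_const p s).prodMk ((hasFDerivAt_id s).const_mul c⁻¹))
    exact ((theta_fderiv (psplit.Φ (p, c⁻¹ * s))).comp s h1).hasFDerivWithinAt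
  · intro s hs s' hs' h
    obtain ⟨k, hk⟩ := Th_inj hp.ne' (show Th p (c⁻¹ * s) = Th p (c⁻¹ * s') from h)
    have h1 := hAs hs
    have h2 := hAs hs'
    simp only [mem_Ico] at h1 h2
    have h3 : (k:ℝ) < 1 := by linarith
    have h4 : (-1:ℝ) < k := by linarith
    have h5 : k < 1 := by exact_mod_cast h3
    have h6 : -1 < k := by exact_mod_cast h4
    have h7 : k = 0 := by omega
    rw [h7] at hk
    have : c⁻¹ * s = c⁻¹ * s' := by simpa using hk
    exact mul_left_cancel₀ (inv_ne_zero hc0.ne') this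
  · intro s _ v
    rw [one_mul]
    exact le_of_sq_le_sq (hDn s v).ge (norm_nonneg _)

lemma Th_image (p : PB Y) (hp : 0 < p.fst) (S : Set (CV Y)) (a : ℝ) :
    S ∩ fib p = Th p '' {t | t ∈ Ico a (a+1) ∧ Th p t ∈ S} := by
  ext x; constructor
  · rintro ⟨hx, hf⟩
    obtain ⟨t, ht, h⟩ := Th_surj x a
    have hf : cpi x = WithLp.ofLp p := hf
    rw [hf] at h
    have h : x = Th p t := h
    exact ⟨t, ⟨ht, h ▸ hx⟩, h.symm⟩
  · rintro ⟨t, ⟨_, h⟩, rfl⟩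
    exact ⟨h, cpi_Th hp.le t⟩

lemma H1_fib {p : PB Y} (hp : 0 < p.fst) {S : Set (CV Y)} (hS : MeasurableSet S) (a : ℝ) :
    μH[1] (S ∩ fib p) = ENNReal.ofReal (2 * Real.pi * p.fst) * volume {t | t ∈ Ioo a (a+1) ∧ Th p t ∈ S} := by
  have hm : MeasurableSet {t | Th p t ∈ S} := (Th_cont.comp (Continuous.prodMk_right p)).measurable hS
  rw [Th_image p hp S a, H1_image hp (A := {t | t ∈ Ico a (a+1) ∧ Th p t ∈ S}) (measurableSet_Ico.inter hm) (fun t ht => ht.1)]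
  congr 1
  refine measure_congr ?_
  exact (Ioo_ae_eq_Ico.symm).inter (ae_eq_refl _)

/-- the circular symmetral in the model space -/
def CF (L : ℝ × Y → ℝ) : Set (CV Y) :=
  {x | x.fst ≠ 0 ∧ Real.arccos (x.fst.re / ‖x.fst‖) < L (cpi x) / (2 * ‖x.fst‖)}

lemma CV_fst_cont : Continuous fun x : CV Y => x.fst := (WithLp.fstL 2 ℝ ℂ Y).continuous

lemma CF_meas {L : ℝ × Y → ℝ} (hL : Measurable L) : MeasurableSet (CF L) := by
  have h1 : Measurable fun x : CV Y => x.fst := CV_fst_cont.measurable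
  have h2 : Measurable fun x : CV Y => L (cpi x) := hL.comp cpi_cont.measurable
  refine MeasurableSet.inter (h1 (measurableSet_singleton 0).compl) (measurableSet_lt ?_ (h2.div (h1.norm.const_mul 2)))
  exact Real.continuous_arccos.measurable.comp ((Complex.measurable_re.comp h1).div h1.norm)

lemma CF_mono (L : ℝ × Y → ℝ) : CMono (CF L) := by
  rintro x y h hre ⟨h1, h2⟩
  have hn : ‖x.fst‖ = ‖y.fst‖ := congrArg Prod.fst h
  refine ⟨fun h0 => h1 (norm_eq_zero.1 (by rw [hn, h0, norm_zero])), ?_⟩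
  rw [← h, ← hn]
  refine lt_of_le_of_lt (Real.antitone_arccos ?_) h2
  exact div_le_div_of_nonneg_right hre (norm_nonneg _)

lemma Th_fst_norm {p : PB Y} (hp : 0 < p.fst) (t : ℝ) : ‖(Th p t).fst‖ = p.fst :=
  congrArg Prod.fst (cpi_Th hp.le t)

lemma Th_mem_CF (L : ℝ × Y → ℝ) {p : PB Y} (hp : 0 < p.fst) (t : ℝ) :
    Th p t ∈ CF L ↔ Real.arccos (Real.cos (2 * Real.pi * t)) < L (WithLp.ofLp p) / (2 * p.fst) := by
  have h1 := Th_fst_norm hp t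
  have h2 : (Th p t).fst.re / ‖(Th p t).fst‖ = Real.cos (2 * Real.pi * t) := by
    rw [h1, ← pe_re]
    change ((p.fst : ℂ) * pe t).re / p.fst = _
    rw [Complex.re_ofReal_mul]; field_simp
  change ((Th p t).fst ≠ 0 ∧ Real.arccos ((Th p t).fst.re / ‖(Th p t).fst‖) < L (cpi (Th p t)) / (2 * ‖(Th p t).fst‖)) ↔ _
  rw [h2, h1, cpi_Th hp.le t]
  exact ⟨fun h => h.2, fun h => ⟨fun h0 => hp.ne' (by rw [← h1, h0, norm_zero]), h⟩⟩

lemma arccos_abs {t : ℝ} (ht : |t| ≤ 1/2) : Real.arccos (Real.cos (2 * Real.pi * t)) = 2 * Real.pi * |t| := by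
  have hpi := Real.pi_pos
  rw [← Real.cos_abs, abs_mul, abs_of_pos (by positivity : 0 < 2 * Real.pi), Real.arccos_cos (by positivity)]
  nlinarith

lemma cavg_CF {L : ℝ × Y → ℝ} (hL : Measurable L) {p : PB Y} (hp : 0 < p.fst) (h0 : 0 ≤ L (WithLp.ofLp p))
    (h1 : L (WithLp.ofLp p) ≤ 2 * Real.pi * p.fst) :
    cavg (CF L) (Th p 0) = ENNReal.ofReal (L (WithLp.ofLp p) / (2 * Real.pi * p.fst)) := by
  have hpi := Real.pi_pos
  rw [← cavg_line (CF_meas hL) p (-1/2)]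
  set w := L (WithLp.ofLp p) / (2 * Real.pi * p.fst) with hw
  have hw0 : 0 ≤ w := by positivity
  have hw1 : w ≤ 1 := by rw [hw, div_le_one (by positivity)]; exact h1
  have hc : L (WithLp.ofLp p) / (2 * p.fst) = Real.pi * w := by rw [hw]; field_simp
  have : {t | t ∈ Ioo (-1/2 : ℝ) (-1/2 + 1) ∧ Th p t ∈ CF L} = Ioo (-(w/2)) (w/2) := by
    ext t
    simp only [mem_setOf_eq, mem_Ioo, Th_mem_CF L hp, hc]
    constructor
    · rintro ⟨⟨h2, h3⟩, h4⟩
      rw [arccos_abs (abs_le.2 ⟨by linarith, by linarith⟩)] at h4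
      have : |t| < w/2 := by nlinarith
      exact abs_lt.1 this
    · rintro ⟨h2, h3⟩
      have : |t| < w/2 := abs_lt.2 ⟨h2, h3⟩
      refine ⟨⟨by linarith, by linarith⟩, ?_⟩
      rw [arccos_abs (by linarith)]; nlinarith
  rw [this, Real.volume_Ioo]; congr 1; ring

lemma fst_null : volume {x : CV Y | x.fst = 0} = 0 := by
  have h : {x : CV Y | x.fst = 0} = ((WithLp.fstL 2 ℝ ℂ Y : CV Y →L[ℝ] ℂ).toLinearMap.ker : Set (CV Y)) := rfl
  rw [h]
  refine Measure.addHaar_submodule _ _ fun hh => ?_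
  have : (WithLp.toLp 2 (1, 0) : CV Y) ∈ (WithLp.fstL 2 ℝ ℂ Y : CV Y →L[ℝ] ℂ).toLinearMap.ker := by rw [hh]; trivial
  exact one_ne_zero (show (1:ℂ) = 0 from this)

lemma ae_transport {Q : ℝ × Y → Prop} (h : ∀ᵐ p : PB Y, 0 < p.fst → Q (WithLp.ofLp p)) :
    ∀ᵐ x : CV Y, Q (cpi x) := by
  set N := {p : PB Y | ¬ (0 < p.fst → Q (WithLp.ofLp p))} with hN
  have hN0 : volume N = 0 := h
  set ι := (stdOrthonormalBasis ℝ (CV Y)).equiv (stdOrthonormalBasis ℝ (PV Y)) (finCongr finrank_CV.symm) with hι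
  set M : Set (PV Y) := {v | v.fst ∈ N} with hM
  have hM0 : volume M = 0 := by
    have h1 := (WithLp.volume_preserving_ofLp (PB Y) ℝ).quasiMeasurePreserving.preimage_null (s := N ×ˢ univ)
      (by rw [Measure.volume_eq_prod, Measure.prod_prod, hN0, zero_mul])
    exact measure_mono_null (show M ⊆ WithLp.ofLp ⁻¹' (N ×ˢ univ) from fun v hv => ⟨hv, trivial⟩) h1
  have h3 : volume ((theta ∘ ι) '' (ι ⁻¹' M)) = 0 := by
    refine addHaar_image_eq_zero_of_differentiableOn_of_addHaar_eq_zero _ ?_ ?_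
    · exact ((theta_contDiff.differentiable one_ne_zero).comp ι.toContinuousLinearEquiv.differentiable).differentiableOn
    · rw [ι.measurePreserving.measure_preimage_emb ι.toHomeomorph.measurableEmbedding]; exact hM0
  refine measure_mono_null ?_ (measure_union_null h3 (fst_null (Y := Y)))
  intro x hx
  by_cases h0 : x.fst = 0
  · exact Or.inr h0
  left
  obtain ⟨t, _, ht⟩ := Th_surj x 0
  refine ⟨ι.symm ((psplit (Y := Y)).Φ (WithLp.toLp 2 (cpi x), t)), ?_, ?_⟩
  · change ι (ι.symm _) ∈ M
    rw [ι.apply_symm_apply]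
    exact fun hh => hx (hh (norm_pos_iff.2 h0))
  · change theta (ι (ι.symm _)) = x
    rw [ι.apply_symm_apply, theta_Φ]; exact ht.symm

lemma CF_jump {L : ℝ × Y → ℝ} {p : PB Y} (hp : 0 < p.fst) {w : ℝ} (hw : w = L (WithLp.ofLp p) / (2 * Real.pi * p.fst)) (hw0 : 0 ≤ w) (hw1 : w ≤ 1)
    {J : Set ℝ} (h : LineOK {t | Th p t ∈ CF L} J) {t : ℝ} (ht : t ∈ J) :
    Th p t = Th p (w/2) ∨ Th p t = Th p (-(w/2)) := by
  have hpi := Real.pi_pos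
  have hc : L (WithLp.ofLp p) / (2 * p.fst) = Real.pi * w := by rw [hw]; field_simp
  have hD : Continuous fun s : ℝ => Real.arccos (Real.cos (2 * Real.pi * s)) :=
    Real.continuous_arccos.comp (Real.continuous_cos.comp (continuous_const.mul continuous_id))
  have key : Real.arccos (Real.cos (2 * Real.pi * t)) = Real.pi * w := by
    rcases lt_trichotomy (Real.arccos (Real.cos (2 * Real.pi * t))) (Real.pi * w) with h1 | h1 | h1
    · exfalso
      obtain ⟨a, b, hab, hs⟩ := mem_nhds_iff_exists_Ioo_subset.1 ((isOpen_lt hD continuous_const).mem_nhds h1)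
      refine (h a b).2 (Or.inr ?_) t hab ht
      convert measure_empty (μ := volume)
      refine eq_empty_of_forall_notMem fun s hs' => hs'.2 ?_
      change Th p s ∈ CF L
      rw [Th_mem_CF L hp, hc]; exact hs hs'.1
    · exact h1
    · exfalso
      obtain ⟨a, b, hab, hs⟩ := mem_nhds_iff_exists_Ioo_subset.1 ((isOpen_lt continuous_const hD).mem_nhds h1)
      refine (h a b).2 (Or.inl ?_) t hab ht
      convert measure_empty (μ := volume)
      refine eq_empty_of_forall_notMem fun s hs' => ?_
      have h2 : Th p s ∈ CF L := hs'.2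
      rw [Th_mem_CF L hp, hc] at h2; exact lt_asymm h2 (hs hs'.1)
  have h2 : Real.cos (2 * Real.pi * t) = Real.cos (Real.pi * w) := by
    rw [← key, Real.cos_arccos (Real.neg_one_le_cos _) (Real.cos_le_one _)]
  obtain ⟨k, hk | hk⟩ := Real.cos_eq_cos_iff.1 h2
  · left
    have : t = w/2 + ((-k : ℤ):ℝ) := by
      push_cast
      have : 2 * Real.pi * t = 2 * Real.pi * (w/2 + -k) := by linarith
      exact mul_left_cancel₀ (by positivity) this
    rw [this, Th_int]
  · right
    have : t = -(w/2) + (k:ℝ) := by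
      have : 2 * Real.pi * t = 2 * Real.pi * (-(w/2) + k) := by linarith
      exact mul_left_cancel₀ (by positivity) this
    rw [this, Th_int]

/-- the structure of a good fibre -/
def Clean (m : ℕ) (E : Set (CV Y)) (p : PB Y) : Prop :=
  LineOK {t | Th p t ∈ E} {t | Th p t ∈ eB (m+1) E} ∧ ({t | Th p t ∈ eB (m+1) E} = ∅ ∨
  ∃ (t0 t1 : ℝ) (g : PB Y), t0 < t1 ∧ t1 < t0 + 1 ∧
    volume {s | s ∈ Ioo t0 t1 ∧ s ∉ {t | Th p t ∈ E}} = 0 ∧ volume {s | s ∈ Ioo t1 (t0+1) ∧ s ∈ {t | Th p t ∈ E}} = 0 ∧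
    BU (m+1) E (Th p t0) (innerSL ℝ (nvec g (-(1/(2*Real.pi*p.fst))) t0)) ∧
    BU (m+1) E (Th p t1) (innerSL ℝ (nvec g (1/(2*Real.pi*p.fst)) t1)))

lemma two_jump {H : Set ℝ} (hH : Per H) {a t b t' : ℝ} (h1 : JL H a t b) (h2 : JL Hᶜ b t' (a+1)) :
    volume {s | s ∈ Ioo t t' ∧ s ∈ H} = 0 ∧ volume {s | s ∈ Ioo (t'-1) t ∧ s ∉ H} = 0 := by
  obtain ⟨_, _, h3, h4⟩ := h1
  obtain ⟨_, _, h5, h6⟩ := h2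
  refine ⟨null_glue h4 (by simpa using h5), null_glue ?_ h3⟩
  have := hH.compl.vol (t'-1) a 1
  rw [Int.cast_one, sub_add_cancel] at this
  exact this.symm.trans h6

lemma nvec_int (g : PB Y) (κ t : ℝ) : nvec g κ (t-1) = nvec g κ t := by
  have := pe_int (t-1) 1
  rw [Int.cast_one, sub_add_cancel] at this
  rw [nvec, nvec, this]

lemma clean_ae {m : ℕ} (hm : Module.finrank ℝ (PB Y) = m) {E : Set (CV Y)} (hE : MeasurableSet E)
    {L : ℝ × Y → ℝ} (hL : Measurable L)
    (hd : ∀ᵐ p : PB Y, 0 < p.fst → 0 ≤ L (WithLp.ofLp p) ∧ L (WithLp.ofLp p) ≤ 2 * Real.pi * p.fst ∧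
      μH[1] (E ∩ fib p) = ENNReal.ofReal (L (WithLp.ofLp p)))
    (hfin : μHE[m] (eB (m+1) E) ≠ ⊤) (hPF : μHE[m] (eB (m+1) (CF L)) = μHE[m] (eB (m+1) E)) :
    ∀ᵐ p : PB Y, 0 < p.fst → Clean m E p := by
  have hpi := Real.pi_pos
  have hV : Module.finrank ℝ (CV Y) = m+1 := by
    rw [← finrank_CV, (psplit (Y := Y)).finrank, hm]
  have hE1 : ∀ᵐ p : PB Y, 0 < p.fst → cavg E (Th p 0) = ENNReal.ofReal (L (WithLp.ofLp p) / (2 * Real.pi * p.fst)) := by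
    filter_upwards [hd] with p hp h0
    obtain ⟨h1, h2, h3⟩ := hp h0
    rw [H1_fib h0 hE 0, cavg_line hE p 0] at h3
    rw [ENNReal.ofReal_div_of_pos (by positivity), ← h3, mul_comm, ENNReal.mul_div_cancel_right]
    · simpa using (by positivity)
    · simp
  have hEq : ∀ᵐ x : CV Y, cavg E x = cavg (CF L) x := by
    have := ae_transport (Y := Y) (Q := fun b => cavg E (csec b) = cavg (CF L) (csec b)) (by
      filter_upwards [hd, hE1] with p hp hp1 h0
      obtain ⟨h1, h2, h3⟩ := hp h0
      have e := cavg_CF hL h0 h1 h2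
      rw [← hp1 h0, cavg_sec E, cavg_sec (CF L), cpi_Th h0.le] at e
      exact e.symm)
    filter_upwards [this] with x hx
    rw [cavg_sec E, cavg_sec (CF L)]; exact hx
  have hcyl : ∀ b, MeasurableSet b → μHE[m] (eB (m+1) (CF L) ∩ cpi ⁻¹' b) = μHE[m] (eB (m+1) E ∩ cpi ⁻¹' b) := by
    intro b hb
    refine cyl_eq hV hE (CF_meas hL) (CF_mono L) (fun b' hb' => ?_) hfin hPF hb
    rw [vol_cyl hE hb', vol_cyl (CF_meas hL) hb']
    exact lintegral_congr_ae (ae_restrict_of_ae hEq)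
  have hF : ∀ᵐ p : PB Y, 0 < p.fst → ∀ t, Th p t ∈ eB (m+1) (CF L) →
      Th p t = Th p ((cavg E (Th p 0)).toReal / 2) ∨ Th p t = Th p (-((cavg E (Th p 0)).toReal / 2)) := by
    filter_upwards [hd, hE1, ae_lineOK (psplit (Y := Y)) hm (theta_cont.measurable (CF_meas hL))] with p hp hp1 hp2 h0 t ht
    obtain ⟨h1, h2, h3⟩ := hp h0
    have hw0 : 0 ≤ L (WithLp.ofLp p) / (2 * Real.pi * p.fst) := by positivity
    rw [hp1 h0, ENNReal.toReal_ofReal hw0]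
    exact CF_jump h0 rfl hw0 (by rw [div_le_one (by positivity)]; exact h2) hp2 ((theta_eB h0 t _ _).2 ht)
  filter_upwards [fibre_structure hm hE hfin hcyl hF] with p hp h0
  obtain ⟨hlo, hs⟩ := hp h0
  refine ⟨hlo, ?_⟩
  rcases hs with hs | ⟨q, σ, f, hq, hfc, hfd, hff, hi⟩
  · exact Or.inl hs
  right
  have hPer : Per {t | Th p t ∈ E} := fun t k => by simp only [mem_setOf_eq, Th_int]
  obtain ⟨a0, j0, z0⟩ := hi 0 (by norm_num)
  obtain ⟨a1, j1, z1⟩ := hi 1 (by norm_num)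
  set g := (InnerProductSpace.toDual ℝ (PB Y)).symm (fderiv ℝ (f 0) p) with hg
  have hg0 : innerSL ℝ g = fderiv ℝ (f 0) p := (InnerProductSpace.toDual ℝ (PB Y)).apply_symm_apply _
  have b0 := BU_jump hm hE (hfc 0) (g := g) h0 j0 z0 (by rw [hg0]; exact (hfd 0).hasFDerivAt)
  have b1 := BU_jump hm hE (hfc 1) (g := g) h0 j1 z1 (by rw [hg0, hff]; exact (hfd 1).hasFDerivAt)
  generalize tt (σ 0) (q 0) (q (0+1)) (f 0 p) = τ0 at *
  generalize tt (σ 1) (q 1) (q (1+1)) (f 1 p) = τ1 at *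
  simp only [zero_add, one_add_one_eq_two, hq] at j0 j1
  clear z0 z1 hi
  generalize σ 0 = σ0 at *
  generalize σ 1 = σ1 at *
  have o1 := j0.1
  have o2 := j0.2.1
  have o3 := j1.1
  have o4 := j1.2.1
  cases σ0 <;> cases σ1
  · exact (not_same_type (hlo.sg false) a1 j0 j1).elim
  · have j0 : JL {t | Th p t ∈ E}ᶜ _ _ _ := j0
    have j1 : JL {t | Th p t ∈ E} _ _ _ := j1
    obtain ⟨v1, v2⟩ := two_jump hPer.compl j0 (by rwa [compl_compl])
    refine ⟨τ0, τ1, g, by linarith, by linarith, v1, ?_, by simpa using b0, by simpa using b1⟩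
    have := hPer.vol (τ1-1) τ0 1
    rw [Int.cast_one, sub_add_cancel] at this
    rw [this]; simpa using v2
  · have j0 : JL {t | Th p t ∈ E} _ _ _ := j0
    have j1 : JL {t | Th p t ∈ E}ᶜ _ _ _ := j1
    obtain ⟨v1, v2⟩ := two_jump hPer j0 j1
    have e : Th p (τ1-1) = Th p τ1 := by have := Th_int p (τ1-1) 1; rw [Int.cast_one, sub_add_cancel] at this; exact this.symm
    refine ⟨τ1-1, τ0, g, by linarith, by linarith, v2, by rw [sub_add_cancel]; exact v1, ?_, by simpa using b0⟩
    rw [e, nvec_int]; simpa using b1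
  · exact (not_same_type (hlo.sg true) a1 j0 j1).elim

lemma pe_inner (s c : ℝ) : ⟪pe s, pe c⟫ = Real.cos (2 * Real.pi * (s - c)) := by
  rw [Complex.inner, Complex.mul_re, Complex.conj_re, Complex.conj_im, pe_re, pe_re, pe_im, pe_im, mul_sub, Real.cos_sub]
  ring

lemma Th_hat {p : PB Y} (hp : 0 < p.fst) (t : ℝ) : ‖(Th p t).fst‖⁻¹ • (Th p t).fst = pe t := by
  rw [Th_fst_norm hp]
  change p.fst⁻¹ • ((p.fst : ℂ) * pe t) = _
  rw [← Complex.real_smul, inv_smul_smul₀ hp.ne']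

lemma Th_dist {p : PB Y} (s t : ℝ) : dist (Th p t) (Th p s) ^ 2 = p.fst^2 * (2 - 2 * Real.cos (2 * Real.pi * (t - s))) := by
  have e : dist (Th p t) (Th p s) ^ 2 = ‖(p.fst : ℂ) * pe t - p.fst * pe s‖^2 := by
    rw [dist_eq_norm, WithLp.prod_norm_sq_eq_of_L2]
    change ‖(p.fst : ℂ) * pe t - p.fst * pe s‖^2 + ‖p.snd - p.snd‖^2 = _
    simp
  rw [e, ← mul_sub, norm_mul, mul_pow, Complex.norm_real, Real.norm_eq_abs, sq_abs,
    @norm_sub_sq_real ℂ, pe_norm, pe_norm, pe_inner]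
  ring

/-- arc density at a point of a fibre -/
def CDens (A : Set (CV Y)) (p : PB Y) (x : CV Y) (t : ℝ≥0∞) : Prop :=
  Tendsto (fun ρ : ℝ => μH[(1:ℝ)] (A ∩ ball x ρ) / μH[(1:ℝ)] (fib p ∩ ball x ρ)) (𝓝[>] (0:ℝ)) (𝓝 t)

/-- the parameter interval of a ball -/
def II (p : PB Y) (s ρ : ℝ) : Set ℝ := {t | t ∈ Ioo (s - 1/2) (s - 1/2 + 1) ∧ Th p t ∈ ball (Th p s) ρ}

lemma Th_cont1 (p : PB Y) : Continuous (Th p) := Th_cont.comp (Continuous.prodMk_right p)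

lemma II_open (p : PB Y) (s ρ : ℝ) : IsOpen (II p s ρ) := isOpen_Ioo.inter (isOpen_ball.preimage (Th_cont1 p))

lemma II_pos (p : PB Y) (s : ℝ) {ρ : ℝ} (h : 0 < ρ) : volume (II p s ρ) ≠ 0 :=
  ((II_open p s ρ).measure_pos _ ⟨s, ⟨by constructor <;> linarith, mem_ball_self h⟩⟩).ne'

lemma II_fin (p : PB Y) (s ρ : ℝ) : volume (II p s ρ) ≠ ⊤ :=
  ne_top_of_le_ne_top (by rw [Real.volume_Ioo]; exact ENNReal.ofReal_ne_top) (measure_mono (fun t ht => ht.1))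

lemma II_symm (p : PB Y) (s ρ t : ℝ) (h : t ∈ II p s ρ) : 2 * s - t ∈ II p s ρ := by
  obtain ⟨⟨h1, h2⟩, h3⟩ := h
  refine ⟨⟨by linarith, by linarith⟩, ?_⟩
  rw [mem_ball] at h3 ⊢
  have : dist (Th p (2 * s - t)) (Th p s) ^ 2 = dist (Th p t) (Th p s) ^ 2 := by
    rw [Th_dist, Th_dist, ← Real.cos_neg (2 * Real.pi * (t - s))]; congr 4; ring
  rwa [(sq_eq_sq₀ dist_nonneg dist_nonneg).1 this]

lemma II_small {p : PB Y} (hp : 0 < p.fst) (s : ℝ) {δ : ℝ} (hδ : 0 < δ) :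
    ∀ᶠ ρ in 𝓝[>] (0:ℝ), II p s ρ ⊆ Ioo (s-δ) (s+δ) := by
  have hpi := Real.pi_pos
  wlog hδ2 : δ ≤ 1/2 generalizing δ
  · push Not at hδ2
    filter_upwards [this (δ := 1/2) (by norm_num) le_rfl] with ρ h
    exact h.trans (Ioo_subset_Ioo (by linarith) (by linarith))
  have hc : Real.cos (2 * Real.pi * δ) < 1 := by
    rw [← Real.cos_zero]
    exact Real.cos_lt_cos_of_nonneg_of_le_pi le_rfl (by nlinarith) (by positivity)
  set K := p.fst^2 * (2 - 2 * Real.cos (2 * Real.pi * δ)) with hK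
  have hK0 : 0 < K := by have : 0 < 2 - 2 * Real.cos (2 * Real.pi * δ) := by linarith
                         positivity
  filter_upwards [Ioo_mem_nhdsGT (Real.sqrt_pos.2 hK0)] with ρ hρ t ht
  obtain ⟨⟨h1, h2⟩, h3⟩ := ht
  rw [mem_ball] at h3
  by_contra hcon
  have hcon : δ ≤ |t - s| := by
    by_contra h; push Not at h
    rw [abs_lt] at h; exact hcon ⟨by linarith, by linarith⟩
  have h5 : |t - s| ≤ 1/2 := abs_le.2 ⟨by linarith, by linarith⟩
  have h4 : Real.cos (2 * Real.pi * (t - s)) ≤ Real.cos (2 * Real.pi * δ) := by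
    rw [← Real.cos_abs (2 * Real.pi * (t - s)), abs_mul, abs_of_pos (by positivity : 0 < 2 * Real.pi)]
    exact Real.cos_le_cos_of_nonneg_of_le_pi (by positivity) (by nlinarith) (by nlinarith)
  have h6 : K ≤ dist (Th p t) (Th p s) ^ 2 := by
    rw [Th_dist, hK]
    have : 0 < p.fst^2 := by positivity
    nlinarith
  have h7 := Real.sqrt_le_sqrt h6
  rw [Real.sqrt_sq dist_nonneg] at h7
  linarith [hρ.2]

lemma CDens_ratio {p : PB Y} (hp : 0 < p.fst) {E : Set (CV Y)} (hE : MeasurableSet E) (s ρ : ℝ) :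
    μH[(1:ℝ)] (E ∩ fib p ∩ ball (Th p s) ρ) / μH[(1:ℝ)] (fib p ∩ ball (Th p s) ρ) =
      volume {t | t ∈ II p s ρ ∧ Th p t ∈ E} / volume (II p s ρ) := by
  have hpi := Real.pi_pos
  have e1 : E ∩ fib p ∩ ball (Th p s) ρ = (E ∩ ball (Th p s) ρ) ∩ fib p := inter_right_comm _ _ _
  rw [e1, inter_comm (fib p), H1_fib hp (hE.inter measurableSet_ball) (s-1/2), H1_fib hp measurableSet_ball (s-1/2),
    ENNReal.mul_div_mul_left _ _ (by simpa using (by positivity)) ENNReal.ofReal_ne_top]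
  congr 2
  ext t; simp only [II, mem_setOf_eq, mem_inter_iff]
  exact ⟨fun h => ⟨⟨h.1, h.2.2⟩, h.2.1⟩, fun h => ⟨h.1.1, h.2, h.1.2⟩⟩

lemma CDens0 {p : PB Y} (hp : 0 < p.fst) {E : Set (CV Y)} (hE : MeasurableSet E) {s δ : ℝ} (hδ : 0 < δ)
    (h : volume {t | t ∈ Ioo (s-δ) (s+δ) ∧ Th p t ∈ E} = 0) : CDens (E ∩ fib p) p (Th p s) 0 := by
  refine tendsto_const_nhds.congr' ?_
  filter_upwards [II_small hp s hδ] with ρ hρ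
  have h' : volume {t | t ∈ II p s ρ ∧ Th p t ∈ E} = 0 := measure_mono_null (by intro t ht; exact ⟨hρ ht.1, ht.2⟩) h
  rw [CDens_ratio hp hE, h', ENNReal.zero_div]

lemma CDens1 {p : PB Y} (hp : 0 < p.fst) {E : Set (CV Y)} (hE : MeasurableSet E) {s δ : ℝ} (hδ : 0 < δ)
    (h : volume {t | t ∈ Ioo (s-δ) (s+δ) ∧ Th p t ∉ E} = 0) : CDens (E ∩ fib p) p (Th p s) 1 := by
  refine tendsto_const_nhds.congr' ?_
  filter_upwards [II_small hp s hδ, self_mem_nhdsWithin] with ρ hρ (h0 : 0 < ρ)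
  rw [CDens_ratio hp hE]
  have : volume {t | t ∈ II p s ρ ∧ Th p t ∈ E} = volume (II p s ρ) := by
    refine le_antisymm (measure_mono fun t ht => ht.1) ?_
    rw [← add_zero (volume {t | t ∈ II p s ρ ∧ Th p t ∈ E}), ← h]
    refine (measure_mono fun t ht => ?_).trans (measure_union_le _ _)
    by_cases hh : Th p t ∈ E
    · exact Or.inl ⟨ht, hh⟩
    · exact Or.inr ⟨hρ ht, hh⟩
  rw [this, ENNReal.div_self (II_pos p s h0) (II_fin p s ρ)]

lemma half_vol {I H : Set ℝ} {s : ℝ} (hI : MeasurableSet I) (hs : ∀ t ∈ I, 2 * s - t ∈ I)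
    (h1 : volume {t | t ∈ I ∧ t < s ∧ t ∈ H} = 0) (h2 : volume {t | t ∈ I ∧ s < t ∧ t ∉ H} = 0) :
    2 * volume {t | t ∈ I ∧ t ∈ H} = volume I := by
  set A := {t | t ∈ I ∧ s < t} with hA
  set B := {t | t ∈ I ∧ t < s} with hB
  have hAm : MeasurableSet A := hI.inter measurableSet_Ioi
  have hBm : MeasurableSet B := hI.inter measurableSet_Iio
  have e1 : volume B = volume A := by
    have : B = (fun t => 2 * s - t) ⁻¹' A := by
      ext t; constructor
      · rintro ⟨h, h'⟩; exact ⟨hs t h, show s < 2 * s - t by linarith⟩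
      · rintro ⟨h, h'⟩
        have h' : s < 2 * s - t := h'
        exact ⟨by have := hs _ h; simpa using this, show t < s by linarith⟩
    rw [this, (Measure.measurePreserving_sub_left volume (2*s)).measure_preimage hAm.nullMeasurableSet]
  have e2 : volume {t | t ∈ I ∧ t ∈ H} = volume A := by
    refine measure_congr ?_
    have n1 : ∀ᵐ t, ¬ (t ∈ I ∧ t < s ∧ t ∈ H) := measure_eq_zero_iff_ae_notMem.1 h1
    have n2 : ∀ᵐ t, ¬ (t ∈ I ∧ s < t ∧ t ∉ H) := measure_eq_zero_iff_ae_notMem.1 h2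
    have n3 : ∀ᵐ t, t ≠ s := measure_eq_zero_iff_ae_notMem.1 (measure_singleton s)
    filter_upwards [n1, n2, n3] with t m1 m2 m3
    apply propext
    change (t ∈ I ∧ t ∈ H) ↔ (t ∈ I ∧ s < t)
    rcases lt_or_gt_of_ne m3 with h | h
    · exact ⟨fun hh => (m1 ⟨hh.1, h, hh.2⟩).elim, fun hh => (lt_asymm h hh.2).elim⟩
    · exact ⟨fun hh => ⟨hh.1, h⟩, fun hh => ⟨hh.1, by_contra fun h' => m2 ⟨hh.1, h, h'⟩⟩⟩
  have e3 : volume I = volume (A ∪ B) := by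
    refine measure_congr ?_
    have n3 : ∀ᵐ t, t ≠ s := measure_eq_zero_iff_ae_notMem.1 (measure_singleton s)
    filter_upwards [n3] with t m3
    apply propext
    change t ∈ I ↔ (t ∈ I ∧ s < t) ∨ (t ∈ I ∧ t < s)
    rcases lt_or_gt_of_ne m3 with h | h
    · exact ⟨fun hh => Or.inr ⟨hh, h⟩, fun hh => hh.elim And.left And.left⟩
    · exact ⟨fun hh => Or.inl ⟨hh, h⟩, fun hh => hh.elim And.left And.left⟩
  have hdis : Disjoint A B := Set.disjoint_left.2 fun t ha hb => lt_asymm ha.2 hb.2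
  rw [e3, measure_union hdis hBm, e1, e2, two_mul]

lemma CDens_half {p : PB Y} (hp : 0 < p.fst) {E : Set (CV Y)} (hE : MeasurableSet E) {s δ : ℝ} (hδ : 0 < δ)
    (h : (volume {t | t ∈ Ioo (s-δ) s ∧ Th p t ∈ E} = 0 ∧ volume {t | t ∈ Ioo s (s+δ) ∧ Th p t ∉ E} = 0) ∨
      (volume {t | t ∈ Ioo (s-δ) s ∧ Th p t ∉ E} = 0 ∧ volume {t | t ∈ Ioo s (s+δ) ∧ Th p t ∈ E} = 0)) :
    ¬ CDens (E ∩ fib p) p (Th p s) 0 ∧ ¬ CDens (E ∩ fib p) p (Th p s) 1 := by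
  have key : CDens (E ∩ fib p) p (Th p s) (1/2) := by
    refine tendsto_const_nhds.congr' ?_
    filter_upwards [II_small hp s hδ, self_mem_nhdsWithin] with ρ hρ (h0 : 0 < ρ)
    rw [CDens_ratio hp hE]
    have hm : MeasurableSet (II p s ρ) := (II_open p s ρ).measurableSet
    have hE' : MeasurableSet {t | Th p t ∈ E} := (Th_cont1 p).measurable hE
    have e : 2 * volume {t | t ∈ II p s ρ ∧ Th p t ∈ E} = volume (II p s ρ) := by
      rcases h with ⟨h1, h2⟩ | ⟨h1, h2⟩
      · exact half_vol (H := {t | Th p t ∈ E}) hm (II_symm p s ρ)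
          (measure_mono_null (by intro t ht; exact ⟨⟨(hρ ht.1).1, ht.2.1⟩, ht.2.2⟩) h1)
          (measure_mono_null (by intro t ht; exact ⟨⟨ht.2.1, (hρ ht.1).2⟩, ht.2.2⟩) h2)
      · have e := half_vol (H := {t | Th p t ∉ E}) hm (II_symm p s ρ)
          (measure_mono_null (by intro t ht; exact ⟨⟨(hρ ht.1).1, ht.2.1⟩, ht.2.2⟩) h1)
          (measure_mono_null (by intro t ht; exact ⟨⟨ht.2.1, (hρ ht.1).2⟩, not_not.1 ht.2.2⟩) h2)
        have e2 := measure_inter_add_diff (μ := volume) (II p s ρ) hE'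
        have e3 : volume (II p s ρ \ {t | Th p t ∈ E}) = volume {t | t ∈ II p s ρ ∧ t ∈ {t | Th p t ∉ E}} := rfl
        have hf : volume {t | t ∈ II p s ρ ∧ t ∈ {t | Th p t ∉ E}} ≠ ⊤ :=
          ne_top_of_le_ne_top (II_fin p s ρ) (measure_mono fun t ht => ht.1)
        rw [e3] at e2
        have e4 : volume {t | t ∈ II p s ρ ∧ Th p t ∈ E} = volume {t | t ∈ II p s ρ ∧ t ∈ {t | Th p t ∉ E}} := by
          have e2' : volume {t | t ∈ II p s ρ ∧ Th p t ∈ E} + _ = _ := e2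
          rw [← e, two_mul] at e2'
          exact (ENNReal.add_left_inj hf).1 e2'
        rw [e4]; exact e
    have hf : volume {t | t ∈ II p s ρ ∧ Th p t ∈ E} ≠ ⊤ :=
          ne_top_of_le_ne_top (II_fin p s ρ) (measure_mono fun t ht => ht.1)
    have hz : volume {t | t ∈ II p s ρ ∧ Th p t ∈ E} ≠ 0 := fun h => II_pos p s h0 (by rw [← e, h, mul_zero])
    rw [← e]
    have := ENNReal.mul_div_mul_right 1 2 hz hf
    rw [one_mul] at this; exact this.symm
  constructor
  · intro h0
    have := tendsto_nhds_unique key h0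
    simp at this
  · intro h0
    have := tendsto_nhds_unique key h0
    simp at this

lemma BU.smul {X : Type*} [NormedAddCommGroup X] [NormedSpace ℝ X] [MeasurableSpace X] [BorelSpace X]
    {d : ℕ} {G : Set X} {x : X} {L L' : X →L[ℝ] ℝ} (h : BU d G x L) {c : ℝ} (hc : 0 < c) (hL : ∀ y, L' y = c * L y) :
    BU d G x L' := by
  have e1 : {y | y ∈ G ∧ 0 < L' (y - x)} = {y | y ∈ G ∧ 0 < L (y - x)} := by
    ext y; simp only [mem_setOf_eq, hL, mul_pos_iff_of_pos_left hc]
  have e2 : {y | y ∉ G ∧ L' (y - x) < 0} = {y | y ∉ G ∧ L (y - x) < 0} := by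
    ext y; simp only [mem_setOf_eq, hL, mul_neg_iff, hc, hc.not_gt, true_and, false_and, or_false]
  exact ⟨e1 ▸ h.1, e2 ▸ h.2⟩

/-- unit normal in the model space -/
def MN (m : ℕ) (E : Set (CV Y)) (x ν : CV Y) : Prop := ‖ν‖ = 1 ∧ BU (m+1) E x (innerSL ℝ ν)

lemma nvec_norm (g : PB Y) (κ t : ℝ) : ‖nvec g κ t‖ = Real.sqrt (g.fst^2 + κ^2 + ‖g.snd‖^2) := by
  rw [← Real.sqrt_sq (norm_nonneg (nvec g κ t)), nvec, WithLp.prod_norm_sq_eq_of_L2]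
  congr 2
  · have := cinner_pe (-g.fst) κ (-g.fst) κ t
    rw [real_inner_self_eq_norm_sq] at this
    refine Eq.trans this ?_
    ring
  · change ‖-g.snd‖^2 = _
    rw [norm_neg]

lemma MN_nvec {m : ℕ} {E : Set (CV Y)} {x : CV Y} {g : PB Y} {κ t : ℝ} (hκ : κ ≠ 0)
    (h : BU (m+1) E x (innerSL ℝ (nvec g κ t))) : MN m E x (‖nvec g κ t‖⁻¹ • nvec g κ t) := by
  have h0 : 0 < ‖nvec g κ t‖ := by rw [nvec_norm]; apply Real.sqrt_pos.2; positivity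
  refine ⟨by rw [norm_smul, norm_inv, norm_norm, inv_mul_cancel₀ h0.ne'], h.smul (inv_pos.2 h0) fun y => ?_⟩
  rw [innerSL_apply_apply, innerSL_apply_apply, real_inner_smul_left]

lemma nvec_parts {p g : PB Y} (hp : 0 < p.fst) (κ t : ℝ) (N : ℝ) (hN : 0 < N) :
    ⟪(N⁻¹ • nvec g κ t).fst, ‖(Th p t).fst‖⁻¹ • (Th p t).fst⟫ = -g.fst / N ∧
    ‖(N⁻¹ • nvec g κ t).fst - ⟪(N⁻¹ • nvec g κ t).fst, ‖(Th p t).fst‖⁻¹ • (Th p t).fst⟫ • (‖(Th p t).fst‖⁻¹ • (Th p t).fst)‖ = |κ| / N ∧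
    (N⁻¹ • nvec g κ t).snd = N⁻¹ • -g.snd := by
  have e0 : (N⁻¹ • nvec g κ t).fst = N⁻¹ • ((((-g.fst : ℝ) : ℂ) + (κ : ℝ) * Complex.I) * pe t) := rfl
  have e1 : ⟪(N⁻¹ • nvec g κ t).fst, ‖(Th p t).fst‖⁻¹ • (Th p t).fst⟫ = -g.fst / N := by
    rw [Th_hat hp, e0, real_inner_smul_left]
    have := cinner_pe (-g.fst) κ 1 0 t
    simp only [Complex.ofReal_one, Complex.ofReal_zero, zero_mul, add_zero, one_mul, mul_one, mul_zero] at this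
    rw [this]; ring
  refine ⟨e1, ?_, rfl⟩
  rw [e1, Th_hat hp, e0]
  have : N⁻¹ • ((((-g.fst : ℝ) : ℂ) + (κ : ℝ) * Complex.I) * pe t) - (-g.fst / N) • pe t = ((κ / N : ℝ) : ℂ) * (Complex.I * pe t) := by
    rw [Complex.real_smul, Complex.real_smul]; push_cast
    have : (N:ℂ) ≠ 0 := by exact_mod_cast hN.ne'
    field_simp; ring
  rw [this, norm_mul, norm_mul, pe_norm, Complex.norm_I, Complex.norm_real, Real.norm_eq_abs, abs_div, abs_of_pos hN]; simp

/-- arcs in the model space -/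
def CArc (c β : ℝ) : Set (CV Y) := {y | Real.arccos ⟪‖y.fst‖⁻¹ • y.fst, pe c⟫ < β}

lemma CArc_meas (c β : ℝ) : MeasurableSet (CArc (Y := Y) c β) := by
  have h1 : Measurable fun x : CV Y => x.fst := CV_fst_cont.measurable
  refine measurableSet_lt (Real.continuous_arccos.measurable.comp ?_) measurable_const
  exact (h1.norm.inv.smul h1).inner measurable_const

lemma Th_CArc {p : PB Y} (hp : 0 < p.fst) (c β t : ℝ) : Th p t ∈ CArc c β ↔ Real.arccos (Real.cos (2 * Real.pi * (t - c))) < β := by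
  change Real.arccos ⟪‖(Th p t).fst‖⁻¹ • (Th p t).fst, pe c⟫ < β ↔ _
  rw [Th_hat hp, pe_inner]

lemma arc_null {p : PB Y} (hp : 0 < p.fst) {E : Set (CV Y)} (hE : MeasurableSet E) (c β a : ℝ)
    (h : ∀ᵐ t, t ∈ Ioo a (a+1) → (Th p t ∈ E ↔ Real.arccos (Real.cos (2 * Real.pi * (t - c))) < β)) :
    μH[1] (symmDiff (E ∩ fib p) (CArc c β ∩ fib p)) = 0 := by
  have e : symmDiff (E ∩ fib p) (CArc c β ∩ fib p) = symmDiff E (CArc c β) ∩ fib p := by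
    rw [inter_symmDiff_distrib_right]
  rw [e, H1_fib hp (hE.symmDiff (CArc_meas c β)) a]
  have : volume {t | t ∈ Ioo a (a+1) ∧ Th p t ∈ symmDiff E (CArc c β)} = 0 := by
    refine measure_eq_zero_iff_ae_notMem.2 ?_
    filter_upwards [h] with t ht hh
    obtain ⟨h1, h2⟩ := hh
    have h3 := ht h1
    rw [← Th_CArc hp] at h3
    rcases h2 with h2 | h2
    · exact h2.2 (h3.1 h2.1)
    · exact h2.2 (h3.2 h2.1)
  rw [this, mul_zero]

lemma arc_iff {t0 t1 s : ℝ} (h1 : t0 < t1) (h2 : t1 < t0 + 1) (hs : s ∈ Ioo t0 (t0+1)) :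
    Real.arccos (Real.cos (2 * Real.pi * (s - (t0+t1)/2))) < Real.pi * (t1 - t0) ↔ s < t1 := by
  have hpi := Real.pi_pos
  obtain ⟨h3, h4⟩ := hs
  by_cases h : s ≤ (t0+t1)/2 + 1/2
  · rw [arccos_abs (abs_le.2 ⟨by linarith, by linarith⟩)]
    have e : 2 * Real.pi * |s - (t0+t1)/2| < Real.pi * (t1 - t0) ↔ |s - (t0+t1)/2| < (t1-t0)/2 := by
      constructor <;> intro h <;> nlinarith
    rw [e, abs_lt]
    constructor
    · intro h; linarith [h.2]
    · intro h; constructor <;> linarith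
  · push Not at h
    have e : Real.cos (2 * Real.pi * (s - (t0+t1)/2)) = Real.cos (2 * Real.pi * (s - 1 - (t0+t1)/2)) := by
      rw [← Real.cos_sub_two_pi]; congr 1; ring
    rw [e, arccos_abs (abs_le.2 ⟨by linarith, by linarith⟩), abs_of_neg (by linarith)]
    constructor
    · intro h; nlinarith
    · intro h; linarith

lemma final_CV {m : ℕ} (hm : Module.finrank ℝ (PB Y) = m) {E : Set (CV Y)} (hE : MeasurableSet E) {p : PB Y}
    (hp : 0 < p.fst) (h : Clean m E p) :
    (∃ c : ℝ, ∃ β ∈ Icc (0:ℝ) Real.pi, μH[1] (symmDiff (E ∩ fib p) (CArc c β ∩ fib p)) = 0) ∧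
    (∀ x ∈ fib p, (¬ CDens (E ∩ fib p) p x 0 ∧ ¬ CDens (E ∩ fib p) p x 1) ↔ ∃ ν, MN m E x ν) ∧
    ∃ (c₁ c₂ : ℝ) (c₃ : Y), ∀ x ∈ fib p, ∀ ν, MN m E x ν →
      ⟪ν.fst, ‖x.fst‖⁻¹ • x.fst⟫ = c₁ ∧ ‖ν.fst - ⟪ν.fst, ‖x.fst‖⁻¹ • x.fst⟫ • (‖x.fst‖⁻¹ • x.fst)‖ = c₂ ∧ ν.snd = c₃ := by
  have hpi := Real.pi_pos
  have hV : Module.finrank ℝ (CV Y) = m+1 := by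
    rw [← finrank_CV, (psplit (Y := Y)).finrank, hm]
  have hMN : ∀ x ν, MN m E x ν → x ∈ eB (m+1) E := fun x ν hx => by
    refine hx.2.mem_eB hV fun h0 => ?_
    have := congrArg (fun L : CV Y →L[ℝ] ℝ => L ν) h0
    simp only [innerSL_apply_apply, real_inner_self_eq_norm_sq, hx.1] at this
    norm_num at this
  have hsurj : ∀ x ∈ fib p, ∀ a, ∃ t ∈ Ico a (a+1), x = Th p t := fun x hx a => by
    obtain ⟨t, ht, h⟩ := Th_surj x a
    rw [show cpi x = WithLp.ofLp p from hx] at h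
    exact ⟨t, ht, h⟩
  obtain ⟨hlo, hJ | ⟨t0, t1, g, h01, h10, v1, v2, b0, b1⟩⟩ := h
  · have hno : ∀ x ∈ fib p, ∀ ν, ¬ MN m E x ν := fun x hx ν hν => by
      obtain ⟨t, _, rfl⟩ := hsurj x hx 0
      have : t ∈ {t | Th p t ∈ eB (m+1) E} := hMN _ _ hν
      rw [hJ] at this; exact this
    have hall : ∀ a b, volume {t | t ∈ Ioo a b ∧ t ∈ {t | Th p t ∈ E}} = 0 ∨ volume {t | t ∈ Ioo a b ∧ t ∉ {t | Th p t ∈ E}} = 0 := fun a b =>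
      (hlo a b).1 fun t _ => by rw [hJ]; exact id
    refine ⟨?_, fun x hx => ⟨fun hh => ?_, fun ⟨ν, hν⟩ => (hno x hx ν hν).elim⟩, 0, 0, 0, fun x hx ν hν => (hno x hx ν hν).elim⟩
    · rcases hall (-1/2) (-1/2+1) with h | h
      · refine ⟨0, 0, ⟨le_rfl, hpi.le⟩, arc_null hp hE 0 0 (-1/2) ?_⟩
        filter_upwards [measure_eq_zero_iff_ae_notMem.1 h] with t ht hI
        exact ⟨fun hh => (ht ⟨hI, hh⟩).elim, fun hh => ((Real.arccos_nonneg _).not_gt hh).elim⟩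
      · refine ⟨0, Real.pi, ⟨hpi.le, le_rfl⟩, arc_null hp hE 0 Real.pi (-1/2) ?_⟩
        filter_upwards [measure_eq_zero_iff_ae_notMem.1 h] with t ht hI
        refine ⟨fun _ => ?_, fun _ => by_contra fun hh => ht ⟨hI, hh⟩⟩
        have : |t| < 1/2 := abs_lt.2 ⟨by linarith [hI.1], by linarith [hI.2]⟩
        rw [sub_zero, arccos_abs this.le]; nlinarith
    · obtain ⟨t, _, rfl⟩ := hsurj x hx 0
      rcases hall (t-1) (t+1) with h | h
      · exact (hh.1 (CDens0 hp hE one_pos h)).elim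
      · exact (hh.2 (CDens1 hp hE one_pos h)).elim
  · have hκ : (1/(2*Real.pi*p.fst)) ≠ 0 := by positivity
    set κ := 1/(2*Real.pi*p.fst) with hκd
    have M0 := MN_nvec (neg_ne_zero.2 hκ) b0
    have M1 := MN_nvec hκ b1
    have hPer : Per {t | Th p t ∈ E} := fun t k => by simp only [mem_setOf_eq, Th_int]
    have nJ1 : ∀ s ∈ Ioo t0 t1, s ∉ {t | Th p t ∈ eB (m+1) E} := (hlo t0 t1).2 (Or.inr v1)
    have nJ2 : ∀ s ∈ Ioo t1 (t0+1), s ∉ {t | Th p t ∈ eB (m+1) E} := (hlo t1 (t0+1)).2 (Or.inl v2)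
    have two : ∀ x ∈ fib p, ∀ ν, MN m E x ν → x = Th p t0 ∨ x = Th p t1 := fun x hx ν hν => by
      obtain ⟨t, ⟨ht1, ht2⟩, rfl⟩ := hsurj x hx t0
      have ht : t ∈ {t | Th p t ∈ eB (m+1) E} := hMN _ _ hν
      rcases eq_or_lt_of_le ht1 with h | h
      · left; rw [h]
      rcases lt_trichotomy t t1 with h' | h' | h'
      · exact (nJ1 t ⟨h, h'⟩ ht).elim
      · right; rw [h']
      · exact (nJ2 t ⟨h', ht2⟩ ht).elim
    refine ⟨⟨(t0+t1)/2, Real.pi * (t1-t0), ⟨by nlinarith, by nlinarith⟩, arc_null hp hE _ _ t0 ?_⟩, fun x hx => ⟨fun hh => ?_, ?_⟩, ?_⟩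
    · have n3 : ∀ᵐ t, t ≠ t1 := measure_eq_zero_iff_ae_notMem.1 (measure_singleton t1)
      filter_upwards [measure_eq_zero_iff_ae_notMem.1 v1, measure_eq_zero_iff_ae_notMem.1 v2, n3] with t m1 m2 m3 hI
      rw [arc_iff h01 h10 hI]
      rcases lt_or_gt_of_ne m3 with h | h
      · exact ⟨fun _ => h, fun _ => by_contra fun hh => m1 ⟨⟨hI.1, h⟩, hh⟩⟩
      · exact ⟨fun hh => (m2 ⟨⟨h, hI.2⟩, hh⟩).elim, fun hh => (lt_asymm h hh).elim⟩
    · obtain ⟨t, ⟨ht1, ht2⟩, rfl⟩ := hsurj x hx t0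
      rcases eq_or_lt_of_le ht1 with h | h
      · rw [← h]; exact ⟨_, M0⟩
      rcases lt_trichotomy t t1 with h' | h' | h'
      · exfalso
        refine hh.2 (CDens1 hp hE (δ := min (t-t0) (t1-t)) (lt_min (by linarith) (by linarith)) (measure_mono_null ?_ v1))
        rintro s ⟨⟨hs1, hs2⟩, hs⟩
        exact ⟨⟨by linarith [min_le_left (t-t0) (t1-t)], by linarith [min_le_right (t-t0) (t1-t)]⟩, hs⟩
      · rw [h']; exact ⟨_, M1⟩
      · exfalso
        refine hh.1 (CDens0 hp hE (δ := min (t-t1) (t0+1-t)) (lt_min (by linarith) (by linarith)) (measure_mono_null ?_ v2))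
        rintro s ⟨⟨hs1, hs2⟩, hs⟩
        exact ⟨⟨by linarith [min_le_left (t-t1) (t0+1-t)], by linarith [min_le_right (t-t1) (t0+1-t)]⟩, hs⟩
    · rintro ⟨ν, hν⟩
      set δ := min (t1-t0) (t0+1-t1) with hδ
      have d1 : δ ≤ t1-t0 := min_le_left _ _
      have d2 : δ ≤ t0+1-t1 := min_le_right _ _
      have d0 : 0 < δ := lt_min (by linarith) (by linarith)
      rcases two x hx ν hν with rfl | rfl
      · refine CDens_half hp hE d0 (Or.inl ⟨?_, measure_mono_null ?_ v1⟩)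
        · have := hPer.vol (t1-1) t0 1
          rw [Int.cast_one, sub_add_cancel, v2] at this
          refine measure_mono_null ?_ this.symm
          rintro s ⟨⟨hs1, hs2⟩, hs⟩
          exact ⟨⟨by linarith, hs2⟩, hs⟩
        · rintro s ⟨⟨hs1, hs2⟩, hs⟩
          exact ⟨⟨hs1, by linarith⟩, hs⟩
      · refine CDens_half hp hE d0 (Or.inr ⟨measure_mono_null ?_ v1, measure_mono_null ?_ v2⟩)
        · rintro s ⟨⟨hs1, hs2⟩, hs⟩
          exact ⟨⟨by linarith, hs2⟩, hs⟩
        · rintro s ⟨⟨hs1, hs2⟩, hs⟩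
          exact ⟨⟨hs1, by linarith⟩, hs⟩
    · set N := Real.sqrt (g.fst^2 + κ^2 + ‖g.snd‖^2) with hN
      have hN0 : 0 < N := Real.sqrt_pos.2 (by positivity)
      have hN1 : ‖nvec g κ t1‖ = N := nvec_norm g κ t1
      have hN2 : ‖nvec g (-κ) t0‖ = N := by rw [nvec_norm, neg_sq]
      rw [hN2] at M0
      rw [hN1] at M1
      refine ⟨-g.fst / N, |κ| / N, N⁻¹ • -g.snd, fun x hx ν hν => ?_⟩
      rcases two x hx ν hν with rfl | rfl
      · rw [hν.2.unique hV M0.2 hν.1 M0.1]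
        have := nvec_parts (g := g) hp (-κ) t0 N hN0
        rwa [abs_neg] at this
      · rw [hν.2.unique hV M1.2 hν.1 M1.1]
        exact nvec_parts (g := g) hp κ t1 N hN0

end A24

section A29

noncomputable def c2 : Euc 2 ≃ₗᵢ[ℝ] ℂ := Complex.orthonormalBasisOneI.repr.symm

lemma pr_norm {n : ℕ} (hn : 2 ≤ n) (x : Euc n) : ‖pr12 hn x‖^2 + ‖prC hn x‖^2 = ‖x‖^2 := by
  obtain ⟨k, rfl⟩ : ∃ k, n = k + 2 := ⟨n - 2, by omega⟩
  rw [EuclideanSpace.norm_sq_eq, EuclideanSpace.norm_sq_eq, EuclideanSpace.norm_sq_eq, Fin.sum_univ_two,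
    Fin.sum_univ_succ (n := k+1), Fin.sum_univ_succ, ← add_assoc]
  rfl

/-- the model isometry -/
noncomputable def TI {n : ℕ} (hn : 2 ≤ n) : Euc n →ₗᵢ[ℝ] CV (Euc (n-2)) where
  toFun x := WithLp.toLp 2 (c2 (pr12 hn x), prC hn x)
  map_add' x y := by
    refine cv_ext ?_ rfl
    exact c2.map_add (pr12 hn x) (pr12 hn y)
  map_smul' a x := by
    refine cv_ext ?_ rfl
    exact c2.map_smul a (pr12 hn x)
  norm_map' x := by
    refine (sq_eq_sq₀ (norm_nonneg _) (norm_nonneg _)).1 ?_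
    change ‖(WithLp.toLp 2 (c2 (pr12 hn x), prC hn x) : CV (Euc (n-2)))‖^2 = _
    rw [WithLp.prod_norm_sq_eq_of_L2, ← pr_norm hn x, ← c2.norm_map]; rfl

lemma finrank_PBE {n : ℕ} (hn : 2 ≤ n) : Module.finrank ℝ (PB (Euc (n-2))) = n - 1 := by
  rw [(WithLp.linearEquiv 2 ℝ (ℝ × Euc (n-2))).finrank_eq, Module.finrank_prod, Module.finrank_self, finrank_euclideanSpace_fin]
  omega

noncomputable def TE {n : ℕ} (hn : 2 ≤ n) : Euc n ≃ₗᵢ[ℝ] CV (Euc (n-2)) :=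
  (TI hn).toLinearIsometryEquiv (by
    rw [← finrank_CV, (psplit (Y := Euc (n-2))).finrank, finrank_PBE hn, finrank_euclideanSpace_fin]; omega)

variable {n : ℕ} (hn : 2 ≤ n)

lemma TE_fst (x : Euc n) : (TE hn x).fst = c2 (pr12 hn x) := rfl
lemma TE_snd (x : Euc n) : (TE hn x).snd = prC hn x := rfl
lemma TE_hat (x : Euc n) : ‖(TE hn x).fst‖⁻¹ • (TE hn x).fst = c2 (hatv (pr12 hn x)) := by
  rw [TE_fst, hatv, c2.map_smul, c2.norm_map]

lemma TE_fib (p : ℝ × Euc (n-2)) (x : Euc n) : TE hn x ∈ fib (WithLp.toLp 2 p) ↔ x ∈ circFiber hn p := by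
  change (‖c2 (pr12 hn x)‖, prC hn x) = p ↔ (prC hn x = p.2 ∧ ‖pr12 hn x‖ = p.1)
  rw [c2.norm_map, Prod.ext_iff, and_comm]

lemma TE_H (d : ℝ) (A : Set (CV (Euc (n-2)))) : μH[d] (TE hn ⁻¹' A) = μH[d] A := by
  rw [← (TE hn).isometry.hausdorffMeasure_image (Or.inr (TE hn).surjective), image_preimage_eq _ (TE hn).surjective]

lemma TE_CF (ℓ : ℝ × Euc (n - 2) → ℝ) : TE hn ⁻¹' (CF ℓ) = circSymm hn ℓ := by
  ext x
  have h1 : ⟪hatv (pr12 hn x), e1 2 (by norm_num)⟫ = (TE hn x).fst.re / ‖(TE hn x).fst‖ := by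
    rw [e1, EuclideanSpace.inner_single_right, TE_fst, c2.norm_map, hatv]
    simp [c2, div_eq_inv_mul]
  change ((TE hn x).fst ≠ 0 ∧ _ < ℓ (cpi (TE hn x)) / (2 * ‖(TE hn x).fst‖)) ↔ (pr12 hn x ≠ 0 ∧ _)
  rw [← h1, cpi, TE_fst, TE_snd, c2.norm_map, Ne, c2.map_eq_zero_iff]

lemma TE_perim {m : ℕ} (hm : n = m + 1) {G : Set (CV (Euc (n-2)))} (hG : MeasurableSet G) :
    μHE[m] (eB (m+1) G) = ((volume : Measure (EuclideanSpace ℝ (Fin m))).addHaarScalarFactor μH[m]) * perim (TE hn ⁻¹' G) univ := by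
  rw [perim, inter_univ, essBoundary_eq_eB ((TE hn).continuous.measurable hG)]
  have : eB n (TE hn ⁻¹' G) = TE hn ⁻¹' (eB n G) := by
    ext x; exact (LBL_of_linearEquiv (TE hn).toContinuousLinearEquiv x).mem_eB_iff n G
  rw [this, TE_H, Measure.euclideanHausdorffMeasure_def, Measure.smul_apply, ← hm]
  have : ((n:ℝ) - 1) = m := by rw [hm]; push_cast; ring
  rw [this]; rfl

lemma TE_normal {m : ℕ} (hm : n = m + 1) (G : Set (CV (Euc (n-2)))) (x ν : Euc n) :
    HasMTNormal (TE hn ⁻¹' G) x ν ↔ MN m G (TE hn x) (TE hn ν) := by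
  have hd : Module.finrank ℝ (Euc n) = m + 1 := by simp [hm]
  have key : ∀ S : Set (CV (Euc (n-2))), Tendsto (fun ρ : ℝ => volume (TE hn ⁻¹' S ∩ ball x ρ) / volume (ball x ρ)) (𝓝[>] (0:ℝ)) (𝓝 0)
      ↔ MZ (m+1) S (TE hn x) := fun S => by
    rw [← MZm_iff_tendsto hd, ← MZ_iff_haar hd]
    exact (LBL_of_linearEquiv (TE hn).toContinuousLinearEquiv x).MZ_iff (m+1) S
  have hi : ∀ y, innerSL ℝ (TE hn ν) (TE hn y - TE hn x) = ⟪y - x, ν⟫ := fun y => by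
    rw [innerSL_apply_apply, ← (TE hn).map_sub, (TE hn).inner_map_map, real_inner_comm]
  have s1 : {y | y ∈ TE hn ⁻¹' G ∧ 0 < ⟪y - x, ν⟫} = TE hn ⁻¹' {y | y ∈ G ∧ 0 < innerSL ℝ (TE hn ν) (y - TE hn x)} := by
    ext y; simp only [mem_setOf_eq, mem_preimage, hi]
  have s2 : {y | y ∉ TE hn ⁻¹' G ∧ ⟪y - x, ν⟫ < 0} = TE hn ⁻¹' {y | y ∉ G ∧ innerSL ℝ (TE hn ν) (y - TE hn x) < 0} := by
    ext y; simp only [mem_setOf_eq, mem_preimage, hi]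
  rw [HasMTNormal, MN, BU, (TE hn).norm_map, s1, s2, key, key]

lemma TE_ball (x : Euc n) (ρ : ℝ) : TE hn ⁻¹' (ball (TE hn x) ρ) = ball x ρ := by
  ext y; simp only [mem_preimage, mem_ball, (TE hn).dist_map]

lemma TE_dens (A : Set (CV (Euc (n-2)))) (p : ℝ × Euc (n-2)) (x : Euc n) (t : ℝ≥0∞) :
    CircDensityAt hn (TE hn ⁻¹' A) p x t ↔ CDens A (WithLp.toLp 2 p) (TE hn x) t := by
  have h : ∀ S ρ, μH[(1:ℝ)] (TE hn ⁻¹' S ∩ ball x ρ) = μH[(1:ℝ)] (S ∩ ball (TE hn x) ρ) := fun S ρ => by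
    rw [← TE_ball hn, ← preimage_inter, TE_H]
  have hf : circFiber hn p = TE hn ⁻¹' (fib (WithLp.toLp 2 p)) := by ext y; exact (TE_fib hn p y).symm
  rw [CircDensityAt, CDens, hf]
  simp only [h]

end A29
/-- **Theorem 1.4, second part (equality cases).** If `P(E) = P(F^ℓ)` then for a.e.
`(r,x')`: (a) `E_{(r,x')}` is `H¹`-equivalent to a circular arc and
`∂*(E_{(r,x')}) = (∂*E)_{(r,x')}`; (b) `ν^E·x̂₁₂`, `|ν₁₂∥^E|` and `ν_{x'}^E` are
constant on `(∂*E)_{(r,x')}`. -/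
theorem circular_equality_cases
    (n : ℕ) (hn : 2 ≤ n)
    (ℓ : ℝ × Euc (n - 2) → ℝ) (hl_meas : Measurable ℓ)
    (hl_nonneg : ∀ p ∈ (Ioi (0:ℝ)) ×ˢ (univ : Set (Euc (n - 2))), 0 ≤ ℓ p)
    (hl_le : ∀ᵐ p ∂(volume.restrict ((Ioi (0:ℝ)) ×ˢ (univ : Set (Euc (n - 2))))),
      ℓ p ≤ 2 * Real.pi * p.1)
    (E : Set (Euc n)) (hE_meas : MeasurableSet E) (hE_dist : CircDistrib hn ℓ E)
    (hE_perim : perim E univ < ⊤) (hE_vol : volume E < ⊤)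
    (hEq : perim E univ = perim (circSymm hn ℓ) univ) :
    ∀ᵐ p ∂(volume.restrict ((Ioi (0:ℝ)) ×ˢ (univ : Set (Euc (n - 2))))),
      ((∃ q : Euc 2, ‖q‖ = 1 ∧ ∃ β ∈ Icc (0:ℝ) Real.pi,
          μH[(1:ℝ)] (symmDiff (cslice hn E p)
            {y : Euc n | y ∈ circFiber hn p ∧ Real.arccos ⟪hatv (pr12 hn y), q⟫ < β}) = 0) ∧
        circEssBoundary hn (cslice hn E p) p = redBoundary E ∩ circFiber hn p) ∧
      ∃ (c₁ c₂ : ℝ) (c₃ : Euc (n - 2)),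
        ∀ x ∈ redBoundary E ∩ circFiber hn p,
          ⟪pr12 hn (mtNormal E x), hatv (pr12 hn x)⟫ = c₁ ∧
            ‖nu12par hn E x‖ = c₂ ∧ prC hn (mtNormal E x) = c₃ := by
  have hm : n = (n - 1) + 1 := by omega
  obtain ⟨G, rfl⟩ : ∃ G, E = TE hn ⁻¹' G :=
    ⟨(TE hn).symm ⁻¹' E, by rw [← preimage_comp]; simp⟩
  have hG : MeasurableSet G := by
    have := (TE hn).symm.continuous.measurable hE_meas
    rwa [← preimage_comp, show (TE hn) ∘ (TE hn).symm = id from funext fun y => (TE hn).apply_symm_apply y, preimage_id] at this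
  have hS : MeasurableSet ((Ioi (0:ℝ)) ×ˢ (univ : Set (Euc (n - 2)))) := measurableSet_Ioi.prod MeasurableSet.univ
  have hslice : ∀ p : ℝ × Euc (n-2), cslice hn (TE hn ⁻¹' G) p = TE hn ⁻¹' (G ∩ fib (WithLp.toLp 2 p)) := fun p => by
    ext y; exact and_congr Iff.rfl (TE_fib hn p y).symm
  have hP := TE_perim hn hm hG
  have hPF := TE_perim hn hm (CF_meas hl_meas)
  rw [TE_CF, ← hEq, ← hP] at hPF
  have hfin : μHE[n-1] (eB (n-1+1) G) ≠ ⊤ := by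
    rw [hP]; exact ENNReal.mul_ne_top ENNReal.coe_ne_top hE_perim.ne
  have hd : ∀ᵐ p : PB (Euc (n-2)), 0 < p.fst → 0 ≤ ℓ (WithLp.ofLp p) ∧ ℓ (WithLp.ofLp p) ≤ 2 * Real.pi * p.fst ∧
      μH[1] (G ∩ fib p) = ENNReal.ofReal (ℓ (WithLp.ofLp p)) := by
    have h1 := hl_le.and hE_dist
    rw [ae_restrict_iff' hS] at h1
    filter_upwards [(WithLp.volume_preserving_ofLp ℝ (Euc (n-2))).quasiMeasurePreserving.ae h1] with p hp h0
    have hmem : WithLp.ofLp p ∈ (Ioi (0:ℝ)) ×ˢ (univ : Set (Euc (n - 2))) := ⟨h0, trivial⟩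
    obtain ⟨h2, h3⟩ := hp hmem
    rw [hslice, TE_H] at h3
    exact ⟨hl_nonneg _ hmem, h2, h3⟩
  have hmain := clean_ae (finrank_PBE hn) hG hl_meas hd hfin hPF
  rw [ae_restrict_iff' hS]
  filter_upwards [(WithLp.volume_preserving_toLp ℝ (Euc (n-2))).quasiMeasurePreserving.ae hmain] with p hp hpm
  have h0 : 0 < (WithLp.toLp 2 p : PB (Euc (n-2))).fst := hpm.1
  obtain ⟨⟨c, β, hβ, harc⟩, hess, c₁, c₂, c₃, hnu⟩ := final_CV (finrank_PBE hn) hG h0 (hp h0)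
  have hred : ∀ x, x ∈ redBoundary (TE hn ⁻¹' G) ↔ ∃ ν, MN (n-1) G (TE hn x) ν := fun x => by
    constructor
    · rintro ⟨ν, hν⟩; exact ⟨_, (TE_normal hn hm G x ν).1 hν⟩
    · rintro ⟨ν, hν⟩
      refine ⟨(TE hn).symm ν, (TE_normal hn hm G x _).2 ?_⟩
      rwa [(TE hn).apply_symm_apply]
  refine ⟨⟨⟨c2.symm (pe c), by rw [c2.symm.norm_map, pe_norm], β, hβ, ?_⟩, ?_⟩, c₁, c₂, c₃, ?_⟩
  · have e : symmDiff (cslice hn (TE hn ⁻¹' G) p)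
            {y : Euc n | y ∈ circFiber hn p ∧ Real.arccos ⟪hatv (pr12 hn y), c2.symm (pe c)⟫ < β} =
        TE hn ⁻¹' (symmDiff (G ∩ fib (WithLp.toLp 2 p)) (CArc c β ∩ fib (WithLp.toLp 2 p))) := by
      rw [hslice, preimage_symmDiff]
      congr 1
      ext y
      change (_ ∧ Real.arccos ⟪hatv (pr12 hn y), c2.symm (pe c)⟫ < β) ↔
        (Real.arccos ⟪‖(TE hn y).fst‖⁻¹ • (TE hn y).fst, pe c⟫ < β ∧ TE hn y ∈ fib (WithLp.toLp 2 p))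
      rw [TE_hat, TE_fib, ← c2.inner_map_map, c2.apply_symm_apply, and_comm]
    rw [e, TE_H]; exact harc
  · ext x
    change (x ∈ circFiber hn p ∧ ¬ CircDensityAt hn (cslice hn (TE hn ⁻¹' G) p) p x 0 ∧
      ¬ CircDensityAt hn (cslice hn (TE hn ⁻¹' G) p) p x 1) ↔ (x ∈ redBoundary (TE hn ⁻¹' G) ∧ x ∈ circFiber hn p)
    rw [hslice, TE_dens, TE_dens, hred, and_comm]
    refine and_congr_left fun hx => hess _ ((TE_fib hn p x).2 hx)
  · rintro x ⟨hx, hxf⟩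
    have hN : HasMTNormal (TE hn ⁻¹' G) x (mtNormal (TE hn ⁻¹' G) x) := by
      have hx' : ∃ ν, HasMTNormal (TE hn ⁻¹' G) x ν := hx
      rw [mtNormal, dif_pos hx']; exact hx'.choose_spec
    rw [nu12par]
    generalize mtNormal (TE hn ⁻¹' G) x = ν at *
    have h := hnu _ ((TE_fib hn p x).2 hxf) _ ((TE_normal hn hm G x ν).1 hN)
    rw [TE_hat, TE_fst, TE_snd, c2.inner_map_map, ← c2.map_smul, ← c2.map_sub, c2.norm_map] at h
    exact h
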